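/- For every integer n ≥ 3 and every set C of 2n−2 distinct complex numbers, the number of Möbius-equivalence classes of rational functions over ℂ that are generic of degree n with critical value set C equals n^{n−3}·(2n−2)!/n!. -/

import Mathlib

open Polynomial

/-- The Wronskian `W = p′q − pq′` of a rational function `f = p/q` (with `p = f.num`,
`q = f.denom` coprime). -/
noncomputable def wronskian' {K : Type*} [Field K] (f : RatFunc K) : Polynomial K :=
  derivative f.num * f.denom - f.num * derivative f.denom

/-- Two rational functions over `K` are Möbius-equivalent if `g = p(L)/q(L)` in `K(X)`
for some `L = (aX+b)/(cX+d)` with `ad − bc ≠ 0`, where `f = p/q`. -/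
def MobiusEquiv {K : Type*} [Field K] (f g : RatFunc K) : Prop :=
  ∃ a b c d : K, a * d - b * c ≠ 0 ∧
    ∃ L : RatFunc K,
      L = algebraMap (Polynomial K) (RatFunc K) (C a * X + C b) /
          algebraMap (Polynomial K) (RatFunc K) (C c * X + C d) ∧
      g = Polynomial.aeval L f.num / Polynomial.aeval L f.denom

/-- A rational function `f = p/q` over `ℂ` is generic of degree `n` with critical value
set `C`: `deg f = n`, `deg W = 2n−2`, `q` does not vanish at roots of `W`, and the set
of critical values `{p(z)/q(z) : W(z) = 0}` equals `C`. -/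
def GenericDegC (n : ℕ) (C : Set ℂ) (f : RatFunc ℂ) : Prop :=
  max f.num.natDegree f.denom.natDegree = n ∧
  (wronskian' f).natDegree = 2 * n - 2 ∧
  (∀ z : ℂ, (wronskian' f).eval z = 0 → f.denom.eval z ≠ 0) ∧
  {w : ℂ | ∃ z : ℂ, (wronskian' f).eval z = 0 ∧ f.num.eval z / f.denom.eval z = w} = C

set_option linter.unusedSectionVars false

namespace CriticalValues

section Basic

variable {κ J : Type} [Fintype κ] [Fintype J]

/-- The rational function `z + ∑ α k / (z - p k)`. -/
noncomputable def rf (α p : κ → ℂ) (z : ℂ) : ℂ := z + ∑ k, α k / (z - p k)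

/-- The derivative of `rf α p`. -/
noncomputable def rd (α p : κ → ℂ) (z : ℂ) : ℂ := 1 - ∑ k, α k / (z - p k) ^ 2

/-- The function `rf α p` has simple poles `p k` and `∞`, with critical points `z j` and critical
values `C j`. -/
structure IsSol (C : J → ℂ) (α p : κ → ℂ) (z : J → ℂ) : Prop where
  res_ne : ∀ k, α k ≠ 0
  inj : Function.Injective p
  ne_pole : ∀ j k, z j ≠ p k
  crit : ∀ j, rd α p (z j) = 0
  val : ∀ j, rf α p (z j) = C j

/-- The set of all normalised rational functions with critical values `C`. -/
def Sol (κ : Type) {J : Type} [Fintype κ] (C : J → ℂ) : Set ((κ → ℂ) × (κ → ℂ) × (J → ℂ)) :=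
  {x | IsSol C x.1 x.2.1 x.2.2}

/-- The denominator of `rf α p`. -/
noncomputable def den (p : κ → ℂ) : ℂ[X] := ∏ k, (X - C (p k))

open Classical in
/-- The denominator of `rf α p` without the factor belonging to `k`. -/
noncomputable def codn (p : κ → ℂ) (k : κ) : ℂ[X] := ∏ l ∈ Finset.univ.erase k, (X - C (p l))

/-- The numerator of `rd α p`. -/
noncomputable def wr (α p : κ → ℂ) : ℂ[X] := den p ^ 2 - ∑ k, C (α k) * codn p k ^ 2

theorem den_eq (p : κ → ℂ) (k : κ) : den p = (X - C (p k)) * codn p k := by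
  classical
  rw [den, codn, Finset.mul_prod_erase _ (fun l => X - C (p l)) (Finset.mem_univ k)]

theorem monic_den (p : κ → ℂ) : (den p).Monic := monic_prod_X_sub_C _ _

theorem natDegree_den (p : κ → ℂ) : (den p).natDegree = Fintype.card κ := by
  rw [den, natDegree_finsetProd_X_sub_C_eq_card, Finset.card_univ]

theorem natDegree_codn (p : κ → ℂ) (k : κ) : (codn p k).natDegree = Fintype.card κ - 1 := by
  classical
  rw [codn, natDegree_finsetProd_X_sub_C_eq_card, Finset.card_erase_of_mem (Finset.mem_univ k),
    Finset.card_univ]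

theorem eval_den_ne {p : κ → ℂ} {z : ℂ} (hz : ∀ k, z ≠ p k) : (den p).eval z ≠ 0 := by
  rw [den, eval_prod]
  exact Finset.prod_ne_zero_iff.2 fun k _ => by simpa [sub_eq_zero] using hz k

theorem eval_den_eq_zero_iff {p : κ → ℂ} {z : ℂ} : (den p).eval z = 0 ↔ ∃ k, z = p k := by
  rw [den, eval_prod, Finset.prod_eq_zero_iff]
  simp [sub_eq_zero]

theorem eval_codn_self {p : κ → ℂ} (hp : Function.Injective p) (k : κ) :
    (codn p k).eval (p k) ≠ 0 := by
  classical
  rw [codn, eval_prod]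
  refine Finset.prod_ne_zero_iff.2 fun l hl => ?_
  simpa [sub_eq_zero] using fun h => (Finset.ne_of_mem_erase hl) (hp h).symm

theorem eval_codn_of_ne (p : κ → ℂ) {k l : κ} (h : k ≠ l) : (codn p k).eval (p l) = 0 := by
  classical
  rw [codn, eval_prod]
  exact Finset.prod_eq_zero (Finset.mem_erase.2 ⟨h.symm, Finset.mem_univ l⟩) (by simp)

theorem eval_codn_eq {p : κ → ℂ} {z : ℂ} {k : κ} (hz : z ≠ p k) :
    (codn p k).eval z = (den p).eval z / (z - p k) := by
  rw [den_eq p k, eval_mul]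
  have : z - p k ≠ 0 := sub_ne_zero.2 hz
  simp only [eval_sub, eval_X, eval_C]
  field_simp

theorem eval_wr (α : κ → ℂ) {p : κ → ℂ} {z : ℂ} (hz : ∀ k, z ≠ p k) :
    (wr α p).eval z = rd α p z * (den p).eval z ^ 2 := by
  rw [wr, rd, sub_mul, one_mul, Finset.sum_mul]
  simp only [eval_sub, eval_pow, eval_finsetSum, eval_mul, eval_C]
  congr 1
  refine Finset.sum_congr rfl fun k _ => ?_
  rw [eval_codn_eq (hz k)]
  have : z - p k ≠ 0 := sub_ne_zero.2 (hz k)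
  field_simp

theorem eval_wr_pole (α p : κ → ℂ) (k : κ) :
    (wr α p).eval (p k) = - α k * (codn p k).eval (p k) ^ 2 := by
  rw [wr]
  simp only [eval_sub, eval_pow, eval_finsetSum, eval_mul, eval_C]
  rw [Finset.sum_eq_single k, eval_den_eq_zero_iff.2 ⟨k, rfl⟩]
  · ring
  · intro l _ hl
    rw [eval_codn_of_ne p hl]; ring
  · simp

theorem degree_sum_lt (p : κ → ℂ) (u v : κ → ℂ) :
    (∑ k, (C (u k) * (X - C (p k)) + C (v k)) * codn p k ^ 2).degree <
      ((2 * Fintype.card κ : ℕ) : WithBot ℕ) := by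
  refine lt_of_le_of_lt (degree_sum_le _ _) ?_
  rw [Finset.sup_lt_iff (WithBot.bot_lt_coe _)]
  intro k _
  have h1 : (C (u k) * (X - C (p k)) + C (v k)).natDegree ≤ 1 := by
    compute_degree
  have h2 : (codn p k ^ 2).natDegree = 2 * (Fintype.card κ - 1) := by
    rw [natDegree_pow, natDegree_codn]
  have h3 : 0 < Fintype.card κ := Fintype.card_pos_iff.2 ⟨k⟩
  refine lt_of_le_of_lt degree_le_natDegree ?_
  have := natDegree_mul_le (p := C (u k) * (X - C (p k)) + C (v k)) (q := codn p k ^ 2)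
  exact_mod_cast (by omega)

theorem monic_wr (α p : κ → ℂ) : (wr α p).Monic := by
  have h := degree_sum_lt p 0 α
  simp only [Pi.zero_apply, map_zero, zero_mul, zero_add] at h
  refine ((monic_den p).pow 2).sub_of_left ?_
  rwa [degree_eq_natDegree ((monic_den p).pow 2).ne_zero, natDegree_pow, natDegree_den]

theorem natDegree_wr (α p : κ → ℂ) : (wr α p).natDegree = 2 * Fintype.card κ := by
  have h := degree_sum_lt p 0 α
  simp only [Pi.zero_apply, map_zero, zero_mul, zero_add] at h
  have h2 : (den p ^ 2).degree = ((2 * Fintype.card κ : ℕ) : WithBot ℕ) := by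
    rw [degree_eq_natDegree ((monic_den p).pow 2).ne_zero, natDegree_pow, natDegree_den]
  refine natDegree_eq_of_degree_eq_some ?_
  rw [wr, degree_sub_eq_left_of_degree_lt (by rwa [h2]), h2]

namespace IsSol

variable {c : J → ℂ} {α p : κ → ℂ} {z : J → ℂ}

theorem z_inj (h : IsSol c α p z) (hc : Function.Injective c) : Function.Injective z := by
  intro i j hij
  apply hc
  rw [← h.val i, ← h.val j, hij]

theorem wr_eq (h : IsSol c α p z) (hz : Function.Injective z)
    (hJ : Fintype.card J = 2 * Fintype.card κ) : wr α p = ∏ j, (X - C (z j)) := by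
  have hm : (∏ j, (X - C (z j))).Monic := monic_prod_X_sub_C _ _
  have hd : (∏ j, (X - C (z j))).degree = ((2 * Fintype.card κ : ℕ) : WithBot ℕ) := by
    rw [degree_eq_natDegree hm.ne_zero, natDegree_finsetProd_X_sub_C_eq_card, Finset.card_univ, hJ]
  have hd' : (wr α p).degree = ((2 * Fintype.card κ : ℕ) : WithBot ℕ) := by
    rw [degree_eq_natDegree (monic_wr α p).ne_zero, natDegree_wr]
  refine eq_of_degree_sub_lt_of_eval_index_eq Finset.univ (v := z) hz.injOn ?_ ?_
  · rw [Finset.card_univ, hJ, ← hd']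
    exact degree_sub_lt_left (hd'.trans hd.symm) (monic_wr α p).ne_zero
      (by rw [(monic_wr α p).leadingCoeff, hm.leadingCoeff])
  · intro j _
    rw [eval_wr α (h.ne_pole j), h.crit, zero_mul, eval_prod,
      Finset.prod_eq_zero (Finset.mem_univ j) (by simp)]

theorem exists_eq_of_crit (h : IsSol c α p z) (hz : Function.Injective z)
    (hJ : Fintype.card J = 2 * Fintype.card κ) {w : ℂ} (hw : ∀ k, w ≠ p k)
    (hr : rd α p w = 0) : ∃ j, w = z j := by
  have h1 : (wr α p).eval w = 0 := by rw [eval_wr α hw, hr, zero_mul]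
  rw [h.wr_eq hz hJ, eval_prod, Finset.prod_eq_zero_iff] at h1
  simpa [sub_eq_zero] using h1

/-- A rational function with at most double poles at the poles of `f` which vanishes at all critical
points of `f` is a multiple of the derivative of `f`. -/
theorem eq_smul_deriv (h : IsSol c α p z) (hz : Function.Injective z)
    (hJ : Fintype.card J = 2 * Fintype.card κ) {e : ℂ} {u v : κ → ℂ}
    (hg : ∀ j, e + ∑ k, u k / (z j - p k) + ∑ k, v k / (z j - p k) ^ 2 = 0) :
    (∀ k, u k = 0) ∧ ∀ k, v k = - e * α k := by
  set G : ℂ[X] := ∑ k, (C (u k) * (X - C (p k)) + C (v k + e * α k)) * codn p k ^ 2 with hG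
  have hG0 : G = 0 := by
    refine eq_zero_of_degree_lt_of_eval_index_eq_zero Finset.univ (v := z) hz.injOn ?_ ?_
    · rw [Finset.card_univ, hJ]
      exact degree_sum_lt p u _
    · intro j _
      have hd := eval_den_ne (h.ne_pole j)
      have h1 := h.crit j
      rw [rd] at h1
      have h2 : G.eval (z j) = (den p).eval (z j) ^ 2 *
          ((e + ∑ k, u k / (z j - p k) + ∑ k, v k / (z j - p k) ^ 2)
            - e * (1 - ∑ k, α k / (z j - p k) ^ 2)) := by
        rw [hG, eval_finsetSum]
        have : ((e + ∑ k, u k / (z j - p k) + ∑ k, v k / (z j - p k) ^ 2)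
            - e * (1 - ∑ k, α k / (z j - p k) ^ 2)) = ∑ k, (u k / (z j - p k)
              + (v k + e * α k) / (z j - p k) ^ 2) := by
          simp only [add_div, Finset.sum_add_distrib, mul_div_assoc, ← Finset.mul_sum]
          ring
        rw [this, Finset.mul_sum]
        refine Finset.sum_congr rfl fun k _ => ?_
        have hk : z j - p k ≠ 0 := sub_ne_zero.2 (h.ne_pole j k)
        simp only [eval_mul, eval_add, eval_C, eval_sub, eval_X, eval_pow,
          eval_codn_eq (h.ne_pole j k)]
        field_simp
      rw [h2, hg j, h1]
      ring
  have hv : ∀ k, v k + e * α k = 0 := by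
    intro k
    have h1 := congrArg (eval (p k)) hG0
    rw [hG, eval_finsetSum, Finset.sum_eq_single k] at h1
    · simpa [eval_codn_self h.inj k] using h1
    · intro l _ hl
      simp [eval_codn_of_ne p hl]
    · simp
  refine ⟨fun k => ?_, fun k => by linear_combination hv k⟩
  have h2 : den p * ∑ k, C (u k) * codn p k = 0 := by
    rw [← hG0, hG, Finset.mul_sum]
    refine Finset.sum_congr rfl fun k _ => ?_
    rw [hv k, den_eq p k]
    simp; ring
  have h3 := (mul_eq_zero.1 h2).resolve_left (monic_den p).ne_zero
  have h1 := congrArg (eval (p k)) h3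
  rw [eval_finsetSum, Finset.sum_eq_single k] at h1
  · simpa [eval_codn_self h.inj k] using h1
  · intro l _ hl
    simp [eval_codn_of_ne p hl]
  · simp

end IsSol

end Basic
end CriticalValues

namespace CriticalValues

open Filter Topology

/-- The holomorphic inverse function theorem, with the hypothesis on the derivative stated in terms
of directional derivatives. -/
theorem exists_local_inverse {E F : Type*} [NormedAddCommGroup E] [NormedSpace ℂ E]
    [NormedAddCommGroup F] [NormedSpace ℂ F] [FiniteDimensional ℂ E] [FiniteDimensional ℂ F]
    (hEF : Module.finrank ℂ E = Module.finrank ℂ F) {Φ : E → F} {x₀ : E}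
    (hΦ : AnalyticAt ℂ Φ x₀)
    (hinj : ∀ v : E, HasDerivAt (fun t : ℂ => Φ (x₀ + t • v)) 0 0 → v = 0) :
    ∃ ψ : F → E, ψ (Φ x₀) = x₀ ∧ (∀ᶠ y in 𝓝 (Φ x₀), DifferentiableAt ℂ ψ y) ∧
      (∀ᶠ x in 𝓝 x₀, ψ (Φ x) = x) ∧ ∀ᶠ y in 𝓝 (Φ x₀), Φ (ψ y) = y := by
  have : CompleteSpace E := FiniteDimensional.complete ℂ E
  have : CompleteSpace F := FiniteDimensional.complete ℂ F
  have hker : Function.Injective (fderiv ℂ Φ x₀) := by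
    rw [injective_iff_map_eq_zero]
    intro v hv
    apply hinj
    have h1 : HasFDerivAt Φ (fderiv ℂ Φ x₀) (x₀ + (0 : ℂ) • v) := by
      simpa using hΦ.differentiableAt.hasFDerivAt
    have h2 : HasDerivAt (fun t : ℂ => x₀ + t • v) v 0 := by
      simpa using ((hasDerivAt_id (0 : ℂ)).smul_const v).const_add x₀
    simpa [hv, Function.comp_def] using h1.comp_hasDerivAt (0 : ℂ) h2
  let e : E ≃L[ℂ] F := (LinearEquiv.ofInjectiveOfFinrankEq
    (fderiv ℂ Φ x₀ : E →ₗ[ℂ] F) hker hEF).toContinuousLinearEquiv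
  have he : (e : E →L[ℂ] F) = fderiv ℂ Φ x₀ := by
    ext v; rfl
  have hc : ContDiffAt ℂ 1 Φ x₀ := hΦ.contDiffAt
  have hd : HasFDerivAt Φ (e : E →L[ℂ] F) x₀ := by
    rw [he]; exact hΦ.differentiableAt.hasFDerivAt
  have hs : HasStrictFDerivAt Φ (e : E →L[ℂ] F) x₀ := by
    rw [he]; exact hΦ.hasStrictFDerivAt
  refine ⟨hc.localInverse hd one_ne_zero, hc.localInverse_apply_image hd one_ne_zero, ?_, ?_, ?_⟩
  · have := hc.to_localInverse hd one_ne_zero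
    exact (this.eventually (by simp)).mono fun y hy => hy.differentiableAt one_ne_zero
  · exact hs.eventually_left_inverse
  · exact hs.eventually_right_inverse

/-- The roots of `N - w D` are bounded when `w` is bounded. -/
theorem exists_root_bound {N D : ℂ[X]} (hDN : D.degree < N.degree) (M : ℝ) :
    ∃ B : ℝ, ∀ w z : ℂ, ‖w‖ ≤ M → (N - C w * D).eval z = 0 → ‖z‖ ≤ B := by
  have hN : N ≠ 0 := by rintro rfl; simp at hDN
  have hlt : ∀ w : ℂ, (C w * D).degree < N.degree := fun w =>
    by
    rw [← smul_eq_C_mul]; exact lt_of_le_of_lt (degree_smul_le w D) hDN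
  refine ⟨(∑ i ∈ Finset.range N.natDegree, (‖N.coeff i‖ + M * ‖D.coeff i‖)) / ‖N.leadingCoeff‖ + 1,
    fun w z hw hz => ?_⟩
  have hM : 0 ≤ M := (norm_nonneg w).trans hw
  have hlc : (N - C w * D).leadingCoeff = N.leadingCoeff := leadingCoeff_sub_of_degree_lt (hlt w)
  have hne : N - C w * D ≠ 0 := by
    rw [← leadingCoeff_ne_zero, hlc]; exact leadingCoeff_ne_zero.2 hN
  have hnd : (N - C w * D).natDegree = N.natDegree :=
    natDegree_eq_of_degree_eq (degree_sub_eq_left_of_degree_lt (hlt w))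
  refine (NNReal.coe_le_coe.2 (IsRoot.norm_lt_cauchyBound hne hz).le).trans ?_
  have h1 : (((Finset.range N.natDegree).sup fun i => ‖(N - C w * D).coeff i‖₊ : NNReal) : ℝ) ≤
      ∑ i ∈ Finset.range N.natDegree, (‖N.coeff i‖ + M * ‖D.coeff i‖) := by
    have h2 : ∀ i ∈ Finset.range N.natDegree, ‖(N - C w * D).coeff i‖₊ ≤
        ∑ i ∈ Finset.range N.natDegree, (‖N.coeff i‖₊ + Real.toNNReal M * ‖D.coeff i‖₊) := by
      intro i hi
      refine le_trans ?_ (Finset.single_le_sum (f := fun i => ‖N.coeff i‖₊ +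
        Real.toNNReal M * ‖D.coeff i‖₊) (fun _ _ => by positivity) hi)
      rw [coeff_sub, coeff_C_mul]
      refine (nnnorm_sub_le _ _).trans ?_
      rw [nnnorm_mul]
      gcongr
      exact NNReal.le_toNNReal_of_coe_le hw
    have := NNReal.coe_le_coe.2 (Finset.sup_le h2)
    simpa [hM] using this
  rw [cauchyBound, hlc, hnd]
  push_cast
  gcongr

/-- A simple root of the pencil `N - f τ D` persists holomorphically. -/
theorem exists_local_root {N D : ℂ[X]} {f : ℂ → ℂ} {τ₀ z₀ : ℂ} (hf : AnalyticAt ℂ f τ₀)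
    (h0 : (N - C (f τ₀) * D).eval z₀ = 0)
    (hs : (derivative (N - C (f τ₀) * D)).eval z₀ ≠ 0) :
    ∃ ψ : ℂ → ℂ, ψ τ₀ = z₀ ∧ (∀ᶠ τ in 𝓝 τ₀, DifferentiableAt ℂ ψ τ) ∧
      (∀ᶠ τ in 𝓝 τ₀, (N - C (f τ) * D).eval (ψ τ) = 0) ∧
      ∀ᶠ x : ℂ × ℂ in 𝓝 (τ₀, z₀), (N - C (f x.1) * D).eval x.2 = 0 → x.2 = ψ x.1 := by
  let G : ℂ × ℂ → ℂ × ℂ := fun x => (x.1, N.eval x.2 - f x.1 * D.eval x.2)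
  have hG : AnalyticAt ℂ G (τ₀, z₀) := by
    refine AnalyticAt.prod analyticAt_fst (AnalyticAt.sub ?_ (AnalyticAt.mul ?_ ?_))
    · simpa using (analyticAt_snd (𝕜 := ℂ) (p := (τ₀, z₀))).aeval_polynomial N
    · exact hf.comp_of_eq analyticAt_fst rfl
    · simpa using (analyticAt_snd (𝕜 := ℂ) (p := (τ₀, z₀))).aeval_polynomial D
  have hG0 : G (τ₀, z₀) = (τ₀, 0) := by
    simpa [G] using h0
  obtain ⟨ψ, h1, h2, h3, h4⟩ := exists_local_inverse rfl hG (by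
    rintro ⟨a, b⟩ hv
    have ha : HasDerivAt (fun t : ℂ => τ₀ + t * a) a 0 := by
      simpa using ((hasDerivAt_id (0 : ℂ)).mul_const a).const_add τ₀
    have hb : HasDerivAt (fun t : ℂ => z₀ + t * b) b 0 := by
      simpa using ((hasDerivAt_id (0 : ℂ)).mul_const b).const_add z₀
    have hv1 : HasDerivAt (fun t : ℂ => τ₀ + t * a) 0 0 := by
      exact hasFDerivAt_fst.comp_hasDerivAt (0 : ℂ) hv
    have ha0 : a = 0 := ha.unique hv1
    subst ha0
    have hv2 : HasDerivAt (fun t : ℂ => (N - C (f τ₀) * D).eval (z₀ + t * b)) 0 0 := by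
      simpa [G, Function.comp_def] using (hasFDerivAt_snd.comp_hasDerivAt (0 : ℂ) hv)
    have hv3 := ((N - C (f τ₀) * D).hasDerivAt (z₀ + 0 * b)).comp (0 : ℂ) hb
    have := hv3.unique hv2
    rw [zero_mul, add_zero] at this
    have hb0 := (mul_eq_zero.1 this).resolve_left hs
    rw [hb0]; rfl)
  rw [hG0] at h1 h2 h4
  have hι : Tendsto (fun τ : ℂ => (τ, (0 : ℂ))) (𝓝 τ₀) (𝓝 (τ₀, 0)) :=
    Continuous.tendsto (by fun_prop) τ₀
  have h4' := hι.eventually h4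
  refine ⟨fun τ => (ψ (τ, 0)).2, by simp [h1], ?_, ?_, ?_⟩
  · filter_upwards [hι.eventually h2] with τ hτ
    exact (hτ.comp (f := fun τ : ℂ => (τ, (0 : ℂ))) τ (by fun_prop)).snd
  · filter_upwards [h4'] with τ hτ
    have h5 : (ψ (τ, 0)).1 = τ := congrArg Prod.fst hτ
    have h6 := congrArg Prod.snd hτ
    simp only [G, h5] at h6
    simpa using h6
  · filter_upwards [h3] with x hx h0
    have : G x = (x.1, 0) := by
      simp only [eval_sub, eval_mul, eval_C] at h0
      simp [G, h0]
    rw [← this, hx]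

/-- Holomorphic selection of a root of a pencil all of whose roots are simple. -/
theorem exists_section {N D : ℂ[X]} (hDN : D.degree < N.degree) {T : Set ℂ} (hTo : IsOpen T)
    (hTc : Convex ℝ T) {f : ℂ → ℂ} (hf : DifferentiableOn ℂ f T)
    (hs : ∀ τ ∈ T, ∀ z, (N - C (f τ) * D).eval z = 0 →
      (derivative (N - C (f τ) * D)).eval z ≠ 0) {τ₀ z₀ : ℂ} (hτ₀ : τ₀ ∈ T)
    (h0 : (N - C (f τ₀) * D).eval z₀ = 0) :
    ∃ g : ℂ → ℂ, DifferentiableOn ℂ g T ∧ g τ₀ = z₀ ∧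
      ∀ τ ∈ T, (N - C (f τ) * D).eval (g τ) = 0 := by
  have hfa : ∀ τ ∈ T, AnalyticAt ℂ f τ := fun τ hτ => hf.analyticAt (hTo.mem_nhds hτ)
  have hfc : ContinuousOn f T := hf.continuousOn
  let E := {x : T × ℂ // (N - C (f x.1) * D).eval x.2 = 0}
  have hEc : IsClosed {x : T × ℂ | (N - C (f x.1) * D).eval x.2 = 0} := by
    refine isClosed_eq ?_ continuous_const
    have : Continuous fun x : T × ℂ => f x.1 := hfc.domRestrict.comp continuous_fst
    simp only [eval_sub, eval_mul, eval_C]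
    exact (N.continuous.comp continuous_snd).sub (this.mul (D.continuous.comp continuous_snd))
  let π : E → T := fun x => x.1.1
  have hπ : Continuous π := by fun_prop
  have hopen : IsOpenMap π := by
    rw [isOpenMap_iff_nhds_le]
    rintro ⟨⟨⟨τ, hτ⟩, z⟩, hz⟩ S hS
    rw [mem_map] at hS
    obtain ⟨ψ, h1, h2, h3, h4⟩ := exists_local_root (hfa τ hτ) hz (hs τ hτ z hz)
    rw [nhds_subtype_eq_comap, mem_comap] at hS
    obtain ⟨V, hV, hVS⟩ := hS
    have hc : Tendsto (fun t : T => (t, ψ t)) (𝓝 ⟨τ, hτ⟩) (𝓝 (⟨τ, hτ⟩, z)) := by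
      refine ContinuousAt.tendsto (f := fun t : T => (t, ψ t)) ?_ |>.trans (by simp [h1])
      have : ContinuousAt ψ ((⟨τ, hτ⟩ : T) : ℂ) := h2.self_of_nhds.continuousAt
      exact continuousAt_id.prodMk (this.comp continuousAt_subtype_val)
    have h3' : ∀ᶠ t : T in 𝓝 (⟨τ, hτ⟩ : T), (N - C (f t) * D).eval (ψ t) = 0 :=
      (continuous_subtype_val.tendsto (⟨τ, hτ⟩ : T)).eventually h3
    filter_upwards [hc.eventually hV, h3'] with t ht1 ht2
    exact @hVS ⟨(t, ψ t), ht2⟩ ht1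
  have hloc : IsLocalHomeomorph π := by
    rw [isLocalHomeomorph_iff_isOpenEmbedding_restrict]
    rintro ⟨⟨⟨τ, hτ⟩, z⟩, hz⟩
    obtain ⟨ψ, h1, h2, h3, h4⟩ := exists_local_root (hfa τ hτ) hz (hs τ hτ z hz)
    obtain ⟨V, hV, hVo, hVm⟩ := eventually_nhds_iff.1 h4
    let ι : E → ℂ × ℂ := fun x => (x.1.1, x.1.2)
    have hι : Continuous ι := by fun_prop
    refine ⟨ι ⁻¹' V, (hVo.preimage hι).mem_nhds hVm,
      .of_continuous_injective_isOpenMap (hπ.comp continuous_subtype_val) ?_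
        (hopen.domRestrict (hVo.preimage hι))⟩
    rintro ⟨⟨⟨t, z⟩, hz⟩, hx⟩ ⟨⟨⟨t', z'⟩, hz'⟩, hx'⟩ h
    obtain rfl : t = t' := h
    have e1 := hV _ hx hz
    have e2 := hV _ hx' hz'
    simp only [ι] at e1 e2
    exact Subtype.ext (Subtype.ext (Prod.ext rfl (e1.trans e2.symm)))
  have hproper : IsProperMap π := by
    rw [isProperMap_iff_ultrafilter]
    refine ⟨hπ, fun 𝒰 t ht => ?_⟩
    have hev : ∀ᶠ x : E in 𝒰, ‖f x.1.1‖ ≤ ‖f t‖ + 1 := by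
      have h1 : Tendsto (fun t : T => ‖f t‖) (𝓝 t) (𝓝 ‖f t‖) :=
        (hfc.domRestrict.norm.tendsto t)
      exact ht.eventually ((h1.eventually_lt_const (lt_add_one _)).mono fun _ h => h.le)
    obtain ⟨B, hB⟩ := exists_root_bound hDN (‖f t‖ + 1)
    have hev2 : ∀ᶠ x : E in 𝒰, x.1.2 ∈ Metric.closedBall (0 : ℂ) B := by
      filter_upwards [hev] with x hx
      simpa using hB _ _ hx x.2
    obtain ⟨z, -, hz⟩ := (isCompact_closedBall (0 : ℂ) B).ultrafilter_le_nhds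
      (𝒰.map fun x : E => x.1.2) (Filter.le_principal_iff.2 hev2)
    have hlim : Tendsto (fun x : E => x.1) 𝒰 (𝓝 (t, z)) := ht.prodMk_nhds hz
    have hmem : (t, z) ∈ {x : T × ℂ | (N - C (f x.1) * D).eval x.2 = 0} :=
      hEc.mem_of_tendsto hlim (Eventually.of_forall fun x => x.2)
    refine ⟨⟨(t, z), hmem⟩, rfl, ?_⟩
    rw [nhds_subtype_eq_comap, ← tendsto_iff_comap]
    exact hlim
  have hcov : IsCoveringMap π := by
    rw [isCoveringMap_iff_isCoveringMapOn_univ]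
    refine hproper.isClosedMap.isCoveringMapOn_of_isLocalHomeomorphOn (fun t _ => ?_)
      hloc.isLocalHomeomorphOn
    have hne : N - C (f t) * D ≠ 0 := by
      intro h
      exact hs t t.2 0 (by simp [h]) (by simp [h])
    refine Set.Finite.of_finite_image (f := fun x : E => x.1.2)
      ((N - C (f t) * D).rootSet_finite ℂ |>.subset ?_) ?_
    · rintro _ ⟨x, hx, rfl⟩
      rw [Set.mem_preimage, Set.mem_singleton_iff] at hx
      rw [mem_rootSet_of_ne hne, ← hx]
      simpa using x.2
    · intro x hx y hy hxy
      exact Subtype.ext (Prod.ext ((hx : π x = t).trans (hy : π y = t).symm) hxy)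
  have : LocallyPathConnectedSpace T := hTo.locallyPathConnectedSpace
  have : ContractibleSpace T := hTc.contractibleSpace ⟨_, hτ₀⟩
  obtain ⟨F, ⟨hF0, hF1⟩, -⟩ := hcov.existsUnique_continuousMap_lifts (ContinuousMap.id T)
    ⟨τ₀, hτ₀⟩ ⟨(⟨τ₀, hτ₀⟩, z₀), h0⟩ rfl
  have hF2 : ∀ t : T, (F t).1.1 = t := fun t => congrFun hF1 t
  classical
  refine ⟨fun τ => if h : τ ∈ T then (F ⟨τ, h⟩).1.2 else 0, ?_, by simp [hτ₀, hF0], ?_⟩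
  swap
  · intro τ hτ
    have := (F ⟨τ, hτ⟩).2
    rw [hF2] at this
    simpa [hτ] using this
  · intro τ hτ
    set g : ℂ → ℂ := fun τ => if h : τ ∈ T then (F ⟨τ, h⟩).1.2 else 0 with hg
    have hg0 : ∀ t ∈ T, (N - C (f t) * D).eval (g t) = 0 := by
      intro τ hτ
      have := (F ⟨τ, hτ⟩).2
      rw [hF2] at this
      simpa [hg, hτ] using this
    have hgc : ContinuousOn g T := by
      rw [continuousOn_iff_continuous_domRestrict]
      have : T.domRestrict g = fun t : T => (F t : E).1.2 := by
        ext t; simp [hg]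
      rw [this]
      exact continuous_snd.comp (continuous_subtype_val.comp F.continuous)
    obtain ⟨ψ, h1, h2, h3, h4⟩ := exists_local_root (hfa τ hτ) (hg0 τ hτ) (hs τ hτ _ (hg0 τ hτ))
    have hca : ContinuousAt g τ := hgc.continuousAt (hTo.mem_nhds hτ)
    have hev : g =ᶠ[𝓝 τ] ψ := by
      have : Tendsto (fun t => (t, g t)) (𝓝 τ) (𝓝 (τ, g τ)) := continuousAt_id.prodMk hca
      filter_upwards [this.eventually h4, hTo.mem_nhds hτ] with t ht htT
      exact ht (hg0 t htT)
    exact (h2.self_of_nhds.congr_of_eventuallyEq hev).differentiableWithinAt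

end CriticalValues

namespace CriticalValues

open Filter Topology Metric

/-- A crude form of Bloch's theorem. -/
theorem exists_ball_subset_image {φ : ℂ → ℂ} {ρ r : ℝ} (hr : 0 < r) (hrρ : r < ρ)
    (hφ : DifferentiableOn ℂ φ (ball 0 ρ)) :
    ∃ a, ball (φ a) (r * ‖deriv φ 0‖ / 48) ⊆ φ '' ball 0 ρ := by
  have hd' : DifferentiableOn ℂ (deriv φ) (ball 0 ρ) := hφ.deriv isOpen_ball
  have hsub : closedBall (0 : ℂ) r ⊆ ball 0 ρ := closedBall_subset_ball hrρ
  obtain ⟨a, ha, hmax⟩ := (isCompact_closedBall (0 : ℂ) r).exists_isMaxOn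
    (f := fun s => (r - ‖s‖) * ‖deriv φ s‖) ⟨0, by simp [hr.le]⟩
    ((continuousOn_const.sub continuous_norm.continuousOn).mul (hd'.continuousOn.mono hsub).norm)
  have hM : r * ‖deriv φ 0‖ ≤ (r - ‖a‖) * ‖deriv φ a‖ := by
    simpa using hmax (show (0 : ℂ) ∈ closedBall 0 r by simp [hr.le])
  rcases (norm_nonneg (deriv φ 0)).eq_or_lt with h0 | h0
  · exact ⟨0, by simp [← h0]⟩
  have hpos : 0 < (r - ‖a‖) * ‖deriv φ a‖ := lt_of_lt_of_le (by positivity) hM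
  have har : ‖a‖ ≤ r := by simpa using ha
  have hm : 0 < ‖deriv φ a‖ := by
    by_contra h
    have : ‖deriv φ a‖ = 0 := le_antisymm (not_lt.1 h) (norm_nonneg _)
    simp [this] at hpos
  have ht : 0 < r - ‖a‖ := (pos_iff_pos_of_mul_pos hpos).2 hm
  set m := ‖deriv φ a‖ with hmdef
  set t := (r - ‖a‖) / 2 with htdef
  have ht0 : 0 < t := by positivity
  have hball : ∀ s ∈ ball a t, ‖s‖ < r - t := by
    intro s hs
    have h1 : ‖s - a‖ < t := by simpa [dist_eq_norm] using hs
    have h2 : ‖s‖ ≤ ‖s - a‖ + ‖a‖ := by simpa using norm_add_le (s - a) a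
    linarith
  have hbr : ball a t ⊆ ball 0 ρ := fun s hs => by
    have := hball s hs
    simp only [mem_ball_zero_iff]; linarith
  have hbd : ∀ s ∈ ball a t, ‖deriv φ s‖ ≤ 2 * m := by
    intro s hs
    have h1 := hball s hs
    have h2 : (r - ‖s‖) * ‖deriv φ s‖ ≤ (r - ‖a‖) * m :=
      hmax (show s ∈ closedBall 0 r by simp; linarith)
    have h3 : t * ‖deriv φ s‖ ≤ (r - ‖s‖) * ‖deriv φ s‖ := by gcongr; linarith
    have h4 : t * ‖deriv φ s‖ ≤ t * (2 * m) := by rw [htdef] at h3 ⊢; linarith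
    exact le_of_mul_le_mul_left h4 ht0
  have hschw : ∀ s ∈ ball a t, ‖deriv φ s - deriv φ a‖ ≤ 3 * m / t * ‖s - a‖ := by
    intro s hs
    have := Complex.dist_le_div_mul_dist_of_mapsTo_ball (f := deriv φ) (c := a) (R₁ := t)
      (R₂ := 3 * m) (hd'.mono hbr) (fun s hs => by
        rw [mem_closedBall, dist_eq_norm]
        exact (norm_sub_le _ _).trans (by linarith [hbd s hs])) hs
    simpa [dist_eq_norm] using this
  set q := t / 6 with hqdef
  have hq0 : 0 < q := by positivity
  have hqt : closedBall a q ⊆ ball a t := closedBall_subset_ball (by rw [hqdef]; linarith)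
  have hlow : ∀ s ∈ sphere a q, m * q / 2 ≤ ‖φ s - φ a‖ := by
    intro s hs
    have hsq : ‖s - a‖ = q := by simpa [dist_eq_norm] using hs
    have h1 : ‖(φ s - s * deriv φ a) - (φ a - a * deriv φ a)‖ ≤ m / 2 * ‖s - a‖ := by
      refine (convex_closedBall a q).norm_image_sub_le_of_norm_hasDerivWithin_le
        (f := fun s => φ s - s * deriv φ a) (f' := fun s => deriv φ s - 1 * deriv φ a)
        (fun x hx => ?_) (fun x hx => ?_) (by simp [hq0.le]) (sphere_subset_closedBall hs)
      · have hxb := hbr (hqt hx)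
        exact ((hφ.differentiableAt (isOpen_ball.mem_nhds hxb)).hasDerivAt.sub
          ((hasDerivAt_id x).mul_const _)).hasDerivWithinAt
      · have h2 := hschw x (hqt hx)
        have h3 : ‖x - a‖ ≤ q := by simpa [dist_eq_norm] using hx
        rw [one_mul]
        refine h2.trans ?_
        calc 3 * m / t * ‖x - a‖ ≤ 3 * m / t * q := by gcongr
          _ = m / 2 := by rw [hqdef]; field_simp; norm_num
    have h2 : ‖(s - a) * deriv φ a‖ = q * m := by rw [norm_mul, hsq]
    have h3 : (s - a) * deriv φ a = (φ s - φ a) -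
      ((φ s - s * deriv φ a) - (φ a - a * deriv φ a)) := by ring
    have h4 := norm_sub_le (φ s - φ a) ((φ s - s * deriv φ a) - (φ a - a * deriv φ a))
    rw [← h3, h2] at h4
    rw [hsq] at h1
    nlinarith
  have hcl : DiffContOnCl ℂ φ (ball a q) :=
    DifferentiableOn.diffContOnCl (by
      rw [closure_ball _ hq0.ne']
      exact hφ.mono (hqt.trans hbr))
  have hfreq : ∃ᶠ z in 𝓝 a, φ z ≠ φ a := by
    intro hev
    have hev' : φ =ᶠ[𝓝 a] fun _ => φ a := by
      filter_upwards [hev] with z hz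
      simpa using hz
    have : deriv φ a = 0 := by rw [hev'.deriv_eq]; simp
    simp [hmdef, this] at hm
  refine ⟨a, fun w hw => ?_⟩
  have hw' : w ∈ ball (φ a) (m * q / 2 / 2) := by
    refine ball_subset_ball ?_ hw
    rw [hqdef, htdef]
    linarith
  exact Set.image_mono (hqt.trans hbr) (hcl.ball_subset_image_closedBall hq0 hlow hfreq hw')

theorem exists_log_ball {h : ℂ → ℂ} {c : ℂ} {ρ : ℝ} (hρ : 0 < ρ)
    (hd : DifferentiableOn ℂ h (ball c ρ)) (h0 : ∀ s ∈ ball c ρ, h s ≠ 0) :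
    ∃ φ : ℂ → ℂ, (∀ s ∈ ball c ρ, HasDerivAt φ (deriv h s / h s) s) ∧
      ∀ s ∈ ball c ρ, Complex.exp (φ s) = h s := by
  have hq : DifferentiableOn ℂ (fun s => deriv h s / h s) (ball c ρ) :=
    (hd.deriv isOpen_ball).div hd h0
  obtain ⟨φ, hφ⟩ := hq.isExactOn_ball
  have hc : c ∈ ball c ρ := mem_ball_self hρ
  refine ⟨fun s => φ s - φ c + Complex.log (h c),
    fun s hs => ((hφ s hs).sub_const _).add_const _, fun s hs => ?_⟩
  have hder : ∀ s ∈ ball c ρ, HasDerivAt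
      (fun s => h s * Complex.exp (-(φ s - φ c + Complex.log (h c)))) 0 s := by
    intro s hs
    have h1 := (hd.differentiableAt (isOpen_ball.mem_nhds hs)).hasDerivAt
    have h2 := (((hφ s hs).sub_const (φ c)).add_const (Complex.log (h c))).neg.cexp
    refine (h1.mul h2).congr_deriv ?_
    have e : h s * (deriv h s / h s) = deriv h s := mul_div_cancel₀ _ (h0 s hs)
    simp only [Pi.neg_apply]
    linear_combination -Complex.exp (-(φ s - φ c + Complex.log (h c))) * e
  have hconst := (convex_ball c ρ).is_const_of_fderivWithin_eq_zero (𝕜 := ℂ)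
    (fun s hs => (hder s hs).differentiableAt.differentiableWithinAt)
    (fun s hs => by
      rw [fderivWithin_of_isOpen isOpen_ball hs, (hder s hs).hasFDerivAt.fderiv]
      ext
      simp) hs hc
  simp only [sub_self, zero_add] at hconst
  rw [Complex.exp_neg, Complex.exp_neg, Complex.exp_log (h0 c hc), mul_inv_cancel₀ (h0 c hc)]
    at hconst
  have := Complex.exp_ne_zero (φ s - φ c + Complex.log (h c))
  field_simp at hconst
  exact hconst.symm

/-- A crude form of Koebe's theorem for nonvanishing univalent functions. -/
theorem norm_deriv_le_of_injOn {h : ℂ → ℂ} {ρ : ℝ} (hρ : 0 < ρ)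
    (hd : DifferentiableOn ℂ h (ball 0 ρ)) (h0 : ∀ s ∈ ball (0 : ℂ) ρ, h s ≠ 0)
    (hinj : Set.InjOn h (ball 0 ρ)) : ‖deriv h 0‖ ≤ 400 / ρ * ‖h 0‖ := by
  obtain ⟨φ, hφd, hφ⟩ := exists_log_ball hρ hd h0
  have hc : (0 : ℂ) ∈ ball (0 : ℂ) ρ := mem_ball_self hρ
  have hdφ : deriv φ 0 = deriv h 0 / h 0 := (hφd 0 hc).deriv
  have hkey : ∀ r, 0 < r → r < ρ → r * ‖deriv φ 0‖ ≤ 400 := by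
    intro r hr hrρ
    by_contra! hcon
    obtain ⟨a, ha⟩ := exists_ball_subset_image hr hrρ
      (fun s hs => (hφd s hs).differentiableAt.differentiableWithinAt)
    have hpi : 2 * Real.pi < r * ‖deriv φ 0‖ / 48 := by
      have := Real.pi_lt_d2
      linarith
    obtain ⟨x, hx, hxa⟩ := ha (mem_ball_self (by positivity))
    obtain ⟨y, hy, hya⟩ := ha (show φ a + 2 * Real.pi * Complex.I ∈ _ by
      simp [abs_of_pos Real.pi_pos, hpi])
    have hxy : x = y := by
      apply hinj hx hy
      rw [← hφ x hx, ← hφ y hy, hxa, hya, Complex.exp_periodic]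
    rw [← hxy, hxa] at hya
    have : (2 * Real.pi * Complex.I : ℂ) = 0 := by linear_combination -hya
    simp [Real.pi_ne_zero] at this
  have hlim : ρ * ‖deriv φ 0‖ ≤ 400 := by
    by_contra! hcon
    have hD : 0 < ‖deriv φ 0‖ := by
      by_contra h
      have : ‖deriv φ 0‖ = 0 := le_antisymm (not_lt.1 h) (norm_nonneg _)
      rw [this] at hcon; norm_num at hcon
    have h1 : 400 / ‖deriv φ 0‖ < ρ := by rwa [div_lt_iff₀ hD]
    obtain ⟨r, hr1, hr2⟩ := exists_between h1
    have := hkey r (lt_trans (by positivity) hr1) hr2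
    rw [div_lt_iff₀ hD] at hr1
    linarith
  rw [hdφ, norm_div] at hlim
  have hh : 0 < ‖h 0‖ := norm_pos_iff.2 (h0 0 hc)
  field_simp at hlim ⊢
  linarith

end CriticalValues

namespace CriticalValues

section Frames

variable {κ J : Type} [Fintype κ] [Fintype J]

/-- The position of the `k`-th pole in the coordinate normalised at the pole `p i`; the index `i`
stands for the old point at infinity. -/
noncomputable def frP (α p : κ → ℂ) (i k : κ) : ℂ := rf α p (p i) + α i / (p k - p i)

open Classical in
/-- The residues in the coordinate normalised at the pole `p i`. -/
noncomputable def frA (α p : κ → ℂ) (i k : κ) : ℂ :=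
  if k = i then α i else - (α i * α k / (p k - p i) ^ 2)

/-- The coordinate normalised at the pole `p i`. -/
noncomputable def frX (α p : κ → ℂ) (i : κ) (z : ℂ) : ℂ := rf α p (p i) + α i / (z - p i)

theorem frX_pole (α p : κ → ℂ) (i k : κ) : frX α p i (p k) = frP α p i k := rfl

theorem frA_self (α p : κ → ℂ) (i : κ) : frA α p i i = α i := if_pos rfl

theorem frA_of_ne (α p : κ → ℂ) {i k : κ} (h : k ≠ i) :
    frA α p i k = - (α i * α k / (p k - p i) ^ 2) := if_neg h

theorem frX_sub_frP_self (α p : κ → ℂ) (i : κ) (z : ℂ) :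
    frX α p i z - frP α p i i = α i / (z - p i) := by simp [frX, frP]

theorem frX_sub_frP {α p : κ → ℂ} {i k : κ} {z : ℂ} (hz : z ≠ p i) (hk : p k ≠ p i) :
    frX α p i z - frP α p i k = α i * (p k - z) / ((z - p i) * (p k - p i)) := by
  have h1 := sub_ne_zero.2 hz
  have h2 := sub_ne_zero.2 hk
  rw [frX, frP]
  field_simp
  ring

variable {α p : κ → ℂ} {i : κ}

theorem rf_frX (hp : Function.Injective p) (hα : α i ≠ 0) {z : ℂ} (hz : ∀ k, z ≠ p k) :
    rf (frA α p i) (frP α p i) (frX α p i z) = rf α p z := by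
  classical
  have hzi := sub_ne_zero.2 (hz i)
  have key : ∀ k, frA α p i k / (frX α p i z - frP α p i k) =
      α k / (z - p k) - α k / (p i - p k) +
        if k = i then (z - p i - α i / (z - p i)) else 0 := by
    intro k
    by_cases hk : k = i
    · subst hk
      rw [frX_sub_frP_self, frA_self]
      simp
      field_simp
    · have h1 := sub_ne_zero.2 (hz k)
      have h2 := sub_ne_zero.2 (hp.ne hk)
      have h3 : p i - p k ≠ 0 := sub_ne_zero.2 (hp.ne hk).symm
      have h4 : p k - z ≠ 0 := sub_ne_zero.2 (hz k).symm
      rw [frX_sub_frP (hz i) (hp.ne hk), frA_of_ne α p hk, if_neg hk]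
      field_simp
      ring
  rw [rf, Finset.sum_congr rfl fun k _ => key k, Finset.sum_add_distrib, Finset.sum_sub_distrib,
    Finset.sum_ite_eq' _ _ _, if_pos (Finset.mem_univ i), frX, rf, rf]
  ring

theorem rd_frX (hp : Function.Injective p) (hα : α i ≠ 0) {z : ℂ} (hz : ∀ k, z ≠ p k) :
    rd (frA α p i) (frP α p i) (frX α p i z) = - ((z - p i) ^ 2 / α i) * rd α p z := by
  classical
  have hzi := sub_ne_zero.2 (hz i)
  have key : ∀ k, frA α p i k / (frX α p i z - frP α p i k) ^ 2 =
      - ((z - p i) ^ 2 / α i) * (α k / (z - p k) ^ 2) +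
        if k = i then (1 + (z - p i) ^ 2 / α i) else 0 := by
    intro k
    by_cases hk : k = i
    · subst hk
      rw [frX_sub_frP_self, frA_self]
      simp
      field_simp
      ring
    · have h1 := sub_ne_zero.2 (hz k)
      have h2 := sub_ne_zero.2 (hp.ne hk)
      have h4 : p k - z ≠ 0 := sub_ne_zero.2 (hz k).symm
      rw [frX_sub_frP (hz i) (hp.ne hk), frA_of_ne α p hk, if_neg hk]
      field_simp
      ring
  rw [rd, Finset.sum_congr rfl fun k _ => key k, Finset.sum_add_distrib,
    Finset.sum_ite_eq' _ _ _, if_pos (Finset.mem_univ i), ← Finset.mul_sum, rd]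
  ring

theorem frP_injective (hp : Function.Injective p) (hα : α i ≠ 0) :
    Function.Injective (frP α p i) := by
  intro k l h
  simp only [frP, add_right_inj] at h
  apply hp
  by_cases hk : p k - p i = 0
  · by_cases hl : p l - p i = 0
    · linear_combination hk - hl
    · rw [hk, div_zero, eq_comm, div_eq_zero_iff] at h
      tauto
  · by_cases hl : p l - p i = 0
    · rw [hl, div_zero, div_eq_zero_iff] at h
      tauto
    · field_simp at h
      linear_combination -h

theorem frX_ne_frP (hα : α i ≠ 0) {z : ℂ} (hz : ∀ k, z ≠ p k) (k : κ) :
    frX α p i z ≠ frP α p i k := by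
  rw [← sub_ne_zero]
  have h := sub_ne_zero.2 (hz i)
  by_cases hk : p k = p i
  · simp [frX, frP, hk, hα, h]
  · rw [frX_sub_frP (hz i) hk]
    have h1 : p k - z ≠ 0 := sub_ne_zero.2 (hz k).symm
    have h2 := sub_ne_zero.2 hk
    positivity

theorem frA_ne_zero (hp : Function.Injective p) (hα : ∀ k, α k ≠ 0) (k : κ) :
    frA α p i k ≠ 0 := by
  by_cases hk : k = i
  · rw [hk, frA_self]; exact hα i
  · rw [frA_of_ne α p hk]
    have h2 := sub_ne_zero.2 (hp.ne hk)
    have := hα i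
    have := hα k
    simp [*]

theorem IsSol.frame {c : J → ℂ} {z : J → ℂ} (h : IsSol c α p z) (i : κ) :
    IsSol c (frA α p i) (frP α p i) (fun j => frX α p i (z j)) where
  res_ne := frA_ne_zero h.inj h.res_ne
  inj := frP_injective h.inj (h.res_ne i)
  ne_pole j k := frX_ne_frP (h.res_ne i) (h.ne_pole j) k
  crit j := by rw [rd_frX h.inj (h.res_ne i) (h.ne_pole j), h.crit j, mul_zero]
  val j := by rw [rf_frX h.inj (h.res_ne i) (h.ne_pole j), h.val j]

end Frames

end CriticalValues

namespace CriticalValues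

section Bound

open Filter Topology Metric

variable {κ J : Type} [Fintype κ] [Fintype J]

theorem hasDerivAt_rf (α : κ → ℂ) {p : κ → ℂ} {z : ℂ} (hz : ∀ k, z ≠ p k) :
    HasDerivAt (rf α p) (rd α p z) z := by
  have : HasDerivAt (fun z => z + ∑ k, α k / (z - p k))
      (1 + ∑ k, (- (α k / (z - p k) ^ 2))) z := by
    refine (hasDerivAt_id z).add (HasDerivAt.fun_sum fun k _ => ?_)
    have h := sub_ne_zero.2 (hz k)
    refine (((hasDerivAt_const z (α k)).div ((hasDerivAt_id z).sub_const (p k)) h)).congr_deriv ?_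
    simp [neg_div]
  refine this.congr_deriv ?_
  rw [rd, Finset.sum_neg_distrib, sub_eq_add_neg]

theorem eventually_ne_pole {p : κ → ℂ} {z : ℂ} (hz : ∀ k, z ≠ p k) : ∀ᶠ w in 𝓝 z, ∀ k, w ≠ p k :=
  eventually_all.2 fun k => isOpen_ne.mem_nhds (hz k)

theorem IsSol.norm_crit_sub_pole_le {c : J → ℂ} {α p : κ → ℂ} {z : J → ℂ} (h : IsSol c α p z)
    (hz : Function.Injective z) (hJ : Fintype.card J = 2 * Fintype.card κ) {R : ℝ}
    (hR : ∀ j, ‖c j‖ < R) (j : J) (k₀ : κ) : ‖z j - p k₀‖ ≤ 800 * R := by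
  classical
  have hR0 : 0 < R := lt_of_le_of_lt (norm_nonneg _) (hR j)
  have hd : ∀ k, z j - p k ≠ 0 := fun k => sub_ne_zero.2 (h.ne_pole j k)
  set e : κ → ℂ := fun k => - (z j - p k)⁻¹ with he
  have he0 : ∀ k, e k ≠ 0 := fun k => by simpa [he] using hd k
  have hei : Function.Injective e := by
    intro k l hkl
    have h1 : z j - p k = z j - p l := by simpa [he] using hkl
    exact h.inj (by linear_combination -h1)
  set β : κ → ℂ := fun k => α k / (z j - p k) ^ 2 with hβ
  have hβ0 : ∀ k, β k ≠ 0 := fun k => div_ne_zero (h.res_ne k) (pow_ne_zero 2 (hd k))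
  set N : ℂ[X] := X * den e with hN
  set D : ℂ[X] := den e - X * ∑ k, C (β k) * codn e k with hD
  set g : ℂ → ℂ := fun ξ => rf α p (z j + ξ⁻¹) - c j with hg
  have hDe : ∀ k, D.eval (e k) ≠ 0 := by
    intro k
    rw [hD, eval_sub, eval_den_eq_zero_iff.2 ⟨k, rfl⟩, eval_mul, eval_finsetSum,
      Finset.sum_eq_single k]
    · simp [he0, hβ0, eval_codn_self hei]
    · intro l _ hl
      simp [eval_codn_of_ne e hl]
    · simp
  have hden0 : (den e).eval 0 ≠ 0 := eval_den_ne fun k => (he0 k).symm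
  have hD0 : D.eval 0 = (den e).eval 0 := by simp [hD]
  have hgN : ∀ ξ, ξ ≠ 0 → (∀ k, ξ ≠ e k) →
      (∀ k, z j + ξ⁻¹ ≠ p k) ∧ D.eval ξ = N.eval ξ * g ξ := by
    intro ξ hξ hξe
    have hpole : ∀ k, z j + ξ⁻¹ ≠ p k := by
      intro k hk
      refine hξe k ?_
      have : ξ⁻¹ = - (z j - p k) := by linear_combination hk
      rw [he]
      simp only
      rw [← inv_inv ξ, this, inv_neg]
    refine ⟨hpole, ?_⟩
    have h1 : g ξ = ξ⁻¹ - ∑ k, β k / (ξ - e k) := by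
      have h2 : ∀ k, α k / (z j + ξ⁻¹ - p k) - α k / (z j - p k) = - (β k / (ξ - e k)) := by
        intro k
        have h3 := hd k
        have h4 := sub_ne_zero.2 (hpole k)
        have h5 := sub_ne_zero.2 (hξe k)
        have h6 : ξ - e k = ξ * (z j + ξ⁻¹ - p k) / (z j - p k) := by
          rw [he]
          field_simp
          ring
        rw [h6, hβ]
        simp only
        rw [div_sub_div _ _ h4 h3, ← neg_div, div_div_eq_mul_div,
          div_eq_div_iff (mul_ne_zero h4 h3) (mul_ne_zero hξ h4)]
        field_simp
        ring
      rw [hg]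
      simp only
      rw [← h.val j, rf, rf]
      have := Finset.sum_congr rfl fun k (_ : k ∈ Finset.univ) => h2 k
      rw [Finset.sum_sub_distrib, Finset.sum_neg_distrib] at this
      linear_combination this
    rw [h1, hD, hN]
    simp only [eval_sub, eval_mul, eval_X, eval_finsetSum, eval_C]
    have h2 : ∀ k, β k * (codn e k).eval ξ = (den e).eval ξ * (β k / (ξ - e k)) := by
      intro k
      rw [eval_codn_eq (hξe k)]
      ring
    rw [Finset.sum_congr rfl fun k _ => h2 k, ← Finset.mul_sum]
    field_simp
  have hDne : ∀ s ξ, (N - C s * D).eval ξ = 0 → D.eval ξ ≠ 0 := by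
    intro s ξ h0 hD'
    have hN0 : N.eval ξ = 0 := by simpa [hD'] using h0
    rw [hN, eval_mul, eval_X, mul_eq_zero, eval_den_eq_zero_iff] at hN0
    rcases hN0 with rfl | ⟨k, rfl⟩
    · exact hden0 (hD0 ▸ hD')
    · exact hDe k hD'
  have hpole0 : ∀ s k, (N - C s * D).eval (e k) = 0 → s = 0 := by
    intro s k h0
    have := hDe k
    simpa [hN, eval_den_eq_zero_iff.2 ⟨k, rfl⟩, this] using h0
  have hDN : D.degree < N.degree := by
    have hNd : N.degree = ((Fintype.card κ + 1 : ℕ) : WithBot ℕ) := by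
      rw [hN, degree_mul, degree_X, degree_eq_natDegree (monic_den e).ne_zero, natDegree_den]
      push_cast
      ring
    have hDd : D.natDegree ≤ Fintype.card κ := by
      rw [hD]
      refine (natDegree_sub_le _ _).trans (max_le (natDegree_den e).le ?_)
      rw [Finset.mul_sum]
      refine natDegree_sum_le_of_forall_le _ _ fun k _ => ?_
      have h3 : 0 < Fintype.card κ := Fintype.card_pos_iff.2 ⟨k⟩
      refine natDegree_mul_le.trans ?_
      rw [natDegree_X]
      have := natDegree_C_mul_le (β k) (codn e k)
      rw [natDegree_codn] at this
      omega
    rw [hNd]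
    refine lt_of_le_of_lt degree_le_natDegree ?_
    exact_mod_cast Nat.lt_succ_of_le hDd
  have hderN0 : (derivative N).eval 0 = (den e).eval 0 := by
    simp [hN]
  set ρ : ℝ := 1 / (2 * R) with hρ
  have hρ0 : 0 < ρ := by positivity
  have hs : ∀ s ∈ ball (0 : ℂ) ρ, ∀ ξ, (N - C s * D).eval ξ = 0 →
      (derivative (N - C s * D)).eval ξ ≠ 0 := by
    intro s hs ξ hξ
    by_cases hξ0 : ξ = 0
    · subst hξ0
      have : s = 0 := by
        have h1 : s * (den e).eval 0 = 0 := by simpa [hN, hD0] using hξ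
        exact (mul_eq_zero.1 h1).resolve_right hden0
      simpa [this, hderN0] using hden0
    by_cases hξe : ∃ k, ξ = e k
    · obtain ⟨k, rfl⟩ := hξe
      rw [hpole0 s k hξ, C_0, zero_mul, sub_zero, hN, den_eq e k]
      simp [he0, eval_codn_self hei]
    · push Not at hξe
      obtain ⟨hp, hDg⟩ := hgN ξ hξ0 hξe
      have hNne : N.eval ξ ≠ 0 := by
        rw [hN, eval_mul, eval_X]
        exact mul_ne_zero hξ0 (eval_den_ne hξe)
      have hsg : s * g ξ = 1 := by
        have h1 : N.eval ξ * (1 - s * g ξ) = 0 := by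
          have h2 : N.eval ξ - s * D.eval ξ = 0 := by simpa using hξ
          rw [hDg] at h2
          linear_combination h2
        have := (mul_eq_zero.1 h1).resolve_left hNne
        linear_combination -this
      have hs0 : s ≠ 0 := by
        rintro rfl
        simp at hsg
      have hrd : rd α p (z j + ξ⁻¹) ≠ 0 := by
        intro h0
        obtain ⟨j', hj'⟩ := h.exists_eq_of_crit hz hJ hp h0
        have h1 : g ξ = c j' - c j := by
          rw [hg]
          simp only
          rw [hj', h.val j']
        have h2 : ‖s‖ * ‖g ξ‖ = 1 := by rw [← norm_mul, hsg, norm_one]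
        have h3 : ‖g ξ‖ ≤ 2 * R := by
          rw [h1]
          refine (norm_sub_le _ _).trans ?_
          linarith [hR j, hR j']
        have h4 : ‖s‖ < ρ := by simpa using hs
        have h5 : ‖s‖ * ‖g ξ‖ < 1 := by
          calc ‖s‖ * ‖g ξ‖ ≤ ‖s‖ * (2 * R) := by gcongr
            _ < ρ * (2 * R) := by gcongr
            _ = 1 := by rw [hρ]; field_simp
        linarith
      have hg' : HasDerivAt g (rd α p (z j + ξ⁻¹) * (- (ξ ^ 2)⁻¹)) ξ := by
        have h1 : HasDerivAt (fun ξ : ℂ => z j + ξ⁻¹) (- (ξ ^ 2)⁻¹) ξ :=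
          (hasDerivAt_inv hξ0).const_add (z j)
        exact ((hasDerivAt_rf α hp).comp ξ h1).sub_const (c j)
      have hder : HasDerivAt (fun x => N.eval x * (1 - s * g x))
          ((derivative N).eval ξ * (1 - s * g ξ) +
            N.eval ξ * (- (s * (rd α p (z j + ξ⁻¹) * (- (ξ ^ 2)⁻¹))))) ξ :=
        (N.hasDerivAt ξ).mul ((hg'.const_mul s).const_sub 1)
      have hev : (fun x => (N - C s * D).eval x) =ᶠ[𝓝 ξ] fun x => N.eval x * (1 - s * g x) := by
        filter_upwards [isOpen_ne.mem_nhds hξ0, eventually_ne_pole hξe] with x hx1 hx2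
        have h1 : (N - C s * D).eval x = N.eval x - s * D.eval x := by simp
        rw [h1, (hgN x hx1 hx2).2]
        ring
      rw [((N - C s * D).hasDerivAt ξ).unique (hder.congr_of_eventuallyEq hev), hsg]
      simp [hNne, hs0, hrd, hξ0]
  obtain ⟨ξ, hξd, hξ0, hξ⟩ := exists_section hDN isOpen_ball (convex_ball (0 : ℂ) ρ)
    (f := fun s => s) differentiableOn_id hs (τ₀ := 0) (z₀ := 0) (mem_ball_self hρ0)
    (by simp [hN])
  have hξat := (hξd.differentiableAt (isOpen_ball.mem_nhds (mem_ball_self hρ0))).hasDerivAt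
  have hξ' : deriv ξ 0 = 1 := by
    have h1 : HasDerivAt (fun s => N.eval (ξ s) - s * D.eval (ξ s))
        ((derivative N).eval (ξ 0) * deriv ξ 0 -
          (1 * D.eval (ξ 0) + 0 * ((derivative D).eval (ξ 0) * deriv ξ 0))) 0 :=
      ((N.hasDerivAt (ξ 0)).comp 0 hξat).sub
        ((hasDerivAt_id (0 : ℂ)).mul ((D.hasDerivAt (ξ 0)).comp 0 hξat))
    have h2 : HasDerivAt (fun s => N.eval (ξ s) - s * D.eval (ξ s)) 0 0 := by
      refine (hasDerivAt_const (0 : ℂ) (0 : ℂ)).congr_of_eventuallyEq ?_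
      filter_upwards [isOpen_ball.mem_nhds (mem_ball_self hρ0)] with s hs
      simpa using hξ s hs
    have h3 := h1.unique h2
    rw [hξ0, hD0, hderN0] at h3
    have h4 : (den e).eval 0 * (deriv ξ 0 - 1) = 0 := by linear_combination h3
    have := (mul_eq_zero.1 h4).resolve_left hden0
    linear_combination this
  have hH : HasDerivAt (fun s => 1 + ξ s * (z j - p k₀)) (1 * (z j - p k₀)) 0 := by
    rw [hξ'] at hξat
    exact (hξat.mul_const _).const_add 1
  have hbound := norm_deriv_le_of_injOn (h := fun s => 1 + ξ s * (z j - p k₀)) hρ0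
    ((hξd.mul_const _).const_add 1) ?_ ?_
  · rw [hH.deriv] at hbound
    simp only [hξ0, one_mul, zero_mul, add_zero, norm_one, mul_one] at hbound
    refine hbound.trans (le_of_eq ?_)
    rw [hρ]
    field_simp
    norm_num
  · intro s hs' h0
    have h1 : ξ s = e k₀ := by
      rw [he]
      have := hd k₀
      field_simp
      linear_combination h0
    have h2 : s = 0 := hpole0 s k₀ (h1 ▸ hξ s hs')
    rw [h2, hξ0] at h1
    exact he0 k₀ h1.symm
  · intro s hs' t ht hst
    have h1 : ξ s = ξ t := by
      have h2 : (ξ s - ξ t) * (z j - p k₀) = 0 := by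
        simp only at hst
        linear_combination hst
      exact sub_eq_zero.1 ((mul_eq_zero.1 h2).resolve_right (hd k₀))
    have h2 := hξ s hs'
    have h3 := hξ t ht
    have h4 := hDne _ _ h3
    rw [h1] at h2
    simp only [eval_sub, eval_mul, eval_C] at h2 h3
    have h5 : (s - t) * D.eval (ξ t) = 0 := by linear_combination h3 - h2
    exact sub_eq_zero.1 ((mul_eq_zero.1 h5).resolve_right h4)

end Bound

end CriticalValues

namespace CriticalValues

open Filter Topology Metric

theorem eqOn_of_exp_eqOn {A : Type*} [TopologicalSpace A] {S : Set A} (hS : IsPreconnected S)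
    {f g : A → ℂ} (hf : ContinuousOn f S) (hg : ContinuousOn g S)
    (h : ∀ a ∈ S, Complex.exp (f a) = Complex.exp (g a)) {a : A} (ha : a ∈ S) (hfg : f a = g a) :
    Set.EqOn f g S :=
  Complex.isCoveringMap_exp.isSeparatedMap.eqOn_of_comp_eqOn
    Complex.isCoveringMap_exp.isLocalHomeomorph.isLocallyInjective hS hf hg
    (fun x hx => Subtype.ext (h x hx)) ha hfg

theorem eqOn_of_root_eqOn {N D : ℂ[X]} {A : Type*} [TopologicalSpace A] {S : Set A}
    (hS : IsPreconnected S) {w f g : A → ℂ} (hw : ContinuousOn w S) (hf : ContinuousOn f S)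
    (hg : ContinuousOn g S) (hfr : ∀ a ∈ S, (N - C (w a) * D).eval (f a) = 0)
    (hgr : ∀ a ∈ S, (N - C (w a) * D).eval (g a) = 0)
    (hs : ∀ a ∈ S, (derivative (N - C (w a) * D)).eval (f a) ≠ 0) {a : A} (ha : a ∈ S)
    (hfg : f a = g a) : Set.EqOn f g S := by
  rw [continuousOn_iff_continuous_domRestrict] at hw hf hg
  have : PreconnectedSpace S := isPreconnected_iff_preconnectedSpace.1 hS
  have hcl : IsClosed {x : S | f x = g x} := isClosed_eq hf hg
  have hop : IsOpen {x : S | f x = g x} := by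
    rw [isOpen_iff_mem_nhds]
    intro x hx
    obtain ⟨ψ, -, -, -, hψ⟩ := exists_local_root (N := N) (D := D) (f := fun s => s) (τ₀ := w x)
      (z₀ := f x) analyticAt_id (hfr x x.2) (hs x x.2)
    have h1 : Tendsto (fun y : S => (w y, f y)) (𝓝 x) (𝓝 (w x, f x)) :=
      (hw.tendsto x).prodMk_nhds (hf.tendsto x)
    have h2 : Tendsto (fun y : S => (w y, g y)) (𝓝 x) (𝓝 (w x, f x)) := by
      have hx' : f x = g x := hx
      rw [hx']
      exact (hw.tendsto x).prodMk_nhds (hg.tendsto x)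
    filter_upwards [h1.eventually hψ, h2.eventually hψ] with y hy1 hy2
    exact (hy1 (hfr y y.2)).trans (hy2 (hgr y y.2)).symm
  have huniv := IsClopen.eq_univ ⟨hcl, hop⟩ ⟨⟨a, ha⟩, hfg⟩
  intro x hx
  have : (⟨x, hx⟩ : S) ∈ {x : S | f x = g x} := huniv ▸ Set.mem_univ _
  exact this

section Numerator

variable {κ J : Type} [Fintype κ] [Fintype J]

/-- The numerator of `rf α p`. -/
noncomputable def num (α p : κ → ℂ) : ℂ[X] := X * den p + ∑ k, C (α k) * codn p k

theorem eval_num (α : κ → ℂ) {p : κ → ℂ} {z : ℂ} (hz : ∀ k, z ≠ p k) :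
    (num α p).eval z = rf α p z * (den p).eval z := by
  rw [num, rf]
  simp only [eval_add, eval_mul, eval_X, eval_finsetSum, eval_C, add_mul, Finset.sum_mul]
  congr 1
  refine Finset.sum_congr rfl fun k _ => ?_
  rw [eval_codn_eq (hz k)]
  ring

theorem eval_num_pole (α p : κ → ℂ) (k : κ) :
    (num α p).eval (p k) = α k * (codn p k).eval (p k) := by
  rw [num, eval_add, eval_mul, eval_den_eq_zero_iff.2 ⟨k, rfl⟩, mul_zero, zero_add,
    eval_finsetSum, Finset.sum_eq_single k]
  · simp
  · intro l _ hl
    simp [eval_codn_of_ne p hl]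
  · simp

theorem degree_sum_codn_lt (α p : κ → ℂ) :
    (∑ k, C (α k) * codn p k).degree < ((Fintype.card κ : ℕ) : WithBot ℕ) := by
  refine lt_of_le_of_lt (degree_sum_le _ _) ?_
  rw [Finset.sup_lt_iff (WithBot.bot_lt_coe _)]
  intro k _
  have h3 : 0 < Fintype.card κ := Fintype.card_pos_iff.2 ⟨k⟩
  refine lt_of_le_of_lt degree_le_natDegree ?_
  have := natDegree_C_mul_le (α k) (codn p k)
  rw [natDegree_codn] at this
  exact_mod_cast (by omega)

theorem degree_den (p : κ → ℂ) : (den p).degree = ((Fintype.card κ : ℕ) : WithBot ℕ) := by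
  rw [degree_eq_natDegree (monic_den p).ne_zero, natDegree_den]

theorem degree_X_mul_den (p : κ → ℂ) :
    (X * den p).degree = ((Fintype.card κ + 1 : ℕ) : WithBot ℕ) := by
  rw [degree_mul, degree_X, degree_den]
  push_cast
  ring

theorem degree_num (α p : κ → ℂ) :
    (num α p).degree = ((Fintype.card κ + 1 : ℕ) : WithBot ℕ) := by
  rw [num, degree_add_eq_left_of_degree_lt, degree_X_mul_den]
  rw [degree_X_mul_den]
  refine (degree_sum_codn_lt α p).trans ?_
  exact_mod_cast Nat.lt_succ_self _

theorem natDegree_num (α p : κ → ℂ) : (num α p).natDegree = Fintype.card κ + 1 :=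
  natDegree_eq_of_degree_eq_some (degree_num α p)

theorem degree_den_lt_num (α p : κ → ℂ) : (den p).degree < (num α p).degree := by
  rw [degree_num, degree_den]
  exact_mod_cast Nat.lt_succ_self _

theorem eval_fiber_eq_zero_iff {α p : κ → ℂ} (hα : ∀ k, α k ≠ 0) (hp : Function.Injective p)
    {w z : ℂ} : (num α p - C w * den p).eval z = 0 ↔ (∀ k, z ≠ p k) ∧ rf α p z = w := by
  by_cases hz : ∀ k, z ≠ p k
  · have h := eval_den_ne hz
    rw [eval_sub, eval_mul, eval_C, eval_num α hz, ← sub_mul, mul_eq_zero, or_iff_left h,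
      sub_eq_zero]
    exact ⟨fun h => ⟨hz, h⟩, fun h => h.2⟩
  · refine iff_of_false ?_ fun h => hz h.1
    push Not at hz
    obtain ⟨k, rfl⟩ := hz
    rw [eval_sub, eval_mul, eval_den_eq_zero_iff.2 ⟨k, rfl⟩, eval_num_pole]
    simp [hα, eval_codn_self hp]

theorem eval_derivative_fiber {α p : κ → ℂ} {z : ℂ} (hz : ∀ k, z ≠ p k) :
    (derivative (num α p - C (rf α p z) * den p)).eval z = rd α p z * (den p).eval z := by
  have h1 : HasDerivAt (fun x => (rf α p x - rf α p z) * (den p).eval x)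
      (rd α p z * (den p).eval z + (rf α p z - rf α p z) * (derivative (den p)).eval z) z :=
    ((hasDerivAt_rf α hz).sub_const _).mul ((den p).hasDerivAt z)
  have h2 : (fun x => (num α p - C (rf α p z) * den p).eval x) =ᶠ[𝓝 z]
      fun x => (rf α p x - rf α p z) * (den p).eval x := by
    filter_upwards [eventually_ne_pole hz] with x hx
    have : (num α p - C (rf α p z) * den p).eval x =
      (num α p).eval x - rf α p z * (den p).eval x := by simp
    rw [this, eval_num α hx]
    ring
  rw [(Polynomial.hasDerivAt _ z).unique (h1.congr_of_eventuallyEq h2)]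
  ring

theorem IsSol.simple_roots {c : J → ℂ} {α p : κ → ℂ} {z : J → ℂ} (h : IsSol c α p z)
    (hz : Function.Injective z) (hJ : Fintype.card J = 2 * Fintype.card κ) {w ζ : ℂ}
    (hw : ∀ j, c j ≠ w) (h0 : (num α p - C w * den p).eval ζ = 0) :
    (derivative (num α p - C w * den p)).eval ζ ≠ 0 := by
  obtain ⟨hp, rfl⟩ := (eval_fiber_eq_zero_iff h.res_ne h.inj).1 h0
  rw [eval_derivative_fiber hp]
  refine mul_ne_zero (fun hr => ?_) (eval_den_ne hp)
  obtain ⟨j, rfl⟩ := h.exists_eq_of_crit hz hJ hp hr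
  exact hw j (h.val j).symm

end Numerator

end CriticalValues

namespace CriticalValues

open Filter Topology Metric

variable {κ J : Type} [Fintype κ] [Fintype J]

theorem isSimplyConnected_of_convex {E : Type*} [AddCommGroup E] [Module ℝ E] [TopologicalSpace E]
    [ContinuousAdd E] [ContinuousSMul ℝ E] {S : Set E} (hS : Convex ℝ S) (hne : S.Nonempty) :
    IsSimplyConnected S := by
  have := hS.contractibleSpace hne
  rw [IsSimplyConnected]
  infer_instance

theorem exists_ball_disjoint_fiber {α p : κ → ℂ} (hα : ∀ k, α k ≠ 0) (hp : Function.Injective p)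
    (i : κ) (M : ℝ) : ∃ η > 0, ∀ ζ w : ℂ, ‖w‖ ≤ M → (num α p - C w * den p).eval ζ = 0 →
      η ≤ ‖ζ - p i‖ := by
  have hN : 0 < ‖(num α p).eval (p i)‖ := by
    rw [eval_num_pole]
    exact norm_pos_iff.2 (mul_ne_zero (hα i) (eval_codn_self hp i))
  have h1 : ContinuousAt (fun ζ => ‖(num α p).eval ζ‖ - M * ‖(den p).eval ζ‖) (p i) := by
    fun_prop
  have h2 : ∀ᶠ ζ in 𝓝 (p i), 0 < ‖(num α p).eval ζ‖ - M * ‖(den p).eval ζ‖ := by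
    refine h1.eventually (lt_mem_nhds ?_)
    simpa [eval_den_eq_zero_iff.2 ⟨i, rfl⟩] using hN
  obtain ⟨η, hη, h3⟩ := Metric.eventually_nhds_iff.1 h2
  refine ⟨η, hη, fun ζ w hw h0 => ?_⟩
  by_contra! hlt
  have h4 := h3 (show dist ζ (p i) < η by rwa [dist_eq_norm])
  have h5 : (num α p).eval ζ = w * (den p).eval ζ := by
    have : (num α p).eval ζ - w * (den p).eval ζ = 0 := by simpa using h0
    linear_combination this
  rw [h5, norm_mul] at h4
  have : ‖w‖ * ‖(den p).eval ζ‖ ≤ M * ‖(den p).eval ζ‖ := by gcongr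
  linarith

theorem IsSol.false_of_winding {c : J → ℂ} {α p : κ → ℂ} {z : J → ℂ} (h : IsSol c α p z)
    (hz : Function.Injective z) (hJ : Fintype.card J = 2 * Fintype.card κ) {q w₀ : ℂ} {δ r : ℝ}
    (hδ : 0 < δ) {i : κ} (hi : ‖p i - q‖ < δ)
    (hcirc : ∀ ζ, ‖ζ - q‖ = δ →
      (∀ k, ζ ≠ p k) ∧ rf α p ζ ≠ w₀ ∧ ‖rf α p ζ - w₀‖ < r)
    (hc : ∀ j, c j ≠ w₀ → r ≤ ‖c j - w₀‖) : False := by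
  set γ : ℝ → ℂ := fun θ => q + δ * Complex.exp (θ * Complex.I) with hγ
  have hγn : ∀ θ, ‖γ θ - q‖ = δ := fun θ => by
    simp [hγ, Complex.norm_exp_ofReal_mul_I, abs_of_pos hδ]
  have hγc : Continuous γ := by fun_prop
  have hfγ : Continuous fun θ => rf α p (γ θ) - w₀ := by
    refine Continuous.sub ?_ continuous_const
    rw [continuous_iff_continuousAt]
    exact fun θ => (hasDerivAt_rf α (hcirc _ (hγn θ)).1).continuousAt.comp hγc.continuousAt
  obtain ⟨l, hlc, hl⟩ := Complex.exists_continuousOn_eqOn_exp_comp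
    (U := (Set.univ : Set ℝ)) (isSimplyConnected_of_convex convex_univ Set.univ_nonempty)
    isOpen_univ
    hfγ.continuousOn (by
      rintro ⟨θ, -, h0⟩
      exact (hcirc _ (hγn θ)).2.1 (sub_eq_zero.1 h0))
  have hl' : ∀ θ, Complex.exp (l θ) = rf α p (γ θ) - w₀ := fun θ => hl (Set.mem_univ θ)
  have hr : 0 < r := lt_of_le_of_lt (norm_nonneg _) (hcirc _ (hγn 0)).2.2
  set T : Set ℂ := {ζ | ζ.re < Real.log r} with hT
  have hTo : IsOpen T := isOpen_lt Complex.continuous_re continuous_const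
  have hTc : Convex ℝ T := convex_halfSpace_re_lt _
  have hexp : ∀ ζ ∈ T, ‖Complex.exp ζ‖ < r := fun ζ hζ => by
    rw [Complex.norm_exp]
    exact (Real.lt_log_iff_exp_lt hr).1 hζ
  have hlT : ∀ θ, l θ ∈ T := fun θ => by
    have h1 := (hcirc _ (hγn θ)).2.2
    rw [← hl' θ, Complex.norm_exp] at h1
    exact (Real.lt_log_iff_exp_lt hr).2 h1
  set F : ℂ → ℂ := fun ζ => w₀ + Complex.exp ζ with hF
  have hFd : Differentiable ℂ F := by fun_prop
  have hFc : ∀ ζ ∈ T, ∀ j, c j ≠ F ζ := by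
    intro ζ hζ j hj
    have h1 : c j - w₀ = Complex.exp ζ := by rw [hj, hF]; ring
    have h2 : c j ≠ w₀ := by
      rw [← sub_ne_zero, h1]
      exact Complex.exp_ne_zero _
    have h3 := hc j h2
    rw [h1] at h3
    linarith [hexp ζ hζ]
  have hs : ∀ τ ∈ T, ∀ ζ, (num α p - C (F τ) * den p).eval ζ = 0 →
      (derivative (num α p - C (F τ) * den p)).eval ζ ≠ 0 :=
    fun τ hτ ζ h0 => h.simple_roots hz hJ (hFc τ hτ) h0
  have hγroot : ∀ θ, (num α p - C (F (l θ)) * den p).eval (γ θ) = 0 := fun θ => by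
    rw [eval_fiber_eq_zero_iff h.res_ne h.inj]
    refine ⟨(hcirc _ (hγn θ)).1, ?_⟩
    rw [hF]
    simp only
    rw [hl' θ]
    ring
  obtain ⟨g, hgd, hg0, hg⟩ := exists_section (degree_den_lt_num α p) hTo hTc hFd.differentiableOn
    hs (hlT 0) (hγroot 0)
  have hgc := hgd.continuousOn
  have hlc' : Continuous l := continuousOn_univ.1 hlc
  have hgl : ∀ θ, g (l θ) = γ θ := by
    have h1 : ContinuousOn (fun θ => g (l θ)) Set.univ :=
      hgc.comp hlc fun θ _ => hlT θ
    have h2 := eqOn_of_root_eqOn (N := num α p) (D := den p) (w := fun θ => F (l θ))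
      (f := fun θ => g (l θ)) (g := γ) isPreconnected_univ
      (hFd.continuous.comp hlc').continuousOn h1 hγc.continuousOn (fun θ _ => hg _ (hlT θ))
      (fun θ _ => hγroot θ) (fun θ _ => hs _ (hlT θ) _ (hg _ (hlT θ))) (Set.mem_univ (0 : ℝ)) hg0
    exact fun θ => h2 (Set.mem_univ θ)
  have hγper : γ (2 * Real.pi) = γ 0 := by simp [hγ]
  obtain ⟨n, hn⟩ := Complex.exp_eq_exp_iff_exists_int.1
    ((hl' (2 * Real.pi)).trans (hγper ▸ (hl' 0).symm))
  set ω : ℂ := n * (2 * Real.pi * Complex.I) with hω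
  have hωre : ω.re = 0 := by simp [hω]
  have hTω : ∀ ζ ∈ T, ∀ s : ℝ, ζ + s * ω ∈ T := fun ζ hζ s => by
    have h1 : ζ.re < Real.log r := hζ
    simpa [hT, hωre] using h1
  have hgper : ∀ ζ ∈ T, g (ζ + ω) = g ζ := by
    have hshift : ∀ ζ ∈ T, ζ + ω ∈ T := fun ζ hζ => by simpa using hTω ζ hζ 1
    have hFω : ∀ ζ, F (ζ + ω) = F ζ := fun ζ => by
      simp only [hF, hω, Complex.exp_add, Complex.exp_int_mul_two_pi_mul_I, mul_one]
    refine eqOn_of_root_eqOn (N := num α p) (D := den p) (w := F)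
      (f := fun ζ => g (ζ + ω)) (g := g) hTc.isPreconnected hFd.continuous.continuousOn
      (hgc.comp (by fun_prop) hshift) hgc (fun ζ hζ => ?_) hg (fun ζ hζ => ?_) (hlT 0) ?_
    · simpa [hFω] using hg _ (hshift ζ hζ)
    · simpa [hFω] using hs _ (hshift ζ hζ) _ (hg _ (hshift ζ hζ))
    · rw [← hn, hgl, hgl, hγper]
  have hFM : ∀ ζ ∈ T, ‖F ζ‖ ≤ ‖w₀‖ + r := fun ζ hζ =>
    (norm_add_le _ _).trans (by linarith [hexp ζ hζ])
  obtain ⟨B, hB⟩ := exists_root_bound (degree_den_lt_num α p) (‖w₀‖ + r)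
  have hgB : ∀ ζ ∈ T, ‖g ζ‖ ≤ B := fun ζ hζ => hB _ _ (hFM ζ hζ) (hg ζ hζ)
  obtain ⟨η, hη, hgη⟩ := exists_ball_disjoint_fiber h.res_ne h.inj i (‖w₀‖ + r)
  have hgη : ∀ ζ ∈ T, η ≤ ‖g ζ - p i‖ := fun ζ hζ => hgη _ _ (hFM ζ hζ) (hg ζ hζ)
  have hgp : ∀ ζ ∈ T, g ζ - p i ≠ 0 := fun ζ hζ => norm_pos_iff.1 (hη.trans_le (hgη ζ hζ))
  obtain ⟨L, hLc, hL⟩ := Complex.exists_continuousOn_eqOn_exp_comp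
    (U := T) (isSimplyConnected_of_convex hTc ⟨_, hlT 0⟩) hTo
    (g := fun ζ => g ζ - p i) (hgc.sub continuousOn_const) (by
      rintro ⟨ζ, hζ, h0⟩
      exact hgp ζ hζ h0)
  have hL' : ∀ ζ ∈ T, Complex.exp (L ζ) = g ζ - p i := fun ζ hζ => hL hζ
  have hB0 : 0 ≤ B := (norm_nonneg _).trans (hgB _ (hlT 0))
  obtain ⟨ξ, hξT, hξ⟩ : ∃ ξ ∈ T, L (ξ + ω) = L ξ := by
    obtain ⟨R, hR, hRη⟩ : ∃ R : ℝ, ‖ω‖ < R ∧ 2 * B / R * ‖ω‖ < η := by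
      refine ⟨‖ω‖ + 2 * B / η * ‖ω‖ + 1, ?_, ?_⟩
      · have : 0 ≤ 2 * B / η * ‖ω‖ := by positivity
        linarith
      · have h1 : 0 < ‖ω‖ + 2 * B / η * ‖ω‖ + 1 := by positivity
        rw [div_mul_eq_mul_div, div_lt_iff₀ h1]
        have h2 : η * (‖ω‖ + 2 * B / η * ‖ω‖ + 1) = η * ‖ω‖ + 2 * B * ‖ω‖ + η := by
          field_simp
        have h3 : 0 ≤ η * ‖ω‖ := by positivity
        linarith
    have hR0 : 0 < R := (norm_nonneg _).trans_lt hR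
    set ξ : ℂ := ((Real.log r - R : ℝ) : ℂ) with hξdef
    have hball : ball ξ R ⊆ T := by
      intro ζ hζ
      have h1 : ‖ζ - ξ‖ < R := by simpa [dist_eq_norm] using hζ
      have h2 := (Complex.abs_re_le_norm (ζ - ξ)).trans_lt h1
      have h3 := (abs_lt.1 h2).2
      rw [Complex.sub_re, hξdef, Complex.ofReal_re] at h3
      simp only [hT, Set.mem_ofPred_eq]
      linarith
    have hξT : ξ ∈ T := hball (mem_ball_self hR0)
    have hsmall : ∀ s ∈ Set.Icc (0 : ℝ) 1, ‖g (ξ + s * ω) - g ξ‖ < η := by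
      intro s hs'
      have h0 : ‖(s : ℂ) * ω‖ ≤ ‖ω‖ := by
        rw [norm_mul, Complex.norm_real, Real.norm_eq_abs, abs_of_nonneg hs'.1]
        exact mul_le_of_le_one_left (norm_nonneg _) hs'.2
      have h1 : ξ + s * ω ∈ ball ξ R := by
        rw [mem_ball, dist_eq_norm, add_sub_cancel_left]
        exact h0.trans_lt hR
      have h2 := Complex.dist_le_div_mul_dist_of_mapsTo_ball (f := g) (c := ξ) (R₁ := R)
        (R₂ := 2 * B) (hgd.mono hball) (fun ζ hζ => by
          rw [mem_closedBall, dist_eq_norm]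
          exact (norm_sub_le _ _).trans (by linarith [hgB ζ (hball hζ), hgB ξ hξT])) h1
      rw [dist_eq_norm, dist_eq_norm, add_sub_cancel_left] at h2
      refine (h2.trans ?_).trans_lt hRη
      gcongr
    have hratio : ∀ s ∈ Set.Icc (0 : ℝ) 1,
        (g (ξ + s * ω) - p i) / (g ξ - p i) ∈ Complex.slitPlane := by
      intro s hs'
      refine Complex.mem_slitPlane_of_norm_lt_one (z := _ - 1) ?_ |> fun h => by simpa using h
      have h1 := hgp ξ hξT
      have h2 : (g (ξ + s * ω) - p i) / (g ξ - p i) - 1 = (g (ξ + s * ω) - g ξ) / (g ξ - p i) := by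
        field_simp
        ring
      rw [h2, norm_div, div_lt_one (norm_pos_iff.2 h1)]
      exact (hsmall s hs').trans_le (hgη ξ hξT)
    have hpath : Continuous fun s : ℝ => ξ + s * ω := by fun_prop
    have hpathT : Set.MapsTo (fun s : ℝ => ξ + s * ω) (Set.Icc 0 1) T := fun s _ => hTω ξ hξT s
    have h1 := eqOn_of_exp_eqOn (S := Set.Icc (0 : ℝ) 1) isPreconnected_Icc
      (f := fun s => L (ξ + s * ω) - L ξ)
      (g := fun s => Complex.log ((g (ξ + s * ω) - p i) / (g ξ - p i)))
      ((hLc.comp hpath.continuousOn hpathT).sub continuousOn_const)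
      (ContinuousOn.clog (((hgc.comp hpath.continuousOn hpathT).sub
        continuousOn_const).div_const _) hratio)
      (fun s hs' => by
        rw [Complex.exp_sub, hL' _ (hpathT hs'), hL' _ hξT,
          Complex.exp_log (Complex.slitPlane_ne_zero (hratio s hs'))])
      (Set.left_mem_Icc.2 zero_le_one) (by simp [hgp ξ hξT])
    have h2 := h1 (Set.right_mem_Icc.2 zero_le_one)
    simp only [Complex.ofReal_one, one_mul, hgper ξ hξT, div_self (hgp ξ hξT),
      Complex.log_one] at h2
    exact ⟨ξ, hξT, sub_eq_zero.1 h2⟩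
  have hLper : L (l (2 * Real.pi)) = L (l 0) := by
    have hshift : ∀ ζ ∈ T, ζ + ω ∈ T := fun ζ hζ => by simpa using hTω ζ hζ 1
    rw [hn]
    exact eqOn_of_exp_eqOn hTc.isPreconnected (f := fun ζ => L (ζ + ω)) (g := L)
      (hLc.comp (by fun_prop) hshift) hLc
      (fun ζ hζ => by rw [hL' _ (hshift ζ hζ), hL' _ hζ, hgper ζ hζ]) hξT hξ (hlT 0)
  set A : ℝ → ℂ := fun θ => 1 - (p i - q) / δ * Complex.exp (-(θ * Complex.I)) with hA
  have hAs : ∀ θ, A θ ∈ Complex.slitPlane := by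
    intro θ
    rw [hA]
    simp only
    rw [sub_eq_add_neg]
    refine Complex.mem_slitPlane_of_norm_lt_one ?_
    rw [norm_neg, norm_mul, norm_div, Complex.norm_real, Real.norm_eq_abs, abs_of_pos hδ]
    have : ‖Complex.exp (-(θ * Complex.I))‖ = 1 := by
      have := Complex.norm_exp_ofReal_mul_I (-θ)
      simpa using this
    rw [this, mul_one, div_lt_one hδ]
    exact hi
  have hA' : ∀ θ : ℝ, δ * Complex.exp (θ * Complex.I) * A θ = γ θ - p i := by
    intro θ
    have h1 : Complex.exp (θ * Complex.I) * Complex.exp (-(θ * Complex.I)) = 1 := by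
      rw [← Complex.exp_add, add_neg_cancel, Complex.exp_zero]
    have h2 : (δ : ℂ) ≠ 0 := by exact_mod_cast hδ.ne'
    have h3 : (δ : ℂ) * ((p i - q) / δ) = p i - q := by field_simp
    rw [hA, hγ]
    simp only
    linear_combination -(δ * ((p i - q) / δ)) * h1 - h3
  have hfin := eqOn_of_exp_eqOn (S := (Set.univ : Set ℝ)) isPreconnected_univ
    (f := fun θ => L (l θ) - L (l 0))
    (g := fun θ => θ * Complex.I + (Complex.log (A θ) - Complex.log (A 0)))
    ((hLc.comp hlc fun θ _ => hlT θ).sub continuousOn_const)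
    (ContinuousOn.add (by fun_prop) (ContinuousOn.sub
      (ContinuousOn.clog (by fun_prop) fun θ _ => hAs θ) continuousOn_const))
    (fun θ _ => by
      rw [Complex.exp_sub, hL' _ (hlT θ), hL' _ (hlT 0), hgl, hgl, Complex.exp_add,
        Complex.exp_sub, Complex.exp_log (Complex.slitPlane_ne_zero (hAs θ)),
        Complex.exp_log (Complex.slitPlane_ne_zero (hAs 0)), ← hA' θ, ← hA' 0]
      have h2 : (δ : ℂ) ≠ 0 := by exact_mod_cast hδ.ne'
      have h3 := Complex.slitPlane_ne_zero (hAs 0)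
      simp only [Complex.ofReal_zero, zero_mul, Complex.exp_zero, mul_one]
      field_simp)
    (Set.mem_univ (0 : ℝ)) (by simp) (Set.mem_univ (2 * Real.pi))
  have hAper : A (2 * Real.pi) = A 0 := by
    simp [hA, Complex.exp_neg]
  simp only [hLper, hAper, sub_self, add_zero] at hfin
  have : (2 * Real.pi * Complex.I : ℂ) = 0 := by
    rw [hfin]
    push_cast
    ring
  simp [Real.pi_ne_zero] at this

end CriticalValues

namespace CriticalValues

open Filter Topology Metric

variable {κ J : Type} [Fintype κ] [Fintype J]

namespace IsSol

variable {c : J → ℂ} {α p : κ → ℂ} {z : J → ℂ} {R : ℝ}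

theorem norm_res_div_le (h : IsSol c α p z) (hc : Function.Injective c)
    (hJ : Fintype.card J = 2 * Fintype.card κ) (hR : ∀ j, ‖c j‖ < R) (j : J) (i : κ) :
    ‖α i / (z j - p i)‖ ≤ 800 * R := by
  have h1 := (h.frame i).norm_crit_sub_pole_le ((h.frame i).z_inj hc) hJ hR j i
  rwa [frX_sub_frP_self] at h1

theorem norm_res_le_crit (h : IsSol c α p z) (hc : Function.Injective c)
    (hJ : Fintype.card J = 2 * Fintype.card κ) (hR : ∀ j, ‖c j‖ < R) (j : J) (i : κ) :
    ‖α i‖ ≤ 800 * R * ‖z j - p i‖ := by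
  have h1 := h.norm_res_div_le hc hJ hR j i
  rwa [norm_div, div_le_iff₀ (norm_pos_iff.2 (sub_ne_zero.2 (h.ne_pole j i)))] at h1

theorem exists_crit_index (i : κ) (hJ : Fintype.card J = 2 * Fintype.card κ) : Nonempty J := by
  have h3 : 0 < Fintype.card κ := Fintype.card_pos_iff.2 ⟨i⟩
  exact Fintype.card_pos_iff.1 (by omega)

theorem norm_res_le (h : IsSol c α p z) (hc : Function.Injective c)
    (hJ : Fintype.card J = 2 * Fintype.card κ) (hR : ∀ j, ‖c j‖ < R) (i : κ) :
    ‖α i‖ ≤ 800 * R * (800 * R) := by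
  obtain ⟨j⟩ := exists_crit_index i hJ
  have hR0 : 0 < R := lt_of_le_of_lt (norm_nonneg _) (hR j)
  refine (h.norm_res_le_crit hc hJ hR j i).trans ?_
  gcongr
  exact h.norm_crit_sub_pole_le (h.z_inj hc) hJ hR j i

theorem norm_res_le_pole (h : IsSol c α p z) (hc : Function.Injective c)
    (hJ : Fintype.card J = 2 * Fintype.card κ) (hR : ∀ j, ‖c j‖ < R) {i k : κ} (hik : k ≠ i) :
    ‖α i‖ ≤ 1600 * R * ‖p k - p i‖ := by
  obtain ⟨j⟩ := exists_crit_index i hJ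
  have hf := h.frame i
  have h1 := hf.norm_crit_sub_pole_le (hf.z_inj hc) hJ hR j i
  have h2 := hf.norm_crit_sub_pole_le (hf.z_inj hc) hJ hR j k
  have h3 : α i / (p k - p i) = (frX α p i (z j) - frP α p i i) -
      (frX α p i (z j) - frP α p i k) := by simp [frP]
  have h4 : ‖α i / (p k - p i)‖ ≤ 1600 * R := by
    rw [h3]
    exact (norm_sub_le _ _).trans (by linarith)
  rwa [norm_div, div_le_iff₀ (norm_pos_iff.2 (sub_ne_zero.2 (h.inj.ne hik)))] at h4

theorem norm_crit_le (h : IsSol c α p z) (hc : Function.Injective c)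
    (hJ : Fintype.card J = 2 * Fintype.card κ) (hR : ∀ j, ‖c j‖ < R) (j : J) :
    ‖z j‖ ≤ R + Fintype.card κ * (800 * R) := by
  have h1 : z j = c j - ∑ k, α k / (z j - p k) := by
    rw [← h.val j, rf]
    ring
  rw [h1]
  refine (norm_sub_le _ _).trans (add_le_add (hR j).le ((norm_sum_le _ _).trans ?_))
  refine (Finset.sum_le_card_nsmul _ _ _ fun k _ => h.norm_res_div_le hc hJ hR j k).trans ?_
  rw [Finset.card_univ, nsmul_eq_mul]

theorem norm_pole_le (h : IsSol c α p z) (hc : Function.Injective c)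
    (hJ : Fintype.card J = 2 * Fintype.card κ) (hR : ∀ j, ‖c j‖ < R) (i : κ) :
    ‖p i‖ ≤ R + Fintype.card κ * (800 * R) + 800 * R := by
  obtain ⟨j⟩ := exists_crit_index i hJ
  have h1 : p i = z j - (z j - p i) := by ring
  rw [h1]
  exact (norm_sub_le _ _).trans
    (add_le_add (h.norm_crit_le hc hJ hR j) (h.norm_crit_sub_pole_le (h.z_inj hc) hJ hR j i))

end IsSol

theorem analyticAt_rf {α p : κ → ℂ} {ζ : ℂ} (hζ : ∀ k, ζ ≠ p k) :
    AnalyticAt ℂ (fun x : (κ → ℂ) × (κ → ℂ) × ℂ => rf x.1 x.2.1 x.2.2) (α, p, ζ) := by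
  unfold rf
  have h1 : AnalyticAt ℂ (fun x : (κ → ℂ) × (κ → ℂ) × ℂ => x.2.2) (α, p, ζ) :=
    ((ContinuousLinearMap.snd ℂ (κ → ℂ) ℂ).comp
      (ContinuousLinearMap.snd ℂ (κ → ℂ) ((κ → ℂ) × ℂ))).analyticAt _
  refine h1.add (Finset.analyticAt_fun_sum _ fun k _ => AnalyticAt.div ?_ ?_ ?_)
  · exact ((ContinuousLinearMap.proj (R := ℂ) k).comp
      (ContinuousLinearMap.fst ℂ (κ → ℂ) ((κ → ℂ) × ℂ))).analyticAt _
  · refine h1.sub ?_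
    exact ((ContinuousLinearMap.proj (R := ℂ) k).comp
      ((ContinuousLinearMap.fst ℂ (κ → ℂ) ℂ).comp
      (ContinuousLinearMap.snd ℂ (κ → ℂ) ((κ → ℂ) × ℂ)))).analyticAt _
  · exact sub_ne_zero.2 (hζ k)

theorem analyticAt_rd {α p : κ → ℂ} {ζ : ℂ} (hζ : ∀ k, ζ ≠ p k) :
    AnalyticAt ℂ (fun x : (κ → ℂ) × (κ → ℂ) × ℂ => rd x.1 x.2.1 x.2.2) (α, p, ζ) := by
  unfold rd
  have h1 : AnalyticAt ℂ (fun x : (κ → ℂ) × (κ → ℂ) × ℂ => x.2.2) (α, p, ζ) :=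
    ((ContinuousLinearMap.snd ℂ (κ → ℂ) ℂ).comp
      (ContinuousLinearMap.snd ℂ (κ → ℂ) ((κ → ℂ) × ℂ))).analyticAt _
  refine analyticAt_const.sub (Finset.analyticAt_fun_sum _ fun k _ => AnalyticAt.div ?_ ?_ ?_)
  · exact ((ContinuousLinearMap.proj (R := ℂ) k).comp
      (ContinuousLinearMap.fst ℂ (κ → ℂ) ((κ → ℂ) × ℂ))).analyticAt _
  · refine (h1.sub ?_).pow 2
    exact ((ContinuousLinearMap.proj (R := ℂ) k).comp
      ((ContinuousLinearMap.fst ℂ (κ → ℂ) ℂ).comp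
      (ContinuousLinearMap.snd ℂ (κ → ℂ) ((κ → ℂ) × ℂ)))).analyticAt _
  · exact pow_ne_zero 2 (sub_ne_zero.2 (hζ k))

/-- A family of solutions, converging along a filter. -/
structure IsLimit {ι : Type*} (F : Filter ι) (c : ι → J → ℂ) (α p : ι → κ → ℂ) (z : ι → J → ℂ)
    (c' : J → ℂ) (α' p' : κ → ℂ) (z' : J → ℂ) : Prop where
  sol : ∀ᶠ t in F, IsSol (c t) (α t) (p t) (z t)
  inj : ∀ᶠ t in F, Function.Injective (c t)
  tc : Tendsto c F (𝓝 c')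
  tα : Tendsto α F (𝓝 α')
  tp : Tendsto p F (𝓝 p')
  tz : Tendsto z F (𝓝 z')

theorem eventually_norm_lt {ι : Type*} {F : Filter ι} {c : ι → J → ℂ} {c' : J → ℂ}
    (tc : Tendsto c F (𝓝 c')) : ∃ R : ℝ, 0 < R ∧ ∀ᶠ t in F, ∀ j, ‖c t j‖ < R := by
  refine ⟨‖c'‖ + 1, by positivity, ?_⟩
  filter_upwards [tc.norm.eventually (gt_mem_nhds (lt_add_one _))] with t ht j
  exact (norm_le_pi_norm (c t) j).trans_lt ht

theorem exists_tendsto_of_norm_le {ι E : Type*} [NormedAddCommGroup E] [ProperSpace E]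
    (F : Ultrafilter ι) {f : ι → E} {M : ℝ} (h : ∀ᶠ t in (F : Filter ι), ‖f t‖ ≤ M) :
    ∃ x, Tendsto f F (𝓝 x) := by
  obtain ⟨x, -, hx⟩ := (isCompact_closedBall (0 : E) M).ultrafilter_le_nhds (F.map f) (by
    rw [Filter.le_principal_iff]
    change f ⁻¹' closedBall 0 M ∈ (F : Filter ι)
    filter_upwards [h] with t ht
    simpa using ht)
  exact ⟨x, hx⟩

theorem exists_isLimit {ι : Type*} (F : Ultrafilter ι) {c : ι → J → ℂ} {α p : ι → κ → ℂ}
    {z : ι → J → ℂ} {c' : J → ℂ} (hJ : Fintype.card J = 2 * Fintype.card κ)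
    (sol : ∀ᶠ t in (F : Filter ι), IsSol (c t) (α t) (p t) (z t))
    (inj : ∀ᶠ t in (F : Filter ι), Function.Injective (c t)) (tc : Tendsto c F (𝓝 c')) :
    ∃ α' p' z', IsLimit (F : Filter ι) c α p z c' α' p' z' := by
  obtain ⟨R, hR0, hR⟩ := eventually_norm_lt tc
  obtain ⟨α', hα⟩ := exists_tendsto_of_norm_le F (f := α) (M := 800 * R * (800 * R)) (by
    filter_upwards [sol, inj, hR] with t h1 h2 h3
    exact (pi_norm_le_iff_of_nonneg (by positivity)).2 fun k => h1.norm_res_le h2 hJ h3 k)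
  obtain ⟨p', hp⟩ := exists_tendsto_of_norm_le F (f := p)
    (M := R + Fintype.card κ * (800 * R) + 800 * R) (by
      filter_upwards [sol, inj, hR] with t h1 h2 h3
      exact (pi_norm_le_iff_of_nonneg (by positivity)).2 fun k => h1.norm_pole_le h2 hJ h3 k)
  obtain ⟨z', hz⟩ := exists_tendsto_of_norm_le F (f := z)
    (M := R + Fintype.card κ * (800 * R)) (by
      filter_upwards [sol, inj, hR] with t h1 h2 h3
      exact (pi_norm_le_iff_of_nonneg (by positivity)).2 fun k => h1.norm_crit_le h2 hJ h3 k)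
  exact ⟨α', p', z', sol, inj, tc, hα, hp, hz⟩

namespace IsLimit

variable {ι : Type*} {F : Filter ι} {c : ι → J → ℂ} {α p : ι → κ → ℂ} {z : ι → J → ℂ}
    {c' : J → ℂ} {α' p' : κ → ℂ} {z' : J → ℂ}

theorem tα_apply (h : IsLimit F c α p z c' α' p' z') (k : κ) :
    Tendsto (fun t => α t k) F (𝓝 (α' k)) := tendsto_pi_nhds.1 h.tα k

theorem tp_apply (h : IsLimit F c α p z c' α' p' z') (k : κ) :
    Tendsto (fun t => p t k) F (𝓝 (p' k)) := tendsto_pi_nhds.1 h.tp k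

theorem tz_apply (h : IsLimit F c α p z c' α' p' z') (j : J) :
    Tendsto (fun t => z t j) F (𝓝 (z' j)) := tendsto_pi_nhds.1 h.tz j

theorem tc_apply (h : IsLimit F c α p z c' α' p' z') (j : J) :
    Tendsto (fun t => c t j) F (𝓝 (c' j)) := tendsto_pi_nhds.1 h.tc j

variable [F.NeBot]

theorem res_eq_zero_of_pole_eq (h : IsLimit F c α p z c' α' p' z')
    (hJ : Fintype.card J = 2 * Fintype.card κ) {i k : κ} (hik : k ≠ i) (he : p' k = p' i) :
    α' i = 0 := by
  obtain ⟨R, hR0, hR⟩ := eventually_norm_lt h.tc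
  have h1 : ∀ᶠ t in F, ‖α t i‖ ≤ 1600 * R * ‖p t k - p t i‖ := by
    filter_upwards [h.sol, h.inj, hR] with t h1 h2 h3
    exact h1.norm_res_le_pole h2 hJ h3 hik
  have h2 := le_of_tendsto_of_tendsto (h.tα_apply i).norm
    (((h.tp_apply k).sub (h.tp_apply i)).norm.const_mul (1600 * R)) h1
  simpa [he] using h2

theorem res_eq_zero_of_crit_eq (h : IsLimit F c α p z c' α' p' z')
    (hJ : Fintype.card J = 2 * Fintype.card κ) {i : κ} {j : J} (he : z' j = p' i) :
    α' i = 0 := by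
  obtain ⟨R, hR0, hR⟩ := eventually_norm_lt h.tc
  have h1 : ∀ᶠ t in F, ‖α t i‖ ≤ 800 * R * ‖z t j - p t i‖ := by
    filter_upwards [h.sol, h.inj, hR] with t h1 h2 h3
    exact h1.norm_res_le_crit h2 hJ h3 j i
  have h2 := le_of_tendsto_of_tendsto (h.tα_apply i).norm
    (((h.tz_apply j).sub (h.tp_apply i)).norm.const_mul (800 * R)) h1
  simpa [he] using h2

end IsLimit

theorem analyticAt_rf_of_res_eq_zero {α p : κ → ℂ} {q : ℂ} (h : ∀ k, p k = q → α k = 0) :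
    AnalyticAt ℂ (rf α p) q := by
  have : AnalyticAt ℂ (fun z => z + ∑ k, α k / (z - p k)) q := by
    refine analyticAt_id.add (Finset.analyticAt_fun_sum _ fun k _ => ?_)
    by_cases hk : p k = q
    · simp only [h k hk, zero_div]
      exact analyticAt_const
    · exact analyticAt_const.div (analyticAt_id.sub analyticAt_const)
        (sub_ne_zero.2 (Ne.symm hk))
  exact this

theorem eventually_ne_pole_punctured (p : κ → ℂ) (q : ℂ) : ∀ᶠ ζ in 𝓝[≠] q, ∀ k, ζ ≠ p k := by
  refine eventually_all.2 fun k => ?_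
  by_cases hk : q = p k
  · subst hk
    exact self_mem_nhdsWithin
  · exact nhdsWithin_le_nhds (isOpen_ne.mem_nhds hk)

theorem eventually_rf_ne {α p : κ → ℂ} {q : ℂ} (h : ∀ k, p k = q → α k = 0) (v : ℂ) :
    ∀ᶠ ζ in 𝓝[≠] q, rf α p ζ ≠ v := by
  refine ((analyticAt_rf_of_res_eq_zero h).eventually_eq_or_eventually_ne
    analyticAt_const).resolve_left fun hv => ?_
  have h1 : {ζ | (wr α p).eval ζ = 0} ∪ {q} ∈ 𝓝 q := by
    rw [Set.union_singleton, insert_mem_nhds_iff]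
    filter_upwards [eventually_ne_pole_punctured p q,
      nhdsWithin_le_nhds hv.eventually_nhds] with ζ h1 h2
    have h3 : rd α p ζ = 0 :=
      (hasDerivAt_rf α h1).unique ((hasDerivAt_const ζ v).congr_of_eventuallyEq h2)
    simp [eval_wr α h1, h3]
  have h2 : {ζ | (wr α p).eval ζ = 0}.Infinite := by
    have := infinite_of_mem_nhds q h1
    intro hfin
    exact this (hfin.union (Set.finite_singleton q))
  exact (monic_wr α p).ne_zero (eq_zero_of_infinite_isRoot _ h2)

theorem exists_gap {J : Type*} [Finite J] (c : J → ℂ) (v : ℂ) :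
    ∃ r : ℝ, 0 < r ∧ ∀ j, c j ≠ v → 2 * r < ‖c j - v‖ := by
  have h1 : ∀ᶠ r : ℝ in 𝓝[>] 0, ∀ j, c j ≠ v → 2 * r < ‖c j - v‖ := by
    refine eventually_all.2 fun j => ?_
    by_cases hj : c j = v
    · simp [hj]
    · have h2 : Tendsto (fun r : ℝ => 2 * r) (𝓝[>] 0) (𝓝 (2 * 0)) :=
        (tendsto_id.mono_left nhdsWithin_le_nhds).const_mul 2
      filter_upwards [h2.eventually (gt_mem_nhds (show 2 * 0 < ‖c j - v‖ by
        simpa [sub_eq_zero] using hj))] with r hr _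
      exact hr
  obtain ⟨r, hr, h2⟩ := (h1.and self_mem_nhdsWithin).exists
  exact ⟨r, h2, hr⟩

theorem IsLimit.exists_collision {ι : Type*} {F : Filter ι} [F.NeBot] {c : ι → J → ℂ}
    {α p : ι → κ → ℂ} {z : ι → J → ℂ} {c' : J → ℂ} {α' p' : κ → ℂ} {z' : J → ℂ}
    (h : IsLimit F c α p z c' α' p' z') (hJ : Fintype.card J = 2 * Fintype.card κ) {i : κ}
    (hi : α' i = 0) :
    ∃ j₁ j₂, j₁ ≠ j₂ ∧ c' j₁ = rf α' p' (p' i) ∧ c' j₂ = rf α' p' (p' i) := by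
  set q := p' i with hq
  set v := rf α' p' q with hv
  have hres : ∀ k, p' k = q → α' k = 0 := by
    intro k hk
    by_cases hki : k = i
    · rwa [hki]
    · exact h.res_eq_zero_of_pole_eq hJ (Ne.symm hki) hk.symm
  by_contra! hcon
  obtain ⟨w, hw, hwj⟩ : ∃ w : ι → ℂ, Tendsto w F (𝓝 v) ∧ ∀ j, c' j = v → ∀ t, c t j = w t := by
    by_cases hex : ∃ j, c' j = v
    · obtain ⟨j₁, hj₁⟩ := hex
      refine ⟨fun t => c t j₁, hj₁ ▸ h.tc_apply j₁, fun j hj t => ?_⟩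
      have : j₁ = j := by
        by_contra hne
        exact hcon j₁ j hne hj₁ hj
      rw [this]
    · push Not at hex
      exact ⟨fun _ => v, tendsto_const_nhds, fun j hj => absurd hj (hex j)⟩
  obtain ⟨r, hr, hgap⟩ := exists_gap c' v
  have hcw : ∀ᶠ t in F, ∀ j, c t j ≠ w t → r ≤ ‖c t j - w t‖ := by
    refine eventually_all.2 fun j => ?_
    by_cases hj : c' j = v
    · exact Eventually.of_forall fun t ht => absurd (hwj j hj t) ht
    · have h1 := ((h.tc_apply j).sub hw).norm
      filter_upwards [h1.eventually (lt_mem_nhds (show r < ‖c' j - v‖ by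
        linarith [hgap j hj]))] with t ht _
      exact ht.le
  have hcont : ∀ᶠ ζ in 𝓝[≠] q, ‖rf α' p' ζ - v‖ < r := by
    have h1 : ContinuousAt (fun ζ => ‖rf α' p' ζ - v‖) q :=
      ((analyticAt_rf_of_res_eq_zero hres).continuousAt.sub continuousAt_const).norm
    exact nhdsWithin_le_nhds (h1.eventually (gt_mem_nhds (by simpa [hv] using hr)))
  obtain ⟨ε, hε, hεP⟩ := Metric.mem_nhdsWithin_iff.1
    ((eventually_ne_pole_punctured p' q).and ((eventually_rf_ne hres v).and hcont))
  set δ := ε / 2 with hδ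
  have hδ0 : 0 < δ := by positivity
  have hcirc : ∀ ζ ∈ sphere q δ, (∀ k, ζ ≠ p' k) ∧ rf α' p' ζ ≠ v ∧ ‖rf α' p' ζ - v‖ < r := by
    intro ζ hζ
    have h1 : dist ζ q = δ := hζ
    refine hεP ⟨?_, ?_⟩
    · rw [mem_ball, h1]
      linarith
    · rw [Set.mem_compl_singleton_iff, ← dist_pos, h1]
      exact hδ0
  have hev : ∀ᶠ y : (κ → ℂ) × (κ → ℂ) × ℂ in 𝓝 (α', p', v), ∀ ζ ∈ sphere q δ,
      (∀ k, ζ ≠ y.2.1 k) ∧ rf y.1 y.2.1 ζ ≠ y.2.2 ∧ ‖rf y.1 y.2.1 ζ - y.2.2‖ < r := by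
    refine (isCompact_sphere q δ).eventually_forall_of_forall_eventually fun ζ hζ => ?_
    obtain ⟨h1, h2, h3⟩ := hcirc ζ hζ
    have hpr : Tendsto (fun x : ((κ → ℂ) × (κ → ℂ) × ℂ) × ℂ => (x.1.1, x.1.2.1, x.2))
        (𝓝 ((α', p', v), ζ)) (𝓝 (α', p', ζ)) := by
      refine Continuous.tendsto ?_ _
      fun_prop
    have hrf : Tendsto (fun x : ((κ → ℂ) × (κ → ℂ) × ℂ) × ℂ => rf x.1.1 x.1.2.1 x.2)
        (𝓝 ((α', p', v), ζ)) (𝓝 (rf α' p' ζ)) :=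
      (analyticAt_rf h1).continuousAt.tendsto.comp hpr
    have hw' : Tendsto (fun x : ((κ → ℂ) × (κ → ℂ) × ℂ) × ℂ => x.1.2.2)
        (𝓝 ((α', p', v), ζ)) (𝓝 v) := by
      refine Continuous.tendsto ?_ _
      fun_prop
    have hpk : ∀ k, Tendsto (fun x : ((κ → ℂ) × (κ → ℂ) × ℂ) × ℂ => x.2 - x.1.2.1 k)
        (𝓝 ((α', p', v), ζ)) (𝓝 (ζ - p' k)) := by
      intro k
      refine Continuous.tendsto ?_ _
      fun_prop
    have hsub := hrf.sub hw'
    refine (eventually_all.2 fun k => ?_).and (Eventually.and ?_ ?_)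
    · filter_upwards [(hpk k).eventually (isOpen_ne.mem_nhds (sub_ne_zero.2 (h1 k)))] with x hx
      exact sub_ne_zero.1 hx
    · filter_upwards [hsub.eventually (isOpen_ne.mem_nhds (sub_ne_zero.2 h2))] with x hx
      exact sub_ne_zero.1 hx
    · exact hsub.norm.eventually (gt_mem_nhds h3)
  have hpi : ∀ᶠ t in F, ‖p t i - q‖ < δ := by
    have h1 := ((h.tp_apply i).sub_const q).norm
    exact h1.eventually (gt_mem_nhds (by simpa [hq] using hδ0))
  obtain ⟨t, h1, h2, h3, h4, h5⟩ := (((h.tα.prodMk_nhds (h.tp.prodMk_nhds hw)).eventually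
    hev).and (hpi.and (hcw.and (h.sol.and h.inj)))).exists
  refine h4.false_of_winding (h4.z_inj h5) hJ hδ0 h2 (fun ζ hζ => ?_) h3
  exact h1 ζ (by simpa [dist_eq_norm] using hζ)

end CriticalValues

namespace CriticalValues

open Filter Topology Metric

theorem exists_ultrafilter_of_not_eventually {Y E : Type*} {l : Filter Y} {P : Y → E → Prop}
    (h : ¬ ∀ᶠ y in l, ∀ x, P y x) :
    ∃ F : Ultrafilter (Y × E), Tendsto Prod.fst (F : Filter (Y × E)) l ∧
      ∀ᶠ t in (F : Filter (Y × E)), ¬ P t.1 t.2 := by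
  have hne : (comap (Prod.fst : Y × E → Y) l ⊓ 𝓟 {t | ¬ P t.1 t.2}).NeBot := by
    rw [inf_principal_neBot_iff]
    rintro U ⟨V, hV, hVU⟩
    have h1 : ∃ᶠ y in l, ∃ x, ¬ P y x := by
      intro hcon
      exact h (hcon.mono fun y hy x => by
        by_contra hx
        exact hy ⟨x, hx⟩)
    obtain ⟨y, ⟨x, hx⟩, hy⟩ := (h1.and_eventually hV).exists
    exact ⟨(y, x), hVU hy, hx⟩
  refine ⟨@Ultrafilter.of _ _ hne, ?_, ?_⟩
  · exact tendsto_comap.mono_left ((@Ultrafilter.of_le _ _ hne).trans inf_le_left)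
  · exact (@Ultrafilter.of_le _ _ hne).trans inf_le_right (mem_principal_self _)

section Branches

variable {κ J : Type} [Fintype κ] [Fintype J]

theorem IsLimit.isSol_of_injective {ι : Type*} {F : Filter ι} [F.NeBot] {c : ι → J → ℂ}
    {α p : ι → κ → ℂ} {z : ι → J → ℂ} {c' : J → ℂ} {α' p' : κ → ℂ} {z' : J → ℂ}
    (h : IsLimit F c α p z c' α' p' z') (hJ : Fintype.card J = 2 * Fintype.card κ)
    (hc : Function.Injective c') : IsSol c' α' p' z' := by
  have hα : ∀ k, α' k ≠ 0 := by
    intro k hk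
    obtain ⟨j₁, j₂, hne, h1, h2⟩ := h.exists_collision hJ hk
    exact hne (hc (h1.trans h2.symm))
  have hz : ∀ j k, z' j ≠ p' k := fun j k he => hα k (h.res_eq_zero_of_crit_eq hJ he)
  have hpr : ∀ j, Tendsto (fun t => (α t, p t, z t j)) F (𝓝 (α', p', z' j)) := fun j =>
    h.tα.prodMk_nhds (h.tp.prodMk_nhds (h.tz_apply j))
  refine ⟨hα, ?_, hz, ?_, ?_⟩
  · intro k i he
    by_contra hki
    exact hα i (h.res_eq_zero_of_pole_eq hJ hki he)
  · intro j
    have h1 := (analyticAt_rd (α := α') (hz j)).continuousAt.tendsto.comp (hpr j)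
    refine tendsto_nhds_unique h1 (tendsto_const_nhds.congr' ?_)
    filter_upwards [h.sol] with t ht
    exact (ht.crit j).symm
  · intro j
    have h1 := (analyticAt_rf (α := α') (hz j)).continuousAt.tendsto.comp (hpr j)
    refine tendsto_nhds_unique h1 ((h.tc_apply j).congr' ?_)
    filter_upwards [h.sol] with t ht
    exact (ht.val j).symm

theorem hasDerivAt_rf_line {α p : κ → ℂ} {ζ : ℂ} (hζ : ∀ k, ζ ≠ p k) (a b : κ → ℂ) (d : ℂ) :
    HasDerivAt (fun t : ℂ => rf (α + t • a) (p + t • b) (ζ + t * d))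
      (rd α p ζ * d + ∑ k, a k / (ζ - p k) + ∑ k, α k * b k / (ζ - p k) ^ 2) 0 := by
  unfold rf
  have h1 : HasDerivAt (fun t : ℂ => ζ + t * d) d 0 := by
    simpa using ((hasDerivAt_id (0 : ℂ)).mul_const d).const_add ζ
  have h2 : ∀ k, HasDerivAt (fun t : ℂ => (α + t • a) k / (ζ + t * d - (p + t • b) k))
      (a k / (ζ - p k) + α k * b k / (ζ - p k) ^ 2 - α k / (ζ - p k) ^ 2 * d) 0 := by
    intro k
    have h3 : HasDerivAt (fun t : ℂ => (α + t • a) k) (a k) 0 := by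
      simpa using ((hasDerivAt_id (0 : ℂ)).mul_const (a k)).const_add (α k)
    have h4 : HasDerivAt (fun t : ℂ => (p + t • b) k) (b k) 0 := by
      simpa using ((hasDerivAt_id (0 : ℂ)).mul_const (b k)).const_add (p k)
    have h5 := sub_ne_zero.2 (hζ k)
    refine (h3.div (h1.sub h4) (by simpa using h5)).congr_deriv ?_
    simp only [zero_smul, add_zero, zero_mul, Pi.sub_apply]
    field_simp
    ring
  refine (h1.add (HasDerivAt.fun_sum fun k _ => h2 k)).congr_deriv ?_
  rw [Finset.sum_sub_distrib, Finset.sum_add_distrib, rd, ← Finset.sum_mul]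
  ring

theorem hasDerivAt_rd {α p : κ → ℂ} {ζ : ℂ} (hζ : ∀ k, ζ ≠ p k) :
    HasDerivAt (rd α p) (∑ k, 2 * α k / (ζ - p k) ^ 3) ζ := by
  unfold rd
  have h2 : ∀ k, HasDerivAt (fun t : ℂ => α k / (t - p k) ^ 2)
      (-(2 * α k / (ζ - p k) ^ 3)) ζ := by
    intro k
    have h5 := sub_ne_zero.2 (hζ k)
    refine ((hasDerivAt_const ζ (α k)).div (((hasDerivAt_id ζ).sub_const (p k)).pow 2)
      (pow_ne_zero 2 h5)).congr_deriv ?_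
    simp only [id, Pi.pow_apply]
    field_simp
    ring
  refine ((HasDerivAt.fun_sum fun k _ => h2 k).const_sub 1).congr_deriv ?_
  simp

theorem IsSol.hasDerivAt_rd_ne_zero {c : J → ℂ} {α p : κ → ℂ} {z : J → ℂ} (h : IsSol c α p z)
    (hz : Function.Injective z) (hJ : Fintype.card J = 2 * Fintype.card κ) (j : J) :
    ∑ k, 2 * α k / (z j - p k) ^ 3 ≠ 0 := by
  classical
  intro h0
  have h1 := hasDerivAt_rd (α := α) (h.ne_pole j)
  rw [h0] at h1
  have h2 : HasDerivAt (fun ζ => rd α p ζ * (den p).eval ζ ^ 2) 0 (z j) := by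
    refine (h1.mul (((den p).hasDerivAt (z j)).pow 2)).congr_deriv ?_
    simp [h.crit j]
  have h3 : HasDerivAt (fun ζ => (wr α p).eval ζ) 0 (z j) := by
    refine h2.congr_of_eventuallyEq ?_
    filter_upwards [eventually_ne_pole (h.ne_pole j)] with ζ hζ
    exact eval_wr α hζ
  have h4 := ((wr α p).hasDerivAt (z j)).unique h3
  rw [h.wr_eq hz hJ, derivative_prod_finset, eval_finsetSum, Finset.sum_eq_single j] at h4
  · simp only [derivative_sub, derivative_X, derivative_C, sub_zero, mul_one, eval_prod] at h4
    obtain ⟨i, hi, h5⟩ := Finset.prod_eq_zero_iff.1 h4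
    exact (Finset.ne_of_mem_erase hi) (hz (by simpa [sub_eq_zero] using h5)).symm
  · intro i _ hij
    rw [eval_mul, eval_prod, Finset.prod_eq_zero (Finset.mem_erase.2 ⟨hij.symm, Finset.mem_univ j⟩)
      (by simp), zero_mul]
  · exact fun hj => absurd (Finset.mem_univ j) hj

theorem hasDerivAt_fst_of_prod {E F : Type*} [NormedAddCommGroup E] [NormedSpace ℂ E]
    [NormedAddCommGroup F] [NormedSpace ℂ F] {f : ℂ → E × F} {t : ℂ} {v : E × F}
    (h : HasDerivAt f v t) : HasDerivAt (fun s => (f s).1) v.1 t :=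
  (ContinuousLinearMap.fst ℂ E F).hasFDerivAt.comp_hasDerivAt t h

theorem hasDerivAt_snd_of_prod {E F : Type*} [NormedAddCommGroup E] [NormedSpace ℂ E]
    [NormedAddCommGroup F] [NormedSpace ℂ F] {f : ℂ → E × F} {t : ℂ} {v : E × F}
    (h : HasDerivAt f v t) : HasDerivAt (fun s => (f s).2) v.2 t :=
  (ContinuousLinearMap.snd ℂ E F).hasFDerivAt.comp_hasDerivAt t h

/-- The derivatives and the values at the marked points. -/
noncomputable def critMap (x : (κ → ℂ) × (κ → ℂ) × (J → ℂ)) : (J → ℂ) × (J → ℂ) :=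
  (fun j => rd x.1 x.2.1 (x.2.2 j), fun j => rf x.1 x.2.1 (x.2.2 j))

theorem analyticAt_critMap {x : (κ → ℂ) × (κ → ℂ) × (J → ℂ)} (hx : ∀ j k, x.2.2 j ≠ x.2.1 k) :
    AnalyticAt ℂ (critMap (κ := κ) (J := J)) x := by
  have hpr : ∀ j, AnalyticAt ℂ
      (fun x : (κ → ℂ) × (κ → ℂ) × (J → ℂ) => (x.1, x.2.1, x.2.2 j)) x := fun j =>
    ((ContinuousLinearMap.fst ℂ (κ → ℂ) ((κ → ℂ) × (J → ℂ))).prod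
      (((ContinuousLinearMap.fst ℂ (κ → ℂ) (J → ℂ)).comp
        (ContinuousLinearMap.snd ℂ (κ → ℂ) ((κ → ℂ) × (J → ℂ)))).prod
      ((ContinuousLinearMap.proj (R := ℂ) j).comp ((ContinuousLinearMap.snd ℂ (κ → ℂ) (J → ℂ)).comp
        (ContinuousLinearMap.snd ℂ (κ → ℂ) ((κ → ℂ) × (J → ℂ))))))).analyticAt _
  refine AnalyticAt.prod (analyticAt_pi_iff.2 fun j => ?_) (analyticAt_pi_iff.2 fun j => ?_)
  · exact AnalyticAt.fun_comp
      (g := fun x : (κ → ℂ) × (κ → ℂ) × ℂ => rd x.1 x.2.1 x.2.2)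
      (f := fun x : (κ → ℂ) × (κ → ℂ) × (J → ℂ) => (x.1, x.2.1, x.2.2 j))
      (analyticAt_rd (hx j)) (hpr j)
  · exact AnalyticAt.fun_comp
      (g := fun x : (κ → ℂ) × (κ → ℂ) × ℂ => rf x.1 x.2.1 x.2.2)
      (f := fun x : (κ → ℂ) × (κ → ℂ) × (J → ℂ) => (x.1, x.2.1, x.2.2 j))
      (analyticAt_rf (hx j)) (hpr j)

theorem eventually_nondegenerate {x₀ : (κ → ℂ) × (κ → ℂ) × (J → ℂ)} {c : J → ℂ}
    (h : x₀ ∈ Sol κ c) : ∀ᶠ x : (κ → ℂ) × (κ → ℂ) × (J → ℂ) in 𝓝 x₀,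
      (∀ k, x.1 k ≠ 0) ∧ Function.Injective x.2.1 ∧ ∀ j k, x.2.2 j ≠ x.2.1 k := by
  refine (eventually_all.2 fun k => ?_).and (Eventually.and ?_
    (eventually_all.2 fun j => eventually_all.2 fun k => ?_))
  · exact (isOpen_ne_fun (by fun_prop) continuous_const).mem_nhds (h.res_ne k)
  · have : ∀ᶠ x : (κ → ℂ) × (κ → ℂ) × (J → ℂ) in 𝓝 x₀, ∀ k l, k ≠ l → x.2.1 k ≠ x.2.1 l := by
      refine eventually_all.2 fun k => eventually_all.2 fun l => ?_
      by_cases hkl : k = l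
      · simp [hkl]
      · have := (isOpen_ne_fun (f := fun x : (κ → ℂ) × (κ → ℂ) × (J → ℂ) => x.2.1 k)
          (g := fun x => x.2.1 l) (by fun_prop) (by fun_prop)).mem_nhds (h.inj.ne hkl)
        filter_upwards [this] with x hx _
        exact hx
    filter_upwards [this] with x hx k l hkl
    by_contra hne
    exact hx k l hne hkl
  · exact (isOpen_ne_fun (by fun_prop) (by fun_prop)).mem_nhds (h.ne_pole j k)

theorem exists_branch (hJ : Fintype.card J = 2 * Fintype.card κ) {c₀ : J → ℂ}
    (hc : Function.Injective c₀) {x₀ : (κ → ℂ) × (κ → ℂ) × (J → ℂ)} (h : x₀ ∈ Sol κ c₀) :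
    ∃ ψ : (J → ℂ) → (κ → ℂ) × (κ → ℂ) × (J → ℂ), ψ c₀ = x₀ ∧
      (∀ᶠ c in 𝓝 c₀, DifferentiableAt ℂ ψ c) ∧ (∀ᶠ c in 𝓝 c₀, ψ c ∈ Sol κ c) ∧
      ∀ᶠ x in 𝓝 x₀, ∀ c, x ∈ Sol κ c → x = ψ c := by
  have hΦ0 : critMap x₀ = (0, c₀) := Prod.ext (funext h.crit) (funext h.val)
  have hz := IsSol.z_inj h hc
  obtain ⟨ψ, h1, h2, h3, h4⟩ := exists_local_inverse (Φ := critMap (κ := κ) (J := J)) (x₀ := x₀)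
    (by simp [hJ]; ring) (analyticAt_critMap h.ne_pole) (by
      rintro ⟨a, b, d⟩ hv
      have h5 : ∀ j, HasDerivAt (fun t : ℂ => rf (x₀.1 + t • a) (x₀.2.1 + t • b)
          (x₀.2.2 j + t * d j)) 0 0 := fun j => by
        have := hasDerivAt_pi.1 (hasDerivAt_snd_of_prod hv) j
        simpa [critMap] using this
      have h6 : ∀ j, HasDerivAt (fun t : ℂ => rd (x₀.1 + t • a) (x₀.2.1 + t • b)
          (x₀.2.2 j + t * d j)) 0 0 := fun j => by
        have := hasDerivAt_pi.1 (hasDerivAt_fst_of_prod hv) j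
        simpa [critMap] using this
      obtain ⟨ha, hb⟩ := IsSol.eq_smul_deriv h hz hJ (e := 0) (u := a)
        (v := fun k => x₀.1 k * b k) (fun j => by
          have := (hasDerivAt_rf_line (α := x₀.1) (h.ne_pole j) a b (d j)).unique (h5 j)
          rw [h.crit j] at this
          linear_combination this)
      have hb' : b = 0 := funext fun k => by
        have := hb k
        simpa [h.res_ne k] using this
      have ha' : a = 0 := funext ha
      subst ha' hb'
      have hd : d = 0 := funext fun j => by
        have h7 := h6 j
        simp only [smul_zero, add_zero] at h7
        have h8 : HasDerivAt (fun t : ℂ => x₀.2.2 j + t * d j) (d j) 0 := by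
          simpa using ((hasDerivAt_id (0 : ℂ)).mul_const (d j)).const_add (x₀.2.2 j)
        have h9 := (HasDerivAt.comp_of_eq (0 : ℂ) (hasDerivAt_rd (α := x₀.1) (h.ne_pole j)) h8
          (by simp)).unique h7
        exact (mul_eq_zero.1 h9).resolve_left (IsSol.hasDerivAt_rd_ne_zero h hz hJ j)
      rw [hd]
      rfl)
  rw [hΦ0] at h1 h2 h4
  have hι : Tendsto (fun c : J → ℂ => ((0 : J → ℂ), c)) (𝓝 c₀) (𝓝 (0, c₀)) :=
    (Continuous.prodMk_right (0 : J → ℂ)).tendsto c₀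
  have hdiff : ∀ᶠ c in 𝓝 c₀, DifferentiableAt ℂ (fun c => ψ (0, c)) c := by
    filter_upwards [hι.eventually h2] with c hc
    exact hc.comp c ((differentiableAt_const _).prodMk differentiableAt_id)
  have hcont : Tendsto (fun c => ψ (0, c)) (𝓝 c₀) (𝓝 x₀) := by
    have := hdiff.self_of_nhds.continuousAt.tendsto
    rwa [h1] at this
  refine ⟨fun c => ψ (0, c), h1, hdiff, ?_, ?_⟩
  · filter_upwards [hcont.eventually (eventually_nondegenerate h), hι.eventually h4]
      with c ⟨h5, h6, h7⟩ h8
    exact ⟨h5, h6, h7, fun j => congrFun (congrArg Prod.fst h8) j,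
      fun j => congrFun (congrArg Prod.snd h8) j⟩
  · filter_upwards [h3] with x hx c hxc
    have : critMap x = (0, c) := Prod.ext (funext hxc.crit) (funext hxc.val)
    rw [← this, hx]

theorem exists_tendsto_sol {ι : Type*} (F : Ultrafilter ι) {c : ι → J → ℂ}
    {x : ι → (κ → ℂ) × (κ → ℂ) × (J → ℂ)} {c' : J → ℂ}
    (hJ : Fintype.card J = 2 * Fintype.card κ)
    (sol : ∀ᶠ t in (F : Filter ι), x t ∈ Sol κ (c t))
    (tc : Tendsto c F (𝓝 c')) (hc : Function.Injective c') :
    ∃ x' ∈ Sol κ c', Tendsto x F (𝓝 x') := by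
  have hinj : ∀ᶠ t in (F : Filter ι), Function.Injective (c t) := by
    have h1 : ∀ᶠ t in (F : Filter ι), ∀ j l, j ≠ l → c t j ≠ c t l := by
      refine eventually_all.2 fun j => eventually_all.2 fun l => ?_
      by_cases hjl : j = l
      · simp [hjl]
      · have := ((tendsto_pi_nhds.1 tc j).sub (tendsto_pi_nhds.1 tc l)).eventually
          (isOpen_ne.mem_nhds (sub_ne_zero.2 (hc.ne hjl)))
        filter_upwards [this] with t ht _
        exact sub_ne_zero.1 ht
    filter_upwards [h1] with t ht j l hjl
    by_contra hne
    exact ht j l hne hjl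
  obtain ⟨α', p', z', h⟩ := exists_isLimit F hJ sol hinj tc
  exact ⟨(α', p', z'), h.isSol_of_injective hJ hc,
    h.tα.prodMk_nhds (h.tp.prodMk_nhds h.tz)⟩

theorem finite_sol (hJ : Fintype.card J = 2 * Fintype.card κ) {c₀ : J → ℂ}
    (hc : Function.Injective c₀) : (Sol κ c₀).Finite := by
  by_contra hinf
  have hinf' : Infinite (Sol κ c₀) := Set.infinite_coe_iff.2 hinf
  obtain ⟨x', hx', hx⟩ := exists_tendsto_sol (κ := κ) (hyperfilter (Sol κ c₀))
    (x := fun x => (x : (κ → ℂ) × (κ → ℂ) × (J → ℂ))) (c := fun _ => c₀) hJ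
    (Eventually.of_forall fun x => x.2) tendsto_const_nhds hc
  obtain ⟨ψ, h1, -, -, h4⟩ := exists_branch hJ hc hx'
  have h5 : ∀ᶠ x in (hyperfilter (Sol κ c₀) : Filter (Sol κ c₀)), x = ⟨x', hx'⟩ := by
    filter_upwards [hx.eventually h4] with x hx
    exact Subtype.ext ((hx c₀ x.2).trans h1)
  exact (Set.finite_singleton _).notMem_hyperfilter h5

theorem exists_branches (hJ : Fintype.card J = 2 * Fintype.card κ) {c₀ : J → ℂ}
    (hc : Function.Injective c₀) :
    ∃ br : (κ → ℂ) × (κ → ℂ) × (J → ℂ) → (J → ℂ) → (κ → ℂ) × (κ → ℂ) × (J → ℂ),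
      (∀ x ∈ Sol κ c₀, br x c₀ = x ∧ ∀ᶠ c in 𝓝 c₀, DifferentiableAt ℂ (br x) c) ∧
      ∀ᶠ c in 𝓝 c₀, Set.BijOn (fun x => br x c) (Sol κ c₀) (Sol κ c) := by
  classical
  choose! br h1 h2 h3 h4 using fun x hx => exists_branch (κ := κ) (x₀ := x) hJ hc hx
  refine ⟨br, fun x hx => ⟨h1 x hx, h2 x hx⟩, ?_⟩
  have hfin := finite_sol (κ := κ) hJ hc
  have hmap : ∀ᶠ c in 𝓝 c₀, ∀ x ∈ Sol κ c₀, br x c ∈ Sol κ c :=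
    (hfin.eventually_all).2 h3
  have hinj : ∀ᶠ c in 𝓝 c₀, ∀ x ∈ Sol κ c₀, ∀ y ∈ Sol κ c₀, x ≠ y → br x c ≠ br y c := by
    refine (hfin.eventually_all).2 fun x hx => (hfin.eventually_all).2 fun y hy => ?_
    by_cases hxy : x = y
    · simp [hxy]
    · have hcx := (h2 x hx).self_of_nhds.continuousAt
      have hcy := (h2 y hy).self_of_nhds.continuousAt
      have hne : br x c₀ ≠ br y c₀ := by rwa [h1 x hx, h1 y hy]
      filter_upwards [(hcx.sub hcy).eventually (isOpen_ne.mem_nhds (sub_ne_zero.2 hne))] with c h _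
      exact sub_ne_zero.1 h
  have hsurj : ∀ᶠ c in 𝓝 c₀, ∀ x, x ∈ Sol κ c → ∃ y ∈ Sol κ c₀, br y c = x := by
    by_contra hcon
    obtain ⟨F, hF1, hF2⟩ := exists_ultrafilter_of_not_eventually hcon
    obtain ⟨x', hx', hx⟩ := exists_tendsto_sol (κ := κ) F (x := Prod.snd) (c := Prod.fst) hJ
      (by filter_upwards [hF2] with t ht; exact (Classical.not_imp.1 ht).1) hF1 hc
    obtain ⟨t, ht1, ht2⟩ := (hF2.and (hx.eventually (h4 x' hx'))).exists
    obtain ⟨h5, h6⟩ := Classical.not_imp.1 ht1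
    exact h6 ⟨x', hx', (ht2 _ h5).symm⟩
  filter_upwards [hmap, hinj, hsurj] with c hc1 hc2 hc3
  refine ⟨hc1, ?_, fun x hx => hc3 x hx⟩
  intro x hx y hy hxy
  by_contra hne
  exact hc2 x hx y hy hne hxy

end Branches

end CriticalValues

namespace CriticalValues

open Filter Topology Metric

variable {κ J : Type} [Fintype κ] [Fintype J]

/-- The residues in the coordinate normalised at a pole; `none` stands for the pole `∞`. -/
noncomputable def gA (α p : κ → ℂ) : Option κ → κ → ℂ
  | none => α
  | some i => frA α p i

/-- The poles in the coordinate normalised at a pole; `none` stands for the pole `∞`. -/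
noncomputable def gP (α p : κ → ℂ) : Option κ → κ → ℂ
  | none => p
  | some i => frP α p i

/-- The coordinate normalised at a pole; `none` stands for the pole `∞`. -/
noncomputable def gX (α p : κ → ℂ) : Option κ → ℂ → ℂ
  | none => id
  | some i => frX α p i

open Classical in
/-- The pole which gets label `k` in the coordinate normalised at a given pole. -/
noncomputable def lbl : Option κ → κ → Option κ
  | none => some
  | some i => fun k => if k = i then none else some k

theorem IsSol.gframe {c : J → ℂ} {α p : κ → ℂ} {z : J → ℂ} (h : IsSol c α p z) (e : Option κ) :
    IsSol c (gA α p e) (gP α p e) (fun j => gX α p e (z j)) := by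
  cases e with
  | none => exact h
  | some i => exact h.frame i

theorem lbl_ne (e : Option κ) (k : κ) : lbl e k ≠ e := by
  classical
  cases e with
  | none => simp [lbl]
  | some i =>
    by_cases h : k = i <;> simp [lbl, h]

theorem lbl_injective (e : Option κ) : Function.Injective (lbl e) := by
  classical
  cases e with
  | none => exact Option.some_injective κ
  | some i =>
    intro k l hkl
    by_cases h : k = i <;> by_cases h' : l = i <;> simp_all [lbl]

theorem exists_lbl {e f : Option κ} (h : f ≠ e) : ∃ k, lbl e k = f := by
  classical
  cases e with
  | none => exact (Option.ne_none_iff_exists.1 h).imp fun _ h => h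
  | some i =>
    cases f with
    | none => exact ⟨i, by simp [lbl]⟩
    | some k => exact ⟨k, by simp [lbl, show k ≠ i from fun hk => h (by rw [hk])]⟩

theorem rf_gX {α p : κ → ℂ} (hp : Function.Injective p) (hα : ∀ k, α k ≠ 0) (e : Option κ) {z : ℂ}
    (hz : ∀ k, z ≠ p k) : rf (gA α p e) (gP α p e) (gX α p e z) = rf α p z := by
  cases e with
  | none => rfl
  | some i => exact rf_frX hp (hα i) hz

/-- The denominator of the coordinate normalised at a pole. -/
noncomputable def gD (p : κ → ℂ) : Option κ → ℂ → ℂ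
  | none => fun _ => 1
  | some i => fun z => z - p i

/-- The numerator of the difference of the coordinate normalised at a pole and `q`. -/
noncomputable def gN (α p : κ → ℂ) (q : ℂ) : Option κ → ℂ → ℂ
  | none => fun z => z - q
  | some i => fun z => α i + (frP α p i i - q) * (z - p i)

theorem continuous_gD (p : κ → ℂ) (e : Option κ) : Continuous (gD p e) := by
  cases e <;> unfold gD <;> fun_prop

theorem continuous_gN (α p : κ → ℂ) (q : ℂ) (e : Option κ) : Continuous (gN α p q e) := by
  cases e <;> unfold gN <;> fun_prop

theorem gN_eq (α p : κ → ℂ) (q : ℂ) {e : Option κ} {z : ℂ} (h : gD p e z ≠ 0) :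
    gN α p q e z = (gX α p e z - q) * gD p e z := by
  cases e with
  | none => simp [gN, gX, gD]
  | some i =>
    have h1 : gX α p (some i) z = frP α p i i + α i / (z - p i) := by
      rw [← frX_sub_frP_self]
      simp [gX]
    have h2 : z - p i ≠ 0 := h
    simp only [gN, h1, gD]
    field_simp
    ring

theorem gD_ne_zero {p : κ → ℂ} (e : Option κ) {z : ℂ} (hz : ∀ k, z ≠ p k) : gD p e z ≠ 0 := by
  cases e with
  | none => exact one_ne_zero
  | some i => exact sub_ne_zero.2 (hz i)

theorem IsSol.false_of_max {c : J → ℂ} {α p : κ → ℂ} {z : J → ℂ} (h : IsSol c α p z)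
    {f : Option κ → Option κ} {q : Option κ → ℂ} {δ r : ℝ} {w : ℂ} {j : J} (hδ : 0 < δ)
    (hj : ∀ e, ‖gX α p (f e) (z j) - q e‖ < δ)
    (hsep : ∀ e, f e = e ∨ ∃ k, lbl (f e) k = e ∧ 2 * δ < ‖gP α p (f e) k - q e‖)
    (hcirc : ∀ e ζ, ‖ζ - q e‖ = δ → ‖rf (gA α p (f e)) (gP α p (f e)) ζ - w‖ < r)
    (hr : r ≤ ‖c j - w‖) : False := by
  classical
  set Ω : Set ℂ := {x | ∀ e, ‖gN α p (q e) (f e) x‖ < δ * ‖gD p (f e) x‖} with hΩ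
  have hopen : IsOpen Ω := by
    rw [hΩ, Set.ofPred_forall]
    exact isOpen_iInter_of_finite fun e => isOpen_lt (continuous_gN _ _ _ _).norm
      (continuous_const.mul (continuous_gD _ _).norm)
  have hcl : closure Ω ⊆ {x | ∀ e, ‖gN α p (q e) (f e) x‖ ≤ δ * ‖gD p (f e) x‖} := by
    refine closure_minimal (fun x hx e => (hx e).le) ?_
    rw [Set.ofPred_forall]
    exact isClosed_iInter fun e => isClosed_le (continuous_gN _ _ _ _).norm
      (continuous_const.mul (continuous_gD _ _).norm)
  have hpole : ∀ x ∈ closure Ω, ∀ k, x ≠ p k := by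
    rintro x hx l rfl
    have h1 := hcl hx (some l)
    rcases hsep (some l) with h2 | ⟨k, h2, h3⟩
    · rw [h2] at h1
      simp only [gN, gD, sub_self, mul_zero, add_zero, norm_zero, norm_le_zero_iff] at h1
      exact h.res_ne l h1
    · have h4 : gD p (f (some l)) (p l) ≠ 0 ∧
          gX α p (f (some l)) (p l) = gP α p (f (some l)) k := by
        generalize f (some l) = g at h2
        cases g with
        | none =>
          have : k = l := by simpa [lbl] using h2
          subst this
          exact ⟨one_ne_zero, rfl⟩
        | some i =>
          by_cases hki : k = i
          · simp [lbl, hki] at h2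
          · have : k = l := by simpa [lbl, hki] using h2
            subst this
            exact ⟨sub_ne_zero.2 (h.inj.ne hki), frX_pole α p i k⟩
      rw [gN_eq _ _ _ h4.1, norm_mul, h4.2] at h1
      have h5 : 0 < ‖gD p (f (some l)) (p l)‖ := norm_pos_iff.2 h4.1
      have h6 := le_of_mul_le_mul_right h1 h5
      linarith
  have hbdd : Bornology.IsBounded Ω := by
    rcases hfn : f none with _ | i
    · refine isBounded_ball.subset (s := Ω) (t := ball (q none) δ) fun x hx => ?_
      have := hx none
      rw [hfn] at this
      simpa [gN, gD, dist_eq_norm] using this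
    · obtain h2 | ⟨k, h2, h3⟩ := hsep none
      · rw [hfn] at h2
        exact absurd h2 (by simp)
      · have hki : k = i := by
          rw [hfn] at h2
          by_contra hki
          simp [lbl, hki] at h2
        rw [hfn, hki] at h3
        refine isBounded_ball.subset (s := Ω) (t := ball (p i) (‖α i‖ / δ)) fun x hx => ?_
        have h4 := hx none
        rw [hfn] at h4
        simp only [gN, gD] at h4
        rw [mem_ball, dist_eq_norm, lt_div_iff₀ hδ]
        have h5 : ‖(frP α p i i - q none) * (x - p i)‖ ≤
            ‖α i + (frP α p i i - q none) * (x - p i)‖ + ‖α i‖ := by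
          have := norm_sub_le (α i + (frP α p i i - q none) * (x - p i)) (α i)
          simpa using this
        rw [norm_mul] at h5
        have h6 : 2 * δ * ‖x - p i‖ ≤ ‖frP α p i i - q none‖ * ‖x - p i‖ := by
          gcongr
          exact h3.le
        linarith
  have hdiff : DiffContOnCl ℂ (fun x => rf α p x - w) Ω := by
    refine DifferentiableOn.diffContOnCl fun x hx => ?_
    exact ((hasDerivAt_rf α (hpole x hx)).differentiableAt.sub_const w).differentiableWithinAt
  have hfr : ∀ x ∈ frontier Ω, ‖rf α p x - w‖ < r := by
    intro x hx
    rw [hopen.frontier_eq] at hx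
    have hp := hpole x hx.1
    have h1 : ∃ e, ¬ ‖gN α p (q e) (f e) x‖ < δ * ‖gD p (f e) x‖ := by
      by_contra! hcon
      exact hx.2 hcon
    obtain ⟨e, he⟩ := h1
    have h2 := le_antisymm (hcl hx.1 e) (not_lt.1 he)
    have h3 := gD_ne_zero (f e) hp
    rw [gN_eq _ _ _ h3, norm_mul] at h2
    have h4 := mul_right_cancel₀ (norm_ne_zero_iff.2 h3) h2
    have h5 := hcirc e _ h4
    rwa [rf_gX h.inj h.res_ne _ hp] at h5
  have hmem : z j ∈ Ω := by
    intro e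
    have h3 := gD_ne_zero (f e) (h.ne_pole j)
    rw [gN_eq _ _ _ h3, norm_mul]
    exact mul_lt_mul_of_pos_right (hj e) (norm_pos_iff.2 h3)
  have hcomp : IsCompact (frontier Ω) :=
    isCompact_of_isClosed_isBounded isClosed_frontier (hbdd.closure.subset frontier_subset_closure)
  have hne : (frontier Ω).Nonempty := by
    rw [nonempty_frontier_iff]
    refine ⟨⟨_, hmem⟩, fun huniv => ?_⟩
    rw [huniv] at hbdd
    exact NormedSpace.unbounded_univ ℝ ℂ hbdd
  obtain ⟨x₀, hx₀, hmax⟩ := hcomp.exists_isMaxOn hne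
    (hdiff.continuousOn.mono frontier_subset_closure).norm
  have h1 := Complex.norm_le_of_forall_mem_frontier_norm_le hbdd hdiff
    (fun x hx => hmax hx) (subset_closure hmem)
  rw [h.val j] at h1
  exact absurd (h1.trans_lt (hfr x₀ hx₀)) (not_lt.2 hr)

end CriticalValues

namespace CriticalValues

open Filter Topology Metric

variable {κ J : Type} [Fintype κ] [Fintype J]

theorem IsSol.card_le {c : J → ℂ} {α p : κ → ℂ} {z : J → ℂ} (h : IsSol c α p z)
    (hc : Function.Injective c) : Fintype.card J ≤ 2 * Fintype.card κ := by
  classical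
  have hz := h.z_inj hc
  have h1 : (Finset.univ.image z).val ⊆ (wr α p).roots := by
    intro x hx
    obtain ⟨j, -, rfl⟩ := Finset.mem_image.1 (show x ∈ Finset.univ.image z from hx)
    rw [mem_roots (monic_wr α p).ne_zero, IsRoot.def, eval_wr α (h.ne_pole j), h.crit j, zero_mul]
  have h2 := (Multiset.card_le_card ((Multiset.le_iff_subset (Finset.nodup _)).2 h1)).trans
    (card_roots' _)
  rwa [natDegree_wr, Finset.card_val, Finset.card_image_of_injective _ hz, Finset.card_univ] at h2

theorem rf_restrict {α p : κ → ℂ} {A : Finset κ} (hA : ∀ k ∉ A, α k = 0) (ζ : ℂ) :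
    rf (fun k : A => α k) (fun k : A => p k) ζ = rf α p ζ := by
  rw [rf, rf, Finset.sum_coe_sort A (fun k => α k / (ζ - p k))]
  congr 1
  exact Finset.sum_subset (Finset.subset_univ A) fun k _ hk => by simp [hA k hk]

theorem rd_restrict {α p : κ → ℂ} {A : Finset κ} (hA : ∀ k ∉ A, α k = 0) (ζ : ℂ) :
    rd (fun k : A => α k) (fun k : A => p k) ζ = rd α p ζ := by
  rw [rd, rd, Finset.sum_coe_sort A (fun k => α k / (ζ - p k) ^ 2)]
  congr 1
  exact Finset.sum_subset (Finset.subset_univ A) fun k _ hk => by simp [hA k hk]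

namespace IsLimit

variable {ι : Type*} {F : Filter ι} {c : ι → J → ℂ} {α p : ι → κ → ℂ} {z : ι → J → ℂ}
    {c' : J → ℂ} {α' p' : κ → ℂ} {z' : J → ℂ}

theorem eventually_circle (h : IsLimit F c α p z c' α' p' z') {q w : ℂ} {r : ℝ} (hr : 0 < r)
    (hq : ∀ k, p' k = q → α' k = 0) (hw : rf α' p' q = w) :
    ∀ᶠ δ : ℝ in 𝓝[>] 0, ∀ᶠ t in F, ∀ ζ, ‖ζ - q‖ = δ → ‖rf (α t) (p t) ζ - w‖ < r := by
  have hcont : ∀ᶠ ζ in 𝓝[≠] q, ‖rf α' p' ζ - w‖ < r := by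
    have h1 : ContinuousAt (fun ζ => ‖rf α' p' ζ - w‖) q :=
      ((analyticAt_rf_of_res_eq_zero hq).continuousAt.sub continuousAt_const).norm
    exact nhdsWithin_le_nhds (h1.eventually (gt_mem_nhds (by simpa [hw] using hr)))
  obtain ⟨ε, hε, hεP⟩ := Metric.mem_nhdsWithin_iff.1
    ((eventually_ne_pole_punctured p' q).and hcont)
  filter_upwards [Ioo_mem_nhdsGT hε] with δ ⟨hδ0, hδε⟩
  have hcirc : ∀ ζ ∈ sphere q δ, (∀ k, ζ ≠ p' k) ∧ ‖rf α' p' ζ - w‖ < r := by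
    intro ζ hζ
    have h1 : dist ζ q = δ := hζ
    refine hεP ⟨by rwa [mem_ball, h1], ?_⟩
    rw [Set.mem_compl_singleton_iff, ← dist_pos, h1]
    exact hδ0
  have hev : ∀ᶠ y : (κ → ℂ) × (κ → ℂ) in 𝓝 (α', p'), ∀ ζ ∈ sphere q δ,
      ‖rf y.1 y.2 ζ - w‖ < r := by
    refine (isCompact_sphere q δ).eventually_forall_of_forall_eventually fun ζ hζ => ?_
    obtain ⟨h1, h3⟩ := hcirc ζ hζ
    have hpr : Tendsto (fun x : ((κ → ℂ) × (κ → ℂ)) × ℂ => (x.1.1, x.1.2, x.2))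
        (𝓝 ((α', p'), ζ)) (𝓝 (α', p', ζ)) := by
      refine Continuous.tendsto ?_ _
      fun_prop
    have hrf : Tendsto (fun x : ((κ → ℂ) × (κ → ℂ)) × ℂ => rf x.1.1 x.1.2 x.2)
        (𝓝 ((α', p'), ζ)) (𝓝 (rf α' p' ζ)) :=
      (analyticAt_rf h1).continuousAt.tendsto.comp hpr
    exact (hrf.sub_const w).norm.eventually (gt_mem_nhds h3)
  filter_upwards [(h.tα.prodMk_nhds h.tp).eventually hev] with t ht ζ hζ
  exact ht ζ (by simpa [dist_eq_norm] using hζ)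

variable [F.NeBot]

theorem isSol_restrict (h : IsLimit F c α p z c' α' p' z')
    (hJ : Fintype.card J = 2 * Fintype.card κ) {A : Finset κ} (hA : ∀ k, k ∈ A ↔ α' k ≠ 0)
    {S : Finset J} (hS : ∀ j ∈ S, ∀ k, α' k = 0 → z' j ≠ p' k) :
    IsSol (fun j : S => c' j) (fun k : A => α' k) (fun k : A => p' k) (fun j : S => z' j) := by
  have hA0 : ∀ k ∉ A, α' k = 0 := fun k hk => not_not.1 fun h0 => hk ((hA k).2 h0)
  have hz : ∀ j ∈ S, ∀ k, z' j ≠ p' k := fun j hj k he =>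
    hS j hj k (h.res_eq_zero_of_crit_eq hJ he) he
  have hpr : ∀ j, Tendsto (fun t => (α t, p t, z t j)) F (𝓝 (α', p', z' j)) := fun j =>
    h.tα.prodMk_nhds (h.tp.prodMk_nhds (h.tz_apply j))
  refine ⟨fun k => (hA k).1 k.2, ?_, fun j k => hz j j.2 k, fun j => ?_, fun j => ?_⟩
  · intro k i he
    by_contra hki
    exact (hA i).1 i.2 (h.res_eq_zero_of_pole_eq hJ (Subtype.coe_injective.ne hki) he)
  · rw [rd_restrict hA0]
    have h1 := (analyticAt_rd (α := α') (hz j j.2)).continuousAt.tendsto.comp (hpr j)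
    refine tendsto_nhds_unique h1 (tendsto_const_nhds.congr' ?_)
    filter_upwards [h.sol] with t ht
    exact (ht.crit j).symm
  · rw [rf_restrict hA0]
    have h1 := (analyticAt_rf (α := α') (hz j j.2)).continuousAt.tendsto.comp (hpr j)
    refine tendsto_nhds_unique h1 ((h.tc_apply j).congr' ?_)
    filter_upwards [h.sol] with t ht
    exact (ht.val j).symm

end IsLimit

/-- The residues in the coordinates normalised at the poles, up to sign. -/
noncomputable def gU (α p : κ → ℂ) : Option κ → Option κ → ℂ
  | none, none => 0
  | none, some k => α k
  | some i, none => α i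
  | some i, some k => α i * α k / (p k - p i) ^ 2

theorem gU_symm (α p : κ → ℂ) (e f : Option κ) : gU α p e f = gU α p f e := by
  cases e <;> cases f <;> simp only [gU]
  rw [mul_comm, ← neg_sub, neg_sq]

theorem gA_eq (α p : κ → ℂ) (e : Option κ) (k : κ) :
    gA α p e k = gU α p e (lbl e k) ∨ gA α p e k = - gU α p e (lbl e k) := by
  cases e with
  | none => exact Or.inl rfl
  | some i =>
    by_cases h : k = i
    · subst h
      left
      simp [gA, frA_self, lbl, gU]
    · right
      simp [gA, frA_of_ne α p h, lbl, h, gU]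

theorem gU_mul {α p : κ → ℂ} (hp : Function.Injective p) (f : Option κ)
    {k l : κ} (hkl : k ≠ l) :
    gU α p (lbl f k) (lbl f l) * (gP α p f k - gP α p f l) ^ 2 =
      gU α p f (lbl f k) * gU α p f (lbl f l) := by
  cases f with
  | none =>
    have := sub_ne_zero.2 (hp.ne hkl)
    have h2 := sub_ne_zero.2 (hp.ne hkl.symm)
    simp only [lbl, gU, gP]
    field_simp
    ring
  | some i =>
    by_cases hk : k = i
    · subst hk
      have h1 := sub_ne_zero.2 (hp.ne hkl.symm)
      have h2 := frX_sub_frP_self α p k (p l)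
      rw [frX_pole] at h2
      have h3 : frP α p k k - frP α p k l = - (α k / (p l - p k)) := by rw [← h2]; ring
      simp only [lbl, if_true, hkl.symm, if_false, gU, gP, h3]
      field_simp
    · by_cases hl : l = i
      · subst hl
        have h1 := sub_ne_zero.2 (hp.ne hk)
        have h2 := frX_sub_frP_self α p l (p k)
        rw [frX_pole] at h2
        simp only [lbl, if_true, hk, if_false, gU, gP, h2]
        field_simp
      · have h1 := sub_ne_zero.2 (hp.ne hk)
        have h4 := sub_ne_zero.2 (hp.ne hl)
        have h5 := sub_ne_zero.2 (hp.ne hkl.symm)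
        have h2 := frX_sub_frP_self α p i (p k)
        have h3 := frX_sub_frP_self α p i (p l)
        rw [frX_pole] at h2 h3
        have h6 : frP α p i k - frP α p i l =
            α i * (p l - p k) / ((p k - p i) * (p l - p i)) := by
          rw [← sub_sub_sub_cancel_right _ _ (frP α p i i), h2, h3]
          field_simp
          ring
        simp only [lbl, hk, hl, if_false, gU, gP, h6]
        field_simp

/-- A family of solutions, converging in all coordinates normalised at poles, such that exactly
two critical values come together. -/
structure IsCollision {ι : Type*} (F : Filter ι) (c : ι → J → ℂ) (α p : ι → κ → ℂ)
    (z : ι → J → ℂ) (c' : J → ℂ) (w : ℂ) (j₁ j₂ : J) (α' p' : Option κ → κ → ℂ)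
    (z' : Option κ → J → ℂ) : Prop where
  lim : ∀ e, IsLimit F c (fun t => gA (α t) (p t) e) (fun t => gP (α t) (p t) e)
    (fun t j => gX (α t) (p t) e (z t j)) c' (α' e) (p' e) (z' e)
  ne : j₁ ≠ j₂
  val : ∀ j, c' j = w ↔ j = j₁ ∨ j = j₂
  inj : ∀ j l, c' j ≠ w → c' j = c' l → j = l
  card : Fintype.card J = 2 * Fintype.card κ

theorem exists_isCollision {ι : Type*} (F : Ultrafilter ι) {c : ι → J → ℂ} {α p : ι → κ → ℂ}
    {z : ι → J → ℂ} {c' : J → ℂ} (hJ : Fintype.card J = 2 * Fintype.card κ)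
    (sol : ∀ᶠ t in (F : Filter ι), IsSol (c t) (α t) (p t) (z t))
    (inj : ∀ᶠ t in (F : Filter ι), Function.Injective (c t)) (tc : Tendsto c F (𝓝 c'))
    {w : ℂ} {j₁ j₂ : J} (hne : j₁ ≠ j₂) (hval : ∀ j, c' j = w ↔ j = j₁ ∨ j = j₂)
    (hinj : ∀ j l, c' j ≠ w → c' j = c' l → j = l) :
    ∃ α' p' z', IsCollision (F : Filter ι) c α p z c' w j₁ j₂ α' p' z' := by
  have h1 : ∀ e, ∃ α' p' z', IsLimit (F : Filter ι) c (fun t => gA (α t) (p t) e)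
      (fun t => gP (α t) (p t) e) (fun t j => gX (α t) (p t) e (z t j)) c' α' p' z' := fun e =>
    exists_isLimit F hJ (sol.mono fun t ht => ht.gframe e) inj tc
  choose α' p' z' h using h1
  exact ⟨α', p', z', h, hne, hval, hinj, hJ⟩

namespace IsCollision

variable {ι : Type*} {F : Filter ι} {c : ι → J → ℂ} {α p : ι → κ → ℂ}
    {z : ι → J → ℂ} {c' : J → ℂ} {w : ℂ} {j₁ j₂ : J} {α' p' : Option κ → κ → ℂ}
    {z' : Option κ → J → ℂ}

/-- Two poles lie on the same component of the limit. -/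
def rel (α' : Option κ → κ → ℂ) (e f : Option κ) : Prop := f = e ∨ ∃ k, lbl e k = f ∧ α' e k ≠ 0

theorem sol (h : IsCollision F c α p z c' w j₁ j₂ α' p' z') :
    ∀ᶠ t in F, IsSol (c t) (α t) (p t) (z t) := (h.lim none).sol

theorem tendsto_gU (h : IsCollision F c α p z c' w j₁ j₂ α' p' z') (e : Option κ) (k : κ) :
    Tendsto (fun t => ‖gU (α t) (p t) e (lbl e k)‖) F (𝓝 ‖α' e k‖) := by
  refine ((h.lim e).tα_apply k).norm.congr fun t => ?_
  rcases gA_eq (α t) (p t) e k with h1 | h1 <;> rw [h1]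
  exact norm_neg _

variable [F.NeBot]

theorem rel_symm (h : IsCollision F c α p z c' w j₁ j₂ α' p' z') {e f : Option κ}
    (hef : rel α' e f) : rel α' f e := by
  rcases hef with rfl | ⟨k, rfl, hk⟩
  · exact Or.inl rfl
  · obtain ⟨l, hl⟩ := exists_lbl (lbl_ne e k).symm
    refine Or.inr ⟨l, hl, fun h0 => hk ?_⟩
    have h1 := h.tendsto_gU (lbl e k) l
    rw [hl, h0, norm_zero] at h1
    have h2 := tendsto_nhds_unique (h.tendsto_gU e k)
      (h1.congr fun t => by rw [gU_symm])
    exact norm_eq_zero.1 h2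

theorem rel_trans (h : IsCollision F c α p z c' w j₁ j₂ α' p' z') {e f g : Option κ}
    (hef : rel α' e f) (hfg : rel α' f g) : rel α' e g := by
  by_cases hge : g = e
  · exact Or.inl hge
  rcases h.rel_symm hef with rfl | ⟨k, rfl, hk⟩
  · exact hfg
  rcases hfg with rfl | ⟨l, rfl, hl⟩
  · exact hef
  have hkl : k ≠ l := fun hkl => hge (by rw [hkl])
  obtain ⟨m, hm⟩ := exists_lbl hge
  refine Or.inr ⟨m, hm, fun h0 => ?_⟩
  have h1 := h.tendsto_gU (lbl f k) m
  rw [hm, h0, norm_zero] at h1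
  have h2 := h1.mul ((((h.lim f).tp_apply k).sub ((h.lim f).tp_apply l)).norm.pow 2)
  have h3 := (h.tendsto_gU f k).mul (h.tendsto_gU f l)
  have h4 := tendsto_nhds_unique h3 (h2.congr' (by
    filter_upwards [h.sol] with t ht
    rw [← norm_pow, ← norm_mul, gU_mul ht.inj f hkl, norm_mul]))
  rw [zero_mul] at h4
  rcases mul_eq_zero.1 h4 with h5 | h5
  · exact hk (norm_eq_zero.1 h5)
  · exact hl (norm_eq_zero.1 h5)

theorem rf_node (h : IsCollision F c α p z c' w j₁ j₂ α' p' z') {e : Option κ} {k : κ}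
    (hk : α' e k = 0) : rf (α' e) (p' e) (p' e k) = w := by
  obtain ⟨l₁, l₂, hne, h1, h2⟩ := (h.lim e).exists_collision h.card hk
  by_contra hw
  exact hne (h.inj l₁ l₂ (by rwa [h1]) (h1.trans h2.symm))

theorem res_eq_zero_of_eq (h : IsCollision F c α p z c' w j₁ j₂ α' p' z') {e : Option κ} {k l : κ}
    (hk : α' e k = 0) (hl : p' e l = p' e k) : α' e l = 0 := by
  by_cases hlk : k = l
  · rwa [← hlk]
  · exact (h.lim e).res_eq_zero_of_pole_eq h.card hlk hl.symm

theorem exists_visible (h : IsCollision F c α p z c' w j₁ j₂ α' p' z') {j : J} (hj : c' j ≠ w) :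
    ∃ e, ∀ f, rel α' e f → ∀ k, α' f k = 0 → z' f j ≠ p' f k := by
  by_contra! hcon
  choose f hf k hk hz using hcon
  obtain ⟨r, hr, hgap⟩ := exists_gap c' w
  have hev : ∀ᶠ δ : ℝ in 𝓝[>] 0, ∀ e, (∀ᶠ t in F, ∀ ζ, ‖ζ - p' (f e) (k e)‖ = δ →
      ‖rf (gA (α t) (p t) (f e)) (gP (α t) (p t) (f e)) ζ - w‖ < r) ∧
      (f e = e ∨ ∃ l, lbl (f e) l = e ∧ 2 * δ < ‖p' (f e) l - p' (f e) (k e)‖) := by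
    refine eventually_all.2 fun e => Eventually.and ?_ ?_
    · exact (h.lim (f e)).eventually_circle hr (fun l hl => h.res_eq_zero_of_eq (hk e) hl)
        (h.rf_node (hk e))
    · rcases h.rel_symm (hf e) with h1 | ⟨l, h1, h2⟩
      · exact Eventually.of_forall fun δ => Or.inl h1.symm
      · have h3 : 0 < ‖p' (f e) l - p' (f e) (k e)‖ :=
          norm_pos_iff.2 (sub_ne_zero.2 fun he => h2 (h.res_eq_zero_of_eq (hk e) he))
        have h4 : Tendsto (fun r : ℝ => 2 * r) (𝓝[>] 0) (𝓝 (2 * 0)) :=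
          (tendsto_id.mono_left nhdsWithin_le_nhds).const_mul 2
        rw [mul_zero] at h4
        filter_upwards [h4.eventually (gt_mem_nhds h3)] with δ hδ
        exact Or.inr ⟨l, h1, hδ⟩
  obtain ⟨δ, hδ, hδ0⟩ := (hev.and self_mem_nhdsWithin).exists
  have h1 : ∀ᶠ t in F, ∀ e, ‖gX (α t) (p t) (f e) (z t j) - p' (f e) (k e)‖ < δ := by
    refine eventually_all.2 fun e => ?_
    exact ((((h.lim (f e)).tz_apply j).sub_const _).norm).eventually
      (gt_mem_nhds (by simpa [hz e] using hδ0))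
  have h2 : ∀ᶠ t in F, ∀ e, f e = e ∨ ∃ l, lbl (f e) l = e ∧
      2 * δ < ‖gP (α t) (p t) (f e) l - p' (f e) (k e)‖ := by
    refine eventually_all.2 fun e => ?_
    rcases (hδ e).2 with h3 | ⟨l, h3, h4⟩
    · exact Eventually.of_forall fun t => Or.inl h3
    · filter_upwards [((((h.lim (f e)).tp_apply l).sub_const _).norm).eventually
        (lt_mem_nhds h4)] with t ht
      exact Or.inr ⟨l, h3, ht⟩
  have h3 : ∀ᶠ t in F, r < ‖c t j - w‖ :=
    ((((h.lim none).tc_apply j).sub_const w).norm).eventually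
      (lt_mem_nhds (by linarith [hgap j hj]))
  have h4 := eventually_all.2 fun e => (hδ e).1
  obtain ⟨t, ht1, ht2, ht3, ht4, ht5⟩ := (h1.and (h2.and (h3.and (h4.and h.sol)))).exists
  exact ht5.false_of_max hδ0 ht1 ht2 ht4 ht3.le

open Classical in
/-- The poles visible from the coordinate normalised at `e`. -/
noncomputable def visPole (α' : Option κ → κ → ℂ) (e : Option κ) : Finset κ :=
  Finset.univ.filter fun k => α' e k ≠ 0

open Classical in
/-- The critical points visible from the coordinate normalised at `e`. -/
noncomputable def visCrit (c' : J → ℂ) (w : ℂ) (α' p' : Option κ → κ → ℂ) (z' : Option κ → J → ℂ)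
    (e : Option κ) : Finset J :=
  Finset.univ.filter fun j => c' j ≠ w ∧ ∀ k, α' e k = 0 → z' e j ≠ p' e k

theorem mem_visPole {α' : Option κ → κ → ℂ} {e : Option κ} {k : κ} :
    k ∈ visPole α' e ↔ α' e k ≠ 0 := by simp [visPole]

theorem mem_visCrit {j : J} {e : Option κ} : j ∈ visCrit c' w α' p' z' e ↔
    c' j ≠ w ∧ ∀ k, α' e k = 0 → z' e j ≠ p' e k := by simp [visCrit]

theorem isSol_vis (h : IsCollision F c α p z c' w j₁ j₂ α' p' z') (e : Option κ) :
    IsSol (fun j : visCrit c' w α' p' z' e => c' j) (fun k : visPole α' e => α' e k)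
      (fun k : visPole α' e => p' e k) (fun j : visCrit c' w α' p' z' e => z' e j) :=
  (h.lim e).isSol_restrict h.card (fun _ => mem_visPole) fun _ hj => (mem_visCrit.1 hj).2

theorem card_visCrit_le (h : IsCollision F c α p z c' w j₁ j₂ α' p' z') (e : Option κ) :
    (visCrit c' w α' p' z' e).card ≤ 2 * (visPole α' e).card := by
  have h1 := (h.isSol_vis e).card_le fun j l hjl =>
    Subtype.ext (h.inj j l (mem_visCrit.1 j.2).1 hjl)
  simpa using h1

theorem card_special (h : IsCollision F c α p z c' w j₁ j₂ α' p' z') [DecidableEq ℂ] :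
    (Finset.univ.filter fun j => c' j ≠ w).card + 2 = 2 * Fintype.card κ := by
  classical
  have h1 : (Finset.univ.filter fun j => c' j = w) = {j₁, j₂} := by
    ext j
    simp [h.val]
  have h2 := Finset.card_filter_add_card_filter_not (s := (Finset.univ : Finset J))
    (fun j => c' j = w)
  rw [h1, Finset.card_pair h.ne, Finset.card_univ, h.card] at h2
  rw [← h2, add_comm]

theorem rel_or_rel (h : IsCollision F c α p z c' w j₁ j₂ α' p' z') {i : κ} (hi : α' none i = 0)
    (e : Option κ) : rel α' none e ∨ rel α' (some i) e := by
  classical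
  by_contra! hcon
  let s : Setoid (Option κ) := ⟨rel α', fun _ => Or.inl rfl, h.rel_symm, h.rel_trans⟩
  have hni : ¬ rel α' none (some i) := by
    rintro (h1 | ⟨k, h1, h2⟩)
    · simp at h1
    · have : k = i := by simpa [lbl] using h1
      exact h2 (this ▸ hi)
  have h3 : 3 ≤ Fintype.card (Quotient s) := by
    have h4 : ({⟦none⟧, ⟦some i⟧, ⟦e⟧} : Finset (Quotient s)).card = 3 := by
      rw [Finset.card_eq_three]
      refine ⟨_, _, _, ?_, ?_, ?_, rfl⟩
      · exact fun h5 => hni (Quotient.exact h5)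
      · exact fun h5 => hcon.1 (Quotient.exact h5)
      · exact fun h5 => hcon.2 (Quotient.exact h5)
    rw [← h4]
    exact Finset.card_le_univ _
  have hclass : ∀ q : Quotient s, (Finset.univ.filter fun e : Option κ => ⟦e⟧ = q).card =
      (visPole α' q.out).card + 1 := by
    intro q
    have h5 : (Finset.univ.filter fun e : Option κ => ⟦e⟧ = q) =
        insert q.out ((visPole α' q.out).image (lbl q.out)) := by
      ext f
      simp only [Finset.mem_filter, Finset.mem_univ, true_and, Finset.mem_insert,
        Finset.mem_image, mem_visPole]
      constructor
      · intro hf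
        have h6 : rel α' q.out f :=
          Quotient.exact (s := s) (a := q.out) (b := f) ((Quotient.out_eq q).trans hf.symm)
        exact h6.imp id fun ⟨k, h7, h8⟩ => ⟨k, h8, h7⟩
      · intro hf
        have h6 : rel α' q.out f := hf.imp id fun ⟨k, h7, h8⟩ => ⟨k, h8, h7⟩
        rw [← Quotient.out_eq q]
        exact Quotient.sound (h.rel_symm h6)
    rw [h5, Finset.card_insert_of_notMem, Finset.card_image_of_injective _ (lbl_injective _)]
    simp only [Finset.mem_image, not_exists, not_and]
    exact fun k _ => lbl_ne _ k
  have hsum : ∑ q : Quotient s, ((visPole α' q.out).card + 1) = Fintype.card κ + 1 := by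
    rw [← Fintype.card_option, ← Finset.card_univ, Finset.card_eq_sum_card_fiberwise
      (f := fun e : Option κ => (⟦e⟧ : Quotient s)) (t := Finset.univ) (fun _ _ => by simp)]
    exact Finset.sum_congr rfl fun q _ => (hclass q).symm
  have hcov : (Finset.univ.filter fun j => c' j ≠ w) ⊆
      Finset.univ.biUnion fun q : Quotient s => visCrit c' w α' p' z' q.out := by
    intro j hj
    have hj' : c' j ≠ w := by simpa using hj
    obtain ⟨f, hf⟩ := h.exists_visible hj'
    refine Finset.mem_biUnion.2 ⟨⟦f⟧, Finset.mem_univ _, mem_visCrit.2 ⟨hj', hf _ ?_⟩⟩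
    exact h.rel_symm (Quotient.mk_out (s := s) f)
  have h6 := (Finset.card_le_card hcov).trans (Finset.card_biUnion_le.trans
    (Finset.sum_le_sum fun q _ => h.card_visCrit_le (Quotient.out q)))
  have h7 := h.card_special
  rw [← Finset.mul_sum] at h6
  rw [Finset.sum_add_distrib, Finset.sum_const, Finset.card_univ, smul_eq_mul, mul_one] at hsum
  omega

end IsCollision

end CriticalValues

namespace CriticalValues

open Filter Topology Metric

variable {κ J : Type} [Fintype κ] [Fintype J]

/-- `x * (1 + fa A u v x) = x + ∑ u k / (x - v k) + ∑ u k / v k`. -/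
noncomputable def fa (A : Finset κ) (u v : κ → ℂ) (x : ℂ) : ℂ := ∑ k ∈ A, u k / (v k * (x - v k))

/-- `1 - fd A u v` is the derivative of `x * (1 + fa A u v x)`. -/
noncomputable def fd (A : Finset κ) (u v : κ → ℂ) (x : ℂ) : ℂ := ∑ k ∈ A, u k / (x - v k) ^ 2

open Classical in
/-- The complement of `A` and `i`. -/
noncomputable def co₁ (i : κ) (A : Finset κ) : Finset κ := Finset.univ.filter fun k => k ∉ A ∧ k ≠ i

open Classical in
/-- The complement of `S`, `j₁` and `j₂`. -/
noncomputable def co₂ (j₁ j₂ : J) (S : Finset J) : Finset J :=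
  Finset.univ.filter fun j => j ∉ S ∧ j ≠ j₁ ∧ j ≠ j₂

theorem mem_co₁ {i : κ} {A : Finset κ} {k : κ} : k ∈ co₁ i A ↔ k ∉ A ∧ k ≠ i := by simp [co₁]

theorem mem_co₂ {j₁ j₂ : J} {S : Finset J} {j : J} :
    j ∈ co₂ j₁ j₂ S ↔ j ∉ S ∧ j ≠ j₁ ∧ j ≠ j₂ := by simp [co₂]

theorem sum_co₁ {i : κ} {A : Finset κ} (hi : i ∉ A) (f : κ → ℂ) :
    ∑ k, f k = f i + ∑ k ∈ A, f k + ∑ k ∈ co₁ i A, f k := by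
  classical
  have h1 : (Finset.univ : Finset κ) = (insert i A) ∪ co₁ i A := by
    ext k
    simp only [Finset.mem_univ, Finset.mem_union, Finset.mem_insert, mem_co₁, true_iff]
    tauto
  have h2 : Disjoint (insert i A) (co₁ i A) := by
    rw [Finset.disjoint_left]
    intro k hk hk'
    rcases Finset.mem_insert.1 hk with h | h
    · exact (mem_co₁.1 hk').2 h
    · exact (mem_co₁.1 hk').1 h
  rw [h1, Finset.sum_union h2, Finset.sum_insert hi]

/-- The positions of the poles and critical points, relative to a node, of a function with critical
values `c j` for `j ∈ S`, taking the value `w` at the node. -/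
structure IsSide (c : J → ℂ) (w : ℂ) (A : Finset κ) (S : Finset J) (u v : κ → ℂ) (y : J → ℂ) :
    Prop where
  card : S.card = 2 * A.card
  ne : ∀ k ∈ A, v k ≠ 0
  sol : IsSol (fun j : S => c j - (w + ∑ k ∈ A, u k / v k)) (fun k : A => u k) (fun k : A => v k)
    (fun j : S => y j)

theorem rd_subtype (A : Finset κ) (u v : κ → ℂ) (x : ℂ) :
    rd (fun k : A => u k) (fun k : A => v k) x = 1 - fd A u v x := by
  rw [rd, fd, Finset.sum_coe_sort A (fun k => u k / (x - v k) ^ 2)]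

theorem rf_subtype {A : Finset κ} {u v : κ → ℂ} {x : ℂ} (hv : ∀ k ∈ A, v k ≠ 0)
    (hx : ∀ k ∈ A, x ≠ v k) : rf (fun k : A => u k) (fun k : A => v k) x =
      x * (1 + fa A u v x) - ∑ k ∈ A, u k / v k := by
  rw [rf, fa, Finset.sum_coe_sort A (fun k => u k / (x - v k)), mul_add, mul_one, add_sub_assoc,
    Finset.mul_sum, ← Finset.sum_sub_distrib]
  congr 1
  refine Finset.sum_congr rfl fun k hk => ?_
  have h1 := hv k hk
  have h2 := sub_ne_zero.2 (hx k hk)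
  field_simp
  ring

namespace IsSide

variable {c : J → ℂ} {w : ℂ} {A : Finset κ} {S : Finset J} {u v : κ → ℂ} {y : J → ℂ}

theorem res_ne (h : IsSide c w A S u v y) {k : κ} (hk : k ∈ A) : u k ≠ 0 := h.sol.res_ne ⟨k, hk⟩

theorem ne_pole (h : IsSide c w A S u v y) {j : J} (hj : j ∈ S) {k : κ} (hk : k ∈ A) :
    y j ≠ v k := h.sol.ne_pole ⟨j, hj⟩ ⟨k, hk⟩

theorem crit (h : IsSide c w A S u v y) {j : J} (hj : j ∈ S) : 1 - fd A u v (y j) = 0 := by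
  rw [← rd_subtype]
  exact h.sol.crit ⟨j, hj⟩

theorem val (h : IsSide c w A S u v y) {j : J} (hj : j ∈ S) :
    w + y j * (1 + fa A u v (y j)) = c j := by
  have h1 := h.sol.val ⟨j, hj⟩
  rw [rf_subtype h.ne fun k hk => h.ne_pole hj hk] at h1
  linear_combination h1

theorem ne_zero (h : IsSide c w A S u v y) {j : J} (hj : j ∈ S) (hw : c j ≠ w) : y j ≠ 0 := by
  intro h0
  apply hw
  rw [← h.val hj, h0, zero_mul, add_zero]

theorem injective (hc : ∀ j ∈ S, ∀ l, c j = c l → j = l) :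
    Function.Injective (fun j : S => c j - (w + ∑ k ∈ A, u k / v k)) := fun j l hjl =>
  Subtype.ext (hc j j.2 l (sub_left_injective hjl))

theorem fd_zero_ne (h : IsSide c w A S u v y) (hw : ∀ j ∈ S, c j ≠ w)
    (hc : ∀ j ∈ S, ∀ l, c j = c l → j = l) : 1 - fd A u v 0 ≠ 0 := by
  intro h0
  rw [← rd_subtype] at h0
  obtain ⟨j, hj⟩ := h.sol.exists_eq_of_crit (h.sol.z_inj (injective hc)) (by simpa using h.card)
    (fun k => (h.ne k k.2).symm) h0
  exact h.ne_zero j.2 (hw j j.2) hj.symm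

end IsSide

theorem fa_zero {A : Finset κ} {u v : κ → ℂ} (hv : ∀ k ∈ A, v k ≠ 0) :
    fa A u v 0 = -fd A u v 0 := by
  rw [fa, fd, ← Finset.sum_neg_distrib]
  refine Finset.sum_congr rfl fun k hk => ?_
  have := hv k hk
  rw [zero_sub, mul_neg, div_neg, neg_sq, sq]

/-- Limiting data for two critical values coming together. -/
structure IsNode (c : J → ℂ) (w : ℂ) (i : κ) (j₁ j₂ : J) (A : Finset κ) (S : Finset J)
    (u v : κ → ℂ) (y : J → ℂ) : Prop where
  notMem : i ∉ A
  notMem₁ : j₁ ∉ S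
  notMem₂ : j₂ ∉ S
  left : IsSide c w A S u v y
  right : IsSide c w (co₁ i A) (co₂ j₁ j₂ S) u v y
  u_node : u i = 0
  v_node : v i = w
  y_node₁ : y j₁ = (1 - fd A u v 0) / (1 - fd (co₁ i A) u v 0)
  y_node₂ : y j₂ = -1

section Glue

variable (i : κ) (j₁ j₂ : J) (A : Finset κ) (S : Finset J)

/-- The residue at the node. -/
def glueσ (x : (κ → ℂ) × (κ → ℂ) × (J → ℂ)) : ℂ := x.1 i ^ 2 * x.2.2 j₁

/-- The pole at the node. -/
noncomputable def glueQ (x : (κ → ℂ) × (κ → ℂ) × (J → ℂ)) : ℂ :=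
  x.2.1 i + ∑ k ∈ A, x.1 k / x.2.1 k

open Classical in
/-- The position of a critical point seen from the left. -/
noncomputable def glueX (x : (κ → ℂ) × (κ → ℂ) × (J → ℂ)) (j : J) : ℂ :=
  if j ∈ S then x.2.2 j else if j = j₁ then x.1 i else if j = j₂ then x.1 i * x.2.2 j₂ else
    glueσ i j₁ x / x.2.2 j

open Classical in
/-- Glue the two sides of a node. -/
noncomputable def glue (x : (κ → ℂ) × (κ → ℂ) × (J → ℂ)) : (κ → ℂ) × (κ → ℂ) × (J → ℂ) :=
  (fun k => if k ∈ A then x.1 k else if k = i then glueσ i j₁ x else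
      -(x.1 k * glueσ i j₁ x / x.2.1 k ^ 2),
    fun k => glueQ i A x + if k ∈ A then x.2.1 k else if k = i then 0 else
      glueσ i j₁ x / x.2.1 k,
    fun j => glueQ i A x + glueX i j₁ j₂ S x j)

open Classical in
/-- The inverse of `glue`. -/
noncomputable def cut (x : (κ → ℂ) × (κ → ℂ) × (J → ℂ)) : (κ → ℂ) × (κ → ℂ) × (J → ℂ) :=
  (fun k => if k ∈ A then x.1 k else if k = i then x.2.2 j₁ - x.2.1 i else
      -(x.1 i * x.1 k / (x.2.1 k - x.2.1 i) ^ 2),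
    fun k => if k ∈ A then x.2.1 k - x.2.1 i else if k = i then
      x.2.1 i - ∑ k ∈ A, x.1 k / (x.2.1 k - x.2.1 i) else x.1 i / (x.2.1 k - x.2.1 i),
    fun j => if j ∈ S then x.2.2 j - x.2.1 i else if j = j₁ then
      x.1 i / (x.2.2 j₁ - x.2.1 i) ^ 2 else if j = j₂ then
      (x.2.2 j₂ - x.2.1 i) / (x.2.2 j₁ - x.2.1 i) else x.1 i / (x.2.2 j - x.2.1 i))

variable {i j₁ j₂ A S}

theorem glueσ_cut (hi : i ∉ A) (h₁ : j₁ ∉ S) {x : (κ → ℂ) × (κ → ℂ) × (J → ℂ)}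
    (hx : x.2.2 j₁ ≠ x.2.1 i) : glueσ i j₁ (cut i j₁ j₂ A S x) = x.1 i := by
  have := sub_ne_zero.2 hx
  simp only [glueσ, cut, hi, h₁, if_true, if_false]
  field_simp

theorem glueQ_cut (hi : i ∉ A) (x : (κ → ℂ) × (κ → ℂ) × (J → ℂ)) :
    glueQ i A (cut i j₁ j₂ A S x) = x.2.1 i := by
  have : ∑ k ∈ A, (cut i j₁ j₂ A S x).1 k / (cut i j₁ j₂ A S x).2.1 k =
      ∑ k ∈ A, x.1 k / (x.2.1 k - x.2.1 i) :=
    Finset.sum_congr rfl fun k hk => by simp only [cut, hk, if_true]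
  rw [glueQ, this]
  simp only [cut, hi, if_true, if_false]
  ring

theorem glue_cut (hi : i ∉ A) (h₁ : j₁ ∉ S) (h₂ : j₂ ∉ S) (hne : j₁ ≠ j₂)
    {x : (κ → ℂ) × (κ → ℂ) × (J → ℂ)} (hα : x.1 i ≠ 0)
    (hp : Function.Injective x.2.1) (hz : ∀ j, x.2.2 j ≠ x.2.1 i) :
    glue i j₁ j₂ A S (cut i j₁ j₂ A S x) = x := by
  have hz1 := sub_ne_zero.2 (hz j₁)
  refine Prod.ext ?_ (Prod.ext ?_ ?_)
  · funext k
    by_cases hk : k ∈ A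
    · simp only [glue, cut, hk, if_true]
    · by_cases hki : k = i
      · simp only [glue, glueσ_cut hi h₁ (hz j₁), hi, hki, if_true, if_false]
      · have := sub_ne_zero.2 (hp.ne hki)
        simp only [glue, glueσ_cut hi h₁ (hz j₁), hk, hki, if_false]
        simp only [hk, hki, if_false, cut]
        field_simp
  · funext k
    by_cases hk : k ∈ A
    · simp only [glue, glueQ_cut hi, hk, if_true]
      simp only [hk, if_true, cut]
      ring
    · by_cases hki : k = i
      · simp only [glue, glueQ_cut hi, hi, hki, if_true, if_false, add_zero]
      · have := sub_ne_zero.2 (hp.ne hki)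
        simp only [glue, glueσ_cut hi h₁ (hz j₁), glueQ_cut hi, hk, hki, if_false]
        simp only [hk, hki, if_false, cut]
        field_simp
        ring
  · funext j
    simp only [glue, glueQ_cut hi, glueX, glueσ_cut hi h₁ (hz j₁)]
    by_cases hj : j ∈ S
    · simp only [hj, if_true, cut]
      ring
    · by_cases hj1 : j = j₁
      · simp only [hj1, h₁, if_true, if_false, cut, hi]
        ring
      · by_cases hj2 : j = j₂
        · simp only [hj2, h₂, hne.symm, if_true, if_false, cut, hi]
          field_simp
          ring
        · have := sub_ne_zero.2 (hz j)
          simp only [hj, hj1, hj2, if_false, cut]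
          field_simp
          ring

theorem rf_glue (hi : i ∉ A) {x : (κ → ℂ) × (κ → ℂ) × (J → ℂ)} (hσ : glueσ i j₁ x ≠ 0)
    (hA : ∀ k ∈ A, x.2.1 k ≠ 0) (hB : ∀ k ∈ co₁ i A, x.2.1 k ≠ 0) {ζ ω : ℂ}
    (hζω : ζ * ω = glueσ i j₁ x) (hζ : ∀ k ∈ A, ζ ≠ x.2.1 k) (hω : ∀ k ∈ co₁ i A, ω ≠ x.2.1 k) :
    rf (glue i j₁ j₂ A S x).1 (glue i j₁ j₂ A S x).2.1 (glueQ i A x + ζ) =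
      x.2.1 i + ζ * (1 + fa A x.1 x.2.1 ζ) + ω * (1 + fa (co₁ i A) x.1 x.2.1 ω) := by
  have hζ0 : ζ ≠ 0 := fun h0 => hσ (by rw [← hζω, h0, zero_mul])
  have hω0 : ω ≠ 0 := fun h0 => hσ (by rw [← hζω, h0, mul_zero])
  rw [rf, sum_co₁ hi]
  have h1 : ∑ k ∈ A, (glue i j₁ j₂ A S x).1 k / (glueQ i A x + ζ - (glue i j₁ j₂ A S x).2.1 k) =
      ζ * fa A x.1 x.2.1 ζ - ∑ k ∈ A, x.1 k / x.2.1 k := by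
    rw [fa, Finset.mul_sum, ← Finset.sum_sub_distrib]
    refine Finset.sum_congr rfl fun k hk => ?_
    have h2 := hA k hk
    have h3 := sub_ne_zero.2 (hζ k hk)
    simp only [glue, hk, if_true, add_sub_add_left_eq_sub]
    field_simp
    ring
  have h2 : ∑ k ∈ co₁ i A,
      (glue i j₁ j₂ A S x).1 k / (glueQ i A x + ζ - (glue i j₁ j₂ A S x).2.1 k) =
      ω * fa (co₁ i A) x.1 x.2.1 ω := by
    rw [fa, Finset.mul_sum]
    refine Finset.sum_congr rfl fun k hk => ?_
    have h2 := hB k hk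
    have h3 := sub_ne_zero.2 (hω k hk)
    have h4 := sub_ne_zero.2 (hω k hk).symm
    have h5 : ζ - ζ * ω / x.2.1 k ≠ 0 := by
      have : ζ - ζ * ω / x.2.1 k = ζ * (x.2.1 k - ω) / x.2.1 k := by field_simp
      rw [this]
      exact div_ne_zero (mul_ne_zero hζ0 h4) h2
    simp only [glue, (mem_co₁.1 hk).1, (mem_co₁.1 hk).2, if_false, add_sub_add_left_eq_sub, ← hζω]
    have h6 : ζ - ζ * ω / x.2.1 k = ζ * (x.2.1 k - ω) / x.2.1 k := by field_simp
    rw [h6]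
    field_simp
    ring
  rw [h1, h2]
  simp only [glue, hi, if_true, if_false, glueQ, add_zero, ← hζω, add_sub_cancel_left,
    mul_div_cancel_left₀ _ hζ0]
  ring

theorem rd_glue (hi : i ∉ A) {x : (κ → ℂ) × (κ → ℂ) × (J → ℂ)} (hσ : glueσ i j₁ x ≠ 0)
    (hB : ∀ k ∈ co₁ i A, x.2.1 k ≠ 0) {ζ ω : ℂ}
    (hζω : ζ * ω = glueσ i j₁ x) (hω : ∀ k ∈ co₁ i A, ω ≠ x.2.1 k) :
    ζ * rd (glue i j₁ j₂ A S x).1 (glue i j₁ j₂ A S x).2.1 (glueQ i A x + ζ) =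
      ζ * (1 - fd A x.1 x.2.1 ζ) - ω * (1 - fd (co₁ i A) x.1 x.2.1 ω) := by
  have hζ0 : ζ ≠ 0 := fun h0 => hσ (by rw [← hζω, h0, zero_mul])
  have hω0 : ω ≠ 0 := fun h0 => hσ (by rw [← hζω, h0, mul_zero])
  rw [rd, sum_co₁ hi]
  have h1 : ∑ k ∈ A,
      (glue i j₁ j₂ A S x).1 k / (glueQ i A x + ζ - (glue i j₁ j₂ A S x).2.1 k) ^ 2 =
      fd A x.1 x.2.1 ζ := by
    rw [fd]
    refine Finset.sum_congr rfl fun k hk => ?_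
    simp only [glue, hk, if_true, add_sub_add_left_eq_sub]
  have h2 : ζ * ∑ k ∈ co₁ i A,
      (glue i j₁ j₂ A S x).1 k / (glueQ i A x + ζ - (glue i j₁ j₂ A S x).2.1 k) ^ 2 =
      - (ω * fd (co₁ i A) x.1 x.2.1 ω) := by
    rw [fd, Finset.mul_sum, Finset.mul_sum, ← Finset.sum_neg_distrib]
    refine Finset.sum_congr rfl fun k hk => ?_
    have h2 := hB k hk
    have h3 := sub_ne_zero.2 (hω k hk)
    have h4 := sub_ne_zero.2 (hω k hk).symm
    simp only [glue, (mem_co₁.1 hk).1, (mem_co₁.1 hk).2, if_false, add_sub_add_left_eq_sub, ← hζω]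
    have h6 : ζ - ζ * ω / x.2.1 k = ζ * (x.2.1 k - ω) / x.2.1 k := by field_simp
    have h7 : (x.2.1 k - ω) ^ 2 = (ω - x.2.1 k) ^ 2 := by ring
    rw [h6, div_pow, mul_pow, h7]
    field_simp
  rw [h1, mul_sub, mul_add, h2]
  simp only [glue, hi, if_true, if_false, add_zero, ← hζω, add_sub_cancel_left]
  field_simp
  ring

end Glue

end CriticalValues

namespace CriticalValues

open Filter Topology Metric

variable {κ J : Type} [Fintype κ] [Fintype J]

theorem tendsto_fd {ι : Type*} {F : Filter ι} {A : Finset κ} {u v : ι → κ → ℂ} {x : ι → ℂ}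
    {u' v' : κ → ℂ} {x' : ℂ} (hu : ∀ k ∈ A, Tendsto (fun t => u t k) F (𝓝 (u' k)))
    (hv : ∀ k ∈ A, Tendsto (fun t => v t k) F (𝓝 (v' k))) (hx : Tendsto x F (𝓝 x'))
    (hne : ∀ k ∈ A, x' ≠ v' k) :
    Tendsto (fun t => fd A (u t) (v t) (x t)) F (𝓝 (fd A u' v' x')) :=
  tendsto_finsetSum _ fun k hk => (hu k hk).div ((hx.sub (hv k hk)).pow 2)
    (pow_ne_zero 2 (sub_ne_zero.2 (hne k hk)))

/-- The divided difference of `-fd`. -/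
noncomputable def fdd (A : Finset κ) (u v : κ → ℂ) (x y : ℂ) : ℂ :=
  ∑ k ∈ A, u k * (x + y - 2 * v k) / ((x - v k) ^ 2 * (y - v k) ^ 2)

theorem fd_sub_fd {A : Finset κ} {u v : κ → ℂ} {x y : ℂ} (hx : ∀ k ∈ A, x ≠ v k)
    (hy : ∀ k ∈ A, y ≠ v k) : fd A u v y - fd A u v x = (x - y) * fdd A u v x y := by
  rw [fd, fd, fdd, Finset.mul_sum, ← Finset.sum_sub_distrib]
  refine Finset.sum_congr rfl fun k hk => ?_
  have h1 := sub_ne_zero.2 (hx k hk)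
  have h2 := sub_ne_zero.2 (hy k hk)
  field_simp
  ring

theorem tendsto_fdd {ι : Type*} {F : Filter ι} {A : Finset κ} {u v : ι → κ → ℂ} {x y : ι → ℂ}
    {u' v' : κ → ℂ} {x' y' : ℂ} (hu : ∀ k ∈ A, Tendsto (fun t => u t k) F (𝓝 (u' k)))
    (hv : ∀ k ∈ A, Tendsto (fun t => v t k) F (𝓝 (v' k))) (hx : Tendsto x F (𝓝 x'))
    (hy : Tendsto y F (𝓝 y')) (hne : ∀ k ∈ A, x' ≠ v' k) (hne' : ∀ k ∈ A, y' ≠ v' k) :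
    Tendsto (fun t => fdd A (u t) (v t) (x t) (y t)) F (𝓝 (fdd A u' v' x' y')) :=
  tendsto_finsetSum _ fun k hk =>
    ((hu k hk).mul ((hx.add hy).sub ((hv k hk).const_mul 2))).div
      (((hx.sub (hv k hk)).pow 2).mul ((hy.sub (hv k hk)).pow 2))
      (mul_ne_zero (pow_ne_zero 2 (sub_ne_zero.2 (hne k hk)))
        (pow_ne_zero 2 (sub_ne_zero.2 (hne' k hk))))

theorem IsSol.sub_const {c : J → ℂ} {α p : κ → ℂ} {z : J → ℂ} (h : IsSol c α p z) (q : ℂ) :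
    IsSol (fun j => c j - q) α (fun k => p k - q) (fun j => z j - q) := by
  refine ⟨h.res_ne, fun k l hkl => h.inj (sub_left_injective hkl),
    fun j k he => h.ne_pole j k (sub_left_injective he), fun j => ?_, fun j => ?_⟩
  · simpa only [rd, sub_sub_sub_cancel_right] using h.crit j
  · have := h.val j
    simp only [rf, sub_sub_sub_cancel_right] at this ⊢
    rw [← this]
    ring

theorem IsSide.congr {c : J → ℂ} {w : ℂ} {A : Finset κ} {S : Finset J} {u v u' v' : κ → ℂ}
    {y y' : J → ℂ} (h : IsSide c w A S u v y) (hu : ∀ k ∈ A, u' k = u k) (hv : ∀ k ∈ A, v' k = v k)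
    (hy : ∀ j ∈ S, y' j = y j) : IsSide c w A S u' v' y' := by
  refine ⟨h.card, fun k hk => by rw [hv k hk]; exact h.ne k hk, ?_⟩
  have h1 : ∑ k ∈ A, u' k / v' k = ∑ k ∈ A, u k / v k :=
    Finset.sum_congr rfl fun k hk => by rw [hu k hk, hv k hk]
  rw [h1, show (fun k : A => u' k) = fun k : A => u k from funext fun k => hu k k.2,
    show (fun k : A => v' k) = fun k : A => v k from funext fun k => hv k k.2,
    show (fun j : S => y' j) = fun j : S => y j from funext fun j => hy j j.2]
  exact h.sol

namespace IsLimit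

variable {ι : Type*} {F : Filter ι} [F.NeBot] {c : ι → J → ℂ} {α p : ι → κ → ℂ} {z : ι → J → ℂ}
    {c' : J → ℂ} {α' p' : κ → ℂ} {z' : J → ℂ}

theorem crit_val (h : IsLimit F c α p z c' α' p' z') {j : J} (hz : ∀ k, z' j ≠ p' k) :
    rd α' p' (z' j) = 0 ∧ rf α' p' (z' j) = c' j := by
  have hpr : Tendsto (fun t => (α t, p t, z t j)) F (𝓝 (α', p', z' j)) :=
    h.tα.prodMk_nhds (h.tp.prodMk_nhds (h.tz_apply j))
  constructor
  · have h1 := (analyticAt_rd (α := α') hz).continuousAt.tendsto.comp hpr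
    refine tendsto_nhds_unique h1 (tendsto_const_nhds.congr' ?_)
    filter_upwards [h.sol] with t ht
    exact (ht.crit j).symm
  · have h1 := (analyticAt_rf (α := α') hz).continuousAt.tendsto.comp hpr
    refine tendsto_nhds_unique h1 ((h.tc_apply j).congr' ?_)
    filter_upwards [h.sol] with t ht
    exact (ht.val j).symm

end IsLimit

namespace IsCollision

variable {ι : Type*} {F : Filter ι} [F.NeBot] {c : ι → J → ℂ} {α p : ι → κ → ℂ}
    {z : ι → J → ℂ} {c' : J → ℂ} {w : ℂ} {j₁ j₂ : J} {α' p' : Option κ → κ → ℂ}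
    {z' : Option κ → J → ℂ}

theorem inj_vis (h : IsCollision F c α p z c' w j₁ j₂ α' p' z') (e : Option κ) :
    Function.Injective fun j : visCrit c' w α' p' z' e => c' j := fun j l hjl =>
  Subtype.ext (h.inj j l (mem_visCrit.1 j.2).1 hjl)

theorem crit_eq_node (h : IsCollision F c α p z c' w j₁ j₂ α' p' z') {e : Option κ} {q : ℂ}
    (hq : ∀ k, α' e k = 0 → p' e k = q)
    (hcard : (visCrit c' w α' p' z' e).card = 2 * (visPole α' e).card) {j : J} (hj : c' j = w) :
    z' e j = q := by
  by_contra hne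
  have hA : ∀ k ∉ visPole α' e, α' e k = 0 := fun k hk => not_not.1 fun h0 => hk (mem_visPole.2 h0)
  have hz : ∀ k, z' e j ≠ p' e k := fun k he =>
    hne (he.trans (hq k ((h.lim e).res_eq_zero_of_crit_eq h.card he)))
  obtain ⟨h1, h2⟩ := (h.lim e).crit_val hz
  rw [← rd_restrict hA] at h1
  rw [← rf_restrict hA] at h2
  have h3 := h.isSol_vis e
  obtain ⟨l, hl⟩ := h3.exists_eq_of_crit (h3.z_inj (h.inj_vis e)) (by simpa using hcard)
    (fun k => hz k) h1
  rw [hl, h3.val l, hj] at h2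
  exact (mem_visCrit.1 l.2).1 h2

theorem isSide (h : IsCollision F c α p z c' w j₁ j₂ α' p' z') {e : Option κ} {i : κ}
    (hi : α' e i = 0)
    (hcard : (visCrit c' w α' p' z' e).card = 2 * (visPole α' e).card) :
    IsSide c' w (visPole α' e) (visCrit c' w α' p' z' e) (α' e) (fun k => p' e k - p' e i)
      (fun j => z' e j - p' e i) := by
  have hA : ∀ k ∉ visPole α' e, α' e k = 0 := fun k hk => not_not.1 fun h0 => hk (mem_visPole.2 h0)
  refine ⟨hcard, fun k hk => sub_ne_zero.2 fun he =>
    mem_visPole.1 hk (h.res_eq_zero_of_eq hi he), ?_⟩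
  have h1 : w + ∑ k ∈ visPole α' e, α' e k / (p' e k - p' e i) = p' e i := by
    have h2 := h.rf_node hi
    rw [← rf_restrict hA, rf,
      Finset.sum_coe_sort (visPole α' e) (fun k => α' e k / (p' e i - p' e k))] at h2
    rw [← h2, add_assoc, ← Finset.sum_add_distrib, Finset.sum_eq_zero, add_zero]
    intro k _
    rw [← neg_sub (p' e k), div_neg]
    ring
  rw [h1]
  exact (h.isSol_vis e).sub_const _

theorem exists_node (h : IsCollision F c α p z c' w j₁ j₂ α' p' z') {i : κ} (hi : α' none i = 0) :
    ∃ A S u v y, IsNode c' w i j₁ j₂ A S u v y ∧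
      Tendsto (fun t => cut i j₁ j₂ A S (α t, p t, z t)) F (𝓝 (u, v, y)) := by
  classical
  have hni : ¬ rel α' none (some i) := by
    rintro (h1 | ⟨k, h1, h2⟩)
    · simp at h1
    · have : k = i := by simpa [lbl] using h1
      exact h2 (this ▸ hi)
  have hi' : α' (some i) i = 0 := by
    by_contra h0
    exact hni (h.rel_symm (Or.inr ⟨i, by simp [lbl], h0⟩))
  set A := visPole α' none with hAdef
  set S := visCrit c' w α' p' z' none with hSdef
  have hiA : i ∉ A := fun hA => mem_visPole.1 hA hi
  have hB : visPole α' (some i) = co₁ i A := by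
    ext k
    rw [mem_visPole, mem_co₁, hAdef, mem_visPole, not_not]
    constructor
    · intro hk
      have hki : k ≠ i := fun hki => hk (hki ▸ hi')
      refine ⟨?_, hki⟩
      by_contra hkn
      exact hni (h.rel_trans (Or.inr ⟨k, rfl, hkn⟩)
        (h.rel_symm (Or.inr ⟨k, by simp [lbl, hki], hk⟩)))
    · rintro ⟨hk, hki⟩
      rcases h.rel_or_rel hi (some k) with (h1 | ⟨l, h1, h2⟩) | (h1 | ⟨l, h1, h2⟩)
      · simp at h1
      · have : l = k := by simpa [lbl] using h1
        exact absurd hk (this ▸ h2)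
      · exact absurd (Option.some_injective _ h1) hki
      · by_cases hl : l = i
        · simp [lbl, hl] at h1
        · have : l = k := by simpa [lbl, hl] using h1
          exact this ▸ h2
  have hcov : (Finset.univ.filter fun j => c' j ≠ w) ⊆ S ∪ visCrit c' w α' p' z' (some i) := by
    intro j hj
    have hj' : c' j ≠ w := by simpa using hj
    obtain ⟨e, he⟩ := h.exists_visible hj'
    rcases h.rel_or_rel hi e with h1 | h1
    · exact Finset.mem_union_left _ (mem_visCrit.2 ⟨hj', he _ (h.rel_symm h1)⟩)
    · exact Finset.mem_union_right _ (mem_visCrit.2 ⟨hj', he _ (h.rel_symm h1)⟩)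
  have hκ : A.card + (visPole α' (some i)).card + 1 = Fintype.card κ := by
    have h1 := sum_co₁ hiA (fun _ => 1)
    simp only [Finset.sum_const, Finset.card_univ, nsmul_eq_mul, mul_one] at h1
    rw [hB]
    have h2 : (Fintype.card κ : ℂ) = ((A.card + (co₁ i A).card + 1 : ℕ) : ℂ) := by
      rw [h1]; push_cast; ring
    exact (Nat.cast_injective h2).symm
  have hc1 := Finset.card_le_card hcov
  have hc2 := Finset.card_union_add_card_inter S (visCrit c' w α' p' z' (some i))
  have hc3 := h.card_visCrit_le none
  have hc4 := h.card_visCrit_le (some i)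
  have hc5 := h.card_special
  rw [← hSdef, ← hAdef] at hc3
  have hcS : S.card = 2 * A.card := by omega
  have hcT : (visCrit c' w α' p' z' (some i)).card = 2 * (visPole α' (some i)).card := by omega
  have hdisj : S ∩ visCrit c' w α' p' z' (some i) = ∅ := Finset.card_eq_zero.1 (by omega)
  have hT : visCrit c' w α' p' z' (some i) = co₂ j₁ j₂ S := by
    ext j
    rw [mem_co₂]
    constructor
    · intro hj
      have h2 : j ∉ S := fun h3 => by
        have := Finset.mem_inter.2 ⟨h3, hj⟩
        simp [hdisj] at this
      have h4 := mt (h.val j).2 (mem_visCrit.1 hj).1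
      exact ⟨h2, not_or.1 h4⟩
    · rintro ⟨h1, h2⟩
      have h3 : c' j ≠ w := mt (h.val j).1 (not_or.2 h2)
      exact (Finset.mem_union.1 (hcov (by simpa using h3))).resolve_left h1
  have h₁ : j₁ ∉ S := fun hj => (mem_visCrit.1 hj).1 ((h.val _).2 (Or.inl rfl))
  have h₂ : j₂ ∉ S := fun hj => (mem_visCrit.1 hj).1 ((h.val _).2 (Or.inr rfl))
  have hsA := h.isSide hi hcS
  have hsB := h.isSide hi' hcT
  rw [hB, hT] at hsB
  have tP : ∀ k, Tendsto (fun t => p t k) F (𝓝 (p' none k)) := fun k => (h.lim none).tp_apply k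
  have tα : ∀ k, Tendsto (fun t => α t k) F (𝓝 (α' none k)) := fun k => (h.lim none).tα_apply k
  have tz : ∀ j, Tendsto (fun t => z t j) F (𝓝 (z' none j)) := fun j => (h.lim none).tz_apply j
  have tP' : ∀ k ∈ co₁ i A, Tendsto (fun t => α t i / (p t k - p t i)) F
      (𝓝 (p' (some i) k - p' (some i) i)) := by
    intro k hk
    refine (((h.lim (some i)).tp_apply k).sub ((h.lim (some i)).tp_apply i)).congr' ?_
    filter_upwards [h.sol] with t ht
    have h3 := frX_sub_frP_self (α t) (p t) i (p t k)
    rw [frX_pole] at h3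
    exact h3
  have tα' : ∀ k ∈ co₁ i A, Tendsto (fun t => -(α t i * α t k / (p t k - p t i) ^ 2)) F
      (𝓝 (α' (some i) k)) := by
    intro k hk
    refine ((h.lim (some i)).tα_apply k).congr fun t => ?_
    exact frA_of_ne _ _ (mem_co₁.1 hk).2
  have tz' : ∀ j, Tendsto (fun t => α t i / (z t j - p t i)) F
      (𝓝 (z' (some i) j - p' (some i) i)) := fun j =>
    (((h.lim (some i)).tz_apply j).sub ((h.lim (some i)).tp_apply i)).congr fun t =>
      frX_sub_frP_self (α t) (p t) i (z t j)
  have hqA : ∀ k, α' none k = 0 → p' none k = p' none i := by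
    intro k hk
    by_cases hki : k = i
    · rw [hki]
    have hkB : k ∈ co₁ i A := mem_co₁.2 ⟨fun hkA => mem_visPole.1 hkA hk, hki⟩
    have h3 := (tα i).div (tP' k hkB) (hsB.ne k hkB)
    rw [hi, zero_div] at h3
    refine sub_eq_zero.1 (tendsto_nhds_unique ((tP k).sub (tP i)) (h3.congr' ?_))
    filter_upwards [h.sol] with t ht
    have h4 := ht.res_ne i
    have h5 := sub_ne_zero.2 (ht.inj.ne hki)
    rw [Pi.div_apply, div_div_cancel₀ h4]
  have hqB : ∀ k, α' (some i) k = 0 → p' (some i) k = p' (some i) i := by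
    intro k hk
    by_cases hki : k = i
    · rw [hki]
    have hkA : k ∈ A := by
      by_contra hkA
      have : k ∈ visPole α' (some i) := hB ▸ mem_co₁.2 ⟨hkA, hki⟩
      exact mem_visPole.1 this hk
    have h3 := (tα i).div ((tP k).sub (tP i)) (hsA.ne k hkA)
    rw [hi, zero_div] at h3
    refine sub_eq_zero.1 (tendsto_nhds_unique
      (((h.lim (some i)).tp_apply k).sub ((h.lim (some i)).tp_apply i)) (h3.congr fun t => ?_))
    have h4 := frX_sub_frP_self (α t) (p t) i (p t k)
    rw [frX_pole] at h4
    exact h4.symm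
  have hzA : ∀ j, c' j = w → Tendsto (fun t => z t j - p t i) F (𝓝 0) := fun j hj => by
    have h3 := (tz j).sub (tP i)
    rwa [h.crit_eq_node hqA hcS hj, sub_self] at h3
  have hzB : ∀ j, c' j = w → Tendsto (fun t => α t i / (z t j - p t i)) F (𝓝 0) := fun j hj => by
    have h3 := tz' j
    rwa [h.crit_eq_node hqB hcT hj, sub_self] at h3
  have hw₁ := (h.val j₁).2 (Or.inl rfl)
  have hw₂ := (h.val j₂).2 (Or.inr rfl)
  set u : κ → ℂ := fun k => if k ∈ A then α' none k else if k = i then 0 else α' (some i) k with hu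
  set v : κ → ℂ := fun k => if k ∈ A then p' none k - p' none i else if k = i then w else
    p' (some i) k - p' (some i) i with hv
  have huB : ∀ k ∈ co₁ i A, u k = α' (some i) k := fun k hk => by
    simp only [hu, (mem_co₁.1 hk).1, (mem_co₁.1 hk).2, if_false]
  have hvB : ∀ k ∈ co₁ i A, v k = p' (some i) k - p' (some i) i := fun k hk => by
    simp only [hv, (mem_co₁.1 hk).1, (mem_co₁.1 hk).2, if_false]
  have huA : ∀ k ∈ A, u k = α' none k := fun k hk => by simp only [hu, hk, if_true]
  have hvA : ∀ k ∈ A, v k = p' none k - p' none i := fun k hk => by simp only [hv, hk, if_true]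
  set y : J → ℂ := fun j => if j ∈ S then z' none j - p' none i else if j = j₁ then
    (1 - fd A u v 0) / (1 - fd (co₁ i A) u v 0) else if j = j₂ then -1 else
    z' (some i) j - p' (some i) i with hy
  have hL : IsSide c' w A S u v y := hsA.congr huA hvA fun j hj => by
    simp only [hy, show j ∈ S from hj, if_true]
  have hR : IsSide c' w (co₁ i A) (co₂ j₁ j₂ S) u v y := hsB.congr huB hvB fun j hj => by
    simp only [hy, (mem_co₂.1 hj).1, (mem_co₂.1 hj).2.1, (mem_co₂.1 hj).2.2, if_false]
  have hnode : IsNode c' w i j₁ j₂ A S u v y := by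
    refine ⟨hiA, h₁, h₂, hL, hR, ?_, ?_, ?_, ?_⟩
    · simp only [hu, hiA, if_true, if_false]
    · simp only [hv, hiA, if_true, if_false]
    · simp only [hy, h₁, if_true, if_false]
    · simp only [hy, h₂, h.ne.symm, if_true, if_false]
  refine ⟨A, S, u, v, y, hnode, ?_⟩
  set x := fun t => cut i j₁ j₂ A S (α t, p t, z t) with hx
  have tu : ∀ k, Tendsto (fun t => (x t).1 k) F (𝓝 (u k)) := by
    intro k
    by_cases hk : k ∈ A
    · simp only [hx, cut, hu, hk, if_true]
      exact tα k
    · by_cases hki : k = i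
      · simp only [hx, cut, hu, hki, hiA, if_true, if_false]
        exact hzA j₁ hw₁
      · rw [huB k (mem_co₁.2 ⟨hk, hki⟩)]
        simp only [hx, cut, hk, hki, if_false]
        exact tα' k (mem_co₁.2 ⟨hk, hki⟩)
  have tv : ∀ k, Tendsto (fun t => (x t).2.1 k) F (𝓝 (v k)) := by
    intro k
    by_cases hk : k ∈ A
    · simp only [hx, cut, hv, hk, if_true]
      exact (tP k).sub (tP i)
    · by_cases hki : k = i
      · have h3 : w = p' none i - ∑ k ∈ A, α' none k / (p' none k - p' none i) := by
          have hA0 : ∀ k ∉ A, α' none k = 0 := fun k hk => not_not.1 fun h0 => hk (mem_visPole.2 h0)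
          rw [← h.rf_node hi, ← rf_restrict hA0, rf, sub_eq_add_neg, ← Finset.sum_neg_distrib,
            Finset.sum_coe_sort A (fun k => α' none k / (p' none i - p' none k))]
          congr 1
          refine Finset.sum_congr rfl fun k _ => ?_
          rw [← neg_sub (p' none k), div_neg]
        rw [hki, hnode.v_node]
        simp only [hx, cut, hiA, if_true, if_false]
        rw [h3]
        exact (tP i).sub (tendsto_finsetSum _ fun k hk =>
          (tα k).div ((tP k).sub (tP i)) (hsA.ne k hk))
      · rw [hvB k (mem_co₁.2 ⟨hk, hki⟩)]
        simp only [hx, cut, hk, hki, if_false]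
        exact tP' k (mem_co₁.2 ⟨hk, hki⟩)
  have hcS' : ∀ j ∈ S, c' j ≠ w := fun j hj => (mem_visCrit.1 hj).1
  have hcT' : ∀ j ∈ co₂ j₁ j₂ S, c' j ≠ w := fun j hj => (mem_visCrit.1 (hT ▸ hj)).1
  have hEA := hL.fd_zero_ne hcS' fun j hj l => h.inj j l (hcS' j hj)
  have hEB := hR.fd_zero_ne hcT' fun j hj l => h.inj j l (hcT' j hj)
  have tEA : ∀ j, c' j = w → Tendsto (fun t => 1 - fd A (x t).1 (x t).2.1 (z t j - p t i)) F
      (𝓝 (1 - fd A u v 0)) := fun j hj => (tendsto_fd (fun k _ => tu k) (fun k _ => tv k)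
        (hzA j hj) fun k hk => (hL.ne k hk).symm).const_sub 1
  have tEB : ∀ j, c' j = w → Tendsto
      (fun t => 1 - fd (co₁ i A) (x t).1 (x t).2.1 (α t i / (z t j - p t i))) F
      (𝓝 (1 - fd (co₁ i A) u v 0)) := fun j hj => (tendsto_fd (fun k _ => tu k) (fun k _ => tv k)
        (hzB j hj) fun k hk => (hR.ne k hk).symm).const_sub 1
  have heq : ∀ j, ∀ᶠ t in F, (z t j - p t i) ^ 2 *
      (1 - fd A (x t).1 (x t).2.1 (z t j - p t i)) =
      α t i * (1 - fd (co₁ i A) (x t).1 (x t).2.1 (α t i / (z t j - p t i))) := by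
    intro j
    filter_upwards [h.sol] with t ht
    have h3 := sub_ne_zero.2 (ht.ne_pole j i)
    have hσ := glueσ_cut (j₂ := j₂) hiA h₁ (x := (α t, p t, z t)) (ht.ne_pole j₁ i)
    have hg := glue_cut hiA h₁ h₂ h.ne (x := (α t, p t, z t)) (ht.res_ne i) ht.inj
      fun j => ht.ne_pole j i
    have hB0 : ∀ k ∈ co₁ i A, (x t).2.1 k = α t i / (p t k - p t i) := fun k hk => by
      simp only [hx, cut, (mem_co₁.1 hk).1, (mem_co₁.1 hk).2, if_false]
    have h4 := rd_glue (i := i) (j₁ := j₁) (j₂ := j₂) (S := S) hiA (x := x t)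
      (ζ := z t j - p t i) (ω := α t i / (z t j - p t i))
      (by rw [hx]; dsimp only; rw [hσ]; exact ht.res_ne i)
      (fun k hk => by
        rw [hB0 k hk]
        exact div_ne_zero (ht.res_ne i) (sub_ne_zero.2 (ht.inj.ne (mem_co₁.1 hk).2)))
      (by rw [hx]; dsimp only; rw [hσ, mul_div_cancel₀ _ h3])
      (fun k hk he => by
        rw [hB0 k hk, div_eq_div_iff h3 (sub_ne_zero.2 (ht.inj.ne (mem_co₁.1 hk).2)),
          mul_right_inj' (ht.res_ne i), sub_left_inj] at he
        exact ht.ne_pole j k he.symm)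
    rw [show glueQ i A (x t) = p t i from glueQ_cut hiA _, add_sub_cancel,
      show glue i j₁ j₂ A S (x t) = _ from hg] at h4
    have h5 := ht.crit j
    rw [h5, mul_zero] at h4
    have h6 := congrArg (fun r => (z t j - p t i) * r) h4
    rw [mul_zero, mul_sub, ← mul_assoc, ← mul_assoc, mul_div_cancel₀ _ h3, ← sq] at h6
    exact (sub_eq_zero.1 h6.symm)
  have hτ : ∀ j, c' j = w → Tendsto (fun t => α t i / (z t j - p t i) ^ 2) F
      (𝓝 ((1 - fd A u v 0) / (1 - fd (co₁ i A) u v 0))) := by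
    intro j hj
    refine ((tEA j hj).div (tEB j hj) hEB).congr' ?_
    filter_upwards [h.sol, heq j, (tEB j hj).eventually_ne hEB] with t ht h4 h5
    have h3 := sub_ne_zero.2 (ht.ne_pole j i)
    rw [Pi.div_apply, div_eq_div_iff h5 (pow_ne_zero 2 h3), ← h4, mul_comm]
  have t1 := hzA j₁ hw₁
  have t2 := hzA j₂ hw₂
  have s1 := hzB j₁ hw₁
  have s2 := hzB j₂ hw₂
  have hτ0 : (1 - fd A u v 0) / (1 - fd (co₁ i A) u v 0) ≠ 0 := div_ne_zero hEA hEB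
  have tgA := tendsto_fdd (fun k _ => tu k) (fun k _ => tv k) t1 t2
    (fun k hk => (hL.ne k hk).symm) (fun k hk => (hL.ne k hk).symm)
  have tgB := tendsto_fdd (fun k _ => tu k) (fun k _ => tv k) s1 s2
    (fun k hk => (hR.ne k hk).symm) (fun k hk => (hR.ne k hk).symm)
  have hζ : Tendsto (fun t => (z t j₂ - p t i) / (z t j₁ - p t i)) F (𝓝 (-1)) := by
    have h3 := ((((t1.mul ((hτ j₁ hw₁).div (hτ j₂ hw₂) hτ0)).mul tgA).add
      (((hτ j₁ hw₁).mul s2).mul tgB)).neg.div (tEA j₁ hw₁) hEA).sub_const 1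
    simp only [zero_mul, mul_zero, add_zero, neg_zero, zero_div, zero_sub] at h3
    refine h3.congr' ?_
    have hi : ∀ᶠ t in F, Function.Injective (c t) := (h.lim none).inj
    have hne : ∀ {B : Finset κ} {ξ : ι → ℂ}, (∀ k ∈ B, v k ≠ 0) → Tendsto ξ F (𝓝 0) →
        ∀ᶠ t in F, ∀ k ∈ B, ξ t ≠ (x t).2.1 k := fun {B ξ} hB hξ =>
      (Finset.eventually_all B).2 fun k hk => by
        filter_upwards [((tv k).sub hξ).eventually_ne (by rw [sub_zero]; exact hB k hk)]
          with t ht he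
        exact ht (sub_eq_zero.2 he.symm)
    filter_upwards [h.sol, heq j₁, heq j₂, (tEA j₁ hw₁).eventually_ne hEA, hi, hne hL.ne t1,
      hne hL.ne t2, hne hR.ne s1, hne hR.ne s2] with t ht e1 e2 h4 hct a1 a2 b1 b2
    have dA := fd_sub_fd (u := (x t).1) a1 a2
    have dB := fd_sub_fd (u := (x t).1) b1 b2
    have hz12 := sub_ne_zero.2 ((ht.z_inj hct).ne h.ne)
    have hx1 := sub_ne_zero.2 (ht.ne_pole j₁ i)
    have hx2 := sub_ne_zero.2 (ht.ne_pole j₂ i)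
    have hα := ht.res_ne i
    simp only [Pi.div_apply]
    rw [← sub_sub_sub_cancel_right _ _ (p t i)] at hz12
    generalize fd A (x t).1 (x t).2.1 (z t j₁ - p t i) = EA₁ at *
    generalize fd A (x t).1 (x t).2.1 (z t j₂ - p t i) = EA₂ at *
    generalize fd (co₁ i A) (x t).1 (x t).2.1 (α t i / (z t j₁ - p t i)) = EB₁ at *
    generalize fd (co₁ i A) (x t).1 (x t).2.1 (α t i / (z t j₂ - p t i)) = EB₂ at *
    generalize fdd A (x t).1 (x t).2.1 (z t j₁ - p t i) (z t j₂ - p t i) = gA at *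
    generalize fdd (co₁ i A) (x t).1 (x t).2.1 (α t i / (z t j₁ - p t i))
      (α t i / (z t j₂ - p t i)) = gB at *
    generalize z t j₁ - p t i = x₁ at *
    generalize z t j₂ - p t i = x₂ at *
    generalize α t i = a at *
    have h5 : (x₁ - x₂) * ((x₁ + x₂) * (1 - EA₁) + x₂ ^ 2 * gA) =
        (x₁ - x₂) * (-(a ^ 2 / (x₁ * x₂) * gB)) := by
      have h6 : a / x₁ - a / x₂ = - (a * (x₁ - x₂) / (x₁ * x₂)) := by
        field_simp
        ring
      rw [h6] at dB
      linear_combination e1 - e2 - x₂ ^ 2 * dA + a * dB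
    have h6 := mul_left_cancel₀ hz12 h5
    have h7 : (x₁ + x₂) * (1 - EA₁) = -(a ^ 2 / (x₁ * x₂) * gB) - x₂ ^ 2 * gA := by
      rw [← h6]; ring
    rw [sub_eq_iff_eq_add, div_eq_iff h4]
    have h8 : (x₂ / x₁ + 1) * (1 - EA₁) = (x₁ + x₂) * (1 - EA₁) / x₁ := by
      field_simp
      ring
    rw [h8, h7]
    field_simp
    ring
  refine (tendsto_pi_nhds.2 tu).prodMk_nhds ((tendsto_pi_nhds.2 tv).prodMk_nhds
    (tendsto_pi_nhds.2 fun j => ?_))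
  by_cases hj : j ∈ S
  · simp only [y, hj, if_true]
    exact (tz j).sub (tP i)
  · by_cases hj1 : j = j₁
    · subst hj1
      simp only [y, hj, if_true, if_false]
      exact hτ j hw₁
    · by_cases hj2 : j = j₂
      · subst hj2
        simp only [y, hj, hj1, if_true, if_false]
        exact hζ
      · simp only [y, hj, hj1, hj2, if_false]
        exact tz' j

end IsCollision

end CriticalValues

namespace CriticalValues

open Filter Topology Metric

variable {κ J : Type} [Fintype κ] [Fintype J]

/-- The first order variation of `x * (1 + fa A u v x)` with the residues and the poles. -/
noncomputable def fv (A : Finset κ) (u v a b : κ → ℂ) (x : ℂ) : ℂ :=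
  ∑ k ∈ A, (a k * (x / (v k * (x - v k))) + u k * b k * (1 / (x - v k) ^ 2 - 1 / v k ^ 2))

theorem fv_zero {A : Finset κ} (u v a b : κ → ℂ) : fv A u v a b 0 = 0 :=
  Finset.sum_eq_zero fun k _ => by simp

theorem hasDerivAt_line (a b : ℂ) : HasDerivAt (fun t : ℂ => a + t * b) b 0 := by
  simpa using ((hasDerivAt_id (0 : ℂ)).mul_const b).const_add a

theorem hasDerivAt_mul_fa {A : Finset κ} {u v : κ → ℂ} (a b : κ → ℂ) {f : ℂ → ℂ} {x d : ℂ}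
    (hf : HasDerivAt f d 0) (h0 : f 0 = x) (hv : ∀ k ∈ A, v k ≠ 0) (hx : ∀ k ∈ A, x ≠ v k) :
    HasDerivAt (fun t => f t * (1 + fa A (u + t • a) (v + t • b) (f t)))
      (d * (1 - fd A u v x) + fv A u v a b x) 0 := by
  have h1 : ∀ t : ℂ, f t * (1 + fa A (u + t • a) (v + t • b) (f t)) =
      f t + ∑ k ∈ A, f t * (u k + t * a k) / ((v k + t * b k) * (f t - (v k + t * b k))) :=
      fun t => by
    rw [fa, mul_add, mul_one, Finset.mul_sum]
    refine congrArg _ (Finset.sum_congr rfl fun k _ => ?_)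
    rw [← mul_div_assoc]
    rfl
  simp only [h1]
  have h2 : ∀ k ∈ A, HasDerivAt (fun t : ℂ => f t * (u k + t * a k) /
      ((v k + t * b k) * (f t - (v k + t * b k))))
      (-d * (u k / (x - v k) ^ 2) + (a k * (x / (v k * (x - v k))) +
        u k * b k * (1 / (x - v k) ^ 2 - 1 / v k ^ 2))) 0 := fun k hk => by
    have h3 := hv k hk
    have h4 := sub_ne_zero.2 (hx k hk)
    have h5 := (hf.mul (hasDerivAt_line (u k) (a k))).div
      ((hasDerivAt_line (v k) (b k)).mul (hf.sub (hasDerivAt_line (v k) (b k))))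
      (by simp [h0, h3, h4])
    refine HasDerivAt.congr_deriv h5 ?_
    simp only [Pi.mul_apply, Pi.sub_apply, h0, zero_mul, add_zero]
    field_simp
    ring
  refine HasDerivAt.congr_deriv (hf.add (HasDerivAt.fun_sum h2)) ?_
  rw [Finset.sum_add_distrib, ← Finset.mul_sum, fv, fd]
  ring

namespace IsSide

variable {c : J → ℂ} {w : ℂ} {A : Finset κ} {S : Finset J} {u v : κ → ℂ} {y : J → ℂ}

theorem eq_zero_of_fv (h : IsSide c w A S u v y) (hw : ∀ j ∈ S, c j ≠ w)
    (hc : ∀ j ∈ S, ∀ l, c j = c l → j = l) {a b : κ → ℂ} (hab : ∀ j ∈ S, fv A u v a b (y j) = 0) :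
    ∀ k ∈ A, a k = 0 ∧ b k = 0 := by
  set e : ℂ := ∑ k ∈ A, (a k / v k - u k * b k / v k ^ 2) with he
  obtain ⟨h1, h2⟩ := h.sol.eq_smul_deriv (h.sol.z_inj (injective hc)) (by simpa using h.card)
    (e := e) (u := fun k : A => a k) (v := fun k : A => u k * b k) (fun j => by
      rw [Finset.sum_coe_sort A (fun k => a k / (y j - v k)),
        Finset.sum_coe_sort A (fun k => u k * b k / (y j - v k) ^ 2), ← hab j j.2, fv, he,
        ← Finset.sum_add_distrib, ← Finset.sum_add_distrib]
      refine Finset.sum_congr rfl fun k hk => ?_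
      have h3 := h.ne k hk
      have h4 := sub_ne_zero.2 (h.ne_pole j.2 hk)
      field_simp
      ring)
  have h5 : ∀ k ∈ A, b k = -e := fun k hk => by
    have := h2 ⟨k, hk⟩
    exact mul_left_cancel₀ (h.res_ne hk) (by rw [this]; ring)
  have h6 : e * (1 - fd A u v 0) = 0 := by
    have : e = e * fd A u v 0 := by
      conv_lhs => rw [he]
      rw [fd, Finset.mul_sum]
      refine Finset.sum_congr rfl fun k hk => ?_
      rw [h5 k hk, show a k = 0 from h1 ⟨k, hk⟩, zero_sub (v k), neg_sq]
      ring
    rw [mul_sub, mul_one, ← this, sub_self]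
  have h7 : e = 0 := (mul_eq_zero.1 h6).resolve_right (h.fd_zero_ne hw hc)
  exact fun k hk => ⟨h1 ⟨k, hk⟩, by rw [h5 k hk, h7, neg_zero]⟩

theorem eq_zero_of_hasDerivAt (h : IsSide c w A S u v y)
    (hc : ∀ j ∈ S, ∀ l, c j = c l → j = l) {j : J} (hj : j ∈ S) {d : ℂ}
    (hd : HasDerivAt (fun t : ℂ => 1 - fd A u v (y j + t * d)) 0 0) : d = 0 := by
  simp only [← rd_subtype] at hd
  have h9 := (HasDerivAt.comp_of_eq (0 : ℂ) (hasDerivAt_rd (α := fun k : A => u k)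
    (h.sol.ne_pole ⟨j, hj⟩)) (hasDerivAt_line (y j) d) (by simp)).unique hd
  exact (mul_eq_zero.1 h9).resolve_left (IsSol.hasDerivAt_rd_ne_zero h.sol
    (h.sol.z_inj (injective hc)) (by simpa using h.card) ⟨j, hj⟩)

end IsSide

theorem eq_or_eq_or_mem_or_mem (j₁ j₂ : J) (S : Finset J) (j : J) :
    j = j₁ ∨ j = j₂ ∨ j ∈ S ∨ j ∈ co₂ j₁ j₂ S := by
  rw [mem_co₂]
  tauto

namespace IsNode

variable {c : J → ℂ} {w : ℂ} {i : κ} {j₁ j₂ : J} {A : Finset κ} {S : Finset J}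
    {u v : κ → ℂ} {y : J → ℂ}

theorem val_ne_left (h : IsNode c w i j₁ j₂ A S u v y) (hval : ∀ j, c j = w ↔ j = j₁ ∨ j = j₂) :
    ∀ j ∈ S, c j ≠ w := fun j hj he => by
  rcases (hval j).1 he with rfl | rfl
  · exact h.notMem₁ hj
  · exact h.notMem₂ hj

theorem val_ne_right (hval : ∀ j, c j = w ↔ j = j₁ ∨ j = j₂) :
    ∀ j ∈ co₂ j₁ j₂ S, c j ≠ w := fun j hj he => by
  rcases (hval j).1 he with rfl | rfl
  · exact (mem_co₂.1 hj).2.1 rfl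
  · exact (mem_co₂.1 hj).2.2 rfl

theorem fd_left_ne (h : IsNode c w i j₁ j₂ A S u v y) (hval : ∀ j, c j = w ↔ j = j₁ ∨ j = j₂)
    (hinj : ∀ j l, c j ≠ w → c j = c l → j = l) : 1 - fd A u v 0 ≠ 0 :=
  h.left.fd_zero_ne (h.val_ne_left hval) fun j hj l => hinj j l (h.val_ne_left hval j hj)

theorem fd_right_ne (h : IsNode c w i j₁ j₂ A S u v y) (hval : ∀ j, c j = w ↔ j = j₁ ∨ j = j₂)
    (hinj : ∀ j l, c j ≠ w → c j = c l → j = l) : 1 - fd (co₁ i A) u v 0 ≠ 0 :=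
  h.right.fd_zero_ne (val_ne_right hval) fun j hj l => hinj j l (val_ne_right hval j hj)

theorem node₁_ne (h : IsNode c w i j₁ j₂ A S u v y) (hval : ∀ j, c j = w ↔ j = j₁ ∨ j = j₂)
    (hinj : ∀ j l, c j ≠ w → c j = c l → j = l) : y j₁ ≠ 0 := by
  rw [h.y_node₁]
  exact div_ne_zero (h.fd_left_ne hval hinj) (h.fd_right_ne hval hinj)

theorem y_ne (h : IsNode c w i j₁ j₂ A S u v y) (hval : ∀ j, c j = w ↔ j = j₁ ∨ j = j₂)
    (hinj : ∀ j l, c j ≠ w → c j = c l → j = l) (j : J) : y j ≠ 0 := by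
  rcases eq_or_eq_or_mem_or_mem j₁ j₂ S j with rfl | rfl | hj | hj
  · exact h.node₁_ne hval hinj
  · rw [h.y_node₂]
    exact neg_ne_zero.2 one_ne_zero
  · exact h.left.ne_zero hj (h.val_ne_left hval j hj)
  · exact h.right.ne_zero hj (val_ne_right hval j hj)

theorem v_ne (h : IsNode c w i j₁ j₂ A S u v y) {k : κ} (hk : k ≠ i) : v k ≠ 0 := by
  by_cases hA : k ∈ A
  · exact h.left.ne k hA
  · exact h.right.ne k (mem_co₁.2 ⟨hA, hk⟩)

theorem u_ne (h : IsNode c w i j₁ j₂ A S u v y) {k : κ} (hk : k ≠ i) : u k ≠ 0 := by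
  by_cases hA : k ∈ A
  · exact h.left.res_ne hA
  · exact h.right.res_ne (mem_co₁.2 ⟨hA, hk⟩)

theorem tangency (h : IsNode c w i j₁ j₂ A S u v y) (hval : ∀ j, c j = w ↔ j = j₁ ∨ j = j₂)
    (hinj : ∀ j l, c j ≠ w → c j = c l → j = l) :
    y j₁ * (1 - fd (co₁ i A) u v 0) = 1 - fd A u v 0 := by
  rw [h.y_node₁, div_mul_cancel₀ _ (h.fd_right_ne hval hinj)]

end IsNode

section NodeMap

variable (i : κ) (j₁ j₂ : J) (A : Finset κ) (S : Finset J)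

open Classical in
/-- The position of a critical point seen from the right. -/
noncomputable def glueW (x : (κ → ℂ) × (κ → ℂ) × (J → ℂ)) (j : J) : ℂ :=
  if j ∈ S then glueσ i j₁ x / x.2.2 j else if j = j₁ then x.1 i * x.2.2 j₁ else
    if j = j₂ then x.1 i * x.2.2 j₁ / x.2.2 j₂ else x.2.2 j

open Classical in
/-- The weight of the left derivative. -/
noncomputable def glueφ (x : (κ → ℂ) × (κ → ℂ) × (J → ℂ)) (j : J) : ℂ :=
  if j ∈ S then 1 else if j = j₁ then 1 else if j = j₂ then 1 else glueσ i j₁ x / x.2.2 j ^ 2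

open Classical in
/-- The weight of the right derivative. -/
noncomputable def glueψ (x : (κ → ℂ) × (κ → ℂ) × (J → ℂ)) (j : J) : ℂ :=
  if j ∈ S then glueσ i j₁ x / x.2.2 j ^ 2 else if j = j₁ then x.2.2 j₁ else
    if j = j₂ then x.2.2 j₁ / x.2.2 j₂ ^ 2 else 1

/-- The renormalised derivatives of a glued function at the marked points. -/
noncomputable def nodeD (x : (κ → ℂ) × (κ → ℂ) × (J → ℂ)) (j : J) : ℂ :=
  glueφ i j₁ j₂ S x j * (1 - fd A x.1 x.2.1 (glueX i j₁ j₂ S x j)) -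
    glueψ i j₁ j₂ S x j * (1 - fd (co₁ i A) x.1 x.2.1 (glueW i j₁ j₂ S x j))

/-- The values of a glued function at the marked points. -/
noncomputable def nodeV (x : (κ → ℂ) × (κ → ℂ) × (J → ℂ)) (j : J) : ℂ :=
  x.2.1 i + glueX i j₁ j₂ S x j * (1 + fa A x.1 x.2.1 (glueX i j₁ j₂ S x j)) +
    glueW i j₁ j₂ S x j * (1 + fa (co₁ i A) x.1 x.2.1 (glueW i j₁ j₂ S x j))

/-- The values and renormalised derivatives of a glued function at the marked points. -/
noncomputable def nodeMap (x : (κ → ℂ) × (κ → ℂ) × (J → ℂ)) : (J → ℂ) × (J → ℂ) :=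
  (nodeD i j₁ j₂ A S x, nodeV i j₁ j₂ A S x)

variable {i j₁ j₂ A S}

theorem glueX_mul_glueW {x : (κ → ℂ) × (κ → ℂ) × (J → ℂ)} (hy : ∀ j, x.2.2 j ≠ 0) (j : J) :
    glueX i j₁ j₂ S x j * glueW i j₁ j₂ S x j = glueσ i j₁ x := by
  have h1 := hy j
  have h2 := hy j₂
  unfold glueX glueW
  split_ifs with h3 h4 h5
  · field_simp
  · rw [glueσ]; ring
  · rw [glueσ]; field_simp
  · field_simp

theorem glueφ_mul_glueW {x : (κ → ℂ) × (κ → ℂ) × (J → ℂ)} (hy : ∀ j, x.2.2 j ≠ 0) (j : J) :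
    glueφ i j₁ j₂ S x j * glueW i j₁ j₂ S x j = glueψ i j₁ j₂ S x j * glueX i j₁ j₂ S x j := by
  have h1 := hy j
  have h2 := hy j₂
  unfold glueX glueW glueφ glueψ
  split_ifs with h3 h4 h5
  · field_simp
  · ring
  · field_simp
  · field_simp

theorem rf_glue_crit (hi : i ∉ A) {x : (κ → ℂ) × (κ → ℂ) × (J → ℂ)} (hσ : glueσ i j₁ x ≠ 0)
    (hy : ∀ j, x.2.2 j ≠ 0) (hv : ∀ k, k ≠ i → x.2.1 k ≠ 0) {j : J}
    (hζ : ∀ k ∈ A, glueX i j₁ j₂ S x j ≠ x.2.1 k)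
    (hω : ∀ k ∈ co₁ i A, glueW i j₁ j₂ S x j ≠ x.2.1 k) :
    rf (glue i j₁ j₂ A S x).1 (glue i j₁ j₂ A S x).2.1 ((glue i j₁ j₂ A S x).2.2 j) =
      nodeV i j₁ j₂ A S x j :=
  rf_glue hi hσ (fun k hk => hv k (fun h => hi (h ▸ hk))) (fun k hk => hv k (mem_co₁.1 hk).2)
    (glueX_mul_glueW hy j) hζ hω

theorem rd_glue_crit (hi : i ∉ A) {x : (κ → ℂ) × (κ → ℂ) × (J → ℂ)} (hσ : glueσ i j₁ x ≠ 0)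
    (hy : ∀ j, x.2.2 j ≠ 0) (hv : ∀ k, k ≠ i → x.2.1 k ≠ 0) {j : J}
    (hω : ∀ k ∈ co₁ i A, glueW i j₁ j₂ S x j ≠ x.2.1 k) :
    glueφ i j₁ j₂ S x j *
        rd (glue i j₁ j₂ A S x).1 (glue i j₁ j₂ A S x).2.1 ((glue i j₁ j₂ A S x).2.2 j) =
      nodeD i j₁ j₂ A S x j := by
  have h1 := rd_glue (j₂ := j₂) (S := S) hi hσ (fun k hk => hv k (mem_co₁.1 hk).2)
    (glueX_mul_glueW hy j) hω
  have h2 : glueX i j₁ j₂ S x j ≠ 0 := left_ne_zero_of_mul (by rwa [glueX_mul_glueW hy])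
  refine mul_left_cancel₀ h2 ?_
  have h3 := glueφ_mul_glueW (i := i) (j₁ := j₁) (j₂ := j₂) (S := S) hy j
  calc _ = glueφ i j₁ j₂ S x j * (glueX i j₁ j₂ S x j * rd (glue i j₁ j₂ A S x).1
        (glue i j₁ j₂ A S x).2.1 (glueQ i A x + glueX i j₁ j₂ S x j)) := by
        simp only [glue]
        ring
    _ = _ := by
        rw [h1, nodeD]
        linear_combination (-(1 - fd (co₁ i A) x.1 x.2.1 (glueW i j₁ j₂ S x j))) * h3

theorem glueφ_ne {x : (κ → ℂ) × (κ → ℂ) × (J → ℂ)} (hσ : glueσ i j₁ x ≠ 0)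
    (hy : ∀ j, x.2.2 j ≠ 0) (j : J) : glueφ i j₁ j₂ S x j ≠ 0 := by
  unfold glueφ
  split_ifs
  iterate 3 exact one_ne_zero
  exact div_ne_zero hσ (pow_ne_zero 2 (hy j))

section Analytic

variable {x₀ : (κ → ℂ) × (κ → ℂ) × (J → ℂ)}

theorem analyticAt_coord₁ (k : κ) :
    AnalyticAt ℂ (fun x : (κ → ℂ) × (κ → ℂ) × (J → ℂ) => x.1 k) x₀ :=
  ((ContinuousLinearMap.proj (R := ℂ) k).comp
    (ContinuousLinearMap.fst ℂ (κ → ℂ) ((κ → ℂ) × (J → ℂ)))).analyticAt _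

theorem analyticAt_coord₂ (k : κ) :
    AnalyticAt ℂ (fun x : (κ → ℂ) × (κ → ℂ) × (J → ℂ) => x.2.1 k) x₀ :=
  ((ContinuousLinearMap.proj (R := ℂ) k).comp ((ContinuousLinearMap.fst ℂ (κ → ℂ) (J → ℂ)).comp
    (ContinuousLinearMap.snd ℂ (κ → ℂ) ((κ → ℂ) × (J → ℂ))))).analyticAt _

theorem analyticAt_coord₃ (j : J) :
    AnalyticAt ℂ (fun x : (κ → ℂ) × (κ → ℂ) × (J → ℂ) => x.2.2 j) x₀ :=
  ((ContinuousLinearMap.proj (R := ℂ) j).comp ((ContinuousLinearMap.snd ℂ (κ → ℂ) (J → ℂ)).comp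
    (ContinuousLinearMap.snd ℂ (κ → ℂ) ((κ → ℂ) × (J → ℂ))))).analyticAt _

theorem analyticAt_glueσ : AnalyticAt ℂ (glueσ (κ := κ) (J := J) i j₁) x₀ :=
  ((analyticAt_coord₁ i).pow 2).mul (analyticAt_coord₃ j₁)

theorem analyticAt_glueX (hy : ∀ j, x₀.2.2 j ≠ 0) (j : J) :
    AnalyticAt ℂ (fun x => glueX (κ := κ) i j₁ j₂ S x j) x₀ := by
  unfold glueX
  split_ifs
  · exact analyticAt_coord₃ j
  · exact analyticAt_coord₁ i
  · exact (analyticAt_coord₁ i).mul (analyticAt_coord₃ j₂)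
  · exact analyticAt_glueσ.div (analyticAt_coord₃ j) (hy j)

theorem analyticAt_glueW (hy : ∀ j, x₀.2.2 j ≠ 0) (j : J) :
    AnalyticAt ℂ (fun x => glueW (κ := κ) i j₁ j₂ S x j) x₀ := by
  unfold glueW
  split_ifs
  · exact analyticAt_glueσ.div (analyticAt_coord₃ j) (hy j)
  · exact (analyticAt_coord₁ i).mul (analyticAt_coord₃ j₁)
  · exact ((analyticAt_coord₁ i).mul (analyticAt_coord₃ j₁)).div (analyticAt_coord₃ j₂) (hy j₂)
  · exact analyticAt_coord₃ j

theorem analyticAt_glueφ (hy : ∀ j, x₀.2.2 j ≠ 0) (j : J) :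
    AnalyticAt ℂ (fun x => glueφ (κ := κ) i j₁ j₂ S x j) x₀ := by
  unfold glueφ
  split_ifs
  iterate 3 exact analyticAt_const
  exact analyticAt_glueσ.div ((analyticAt_coord₃ j).pow 2) (pow_ne_zero 2 (hy j))

theorem analyticAt_glueψ (hy : ∀ j, x₀.2.2 j ≠ 0) (j : J) :
    AnalyticAt ℂ (fun x => glueψ (κ := κ) i j₁ j₂ S x j) x₀ := by
  unfold glueψ
  split_ifs
  · exact analyticAt_glueσ.div ((analyticAt_coord₃ j).pow 2) (pow_ne_zero 2 (hy j))
  · exact analyticAt_coord₃ j₁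
  · exact (analyticAt_coord₃ j₁).div ((analyticAt_coord₃ j₂).pow 2) (pow_ne_zero 2 (hy j₂))
  · exact analyticAt_const

theorem analyticAt_fd {A : Finset κ} {f : (κ → ℂ) × (κ → ℂ) × (J → ℂ) → ℂ} (hf : AnalyticAt ℂ f x₀)
    (hx : ∀ k ∈ A, f x₀ ≠ x₀.2.1 k) : AnalyticAt ℂ (fun x => fd A x.1 x.2.1 (f x)) x₀ :=
  Finset.analyticAt_fun_sum _ fun k hk => (analyticAt_coord₁ k).div
    ((hf.sub (analyticAt_coord₂ k)).pow 2) (pow_ne_zero 2 (sub_ne_zero.2 (hx k hk)))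

theorem analyticAt_fa {A : Finset κ} {f : (κ → ℂ) × (κ → ℂ) × (J → ℂ) → ℂ} (hf : AnalyticAt ℂ f x₀)
    (hv : ∀ k ∈ A, x₀.2.1 k ≠ 0) (hx : ∀ k ∈ A, f x₀ ≠ x₀.2.1 k) :
    AnalyticAt ℂ (fun x => fa A x.1 x.2.1 (f x)) x₀ :=
  Finset.analyticAt_fun_sum _ fun k hk => (analyticAt_coord₁ k).div
    ((analyticAt_coord₂ k).mul (hf.sub (analyticAt_coord₂ k)))
    (mul_ne_zero (hv k hk) (sub_ne_zero.2 (hx k hk)))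

theorem analyticAt_nodeMap (hi : i ∉ A) (hy : ∀ j, x₀.2.2 j ≠ 0) (hv : ∀ k, k ≠ i → x₀.2.1 k ≠ 0)
    (hζ : ∀ j, ∀ k ∈ A, glueX i j₁ j₂ S x₀ j ≠ x₀.2.1 k)
    (hω : ∀ j, ∀ k ∈ co₁ i A, glueW i j₁ j₂ S x₀ j ≠ x₀.2.1 k) :
    AnalyticAt ℂ (nodeMap i j₁ j₂ A S) x₀ := by
  have hA : ∀ k ∈ A, x₀.2.1 k ≠ 0 := fun k hk => hv k fun h => hi (h ▸ hk)
  have hB : ∀ k ∈ co₁ i A, x₀.2.1 k ≠ 0 := fun k hk => hv k (mem_co₁.1 hk).2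
  refine AnalyticAt.prod (analyticAt_pi_iff.2 fun j => ?_) (analyticAt_pi_iff.2 fun j => ?_)
  · exact ((analyticAt_glueφ hy j).mul
      (analyticAt_const.sub (analyticAt_fd (analyticAt_glueX hy j) (hζ j)))).sub
      ((analyticAt_glueψ hy j).mul
      (analyticAt_const.sub (analyticAt_fd (analyticAt_glueW hy j) (hω j))))
  · exact ((analyticAt_coord₂ i).add ((analyticAt_glueX hy j).mul
      (analyticAt_const.add (analyticAt_fa (analyticAt_glueX hy j) hA (hζ j))))).add
      ((analyticAt_glueW hy j).mul
      (analyticAt_const.add (analyticAt_fa (analyticAt_glueW hy j) hB (hω j))))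

end Analytic

end NodeMap

end CriticalValues

namespace CriticalValues

open Filter Topology Metric

variable {κ J : Type} [Fintype κ] [Fintype J]

section NodeMap

variable {i : κ} {j₁ j₂ : J} {A : Finset κ} {S : Finset J} (x : (κ → ℂ) × (κ → ℂ) × (J → ℂ)) {j : J}

theorem nodeV_mem (hj : j ∈ S) : nodeV i j₁ j₂ A S x j =
    x.2.1 i + x.2.2 j * (1 + fa A x.1 x.2.1 (x.2.2 j)) + glueσ i j₁ x / x.2.2 j *
      (1 + fa (co₁ i A) x.1 x.2.1 (glueσ i j₁ x / x.2.2 j)) := by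
  simp only [nodeV, glueX, glueW, hj, if_true]

theorem nodeV_node₁ (h₁ : j₁ ∉ S) : nodeV i j₁ j₂ A S x j₁ =
    x.2.1 i + x.1 i * (1 + fa A x.1 x.2.1 (x.1 i)) + x.1 i * x.2.2 j₁ *
      (1 + fa (co₁ i A) x.1 x.2.1 (x.1 i * x.2.2 j₁)) := by
  simp only [nodeV, glueX, glueW, h₁, if_true, if_false]

theorem nodeV_node₂ (h₂ : j₂ ∉ S) (hne : j₁ ≠ j₂) : nodeV i j₁ j₂ A S x j₂ =
    x.2.1 i + x.1 i * x.2.2 j₂ * (1 + fa A x.1 x.2.1 (x.1 i * x.2.2 j₂)) +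
      x.1 i * x.2.2 j₁ / x.2.2 j₂ *
      (1 + fa (co₁ i A) x.1 x.2.1 (x.1 i * x.2.2 j₁ / x.2.2 j₂)) := by
  simp only [nodeV, glueX, glueW, h₂, hne.symm, if_true, if_false]

theorem nodeV_co (hj : j ∈ co₂ j₁ j₂ S) : nodeV i j₁ j₂ A S x j =
    x.2.1 i + glueσ i j₁ x / x.2.2 j * (1 + fa A x.1 x.2.1 (glueσ i j₁ x / x.2.2 j)) + x.2.2 j *
      (1 + fa (co₁ i A) x.1 x.2.1 (x.2.2 j)) := by
  obtain ⟨h0, h1, h2⟩ := mem_co₂.1 hj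
  simp only [nodeV, glueX, glueW, h0, h1, h2, if_false]

theorem nodeD_mem (hj : j ∈ S) : nodeD i j₁ j₂ A S x j =
    1 - fd A x.1 x.2.1 (x.2.2 j) - glueσ i j₁ x / x.2.2 j ^ 2 *
      (1 - fd (co₁ i A) x.1 x.2.1 (glueσ i j₁ x / x.2.2 j)) := by
  simp only [nodeD, glueX, glueW, glueφ, glueψ, hj, if_true, one_mul]

theorem nodeD_node₁ (h₁ : j₁ ∉ S) : nodeD i j₁ j₂ A S x j₁ =
    1 - fd A x.1 x.2.1 (x.1 i) - x.2.2 j₁ *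
      (1 - fd (co₁ i A) x.1 x.2.1 (x.1 i * x.2.2 j₁)) := by
  simp only [nodeD, glueX, glueW, glueφ, glueψ, h₁, if_true, if_false, one_mul]

theorem nodeD_node₂ (h₂ : j₂ ∉ S) (hne : j₁ ≠ j₂) : nodeD i j₁ j₂ A S x j₂ =
    1 - fd A x.1 x.2.1 (x.1 i * x.2.2 j₂) - x.2.2 j₁ / x.2.2 j₂ ^ 2 *
      (1 - fd (co₁ i A) x.1 x.2.1 (x.1 i * x.2.2 j₁ / x.2.2 j₂)) := by
  simp only [nodeD, glueX, glueW, glueφ, glueψ, h₂, hne.symm, if_true, if_false, one_mul]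

theorem nodeD_co (hj : j ∈ co₂ j₁ j₂ S) : nodeD i j₁ j₂ A S x j =
    glueσ i j₁ x / x.2.2 j ^ 2 * (1 - fd A x.1 x.2.1 (glueσ i j₁ x / x.2.2 j)) -
      (1 - fd (co₁ i A) x.1 x.2.1 (x.2.2 j)) := by
  obtain ⟨h0, h1, h2⟩ := mem_co₂.1 hj
  simp only [nodeD, glueX, glueW, glueφ, glueψ, h0, h1, h2, if_false, one_mul]

end NodeMap

namespace IsNode

variable {c : J → ℂ} {w : ℂ} {i : κ} {j₁ j₂ : J} {A : Finset κ} {S : Finset J}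
    {u v : κ → ℂ} {y : J → ℂ}

theorem glueσ_eq (h : IsNode c w i j₁ j₂ A S u v y) : glueσ i j₁ (u, v, y) = 0 := by
  simp [glueσ, h.u_node]

theorem glueX_ne (h : IsNode c w i j₁ j₂ A S u v y) (j : J) {k : κ} (hk : k ∈ A) :
    glueX i j₁ j₂ S (u, v, y) j ≠ v k := by
  have h0 := h.glueσ_eq
  unfold glueX
  split_ifs with h1 h2 h3
  · exact h.left.ne_pole h1 hk
  all_goals simpa [h.u_node, h0] using (h.left.ne k hk).symm

theorem glueW_ne (h : IsNode c w i j₁ j₂ A S u v y) (j : J) {k : κ} (hk : k ∈ co₁ i A) :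
    glueW i j₁ j₂ S (u, v, y) j ≠ v k := by
  have h0 := h.glueσ_eq
  unfold glueW
  split_ifs with h1 h2 h3
  iterate 3 simpa [h.u_node, h0] using (h.right.ne k hk).symm
  exact h.right.ne_pole (mem_co₂.2 ⟨h1, h2, h3⟩) hk

theorem nodeMap_eq (h : IsNode c w i j₁ j₂ A S u v y) (hne : j₁ ≠ j₂)
    (hval : ∀ j, c j = w ↔ j = j₁ ∨ j = j₂)
    (hinj : ∀ j l, c j ≠ w → c j = c l → j = l) : nodeMap i j₁ j₂ A S (u, v, y) = (0, c) := by
  have h0 := h.glueσ_eq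
  refine Prod.ext (funext fun j => ?_) (funext fun j => ?_)
  · change nodeD i j₁ j₂ A S (u, v, y) j = 0
    rcases eq_or_eq_or_mem_or_mem j₁ j₂ S j with rfl | rfl | hj | hj
    · rw [nodeD_node₁ _ h.notMem₁]
      simp [h.u_node, h.tangency hval hinj]
    · rw [nodeD_node₂ _ h.notMem₂ hne]
      simp [h.u_node, h.tangency hval hinj, h.y_node₂]
    · rw [nodeD_mem _ hj, h0]
      simp [h.left.crit hj]
    · rw [nodeD_co _ hj, h0]
      simp [h.right.crit hj]
  · change nodeV i j₁ j₂ A S (u, v, y) j = c j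
    rcases eq_or_eq_or_mem_or_mem j₁ j₂ S j with rfl | rfl | hj | hj
    · rw [nodeV_node₁ _ h.notMem₁, (hval j).2 (Or.inl rfl)]
      simp [h.u_node, h.v_node]
    · rw [nodeV_node₂ _ h.notMem₂ hne, (hval j).2 (Or.inr rfl)]
      simp [h.u_node, h.v_node]
    · rw [nodeV_mem _ hj, h0]
      simp [h.left.val hj, h.v_node]
    · rw [nodeV_co _ hj, h0]
      simp [h.right.val hj, h.v_node]

theorem hasDerivAt_glueσ (h : IsNode c w i j₁ j₂ A S u v y) (a : κ → ℂ) (b : κ → ℂ) (d : J → ℂ) :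
    HasDerivAt (fun t : ℂ => glueσ i j₁ ((u, v, y) + t • (a, b, d))) 0 0 := by
  have h1 := ((hasDerivAt_line (u i) (a i)).pow 2).mul (hasDerivAt_line (y j₁) (d j₁))
  refine HasDerivAt.congr_deriv (f := fun t : ℂ => glueσ i j₁ ((u, v, y) + t • (a, b, d))) h1 ?_
  simp [h.u_node]

theorem deriv_val (h : IsNode c w i j₁ j₂ A S u v y) (hne : j₁ ≠ j₂)
    (hval : ∀ j, c j = w ↔ j = j₁ ∨ j = j₂)
    (hinj : ∀ j l, c j ≠ w → c j = c l → j = l) {a b : κ → ℂ} {d : J → ℂ}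
    (hV : ∀ j, HasDerivAt (fun t : ℂ => nodeV i j₁ j₂ A S ((u, v, y) + t • (a, b, d)) j) 0 0) :
    a = 0 ∧ b = 0 := by
  have h0 := h.glueσ_eq
  have hσ := h.hasDerivAt_glueσ a b d
  have hy : ∀ j, HasDerivAt (fun t : ℂ => y j + t * d j) (d j) 0 := fun j => hasDerivAt_line _ _
  have hu : HasDerivAt (fun t : ℂ => u i + t * a i) (a i) 0 := hasDerivAt_line _ _
  have hyn := h.y_ne hval hinj
  have hAz : ∀ k ∈ A, (0 : ℂ) ≠ v k := fun k hk => (h.left.ne k hk).symm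
  have hBz : ∀ k ∈ co₁ i A, (0 : ℂ) ≠ v k := fun k hk => (h.right.ne k hk).symm
  have ht := h.tangency hval hinj
  have hσ' : ∀ j, HasDerivAt (fun t : ℂ => glueσ i j₁ ((u, v, y) + t • (a, b, d)) / (y j + t * d j))
      0 0 := fun j => by
    refine HasDerivAt.congr_deriv (hσ.div (hy j) (by simpa using hyn j)) ?_
    simp [h0]
  have h1 : b i + 2 * a i * (1 - fd A u v 0) = 0 := by
    have h2 := ((hasDerivAt_line (v i) (b i)).add
      (hasDerivAt_mul_fa (u := u) a b hu (x := 0) (by simp [h.u_node]) h.left.ne hAz)).add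
      (hasDerivAt_mul_fa (u := u) a b (hu.mul (hy j₁)) (x := 0) (by simp [h.u_node]) h.right.ne hBz)
    have h3 := hV j₁
    simp only [nodeV_node₁ _ h.notMem₁] at h3
    have h4 := h2.unique h3
    simp only [fv_zero, h.u_node] at h4
    linear_combination h4 - a i * ht
  have h2 : b i - 2 * a i * (1 - fd A u v 0) = 0 := by
    have h2 := ((hasDerivAt_line (v i) (b i)).add
      (hasDerivAt_mul_fa (u := u) a b (hu.mul (hy j₂)) (x := 0) (by simp [h.u_node])
        h.left.ne hAz)).add
      (hasDerivAt_mul_fa (u := u) a b ((hu.mul (hy j₁)).div (hy j₂) (by simpa using hyn j₂))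
        (x := 0)
        (by simp [h.u_node]) h.right.ne hBz)
    have h3 := hV j₂
    simp only [nodeV_node₂ _ h.notMem₂ hne] at h3
    have h4 := h2.unique h3
    simp only [fv_zero, h.u_node, h.y_node₂, Pi.mul_apply, zero_mul, add_zero, zero_add] at h4
    linear_combination h4 + a i * ht
  have hbi : b i = 0 := by linear_combination (h1 + h2) / 2
  have hai : a i = 0 := by
    rw [hbi, zero_add] at h1
    simpa using (mul_eq_zero.1 h1).resolve_right (h.fd_left_ne hval hinj)
  have hA : ∀ k ∈ A, a k = 0 ∧ b k = 0 := by
    refine h.left.eq_zero_of_fv (h.val_ne_left hval)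
      (fun j hj l => hinj j l (h.val_ne_left hval j hj)) fun j hj => ?_
    have h2 := ((hasDerivAt_line (v i) (b i)).add
      (hasDerivAt_mul_fa (u := u) a b (hy j) (x := y j) (by simp) h.left.ne
        fun k hk => h.left.ne_pole hj hk)).add
      (hasDerivAt_mul_fa (u := u) a b (hσ' j) (x := 0) (by simp [h0]) h.right.ne hBz)
    have h3 := hV j
    simp only [nodeV_mem _ hj] at h3
    have h4 := h2.unique h3
    rw [h.left.crit hj, fv_zero, hbi] at h4
    linear_combination h4
  have hB : ∀ k ∈ co₁ i A, a k = 0 ∧ b k = 0 := by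
    refine h.right.eq_zero_of_fv (val_ne_right hval)
      (fun j hj l => hinj j l (val_ne_right hval j hj)) fun j hj => ?_
    have h2 := ((hasDerivAt_line (v i) (b i)).add
      (hasDerivAt_mul_fa (u := u) a b (hσ' j) (x := 0) (by simp [h0]) h.left.ne hAz)).add
      (hasDerivAt_mul_fa (u := u) a b (hy j) (x := y j) (by simp) h.right.ne
        fun k hk => h.right.ne_pole hj hk)
    have h3 := hV j
    simp only [nodeV_co _ hj] at h3
    have h4 := h2.unique h3
    rw [h.right.crit hj, fv_zero, hbi] at h4
    linear_combination h4
  have hall : ∀ k, a k = 0 ∧ b k = 0 := fun k => by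
    by_cases hk : k = i
    · exact hk ▸ ⟨hai, hbi⟩
    · by_cases hkA : k ∈ A
      · exact hA k hkA
      · exact hB k (mem_co₁.2 ⟨hkA, hk⟩)
  exact ⟨funext fun k => (hall k).1, funext fun k => (hall k).2⟩

theorem deriv_crit (h : IsNode c w i j₁ j₂ A S u v y) (hne : j₁ ≠ j₂)
    (hval : ∀ j, c j = w ↔ j = j₁ ∨ j = j₂)
    (hinj : ∀ j l, c j ≠ w → c j = c l → j = l) {d : J → ℂ}
    (hD : ∀ j, HasDerivAt (fun t : ℂ => nodeD i j₁ j₂ A S ((u, v, y) + t • (0, 0, d)) j) 0 0) :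
    d = 0 := by
  have hσ : ∀ t : ℂ, glueσ i j₁ ((u, v, y) + t • ((0 : κ → ℂ), (0 : κ → ℂ), d)) = 0 := fun t => by
    simp [glueσ, h.u_node]
  have hBn := h.fd_right_ne hval hinj
  have h1 : d j₁ = 0 := by
    have h3 := hD j₁
    simp only [nodeD_node₁ _ h.notMem₁] at h3
    simp only [Prod.fst_add, Prod.snd_add, Prod.smul_fst, Prod.smul_snd, smul_zero, Pi.zero_apply,
      add_zero, Pi.add_apply, Pi.smul_apply, smul_eq_mul, h.u_node, zero_mul] at h3
    have h4 := (((hasDerivAt_line (y j₁) (d j₁)).mul_const (1 - fd (co₁ i A) u v 0)).const_sub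
      (1 - fd A u v 0)).unique h3
    exact (mul_eq_zero.1 (neg_eq_zero.1 h4)).resolve_right hBn
  have h2 : d j₂ = 0 := by
    have h3 := hD j₂
    simp only [nodeD_node₂ _ h.notMem₂ hne] at h3
    simp only [Prod.fst_add, Prod.snd_add, Prod.smul_fst, Prod.smul_snd, smul_zero, Pi.zero_apply,
      add_zero, Pi.add_apply, Pi.smul_apply, smul_eq_mul, h.u_node, zero_mul, zero_div, h1, mul_zero,
      h.y_node₂] at h3
    have h4 := ((((hasDerivAt_const (0 : ℂ) (y j₁)).div ((hasDerivAt_line (-1) (d j₂)).pow 2)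
      (by simp)).mul_const (1 - fd (co₁ i A) u v 0)).const_sub
      (1 - fd A u v 0)).unique h3
    simp at h4
    rcases h4 with (h4 | h4) | h4
    · exact absurd h4 (h.node₁_ne hval hinj)
    · exact h4
    · exact absurd h4 hBn
  refine funext fun j => ?_
  rcases eq_or_eq_or_mem_or_mem j₁ j₂ S j with rfl | rfl | hj | hj
  · exact h1
  · exact h2
  · refine h.left.eq_zero_of_hasDerivAt (fun j hj l => hinj j l (h.val_ne_left hval j hj)) hj ?_
    have h3 := hD j
    simp only [nodeD_mem _ hj, hσ] at h3
    simpa using h3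
  · refine h.right.eq_zero_of_hasDerivAt (fun j hj l => hinj j l (val_ne_right hval j hj)) hj ?_
    have h3 := (hD j).fun_neg
    simp only [nodeD_co _ hj, hσ] at h3
    simpa using h3

end IsNode

end CriticalValues

namespace CriticalValues

open Filter Topology Metric

variable {κ J : Type} [Fintype κ] [Fintype J]

theorem cut_glue {i : κ} {j₁ j₂ : J} {A : Finset κ} {S : Finset J} (hi : i ∉ A) (h₁ : j₁ ∉ S)
    (h₂ : j₂ ∉ S) (hne : j₁ ≠ j₂) {x : (κ → ℂ) × (κ → ℂ) × (J → ℂ)} (hσ : glueσ i j₁ x ≠ 0)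
    (hv : ∀ k, k ≠ i → x.2.1 k ≠ 0) : cut i j₁ j₂ A S (glue i j₁ j₂ A S x) = x := by
  have hs : x.1 i ≠ 0 := fun h => hσ (by simp [glueσ, h])
  have hp : (glue i j₁ j₂ A S x).2.1 i = glueQ i A x := by simp [glue, hi]
  have hα : (glue i j₁ j₂ A S x).1 i = glueσ i j₁ x := by simp [glue, hi]
  have hz : ∀ j, (glue i j₁ j₂ A S x).2.2 j = glueQ i A x + glueX i j₁ j₂ S x j := fun j => rfl
  have hX₁ : glueX i j₁ j₂ S x j₁ = x.1 i := by simp [glueX, h₁]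
  have hX₂ : glueX i j₁ j₂ S x j₂ = x.1 i * x.2.2 j₂ := by simp [glueX, h₂, hne.symm]
  refine Prod.ext (funext fun k => ?_) (Prod.ext (funext fun k => ?_) (funext fun j => ?_))
  · simp only [cut, hp, hα, hz, hX₁, add_sub_cancel_left]
    by_cases hk : k ∈ A
    · simp only [glue, hk, if_true]
    · by_cases hki : k = i
      · simp only [hki, hi, if_true, if_false]
      · have h3 := hv k hki
        simp only [glue, hk, hki, if_false, add_sub_cancel_left]
        field_simp
  · simp only [cut, hp, hα]
    by_cases hk : k ∈ A
    · simp only [glue, hk, if_true, add_sub_cancel_left]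
    · by_cases hki : k = i
      · have h4 : ∑ k ∈ A, (glue i j₁ j₂ A S x).1 k / ((glue i j₁ j₂ A S x).2.1 k - glueQ i A x) =
            ∑ k ∈ A, x.1 k / x.2.1 k := Finset.sum_congr rfl fun l hl => by
          simp only [glue, hl, if_true, add_sub_cancel_left]
        rw [h4]
        simp only [hki, hi, if_true, if_false, glueQ, add_sub_cancel_right]
      · have h3 := hv k hki
        simp only [glue, hk, hki, if_false, add_sub_cancel_left]
        field_simp
  · simp only [cut, hp, hα, hz, hX₁, hX₂, add_sub_cancel_left]
    by_cases hj : j ∈ S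
    · simp only [glueX, hj, if_true]
    · by_cases hj1 : j = j₁
      · simp only [hj1, h₁, if_true, if_false, glueσ]
        field_simp
      · by_cases hj2 : j = j₂
        · simp only [hj2, h₂, hne.symm, if_true, if_false]
          field_simp
        · simp only [glueX, hj, hj1, hj2, if_false]
          rw [div_div_cancel₀ hσ]

/-- The points at which gluing gives a nondegenerate function. -/
structure Gluable (i : κ) (j₁ j₂ : J) (A : Finset κ) (S : Finset J)
    (x : (κ → ℂ) × (κ → ℂ) × (J → ℂ)) : Prop where
  y_ne : ∀ j, x.2.2 j ≠ 0
  v_ne : ∀ k, k ≠ i → x.2.1 k ≠ 0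
  u_ne : ∀ k, k ≠ i → x.1 k ≠ 0
  X_ne : ∀ j, ∀ k ∈ A, glueX i j₁ j₂ S x j ≠ x.2.1 k
  W_ne : ∀ j, ∀ k ∈ co₁ i A, glueW i j₁ j₂ S x j ≠ x.2.1 k
  inj_left : ∀ k ∈ A, ∀ l ∈ A, k ≠ l → x.2.1 k ≠ x.2.1 l
  inj_right : ∀ k ∈ co₁ i A, ∀ l ∈ co₁ i A, k ≠ l → x.2.1 k ≠ x.2.1 l
  inj_mid : ∀ k ∈ A, ∀ l ∈ co₁ i A, x.2.1 k * x.2.1 l ≠ glueσ i j₁ x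

namespace Gluable

variable {i : κ} {j₁ j₂ : J} {A : Finset κ} {S : Finset J} {x : (κ → ℂ) × (κ → ℂ) × (J → ℂ)}

theorem nodeMap_eq (h : Gluable i j₁ j₂ A S x) (hi : i ∉ A) {b : J → ℂ}
    (hx : glue i j₁ j₂ A S x ∈ Sol κ b) : nodeMap i j₁ j₂ A S x = (0, b) := by
  have hσ : glueσ i j₁ x ≠ 0 := by
    have := hx.res_ne i
    simpa [glue, hi] using this
  refine Prod.ext (funext fun j => ?_) (funext fun j => ?_)
  · exact (rd_glue_crit hi hσ h.y_ne h.v_ne (h.W_ne j)).symm.trans (by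
      rw [hx.crit j, mul_zero]; rfl)
  · exact (rf_glue_crit hi hσ h.y_ne h.v_ne (h.X_ne j) (h.W_ne j)).symm.trans (hx.val j)

theorem glue_mem (h : Gluable i j₁ j₂ A S x) (hi : i ∉ A) (hσ : glueσ i j₁ x ≠ 0) {b : J → ℂ}
    (hx : nodeMap i j₁ j₂ A S x = (0, b)) : glue i j₁ j₂ A S x ∈ Sol κ b := by
  have hX : ∀ j, glueX i j₁ j₂ S x j ≠ 0 := fun j => left_ne_zero_of_mul
    (b := glueW i j₁ j₂ S x j) (by rwa [glueX_mul_glueW h.y_ne])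
  refine ⟨fun k => ?_, fun k l hkl => ?_, fun j k hjk => ?_, fun j => ?_, fun j => ?_⟩
  · simp only [glue]
    split_ifs with h1 h2
    · exact h.u_ne k fun h => hi (h ▸ h1)
    · exact hσ
    · exact neg_ne_zero.2 (div_ne_zero (mul_ne_zero (h.u_ne k h2) hσ)
        (pow_ne_zero 2 (h.v_ne k h2)))
  · by_contra hne
    simp only [glue, add_right_inj] at hkl
    split_ifs at hkl with h1 h2 h3 h4 h5 h6 h7 h8
    · exact h.inj_left k h1 l h2 hne hkl
    · exact h.v_ne k (fun h => hi (h ▸ h1)) hkl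
    · refine h.inj_mid k h1 l (mem_co₁.2 ⟨h2, h3⟩) ?_
      rw [hkl, div_mul_cancel₀ _ (h.v_ne l h3)]
    · exact h.v_ne l (fun h => hi (h ▸ h5)) hkl.symm
    · exact hne (h4.trans h6.symm)
    · exact div_ne_zero hσ (h.v_ne l h6) hkl.symm
    · refine h.inj_mid l h7 k (mem_co₁.2 ⟨h1, h4⟩) ?_
      rw [← hkl, div_mul_cancel₀ _ (h.v_ne k h4)]
    · exact div_ne_zero hσ (h.v_ne k h4) hkl
    · refine h.inj_right k (mem_co₁.2 ⟨h1, h4⟩) l (mem_co₁.2 ⟨h7, h8⟩) hne ?_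
      rw [div_eq_mul_inv, div_eq_mul_inv] at hkl
      exact inv_injective (mul_left_cancel₀ hσ hkl)
  · simp only [glue, add_right_inj] at hjk
    split_ifs at hjk with h1 h2
    · exact h.X_ne j k h1 hjk
    · exact hX j hjk
    · refine h.W_ne j k (mem_co₁.2 ⟨h1, h2⟩) (mul_left_cancel₀ (hX j) ?_)
      rw [glueX_mul_glueW h.y_ne, hjk, div_mul_cancel₀ _ (h.v_ne k h2)]
  · have h1 := (rd_glue_crit (S := S) hi hσ h.y_ne h.v_ne (h.W_ne j)).trans
      (congrFun (congrArg Prod.fst hx) j)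
    exact (mul_eq_zero.1 h1).resolve_left (glueφ_ne hσ h.y_ne j)
  · exact (rf_glue_crit hi hσ h.y_ne h.v_ne (h.X_ne j) (h.W_ne j)).trans
      (congrFun (congrArg Prod.snd hx) j)

end Gluable

namespace IsNode

variable {c : J → ℂ} {w : ℂ} {i : κ} {j₁ j₂ : J} {A : Finset κ} {S : Finset J}
    {u v : κ → ℂ} {y : J → ℂ}

theorem eventually_gluable (h : IsNode c w i j₁ j₂ A S u v y)
    (hval : ∀ j, c j = w ↔ j = j₁ ∨ j = j₂) (hinj : ∀ j l, c j ≠ w → c j = c l → j = l) :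
    ∀ᶠ x in 𝓝 (u, v, y), Gluable i j₁ j₂ A S x := by
  have hy := h.y_ne hval hinj
  have hne : ∀ {f g : (κ → ℂ) × (κ → ℂ) × (J → ℂ) → ℂ}, AnalyticAt ℂ f (u, v, y) →
      AnalyticAt ℂ g (u, v, y) → f (u, v, y) ≠ g (u, v, y) → ∀ᶠ x in 𝓝 (u, v, y), f x ≠ g x := by
    intro f g hf hg hfg
    filter_upwards [(hf.continuousAt.sub hg.continuousAt).eventually
      (isOpen_ne.mem_nhds (sub_ne_zero.2 hfg))] with x hx
    exact sub_ne_zero.1 hx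
  have h1 : ∀ᶠ x : (κ → ℂ) × (κ → ℂ) × (J → ℂ) in 𝓝 (u, v, y), ∀ j, x.2.2 j ≠ 0 :=
    eventually_all.2 fun j => hne (analyticAt_coord₃ j) analyticAt_const (hy j)
  have h2 : ∀ᶠ x : (κ → ℂ) × (κ → ℂ) × (J → ℂ) in 𝓝 (u, v, y), ∀ k, k ≠ i → x.2.1 k ≠ 0 := by
    refine eventually_all.2 fun k => ?_
    by_cases hk : k = i
    · simp [hk]
    · filter_upwards [hne (analyticAt_coord₂ k) analyticAt_const (h.v_ne hk)] with x hx _ using hx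
  have h3 : ∀ᶠ x : (κ → ℂ) × (κ → ℂ) × (J → ℂ) in 𝓝 (u, v, y), ∀ k, k ≠ i → x.1 k ≠ 0 := by
    refine eventually_all.2 fun k => ?_
    by_cases hk : k = i
    · simp [hk]
    · filter_upwards [hne (analyticAt_coord₁ k) analyticAt_const (h.u_ne hk)] with x hx _ using hx
  have h4 : ∀ᶠ x in 𝓝 (u, v, y), ∀ j, ∀ k ∈ A, glueX i j₁ j₂ S x j ≠ x.2.1 k :=
    eventually_all.2 fun j => (Finset.eventually_all A).2 fun k hk =>
      hne (analyticAt_glueX hy j) (analyticAt_coord₂ k) (h.glueX_ne j hk)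
  have h5 : ∀ᶠ x in 𝓝 (u, v, y), ∀ j, ∀ k ∈ co₁ i A, glueW i j₁ j₂ S x j ≠ x.2.1 k :=
    eventually_all.2 fun j => (Finset.eventually_all _).2 fun k hk =>
      hne (analyticAt_glueW hy j) (analyticAt_coord₂ k) (h.glueW_ne j hk)
  have h6 : ∀ᶠ x : (κ → ℂ) × (κ → ℂ) × (J → ℂ) in 𝓝 (u, v, y), ∀ k ∈ A, ∀ l ∈ A,
      k ≠ l → x.2.1 k ≠ x.2.1 l := by
    refine (Finset.eventually_all A).2 fun k hk => (Finset.eventually_all A).2 fun l hl => ?_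
    by_cases hkl : k = l
    · simp [hkl]
    · filter_upwards [hne (analyticAt_coord₂ k) (analyticAt_coord₂ l) (fun he => hkl
        (congrArg Subtype.val (@h.left.sol.inj ⟨k, hk⟩ ⟨l, hl⟩ he)))] with x hx _ using hx
  have h7 : ∀ᶠ x : (κ → ℂ) × (κ → ℂ) × (J → ℂ) in 𝓝 (u, v, y), ∀ k ∈ co₁ i A, ∀ l ∈ co₁ i A,
      k ≠ l → x.2.1 k ≠ x.2.1 l := by
    refine (Finset.eventually_all _).2 fun k hk => (Finset.eventually_all _).2 fun l hl => ?_
    by_cases hkl : k = l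
    · simp [hkl]
    · filter_upwards [hne (analyticAt_coord₂ k) (analyticAt_coord₂ l) (fun he => hkl
        (congrArg Subtype.val (@h.right.sol.inj ⟨k, hk⟩ ⟨l, hl⟩ he)))] with x hx _ using hx
  have h8 : ∀ᶠ x in 𝓝 (u, v, y), ∀ k ∈ A, ∀ l ∈ co₁ i A, x.2.1 k * x.2.1 l ≠ glueσ i j₁ x :=
    (Finset.eventually_all A).2 fun k hk => (Finset.eventually_all _).2 fun l hl =>
      hne ((analyticAt_coord₂ k).mul (analyticAt_coord₂ l)) analyticAt_glueσ
        (by rw [h.glueσ_eq]; exact mul_ne_zero (h.left.ne k hk) (h.right.ne l hl))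
  filter_upwards [h1, h2, h3, h4, h5, h6, h7, h8] with x h1 h2 h3 h4 h5 h6 h7 h8
  exact ⟨h1, h2, h3, h4, h5, h6, h7, h8⟩

/-- The ratio of the residue at the node to the square of the difference of the two values. -/
theorem exists_glueσ_eq (h : IsNode c w i j₁ j₂ A S u v y) (hne : j₁ ≠ j₂)
    (hval : ∀ j, c j = w ↔ j = j₁ ∨ j = j₂) (hinj : ∀ j l, c j ≠ w → c j = c l → j = l) :
    ∃ g : (κ → ℂ) × (κ → ℂ) × (J → ℂ) → ℂ, ContinuousAt g (u, v, y) ∧ g (u, v, y) ≠ 0 ∧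
      ∀ᶠ x in 𝓝 (u, v, y), glueσ i j₁ x =
        (nodeV i j₁ j₂ A S x j₁ - nodeV i j₁ j₂ A S x j₂) ^ 2 * g x := by
  have hy := h.y_ne hval hinj
  have hX := fun j => analyticAt_glueX (i := i) (j₁ := j₁) (j₂ := j₂) (S := S)
    (x₀ := (u, v, y)) hy j
  have hW := fun j => analyticAt_glueW (i := i) (j₁ := j₁) (j₂ := j₂) (S := S)
    (x₀ := (u, v, y)) hy j
  have hfX := fun j => analyticAt_fa (hX j) h.left.ne (fun k hk => h.glueX_ne j hk)
  have hfW := fun j => analyticAt_fa (hW j) h.right.ne (fun k hk => h.glueW_ne j hk)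
  have hX₁ : ∀ x : (κ → ℂ) × (κ → ℂ) × (J → ℂ), glueX i j₁ j₂ S x j₁ = x.1 i := fun x => by
    simp [glueX, h.notMem₁]
  have hX₂ : ∀ x : (κ → ℂ) × (κ → ℂ) × (J → ℂ), glueX i j₁ j₂ S x j₂ = x.1 i * x.2.2 j₂ :=
    fun x => by simp [glueX, h.notMem₂, hne.symm]
  have hW₁ : ∀ x : (κ → ℂ) × (κ → ℂ) × (J → ℂ), glueW i j₁ j₂ S x j₁ = x.1 i * x.2.2 j₁ :=
    fun x => by simp [glueW, h.notMem₁]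
  have hW₂ : ∀ x : (κ → ℂ) × (κ → ℂ) × (J → ℂ),
      glueW i j₁ j₂ S x j₂ = x.1 i * x.2.2 j₁ / x.2.2 j₂ :=
    fun x => by simp [glueW, h.notMem₂, hne.symm]
  set H : (κ → ℂ) × (κ → ℂ) × (J → ℂ) → ℂ := fun x =>
    (1 + fa A x.1 x.2.1 (glueX i j₁ j₂ S x j₁)) +
      x.2.2 j₁ * (1 + fa (co₁ i A) x.1 x.2.1 (glueW i j₁ j₂ S x j₁)) -
    (x.2.2 j₂ * (1 + fa A x.1 x.2.1 (glueX i j₁ j₂ S x j₂)) +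
      x.2.2 j₁ / x.2.2 j₂ * (1 + fa (co₁ i A) x.1 x.2.1 (glueW i j₁ j₂ S x j₂))) with hH
  have hHa : AnalyticAt ℂ H (u, v, y) :=
    ((analyticAt_const.add (hfX j₁)).add
      ((analyticAt_coord₃ j₁).mul (analyticAt_const.add (hfW j₁)))).sub
    (((analyticAt_coord₃ j₂).mul (analyticAt_const.add (hfX j₂))).add
      (((analyticAt_coord₃ j₁).div (analyticAt_coord₃ j₂) (hy j₂)).mul
        (analyticAt_const.add (hfW j₂))))
  have hH0 : H (u, v, y) ≠ 0 := by
    have : H (u, v, y) = 4 * (1 - fd A u v 0) := by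
      simp only [hH, hX₁, hX₂, hW₁, hW₂, h.u_node, zero_mul, zero_div, fa_zero h.left.ne,
        fa_zero h.right.ne, h.y_node₂]
      linear_combination 2 * h.tangency hval hinj
    rw [this]
    exact mul_ne_zero (by norm_num) (h.fd_left_ne hval hinj)
  refine ⟨fun x => x.2.2 j₁ / H x ^ 2,
    ((analyticAt_coord₃ j₁).div (hHa.pow 2) (pow_ne_zero 2 hH0)).continuousAt,
    div_ne_zero (hy j₁) (pow_ne_zero 2 hH0), ?_⟩
  filter_upwards [hHa.continuousAt.eventually (isOpen_ne.mem_nhds hH0)] with x hx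
  have h1 : nodeV i j₁ j₂ A S x j₁ - nodeV i j₁ j₂ A S x j₂ = x.1 i * H x := by
    simp only [nodeV, hX₁, hX₂, hW₁, hW₂, hH]
    ring
  rw [h1, glueσ, mul_pow, mul_assoc, mul_div_cancel₀ _ (pow_ne_zero 2 hx)]

theorem exists_branch (h : IsNode c w i j₁ j₂ A S u v y)
    (hJ : Fintype.card J = 2 * Fintype.card κ) (hne : j₁ ≠ j₂)
    (hval : ∀ j, c j = w ↔ j = j₁ ∨ j = j₂) (hinj : ∀ j l, c j ≠ w → c j = c l → j = l) :
    ∃ (ψ : (J → ℂ) → (κ → ℂ) × (κ → ℂ) × (J → ℂ)) (g : (J → ℂ) → ℂ) (g₀ : ℂ),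
      Tendsto ψ (𝓝 c) (𝓝 (u, v, y)) ∧ Tendsto g (𝓝 c) (𝓝 g₀) ∧ g₀ ≠ 0 ∧
      (∀ᶠ b in 𝓝 c, glueσ i j₁ (ψ b) = (b j₁ - b j₂) ^ 2 * g b) ∧
      (∀ᶠ b in 𝓝 c, b j₁ ≠ b j₂ → glue i j₁ j₂ A S (ψ b) ∈ Sol κ b) ∧
      ∀ᶠ x in 𝓝 (u, v, y), ∀ b, glue i j₁ j₂ A S x ∈ Sol κ b → x = ψ b := by
  obtain ⟨ψ, h1, h2, h3, h4⟩ := exists_local_inverse (Φ := nodeMap i j₁ j₂ A S) (x₀ := (u, v, y))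
    (by simp [hJ]; ring)
    (analyticAt_nodeMap h.notMem (h.y_ne hval hinj) (fun k => h.v_ne) (fun j k => h.glueX_ne j)
      fun j k => h.glueW_ne j) (by
      rintro ⟨a, b, d⟩ hv
      obtain ⟨rfl, rfl⟩ := h.deriv_val hne hval hinj (a := a) (b := b) (d := d)
        fun j => hasDerivAt_pi.1 (hasDerivAt_snd_of_prod hv) j
      rw [h.deriv_crit hne hval hinj (d := d)
        fun j => hasDerivAt_pi.1 (hasDerivAt_fst_of_prod hv) j]
      rfl)
  obtain ⟨g, hg1, hg2, hg3⟩ := h.exists_glueσ_eq hne hval hinj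
  have hgl := h.eventually_gluable hval hinj
  rw [h.nodeMap_eq hne hval hinj] at h1 h2 h4
  have hι : Tendsto (fun c : J → ℂ => ((0 : J → ℂ), c)) (𝓝 c) (𝓝 (0, c)) :=
    (Continuous.prodMk_right (0 : J → ℂ)).tendsto c
  have hψ : Tendsto (fun b => ψ (0, b)) (𝓝 c) (𝓝 (u, v, y)) := by
    have := h2.self_of_nhds.continuousAt.tendsto
    rw [h1] at this
    exact this.comp hι
  have hσ : ∀ᶠ b in 𝓝 c, glueσ i j₁ (ψ (0, b)) = (b j₁ - b j₂) ^ 2 * g (ψ (0, b)) := by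
    filter_upwards [hψ.eventually hg3, hι.eventually h4] with b hb hb'
    rw [hb]
    have h5 : nodeV i j₁ j₂ A S (ψ (0, b)) = b := congrArg Prod.snd hb'
    rw [h5]
  refine ⟨fun b => ψ (0, b), fun b => g (ψ (0, b)), _, hψ, hg1.tendsto.comp hψ, hg2, hσ, ?_, ?_⟩
  · filter_upwards [hψ.eventually hgl, hι.eventually h4, hσ,
      (hg1.tendsto.comp hψ).eventually (isOpen_ne.mem_nhds hg2)] with b hb1 hb2 hb3 hb4 hb5
    refine hb1.glue_mem h.notMem ?_ hb2
    rw [hb3]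
    exact mul_ne_zero (pow_ne_zero 2 (sub_ne_zero.2 hb5)) hb4
  · filter_upwards [h3, hgl] with x hx1 hx2 b hb
    rw [← hx2.nodeMap_eq h.notMem hb, hx1]

end IsNode

end CriticalValues

namespace CriticalValues

open Filter Topology Metric

variable {κ J : Type} [Fintype κ] [Fintype J]

/-- The set of all limiting data at a collision of `c j₁` and `c j₂`. -/
def Nodes (c : J → ℂ) (w : ℂ) (i : κ) (j₁ j₂ : J) :
    Set (Finset κ × Finset J × (κ → ℂ) × (κ → ℂ) × (J → ℂ)) :=
  {ν | IsNode c w i j₁ j₂ ν.1 ν.2.1 ν.2.2.1 ν.2.2.2.1 ν.2.2.2.2}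

namespace IsNode

variable {c : J → ℂ} {w : ℂ} {i : κ} {j₁ j₂ : J} {A : Finset κ} {S : Finset J}
    {u v : κ → ℂ} {y : J → ℂ} {ι : Type*} {F : Filter ι} {x : ι → (κ → ℂ) × (κ → ℂ) × (J → ℂ)}

theorem tendsto_glue_res (h : IsNode c w i j₁ j₂ A S u v y) (hx : Tendsto x F (𝓝 (u, v, y)))
    (k : κ) :
    Tendsto (fun t => (glue i j₁ j₂ A S (x t)).1 k) F (𝓝 ((A : Set κ).indicator u k)) := by
  have hu := ((analyticAt_coord₁ k).continuousAt (x := (u, v, y))).tendsto.comp hx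
  have hv := ((analyticAt_coord₂ k).continuousAt (x := (u, v, y))).tendsto.comp hx
  have hσ := ((analyticAt_glueσ (i := i) (j₁ := j₁)).continuousAt (x := (u, v, y))).tendsto.comp hx
  rw [h.glueσ_eq] at hσ
  by_cases h1 : k ∈ A
  · rw [Set.indicator_of_mem (Finset.mem_coe.2 h1)]
    simpa only [glue, h1, if_true, Function.comp_def] using hu
  rw [Set.indicator_of_notMem (mt Finset.mem_coe.1 h1)]
  by_cases h2 : k = i
  · simpa only [glue, h1, h2, if_true, if_false, h.notMem, Function.comp_def] using hσ
  · have h3 := ((hu.mul hσ).div (hv.pow 2) (pow_ne_zero 2 (h.v_ne h2))).neg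
    simp only [mul_zero, zero_div, neg_zero] at h3
    simpa only [glue, h1, h2, if_false, Function.comp_def, Pi.div_apply] using h3

theorem tendsto_glueX (h : IsNode c w i j₁ j₂ A S u v y)
    (hval : ∀ j, c j = w ↔ j = j₁ ∨ j = j₂) (hinj : ∀ j l, c j ≠ w → c j = c l → j = l)
    (hx : Tendsto x F (𝓝 (u, v, y))) (j : J) :
    Tendsto (fun t => (glue i j₁ j₂ A S (x t)).2.2 j - (glue i j₁ j₂ A S (x t)).2.1 i) F
      (𝓝 ((S : Set J).indicator y j)) := by
  have h1 := ((analyticAt_glueX (i := i) (j₁ := j₁) (j₂ := j₂) (S := S)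
    (h.y_ne hval hinj) j).continuousAt (x := (u, v, y))).tendsto.comp hx
  have h2 : glueX i j₁ j₂ S (u, v, y) j = (S : Set J).indicator y j := by
    by_cases hj : j ∈ S
    · simp only [glueX, Set.indicator_of_mem (Finset.mem_coe.2 hj), hj, if_true]
    · simp only [glueX, Set.indicator_of_notMem (mt Finset.mem_coe.1 hj), hj, if_false, h.u_node,
        h.glueσ_eq, zero_mul, zero_div, ite_self]
  rw [h2] at h1
  refine h1.congr fun t => ?_
  simp [glue, h.notMem]

theorem unique [F.NeBot] (h : IsNode c w i j₁ j₂ A S u v y) (hne : j₁ ≠ j₂)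
    (hval : ∀ j, c j = w ↔ j = j₁ ∨ j = j₂) (hinj : ∀ j l, c j ≠ w → c j = c l → j = l)
    (hx : Tendsto x F (𝓝 (u, v, y))) {A' : Finset κ} {S' : Finset J} {u' v' : κ → ℂ} {y' : J → ℂ}
    {x' : ι → (κ → ℂ) × (κ → ℂ) × (J → ℂ)} (h' : IsNode c w i j₁ j₂ A' S' u' v' y')
    (hx' : Tendsto x' F (𝓝 (u', v', y'))) (hσ : ∀ᶠ t in F, glueσ i j₁ (x t) ≠ 0)
    (hσ' : ∀ᶠ t in F, glueσ i j₁ (x' t) ≠ 0)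
    (he : ∀ᶠ t in F, glue i j₁ j₂ A S (x t) = glue i j₁ j₂ A' S' (x' t)) :
    (A, S, u, v, y) = (A', S', u', v', y') := by
  have h1 : ∀ k, (A : Set κ).indicator u k = (A' : Set κ).indicator u' k := fun k =>
    tendsto_nhds_unique_of_eventuallyEq (h.tendsto_glue_res hx k) (h'.tendsto_glue_res hx' k)
      (he.mono fun t ht => by simp only [ht])
  have h2 : ∀ j, (S : Set J).indicator y j = (S' : Set J).indicator y' j := fun j =>
    tendsto_nhds_unique_of_eventuallyEq (h.tendsto_glueX hval hinj hx j)
      (h'.tendsto_glueX hval hinj hx' j) (he.mono fun t ht => by simp only [ht])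
  have hA : A = A' := by
    have h3 : Function.support ((A : Set κ).indicator u) = A := by
      rw [Set.support_indicator]
      exact Set.inter_eq_left.2 fun k hk => h.left.res_ne hk
    have h4 : Function.support ((A' : Set κ).indicator u') = A' := by
      rw [Set.support_indicator]
      exact Set.inter_eq_left.2 fun k hk => h'.left.res_ne hk
    rw [← Finset.coe_inj, ← h3, ← h4, funext h1]
  have hS : S = S' := by
    have h3 : Function.support ((S : Set J).indicator y) = S := by
      rw [Set.support_indicator]
      exact Set.inter_eq_left.2 fun j _ => h.y_ne hval hinj j
    have h4 : Function.support ((S' : Set J).indicator y') = S' := by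
      rw [Set.support_indicator]
      exact Set.inter_eq_left.2 fun j _ => h'.y_ne hval hinj j
    rw [← Finset.coe_inj, ← h3, ← h4, funext h2]
  subst hA hS
  have h3 : (u, v, y) = (u', v', y') := by
    refine tendsto_nhds_unique_of_eventuallyEq hx hx' ?_
    filter_upwards [hσ, hσ', he, hx.eventually (h.eventually_gluable hval hinj),
      hx'.eventually (h'.eventually_gluable hval hinj)] with t h4 h5 h6 h7 h8
    rw [← cut_glue (A := A) (S := S) h.notMem h.notMem₁ h.notMem₂ hne h4 h7.v_ne, h6,
      cut_glue h.notMem h.notMem₁ h.notMem₂ hne h5 h8.v_ne]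
  rw [h3]

end IsNode

theorem exists_local_structure {c : J → ℂ} {w : ℂ} (i : κ) {j₁ j₂ : J}
    (hJ : Fintype.card J = 2 * Fintype.card κ) (hne : j₁ ≠ j₂)
    (hval : ∀ j, c j = w ↔ j = j₁ ∨ j = j₂) (hinj : ∀ j l, c j ≠ w → c j = c l → j = l)
    (hfin : (Nodes c w i j₁ j₂).Finite) :
    ∃ (X : Finset κ × Finset J × (κ → ℂ) × (κ → ℂ) × (J → ℂ) → (J → ℂ) →
        (κ → ℂ) × (κ → ℂ) × (J → ℂ))
      (g : Finset κ × Finset J × (κ → ℂ) × (κ → ℂ) × (J → ℂ) → (J → ℂ) → ℂ)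
      (g₀ : Finset κ × Finset J × (κ → ℂ) × (κ → ℂ) × (J → ℂ) → ℂ) (η : ℝ), 0 < η ∧
      (∀ ν ∈ Nodes c w i j₁ j₂, Tendsto (g ν) (𝓝 c) (𝓝 (g₀ ν)) ∧ g₀ ν ≠ 0) ∧
      ∀ᶠ b in 𝓝 c, Function.Injective b →
        (∀ ν ∈ Nodes c w i j₁ j₂, X ν b ∈ Sol κ b ∧ (X ν b).1 i = (b j₁ - b j₂) ^ 2 * g ν b) ∧
        Set.InjOn (fun ν => X ν b) (Nodes c w i j₁ j₂) ∧
        ∀ x ∈ Sol κ b, (∀ ν ∈ Nodes c w i j₁ j₂, X ν b ≠ x) → η ≤ ‖x.1 i‖ := by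
  choose! ψ g g₀ h1 h2 h3 h4 h5 h6 using fun ν (hν : ν ∈ Nodes c w i j₁ j₂) =>
    IsNode.exists_branch hν hJ hne hval hinj
  have hσ : ∀ ν ∈ Nodes c w i j₁ j₂, ∀ᶠ b in 𝓝 c, b j₁ ≠ b j₂ → glueσ i j₁ (ψ ν b) ≠ 0 := by
    intro ν hν
    filter_upwards [h4 ν hν, (h2 ν hν).eventually (isOpen_ne.mem_nhds (h3 ν hν))] with b hb1 hb2 hb3
    rw [hb1]
    exact mul_ne_zero (pow_ne_zero 2 (sub_ne_zero.2 hb3)) hb2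
  have hI : ∀ᶠ b in 𝓝 c, ∀ ν ∈ Nodes c w i j₁ j₂, ∀ ν' ∈ Nodes c w i j₁ j₂, ν ≠ ν' →
      Function.Injective b →
        glue i j₁ j₂ ν.1 ν.2.1 (ψ ν b) ≠ glue i j₁ j₂ ν'.1 ν'.2.1 (ψ ν' b) := by
    refine hfin.eventually_all.2 fun ν hν => hfin.eventually_all.2 fun ν' hν' => ?_
    by_cases hνν : ν = ν'
    · simp [hνν]
    by_contra hcon
    have hfr : ∃ᶠ b in 𝓝 c, Function.Injective b ∧
        glue i j₁ j₂ ν.1 ν.2.1 (ψ ν b) = glue i j₁ j₂ ν'.1 ν'.2.1 (ψ ν' b) := fun hev =>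
      hcon (hev.mono fun b hb _ hbi he => hb ⟨hbi, he⟩)
    have hbot : (𝓝 c ⊓ 𝓟 {b | Function.Injective b ∧ glue i j₁ j₂ ν.1 ν.2.1 (ψ ν b) =
        glue i j₁ j₂ ν'.1 ν'.2.1 (ψ ν' b)}).NeBot := frequently_mem_iff_neBot.1 hfr
    set F := 𝓝 c ⊓ 𝓟 {b | Function.Injective b ∧ glue i j₁ j₂ ν.1 ν.2.1 (ψ ν b) =
        glue i j₁ j₂ ν'.1 ν'.2.1 (ψ ν' b)}
    have hF : F ≤ 𝓝 c := inf_le_left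
    have hF' : ∀ᶠ b in F, Function.Injective b ∧ glue i j₁ j₂ ν.1 ν.2.1 (ψ ν b) =
        glue i j₁ j₂ ν'.1 ν'.2.1 (ψ ν' b) := mem_inf_of_right (mem_principal_self _)
    have hF1 : ∀ᶠ b in F, b j₁ ≠ b j₂ := by
      filter_upwards [hF'] with b hb using hb.1.ne hne
    refine hνν (IsNode.unique hν hne hval hinj ((h1 ν hν).mono_left hF) hν'
      ((h1 ν' hν').mono_left hF) ?_ ?_ ?_)
    · filter_upwards [hF1, hF (hσ ν hν)] with b h7 h8 using h8 h7
    · filter_upwards [hF1, hF (hσ ν' hν')] with b h7 h8 using h8 h7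
    · filter_upwards [hF'] with b hb using hb.2
  have hbig : ∀ᶠ t : (J → ℂ) × ℝ in 𝓝 c ×ˢ 𝓝[>] (0 : ℝ), ∀ x : (κ → ℂ) × (κ → ℂ) × (J → ℂ),
      Function.Injective t.1 → x ∈ Sol κ t.1 →
      (∀ ν ∈ Nodes c w i j₁ j₂, glue i j₁ j₂ ν.1 ν.2.1 (ψ ν t.1) ≠ x) → t.2 ≤ ‖x.1 i‖ := by
    by_contra hcon
    obtain ⟨F, hF1, hF2⟩ := exists_ultrafilter_of_not_eventually hcon
    have hF3 : ∀ᶠ t in (F : Filter (((J → ℂ) × ℝ) × (κ → ℂ) × (κ → ℂ) × (J → ℂ))),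
        Function.Injective t.1.1 ∧ t.2 ∈ Sol κ t.1.1 ∧
        (∀ ν ∈ Nodes c w i j₁ j₂, glue i j₁ j₂ ν.1 ν.2.1 (ψ ν t.1.1) ≠ t.2) ∧
          ‖t.2.1 i‖ < t.1.2 := by
      filter_upwards [hF2] with t ht
      simpa only [Classical.not_imp, not_le] using ht
    have hFc := tendsto_fst.comp hF1
    have hFη := (tendsto_nhds_of_tendsto_nhdsWithin (tendsto_snd.comp hF1))
    obtain ⟨α', p', z', hcol⟩ := exists_isCollision F (c := fun t => t.1.1) (α := fun t => t.2.1)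
      (p := fun t => t.2.2.1) (z := fun t => t.2.2.2) hJ (hF3.mono fun t ht => ht.2.1)
      (hF3.mono fun t ht => ht.1) hFc hne hval hinj
    have hi : α' none i = 0 := by
      refine tendsto_nhds_unique ((hcol.lim none).tα_apply i)
        (squeeze_zero_norm' (hF3.mono fun t ht => ?_) hFη)
      exact ht.2.2.2.le
    obtain ⟨A, S, u, v, y, hν, hcut⟩ := hcol.exists_node hi
    obtain ⟨t, ⟨ht1, ht2, ht3, -⟩, ht4⟩ :=
      (hF3.and (hcut.eventually (h6 (A, S, u, v, y) hν))).exists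
    have hgc : glue i j₁ j₂ A S (cut i j₁ j₂ A S t.2) = t.2 :=
      glue_cut hν.notMem hν.notMem₁ hν.notMem₂ hne (ht2.res_ne i) ht2.inj fun j => ht2.ne_pole j i
    refine ht3 (A, S, u, v, y) hν ?_
    rw [← ht4 t.1.1 (by rw [hgc]; exact ht2)]
    exact hgc
  obtain ⟨pa, hpa, pb, hpb, hab⟩ := eventually_prod_iff.1 hbig
  obtain ⟨η, hη1, hη2⟩ := (hpb.and self_mem_nhdsWithin).exists
  refine ⟨fun ν b => glue i j₁ j₂ ν.1 ν.2.1 (ψ ν b), g, g₀, η, hη2,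
    fun ν hν => ⟨h2 ν hν, h3 ν hν⟩, ?_⟩
  filter_upwards [hI, hpa, hfin.eventually_all.2 h4, hfin.eventually_all.2 h5]
    with b hb1 hb2 hb3 hb4 hbi
  refine ⟨fun ν hν => ⟨hb4 ν hν (hbi.ne hne), ?_⟩, fun ν hν ν' hν' he => ?_,
    fun x hx hxν => hab hb2 hη1 x hbi hx hxν⟩
  · rw [← hb3 ν hν]
    simp [glue, hν.notMem]
  · by_contra hνν
    exact hb1 ν hν ν' hν' hνν hbi he

/-- The product of the residues at the pole `i` of all solutions. -/
noncomputable def resProd (i : κ) (c : J → ℂ) : ℂ := ∏ᶠ x ∈ Sol κ c, x.1 i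

theorem exists_resProd_bounds {c : J → ℂ} {w : ℂ} (i : κ) {j₁ j₂ : J}
    (hJ : Fintype.card J = 2 * Fintype.card κ) (hne : j₁ ≠ j₂)
    (hval : ∀ j, c j = w ↔ j = j₁ ∨ j = j₂) (hinj : ∀ j l, c j ≠ w → c j = c l → j = l)
    (hfin : (Nodes c w i j₁ j₂).Finite) (K : ℕ) :
    ∃ m M : ℝ, 0 < m ∧ 0 < M ∧ ∀ᶠ b in 𝓝 c, Function.Injective b → (Sol κ b).ncard ≤ K →
      m * ‖b j₁ - b j₂‖ ^ (2 * (Nodes c w i j₁ j₂).ncard) ≤ ‖resProd i b‖ ∧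
      ‖resProd i b‖ ≤ M * ‖b j₁ - b j₂‖ ^ (2 * (Nodes c w i j₁ j₂).ncard) := by
  obtain ⟨X, g, g₀, η, hη, h1, h2⟩ := exists_local_structure i hJ hne hval hinj hfin
  set N := Nodes c w i j₁ j₂ with hN
  set G : ℝ := ∏ ν ∈ hfin.toFinset, ‖g₀ ν‖ with hG
  have hG0 : 0 < G := Finset.prod_pos fun ν hν =>
    norm_pos_iff.2 (h1 ν (hfin.mem_toFinset.1 hν)).2
  have hGt : Tendsto (fun b => ∏ ν ∈ hfin.toFinset, ‖g ν b‖) (𝓝 c) (𝓝 G) :=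
    tendsto_finsetProd _ fun ν hν => (h1 ν (hfin.mem_toFinset.1 hν)).1.norm
  obtain ⟨R, hR0, hR⟩ := eventually_norm_lt (F := 𝓝 c) (c := fun b : J → ℂ => b) (c' := c)
    tendsto_id
  set η' := min η 1 with hη'
  set T := max (800 * R * (800 * R)) 1 with hT
  have hη0 : 0 < η' := lt_min hη one_pos
  have hT0 : 0 < T := lt_of_lt_of_le one_pos (le_max_right _ _)
  refine ⟨G / 2 * η' ^ K, 2 * G * T ^ K, by positivity, by positivity, ?_⟩
  filter_upwards [h2, hR, hGt.eventually (lt_mem_nhds (half_lt_self hG0)),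
    hGt.eventually (gt_mem_nhds (show G < 2 * G by linarith))] with b hb1 hb2 hb3 hb4 hbi hbK
  obtain ⟨h3, h4, h5⟩ := hb1 hbi
  have hSf := finite_sol (κ := κ) hJ hbi
  set I := (fun ν => X ν b) '' N with hI
  have hIs : I ⊆ Sol κ b := by
    rintro _ ⟨ν, hν, rfl⟩
    exact (h3 ν hν).1
  have hprod : resProd i b = (∏ᶠ x ∈ I, x.1 i) * ∏ᶠ x ∈ Sol κ b \ I, x.1 i := by
    rw [resProd, ← finprod_mem_union Set.disjoint_sdiff_right (hSf.subset hIs) hSf.sdiff,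
      Set.union_sdiff_cancel hIs]
  have hP1 : ‖∏ᶠ x ∈ I, x.1 i‖ = ‖b j₁ - b j₂‖ ^ (2 * N.ncard) * ∏ ν ∈ hfin.toFinset, ‖g ν b‖ := by
    rw [finprod_mem_image h4, finprod_mem_eq_finite_toFinset_prod _ hfin, norm_prod,
      Finset.prod_congr rfl (fun ν hν => by
        rw [(h3 ν (hfin.mem_toFinset.1 hν)).2, norm_mul, norm_pow]), Finset.prod_mul_distrib,
      Finset.prod_const, ← pow_mul, Set.ncard_eq_toFinset_card N hfin]
  have hcard : (hSf.sdiff (t := I)).toFinset.card ≤ K := by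
    rw [← Set.ncard_eq_toFinset_card (Sol κ b \ I) hSf.sdiff]
    exact (Set.ncard_le_ncard Set.sdiff_subset hSf).trans hbK
  have hP2 : η' ^ K ≤ ‖∏ᶠ x ∈ Sol κ b \ I, x.1 i‖ := by
    rw [finprod_mem_eq_finite_toFinset_prod _ hSf.sdiff, norm_prod]
    refine (pow_le_pow_of_le_one hη0.le (min_le_right _ _) hcard).trans ?_
    rw [← Finset.prod_const]
    refine Finset.prod_le_prod (fun _ _ => hη0.le) fun x hx => ?_
    obtain ⟨hx1, hx2⟩ := hSf.sdiff.mem_toFinset.1 hx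
    exact (min_le_left _ _).trans (h5 x hx1 fun ν hν he => hx2 ⟨ν, hν, he⟩)
  have hP3 : ‖∏ᶠ x ∈ Sol κ b \ I, x.1 i‖ ≤ T ^ K := by
    rw [finprod_mem_eq_finite_toFinset_prod _ hSf.sdiff, norm_prod]
    refine le_trans ?_ (pow_le_pow_right₀ (le_max_right _ _) hcard)
    rw [← Finset.prod_const]
    refine Finset.prod_le_prod (fun _ _ => norm_nonneg _) fun x hx => ?_
    have hx1 : x ∈ Sol κ b := (hSf.sdiff.mem_toFinset.1 hx).1
    exact (IsSol.norm_res_le hx1 hbi hJ hb2 i).trans (le_max_left _ _)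
  rw [hprod, norm_mul, hP1]
  set D := ‖b j₁ - b j₂‖ ^ (2 * N.ncard)
  have hD : 0 ≤ D := by positivity
  constructor
  · calc G / 2 * η' ^ K * D = D * (G / 2) * η' ^ K := by ring
      _ ≤ _ := by gcongr
  · calc _ ≤ D * (2 * G) * T ^ K := by gcongr
      _ = _ := by ring

end CriticalValues

namespace CriticalValues

open Filter Topology Metric

variable {κ J : Type} [Fintype κ] [Fintype J]

open Classical in
/-- The fibre of `rf α p` over `w`. -/
noncomputable def fiber (α p : κ → ℂ) (w : ℂ) : Finset ℂ := (num α p - C w * den p).roots.toFinset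

theorem natDegree_num_sub (α p : κ → ℂ) (w : ℂ) :
    (num α p - C w * den p).natDegree = Fintype.card κ + 1 := by
  have h : (C w * den p).degree < (num α p).degree := by
    refine lt_of_le_of_lt ?_ (degree_den_lt_num α p)
    refine (degree_mul_le _ _).trans ?_
    calc (C w).degree + (den p).degree ≤ 0 + (den p).degree := by gcongr; exact degree_C_le
      _ = _ := zero_add _
  rw [natDegree_eq_of_degree_eq (degree_sub_eq_left_of_degree_lt h), natDegree_num]

theorem num_sub_ne_zero (α p : κ → ℂ) (w : ℂ) : num α p - C w * den p ≠ 0 := by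
  intro h
  have := natDegree_num_sub α p w
  rw [h, natDegree_zero] at this
  omega

theorem mem_fiber {α p : κ → ℂ} (hα : ∀ k, α k ≠ 0) (hp : Function.Injective p) {w q : ℂ} :
    q ∈ fiber α p w ↔ (∀ k, q ≠ p k) ∧ rf α p q = w := by
  rw [fiber, Multiset.mem_toFinset, mem_roots (num_sub_ne_zero α p w), IsRoot.def,
    eval_fiber_eq_zero_iff hα hp]

theorem IsSol.card_fiber {c : J → ℂ} {α p : κ → ℂ} {z : J → ℂ} (h : IsSol c α p z)
    (hz : Function.Injective z) (hJ : Fintype.card J = 2 * Fintype.card κ) {w : ℂ}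
    (hw : ∀ j, c j ≠ w) : (fiber α p w).card = Fintype.card κ + 1 := by
  classical
  have h0 := num_sub_ne_zero α p w
  have hnd : (num α p - C w * den p).roots.Nodup := by
    rw [Multiset.nodup_iff_count_le_one]
    intro a
    rw [count_roots]
    by_contra hlt
    obtain ⟨h1, h2⟩ := (one_lt_rootMultiplicity_iff_isRoot h0).1 (not_le.1 hlt)
    exact h.simple_roots hz hJ hw h1 h2
  rw [fiber, Multiset.toFinset_card_of_nodup hnd,
    splits_iff_card_roots.1 (IsAlgClosed.splits _), natDegree_num_sub]

/-- The solutions, translated so that they take the value `w` at the origin. -/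
def Pointed (κ : Type) {J : Type} [Fintype κ] (c : J → ℂ) (w : ℂ) :
    Set ((κ → ℂ) × (κ → ℂ) × (J → ℂ)) :=
  {x | (∀ k, x.2.1 k ≠ 0) ∧ IsSol (fun j => c j - (w + ∑ k, x.1 k / x.2.1 k)) x.1 x.2.1 x.2.2}

theorem rf_sub_const (α p : κ → ℂ) (q z : ℂ) :
    rf α (fun k => p k - q) (z - q) = rf α p z - q := by
  simp only [rf, sub_sub_sub_cancel_right]
  ring

theorem rf_zero (α p : κ → ℂ) : rf α p 0 = -∑ k, α k / p k := by
  simp [rf, div_neg]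

theorem pointed_eq_image (c : J → ℂ) (w : ℂ) : Pointed κ c w =
    (fun t : ((κ → ℂ) × (κ → ℂ) × (J → ℂ)) × ℂ =>
      (t.1.1, (fun k => t.1.2.1 k - t.2), fun j => t.1.2.2 j - t.2)) ''
      {t | t.1 ∈ Sol κ c ∧ t.2 ∈ fiber t.1.1 t.1.2.1 w} := by
  ext ⟨u, v, y⟩
  constructor
  · rintro ⟨h1, h2⟩
    dsimp only at h1 h2
    set r := w + ∑ k, u k / v k with hr
    have h3 := h2.sub_const (-r)
    simp only [sub_neg_eq_add, sub_add_cancel] at h3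
    refine ⟨((u, (fun k => v k + r), fun j => y j + r), r), ⟨h3, ?_⟩, ?_⟩
    · refine (mem_fiber h3.res_ne h3.inj).2 ⟨fun k hk => h1 k (by linear_combination -hk), ?_⟩
      have h4 := rf_sub_const u (fun k => v k + r) r r
      simp only [add_sub_cancel_right, sub_self, rf_zero] at h4
      linear_combination -h4 + hr
    · simp
  · rintro ⟨⟨⟨α, p, z⟩, q⟩, ⟨h1, h2⟩, h3⟩
    simp only [Prod.mk.injEq] at h3 h2
    obtain ⟨rfl, rfl, rfl⟩ := h3
    have h1' : IsSol c α p z := h1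
    obtain ⟨h4, h5⟩ := (mem_fiber h1'.res_ne h1'.inj).1 h2
    refine ⟨fun k => sub_ne_zero.2 (h4 k).symm, ?_⟩
    have h6 := rf_sub_const α p q q
    rw [sub_self, rf_zero, h5] at h6
    dsimp only
    rw [show w + ∑ k, α k / (p k - q) = q by linear_combination -h6]
    exact h1'.sub_const q

theorem ncard_pointed (hJ : Fintype.card J = 2 * Fintype.card κ) {c : J → ℂ}
    (hc : Function.Injective c) {w : ℂ} (hw : ∀ j, c j ≠ w) :
    (Pointed κ c w).Finite ∧
      (Pointed κ c w).ncard = (Fintype.card κ + 1) * (Sol κ c).ncard := by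
  have hSf := finite_sol (κ := κ) hJ hc
  have hE : {t : ((κ → ℂ) × (κ → ℂ) × (J → ℂ)) × ℂ | t.1 ∈ Sol κ c ∧ t.2 ∈ fiber t.1.1 t.1.2.1 w} =
      Equiv.sigmaEquivProd _ _ '' (hSf.toFinset.sigma fun x => fiber x.1 x.2.1 w : Finset _) := by
    ext ⟨x, q⟩
    simp
  have hfin : {t : ((κ → ℂ) × (κ → ℂ) × (J → ℂ)) × ℂ |
      t.1 ∈ Sol κ c ∧ t.2 ∈ fiber t.1.1 t.1.2.1 w}.Finite := by
    rw [hE]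
    exact (Finset.finite_toSet _).image _
  rw [pointed_eq_image]
  refine ⟨hfin.image _, ?_⟩
  rw [Set.InjOn.ncard_image, hE, Set.ncard_image_of_injective _ (Equiv.injective _),
    Set.ncard_coe_finset, Finset.card_sigma, Finset.sum_const_nat (m := Fintype.card κ + 1),
    ← Set.ncard_eq_toFinset_card _ hSf, mul_comm]
  · intro x hx
    have hx' : IsSol c x.1 x.2.1 x.2.2 := hSf.mem_toFinset.1 hx
    exact hx'.card_fiber (hx'.z_inj hc) hJ hw
  · rintro ⟨⟨α, p, z⟩, q⟩ ⟨h1, h2⟩ ⟨⟨α', p', z'⟩, q'⟩ ⟨h1', h2'⟩ h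
    simp only [Prod.mk.injEq] at h h2 h2'
    obtain ⟨rfl, h3, h4⟩ := h
    have e1 : IsSol c α p z := h1
    have e2 : IsSol c α p' z' := h1'
    have h5 := rf_sub_const α p q q
    have h6 := rf_sub_const α p' q' q'
    rw [sub_self, ((mem_fiber e1.res_ne e1.inj).1 h2).2] at h5
    rw [sub_self, ((mem_fiber e2.res_ne e2.inj).1 h2').2, ← h3, h5] at h6
    have hq : q = q' := by linear_combination -h6
    subst hq
    have h7 : p = p' := funext fun k => by simpa using congrFun h3 k
    have h8 : z = z' := funext fun k => by simpa using congrFun h4 k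
    rw [h7, h8]

end CriticalValues

namespace CriticalValues

open Filter Topology Metric

variable {κ J : Type} [Fintype κ] [Fintype J]

theorem isSide_iff {c : J → ℂ} {w : ℂ} {A : Finset κ} {S : Finset J} {u v : κ → ℂ} {y : J → ℂ} :
    IsSide c w A S u v y ↔ S.card = 2 * A.card ∧
      ((fun k : A => u k, fun k : A => v k, fun j : S => y j) :
        (A → ℂ) × (A → ℂ) × (S → ℂ)) ∈ Pointed A (fun j : S => c j) w := by
  have h : ∑ k : A, u k / v k = ∑ k ∈ A, u k / v k := Finset.sum_coe_sort A fun k => u k / v k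
  constructor
  · intro hs
    refine ⟨hs.card, fun k => hs.ne k k.2, ?_⟩
    have h2 := hs.sol
    rw [← h] at h2
    exact h2
  · rintro ⟨h1, h2, h3⟩
    refine ⟨h1, fun k hk => h2 ⟨k, hk⟩, ?_⟩
    rw [← h]
    exact h3

/-- The limiting data at a collision with visible poles `A` and visible critical points `S`. -/
def NodesAt (c : J → ℂ) (w : ℂ) (i : κ) (j₁ j₂ : J) (A : Finset κ) (S : Finset J) :
    Set ((κ → ℂ) × (κ → ℂ) × (J → ℂ)) :=
  {x | IsNode c w i j₁ j₂ A S x.1 x.2.1 x.2.2}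

theorem card_co₁ {i : κ} {A : Finset κ} (hi : i ∉ A) :
    (co₁ i A).card + A.card + 1 = Fintype.card κ := by
  have h := sum_co₁ hi fun _ => (1 : ℂ)
  simp only [Finset.sum_const, nsmul_eq_mul, mul_one, Finset.card_univ] at h
  have h2 : ((Fintype.card κ : ℕ) : ℂ) = (((co₁ i A).card + A.card + 1 : ℕ) : ℂ) := by
    rw [h]
    push_cast
    ring
  exact_mod_cast h2.symm

theorem card_co₂ {j₁ j₂ : J} {S : Finset J} (hne : j₁ ≠ j₂) (h₁ : j₁ ∉ S) (h₂ : j₂ ∉ S) :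
    (co₂ j₁ j₂ S).card + S.card + 2 = Fintype.card J := by
  classical
  have h : co₂ j₁ j₂ S = (insert j₁ (insert j₂ S))ᶜ := by
    ext j
    simp only [mem_co₂, Finset.mem_compl, Finset.mem_insert]
    tauto
  have h3 := Finset.card_add_card_compl (insert j₁ (insert j₂ S))
  rw [← h, Finset.card_insert_of_notMem (by simp [hne, h₁]), Finset.card_insert_of_notMem h₂] at h3
  omega

theorem nodesAt_eq_empty {c : J → ℂ} {w : ℂ} {i : κ} {j₁ j₂ : J} {A : Finset κ} {S : Finset J}
    (h : ¬(i ∉ A ∧ j₁ ∉ S ∧ j₂ ∉ S ∧ S.card = 2 * A.card)) : NodesAt c w i j₁ j₂ A S = ∅ := by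
  refine Set.eq_empty_of_forall_notMem fun x hx => h ?_
  exact ⟨hx.notMem, hx.notMem₁, hx.notMem₂, hx.left.card⟩

theorem bijOn_nodesAt {c : J → ℂ} {w : ℂ} {i : κ} {j₁ j₂ : J} {A : Finset κ} {S : Finset J}
    (hJ : Fintype.card J = 2 * Fintype.card κ) (hne : j₁ ≠ j₂) (hi : i ∉ A) (h₁ : j₁ ∉ S)
    (h₂ : j₂ ∉ S) (hcard : S.card = 2 * A.card) :
    Set.BijOn (fun x : (κ → ℂ) × (κ → ℂ) × (J → ℂ) =>
      (((fun k : A => x.1 k, fun k : A => x.2.1 k, fun j : S => x.2.2 j),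
        (fun k : co₁ i A => x.1 k, fun k : co₁ i A => x.2.1 k, fun j : co₂ j₁ j₂ S => x.2.2 j)) :
        ((A → ℂ) × (A → ℂ) × (S → ℂ)) ×
          ((co₁ i A → ℂ) × (co₁ i A → ℂ) × (co₂ j₁ j₂ S → ℂ))))
      (NodesAt c w i j₁ j₂ A S)
      (Pointed A (fun j : S => c j) w ×ˢ Pointed (co₁ i A) (fun j : co₂ j₁ j₂ S => c j) w) := by
  classical
  have hcard' : (co₂ j₁ j₂ S).card = 2 * (co₁ i A).card := by
    have h1 := card_co₁ hi
    have h2 := card_co₂ hne h₁ h₂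
    omega
  refine ⟨fun x hx => ⟨(isSide_iff.1 hx.left).2, (isSide_iff.1 hx.right).2⟩, ?_, ?_⟩
  · rintro ⟨u, v, y⟩ hx ⟨u', v', y'⟩ hx' h
    simp only [Prod.mk.injEq, funext_iff, Subtype.forall] at h
    obtain ⟨⟨ha, hb, hc⟩, ha', hb', hc'⟩ := h
    have hu : u = u' := by
      funext k
      by_cases hk : k ∈ A
      · exact ha k hk
      by_cases hki : k = i
      · exact hki ▸ hx.u_node.trans hx'.u_node.symm
      · exact ha' k (mem_co₁.2 ⟨hk, hki⟩)
    have hv : v = v' := by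
      funext k
      by_cases hk : k ∈ A
      · exact hb k hk
      by_cases hki : k = i
      · exact hki ▸ hx.v_node.trans hx'.v_node.symm
      · exact hb' k (mem_co₁.2 ⟨hk, hki⟩)
    subst hu hv
    have hy : y = y' := by
      funext j
      by_cases hj : j ∈ S
      · exact hc j hj
      by_cases hj1 : j = j₁
      · exact hj1 ▸ hx.y_node₁.trans hx'.y_node₁.symm
      by_cases hj2 : j = j₂
      · exact hj2 ▸ hx.y_node₂.trans hx'.y_node₂.symm
      · exact hc' j (mem_co₂.2 ⟨hj, hj1, hj2⟩)
    rw [hy]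
  · rintro ⟨⟨u, v, y⟩, u', v', y'⟩ ⟨h, h'⟩
    set U : κ → ℂ := fun k => if hk : k ∈ A then u ⟨k, hk⟩ else
      if hk : k ∈ co₁ i A then u' ⟨k, hk⟩ else 0 with hU
    set V : κ → ℂ := fun k => if hk : k ∈ A then v ⟨k, hk⟩ else
      if hk : k ∈ co₁ i A then v' ⟨k, hk⟩ else w with hV
    set Y : J → ℂ := fun j => if hj : j ∈ S then y ⟨j, hj⟩ else
      if hj : j ∈ co₂ j₁ j₂ S then y' ⟨j, hj⟩ else
      if j = j₁ then (1 - fd A U V 0) / (1 - fd (co₁ i A) U V 0) else -1 with hY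
    have e1 : (fun k : A => U k) = u := by
      funext k
      simp only [hU, k.2, dite_true]
    have e2 : (fun k : A => V k) = v := by
      funext k
      simp only [hV, k.2, dite_true]
    have e3 : (fun j : S => Y j) = y := by
      funext j
      simp only [hY, j.2, dite_true]
    have e4 : (fun k : co₁ i A => U k) = u' := by
      funext k
      simp only [hU, k.2, dite_true, (mem_co₁.1 k.2).1, dite_false]
    have e5 : (fun k : co₁ i A => V k) = v' := by
      funext k
      simp only [hV, k.2, dite_true, (mem_co₁.1 k.2).1, dite_false]
    have e6 : (fun j : co₂ j₁ j₂ S => Y j) = y' := by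
      funext j
      simp only [hY, j.2, dite_true, (mem_co₂.1 j.2).1, dite_false]
    refine ⟨(U, V, Y), ⟨hi, h₁, h₂, isSide_iff.2 ⟨hcard, ?_⟩, isSide_iff.2 ⟨hcard', ?_⟩, ?_, ?_, ?_,
      ?_⟩, ?_⟩
    · simp only [e1, e2, e3]
      exact h
    · simp only [e4, e5, e6]
      exact h'
    · simp [hU, hi, mem_co₁]
    · simp [hV, hi, mem_co₁]
    · simp [hY, h₁, mem_co₂]
    · simp [hY, h₂, mem_co₂, hne.symm]
    · simp only [e1, e2, e3, e4, e5, e6]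

end CriticalValues

namespace CriticalValues

open Filter Topology Metric

/-- Abel's binomial identity. -/
theorem abel_binomial (n : ℕ) (y : ℂ) : ∑ k ∈ Finset.range (n + 1),
    (n.choose k : ℂ) * ((k : ℂ) + 1) ^ (k - 1) * (y + (n - k : ℕ)) ^ (n - k) = (y + 1 + n) ^ n := by
  induction n generalizing y with
  | zero => simp
  | succ n ih =>
    set f : ℂ → ℂ := fun y => ∑ k ∈ Finset.range (n + 1 + 1),
      ((n + 1).choose k : ℂ) * ((k : ℂ) + 1) ^ (k - 1) * (y + (n + 1 - k : ℕ)) ^ (n + 1 - k) -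
        (y + 1 + (n + 1 : ℕ)) ^ (n + 1) with hf
    have hd : ∀ y, HasDerivAt f 0 y := by
      intro y
      have h1 : ∀ k ∈ Finset.range (n + 1 + 1), HasDerivAt (fun y : ℂ =>
          ((n + 1).choose k : ℂ) * ((k : ℂ) + 1) ^ (k - 1) * (y + (n + 1 - k : ℕ)) ^ (n + 1 - k))
          (((n + 1).choose k : ℂ) * ((k : ℂ) + 1) ^ (k - 1) * (((n + 1 - k : ℕ) : ℂ) *
            (y + (n + 1 - k : ℕ)) ^ (n + 1 - k - 1) * 1)) y := fun k _ =>
        (((hasDerivAt_id y).add_const _).pow _).const_mul _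
      have h2 : HasDerivAt (fun y : ℂ => (y + 1 + (n + 1 : ℕ)) ^ (n + 1))
          (((n + 1 : ℕ) : ℂ) * (y + 1 + (n + 1 : ℕ)) ^ n * 1) y :=
        (((hasDerivAt_id y).add_const (1 : ℂ)).add_const ((n + 1 : ℕ) : ℂ)).pow (n + 1)
      refine ((HasDerivAt.fun_sum h1).sub h2).congr_deriv ?_
      rw [Finset.sum_range_succ, sub_eq_zero]
      simp only [Nat.sub_self, Nat.cast_zero, zero_mul, mul_zero, add_zero, mul_one]
      have h3 := ih (y + 1)
      rw [show y + 1 + (n + 1 : ℕ) = y + 1 + 1 + n by push_cast; ring, ← h3, Finset.mul_sum]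
      refine Finset.sum_congr rfl fun k hk => ?_
      have hkn : k ≤ n := Finset.mem_range_succ_iff.1 hk
      have h4 : ((n + 1).choose k : ℂ) * ((n + 1 - k : ℕ) : ℂ) =
          ((n + 1 : ℕ) : ℂ) * n.choose k := by
        exact_mod_cast (Nat.choose_mul_succ_eq n k).symm.trans (mul_comm _ _)
      rw [show n + 1 - k - 1 = n - k by omega, show n + 1 - k = n - k + 1 by omega] at *
      push_cast at h4 ⊢
      linear_combination ((k : ℂ) + 1) ^ (k - 1) * (y + (((n - k : ℕ) : ℂ) + 1)) ^ (n - k) * h4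
    have h0 : f (-1 - (n + 1 : ℕ)) = 0 := by
      have h1 := congrFun (fwdDiff_iter_pow_eq_zero_of_lt (R := ℂ) (Nat.lt_succ_self n)) 1
      rw [fwdDiff_iter_eq_sum_shift] at h1
      rw [hf]
      simp only [Pi.zero_apply, zsmul_eq_mul, nsmul_eq_mul, mul_one] at h1
      dsimp only
      rw [show (-1 - ((n + 1 : ℕ) : ℂ) + 1 + ((n + 1 : ℕ) : ℂ)) = 0 by ring, zero_pow (by omega),
        sub_zero, ← h1]
      refine Finset.sum_congr rfl fun k hk => ?_
      have hkn : k ≤ n + 1 := Finset.mem_range_succ_iff.1 hk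
      rw [show (-1 - ((n + 1 : ℕ) : ℂ) + ((n + 1 - k : ℕ) : ℂ)) = -1 * ((k : ℂ) + 1) by
        push_cast [Nat.cast_sub hkn]; ring, mul_pow]
      have h2 : ((k : ℂ) + 1) ^ (k - 1) * ((k : ℂ) + 1) ^ (n + 1 - k) = (1 + (k : ℂ)) ^ n := by
        rcases Nat.eq_zero_or_pos k with rfl | hk
        · simp
        · rw [← pow_add, show k - 1 + (n + 1 - k) = n by omega, add_comm]
      push_cast
      linear_combination ((n + 1).choose k : ℂ) * (-1) ^ (n + 1 - k) * h2
    have h3 : f y = f (-1 - (n + 1 : ℕ)) :=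
      is_const_of_deriv_eq_zero (fun y => (hd y).differentiableAt) (fun y => (hd y).deriv) _ _
    rw [h0] at h3
    linear_combination h3

/-- The number of ways to join two rooted labelled trees. -/
theorem sum_choose_mul_pow_mul_pow (n : ℕ) : (n + 2) * ∑ k ∈ Finset.range (n + 1),
    n.choose k * ((k + 1) ^ (k - 1) * (n - k + 1) ^ (n - k - 1)) = 2 * (n + 2) ^ n := by
  have h1 : ∀ k, (k + 1) ^ (k - 1) * (k + 1) = (k + 1) ^ k := by
    rintro (_ | k)
    · simp
    · rw [← pow_succ]
      simp
  have h2 : ∑ k ∈ Finset.range (n + 1), n.choose k * ((k + 1) ^ (k - 1) * (n - k + 1) ^ (n - k)) =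
      (n + 2) ^ n := by
    have h := abel_binomial n 1
    have h' : ((∑ k ∈ Finset.range (n + 1),
        n.choose k * ((k + 1) ^ (k - 1) * (n - k + 1) ^ (n - k)) : ℕ) : ℂ) = ((n + 2) ^ n : ℕ) := by
      push_cast
      rw [show (n : ℂ) + 2 = 1 + 1 + n by ring, ← h]
      refine Finset.sum_congr rfl fun k _ => ?_
      ring
    exact_mod_cast h'
  have h3 : ∑ k ∈ Finset.range (n + 1), n.choose k * ((k + 1) ^ k * (n - k + 1) ^ (n - k - 1)) =
      (n + 2) ^ n := by
    rw [← h2, ← Finset.sum_range_reflect]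
    refine Finset.sum_congr rfl fun k hk => ?_
    have hkn : k ≤ n := Finset.mem_range_succ_iff.1 hk
    rw [show n + 1 - 1 - k = n - k by omega, Nat.choose_symm hkn, show n - (n - k) = k by omega]
    ring
  rw [two_mul]
  nth_rewrite 1 [← h2]
  rw [← h3, ← Finset.sum_add_distrib, Finset.mul_sum]
  refine Finset.sum_congr rfl fun k hk => ?_
  have hkn : k ≤ n := Finset.mem_range_succ_iff.1 hk
  rw [← h1 k, ← h1 (n - k), show n + 2 = (k + 1) + (n - k + 1) by omega]
  ring

end CriticalValues

namespace CriticalValues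

open Filter Topology Metric

/-- The counting formula for `Sol`. -/
def CountHolds (m : ℕ) : Prop :=
  ∀ (κ J : Type) [Fintype κ] [Fintype J] (c : J → ℂ), Fintype.card κ = m →
    Fintype.card J = 2 * Fintype.card κ → Function.Injective c →
    (m + 1) * (Sol κ c).ncard = (2 * m).factorial * (m + 1) ^ (m - 1)

variable {κ J : Type} [Fintype κ] [Fintype J]

theorem ncard_nodesAt {c : J → ℂ} {w : ℂ} {i : κ} {j₁ j₂ : J} {A : Finset κ} {S : Finset J}
    (ih : ∀ m < Fintype.card κ, CountHolds m)
    (hJ : Fintype.card J = 2 * Fintype.card κ) (hne : j₁ ≠ j₂)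
    (hval : ∀ j, c j = w ↔ j = j₁ ∨ j = j₂) (hinj : ∀ j l, c j ≠ w → c j = c l → j = l)
    (hi : i ∉ A) (h₁ : j₁ ∉ S) (h₂ : j₂ ∉ S) (hcard : S.card = 2 * A.card) :
    (NodesAt c w i j₁ j₂ A S).Finite ∧ (NodesAt c w i j₁ j₂ A S).ncard =
      (2 * A.card).factorial * (A.card + 1) ^ (A.card - 1) *
        ((2 * (co₁ i A).card).factorial * ((co₁ i A).card + 1) ^ ((co₁ i A).card - 1)) := by
  have hcard₁ := card_co₁ hi
  have hcard₂ := card_co₂ hne h₁ h₂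
  have hwS : ∀ j ∈ S, c j ≠ w := fun j hj he => by
    rcases (hval j).1 he with rfl | rfl
    exacts [h₁ hj, h₂ hj]
  have hwS' : ∀ j ∈ co₂ j₁ j₂ S, c j ≠ w := fun j hj he => by
    rcases (hval j).1 he with rfl | rfl
    exacts [(mem_co₂.1 hj).2.1 rfl, (mem_co₂.1 hj).2.2 rfl]
  have hl : Function.Injective fun j : S => c j := fun j l he =>
    Subtype.ext (hinj j l (hwS j j.2) he)
  have hr : Function.Injective fun j : co₂ j₁ j₂ S => c j := fun j l he =>
    Subtype.ext (hinj j l (hwS' j j.2) he)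
  have hcl : Fintype.card S = 2 * Fintype.card A := by simpa using hcard
  have hcr : Fintype.card (co₂ j₁ j₂ S) = 2 * Fintype.card (co₁ i A) := by
    simp only [Fintype.card_coe]
    omega
  obtain ⟨h1, h2⟩ := ncard_pointed hcl hl (w := w) fun j => hwS j j.2
  obtain ⟨h3, h4⟩ := ncard_pointed hcr hr (w := w) fun j => hwS' j j.2
  have hb := bijOn_nodesAt (c := c) (w := w) hJ hne hi h₁ h₂ hcard
  have h5 := ih A.card (by omega) A S (fun j : S => c j) (Fintype.card_coe A) hcl hl
  have h6 := ih (co₁ i A).card (by omega) (co₁ i A) (co₂ j₁ j₂ S) (fun j => c j)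
    (Fintype.card_coe _) hcr hr
  rw [Fintype.card_coe] at h2 h4
  refine ⟨hb.finite_iff_finite.2 (h1.prod h3), ?_⟩
  rw [Set.BijOn.ncard_eq hb, Set.ncard_prod, h2, h4, h5, h6]

theorem nodes_ncard {c : J → ℂ} {w : ℂ} {i : κ} {j₁ j₂ : J}
    (ih : ∀ m < Fintype.card κ, CountHolds m)
    (hJ : Fintype.card J = 2 * Fintype.card κ) (hne : j₁ ≠ j₂)
    (hval : ∀ j, c j = w ↔ j = j₁ ∨ j = j₂) (hinj : ∀ j l, c j ≠ w → c j = c l → j = l) :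
    (Nodes c w i j₁ j₂).Finite ∧ (Fintype.card κ + 1) * (Nodes c w i j₁ j₂).ncard =
      (2 * (Fintype.card κ - 1)).factorial * (2 * (Fintype.card κ + 1) ^ (Fintype.card κ - 1)) := by
  classical
  obtain ⟨M, hM⟩ : ∃ M, Fintype.card κ = M + 1 :=
    ⟨Fintype.card κ - 1, by have := Fintype.card_pos_iff.2 ⟨i⟩; omega⟩
  set U := (Finset.univ : Finset κ).erase i with hU
  set W := ((Finset.univ : Finset J).erase j₁).erase j₂ with hW
  have hUc : U.card = M := by
    rw [hU, Finset.card_erase_of_mem (Finset.mem_univ _), Finset.card_univ, hM]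
    rfl
  have hWc : W.card = 2 * M := by
    rw [hW, Finset.card_erase_of_mem (by simp [hne.symm]),
      Finset.card_erase_of_mem (Finset.mem_univ _), Finset.card_univ, hJ, hM]
    omega
  set G : Finset (Σ _ : Finset κ, Finset J) :=
    U.powerset.sigma fun A => W.powersetCard (2 * A.card) with hG
  have hmem : ∀ A S, (⟨A, S⟩ : Σ _ : Finset κ, Finset J) ∈ G ↔
      i ∉ A ∧ j₁ ∉ S ∧ j₂ ∉ S ∧ S.card = 2 * A.card := by
    intro A S
    simp only [hG, hU, hW, Finset.mem_sigma, Finset.mem_powerset, Finset.mem_powersetCard,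
      Finset.subset_erase, Finset.subset_univ, true_and, and_assoc]
  have hat : ∀ p : Σ _ : Finset κ, Finset J, (NodesAt c w i j₁ j₂ p.1 p.2).Finite := by
    rintro ⟨A, S⟩
    by_cases hp : i ∉ A ∧ j₁ ∉ S ∧ j₂ ∉ S ∧ S.card = 2 * A.card
    · exact (ncard_nodesAt ih hJ hne hval hinj hp.1 hp.2.1 hp.2.2.1 hp.2.2.2).1
    · rw [nodesAt_eq_empty hp]
      exact Set.finite_empty
  have hN : Nodes c w i j₁ j₂ = (fun t : Σ _ : (Σ _ : Finset κ, Finset J),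
      (κ → ℂ) × (κ → ℂ) × (J → ℂ) => (t.1.1, t.1.2, t.2)) ''
      (G.sigma fun p => (hat p).toFinset : Finset _) := by
    ext ⟨A, S, x⟩
    constructor
    · intro hx
      have hx' : x ∈ NodesAt c w i j₁ j₂ A S := hx
      refine ⟨⟨⟨A, S⟩, x⟩, ?_, rfl⟩
      rw [Finset.mem_coe, Finset.mem_sigma]
      exact ⟨(hmem A S).2 ⟨hx'.notMem, hx'.notMem₁, hx'.notMem₂, hx'.left.card⟩,
        (hat ⟨A, S⟩).mem_toFinset.2 hx'⟩
    · rintro ⟨⟨⟨A', S'⟩, x'⟩, h1, h2⟩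
      simp only [Prod.mk.injEq] at h2
      obtain ⟨rfl, rfl, rfl⟩ := h2
      exact (hat _).mem_toFinset.1 (Finset.mem_sigma.1 h1).2
  have hinj' : Function.Injective (fun t : Σ _ : (Σ _ : Finset κ, Finset J),
      (κ → ℂ) × (κ → ℂ) × (J → ℂ) => (t.1.1, t.1.2, t.2)) := by
    rintro ⟨⟨A, S⟩, x⟩ ⟨⟨A', S'⟩, x'⟩ h
    simp only [Prod.mk.injEq] at h
    obtain ⟨rfl, rfl, rfl⟩ := h
    rfl
  have hcount : (Nodes c w i j₁ j₂).ncard = ∑ A ∈ U.powerset, (2 * M).choose (2 * A.card) *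
      ((2 * A.card).factorial * (A.card + 1) ^ (A.card - 1) *
        ((2 * (M - A.card)).factorial * ((M - A.card) + 1) ^ ((M - A.card) - 1))) := by
    rw [hN, Set.ncard_image_of_injective _ hinj', Set.ncard_coe_finset, Finset.card_sigma, hG,
      Finset.sum_sigma]
    refine Finset.sum_congr rfl fun A hA => ?_
    rw [← hWc, ← Finset.card_powersetCard]
    refine Finset.sum_const_nat fun S hS => ?_
    have hp := (hmem A S).1 (Finset.mem_sigma.2 ⟨hA, hS⟩)
    have h1 := card_co₁ hp.1
    rw [← Set.ncard_eq_toFinset_card _ (hat ⟨A, S⟩),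
      (ncard_nodesAt ih hJ hne hval hinj hp.1 hp.2.1 hp.2.2.1 hp.2.2.2).2,
      show (co₁ i A).card = M - A.card by omega]
  refine ⟨hN ▸ (Finset.finite_toSet _).image _, ?_⟩
  rw [hcount, Finset.sum_powerset_apply_card (fun a : ℕ => (2 * M).choose (2 * a) *
      ((2 * a).factorial * (a + 1) ^ (a - 1) *
        ((2 * (M - a)).factorial * ((M - a) + 1) ^ ((M - a) - 1)) : ℕ)), hUc, hM,
    show M + 1 + 1 = M + 2 from rfl, Nat.add_sub_cancel, ← sum_choose_mul_pow_mul_pow,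
    Finset.mul_sum, Finset.mul_sum, Finset.mul_sum]
  refine Finset.sum_congr rfl fun a ha => ?_
  have haM : a ≤ M := Finset.mem_range_succ_iff.1 ha
  rw [← Nat.choose_mul_factorial_mul_factorial (show 2 * a ≤ 2 * M by omega),
    show 2 * M - 2 * a = 2 * (M - a) by omega, smul_eq_mul]
  ring

end CriticalValues

namespace CriticalValues

open Filter Topology Metric

theorem div_bounds {m M a b X Y F G : ℝ} (hm : 0 < m) (hX : 0 ≤ X) (ha : 0 < a) (hY : 0 < Y)
    (h₁ : m * X ≤ F) (h₂ : F ≤ M * X) (h₃ : a * Y ≤ G) (h₄ : G ≤ b * Y) :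
    m / b * (X / Y) ≤ F / G ∧ F / G ≤ M / a * (X / Y) := by
  have hG : 0 < G := lt_of_lt_of_le (mul_pos ha hY) h₃
  have hF : 0 ≤ F := (mul_nonneg hm.le hX).trans h₁
  constructor
  · rw [div_mul_div_comm]
    exact div_le_div₀ hF h₁ hG h₄
  · rw [div_mul_div_comm]
    exact div_le_div₀ (hF.trans h₂) h₂ (mul_pos ha hY) h₃

/-- A nowhere vanishing function on the plane has order zero at infinity. -/
theorem order_infty_eq_zero {f : ℂ → ℂ} {d : ℤ} (hf : Differentiable ℂ f) (h0 : ∀ z, f z ≠ 0)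
    {m M : ℝ} (hm : 0 < m)
    (h : ∀ᶠ z in cocompact ℂ, m * ‖z‖ ^ d ≤ ‖f z‖ ∧ ‖f z‖ ≤ M * ‖z‖ ^ d) : d = 0 := by
  have hzpow : ∀ {n : ℤ}, n < 0 → Tendsto (fun z : ℂ => ‖z‖ ^ n) (cocompact ℂ) (𝓝 0) := by
    intro n hn
    obtain ⟨k, rfl⟩ : ∃ k : ℕ, n = -(k + 1 : ℕ) := ⟨(-n - 1).toNat, by omega⟩
    simp only [zpow_neg, zpow_natCast]
    exact tendsto_inv_atTop_zero.comp
      ((tendsto_pow_atTop (Nat.succ_ne_zero k)).comp (tendsto_norm_cocompact_atTop (E := ℂ)))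
  rcases lt_trichotomy d 0 with hd | hd | hd
  · have h1 : Tendsto f (cocompact ℂ) (𝓝 0) := by
      refine squeeze_zero_norm' (h.mono fun z hz => hz.2) ?_
      simpa using (hzpow hd).const_mul M
    exact absurd (hf.apply_eq_of_tendsto_cocompact 0 h1) (h0 0)
  · exact hd
  · have h1 : Tendsto (fun z => (f z)⁻¹) (cocompact ℂ) (𝓝 0) := by
      refine squeeze_zero_norm' (a := fun z => m⁻¹ * ‖z‖ ^ (-d)) ?_ ?_
      · have h2 : ∀ᶠ z : ℂ in cocompact ℂ, 0 < ‖z‖ :=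
          (tendsto_norm_cocompact_atTop (E := ℂ)).eventually (eventually_gt_atTop 0)
        filter_upwards [h, h2] with z hz hz0
        rw [norm_inv, zpow_neg, ← mul_inv]
        have := zpow_pos hz0 d
        exact inv_anti₀ (by positivity) hz.1
      · simpa using (hzpow (show -d < 0 by omega)).const_mul m⁻¹
    exact absurd ((hf.inv h0).apply_eq_of_tendsto_cocompact 0 h1) (inv_ne_zero (h0 0))

/-- The order at infinity of a function is the sum of its orders at its zeros. -/
theorem order_infty_eq (E : Finset ℂ) (k : ℕ) : ∀ (f : ℂ → ℂ) (d : ℤ),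
    (∀ z ∉ E, DifferentiableAt ℂ f z ∧ f z ≠ 0) →
    (∀ e ∈ E, ∃ m M : ℝ, 0 < m ∧ ∀ᶠ z in 𝓝[≠] e,
      m * ‖z - e‖ ^ k ≤ ‖f z‖ ∧ ‖f z‖ ≤ M * ‖z - e‖ ^ k) →
    (∃ m M : ℝ, 0 < m ∧ ∀ᶠ z in cocompact ℂ, m * ‖z‖ ^ d ≤ ‖f z‖ ∧ ‖f z‖ ≤ M * ‖z‖ ^ d) →
    d = k * E.card := by
  classical
  induction E using Finset.induction_on with
  | empty =>
    rintro f d hf - ⟨m, M, hm, h⟩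
    simpa using order_infty_eq_zero (fun z => (hf z (by simp)).1) (fun z => (hf z (by simp)).2) hm h
  | insert e E he ih =>
    intro f d hf hE ⟨m, M, hm, h⟩
    set g : ℂ → ℂ := fun z => f z / (z - e) ^ k with hg
    set g₁ := Function.update g e (limUnder (𝓝[≠] e) g) with hg₁
    have hg₁' : ∀ z ≠ e, g₁ z = g z := fun z hz => Function.update_of_ne hz _ _
    have hgd : ∀ z ∉ insert e E, DifferentiableAt ℂ g z ∧ g z ≠ 0 := by
      intro z hz
      have hze : z - e ≠ 0 := sub_ne_zero.2 fun h => hz (h ▸ Finset.mem_insert_self _ _)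
      exact ⟨(hf z hz).1.div (by fun_prop) (pow_ne_zero k hze),
        div_ne_zero (hf z hz).2 (pow_ne_zero k hze)⟩
    have hEc : ∀ᶠ z in 𝓝 e, z ∉ E :=
      E.finite_toSet.isClosed.isOpen_compl.mem_nhds fun h => he h
    obtain ⟨m₀, M₀, hm₀, h₀⟩ := hE e (Finset.mem_insert_self _ _)
    have hge : ∀ᶠ z in 𝓝[≠] e, z ∉ insert e E ∧ m₀ ≤ ‖g z‖ ∧ ‖g z‖ ≤ M₀ := by
      filter_upwards [h₀, nhdsWithin_le_nhds hEc, self_mem_nhdsWithin] with z hz hz' hze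
      have hze' : 0 < ‖z - e‖ ^ k := pow_pos (norm_pos_iff.2 (sub_ne_zero.2 hze)) k
      refine ⟨?_, ?_⟩
      · rw [Finset.mem_insert, not_or]
        exact ⟨hze, hz'⟩
      · rw [hg, norm_div, norm_pow, le_div_iff₀ hze', div_le_iff₀ hze']
        exact hz
    have hde : DifferentiableAt ℂ g₁ e := by
      set s : Set ℂ := insert e {z | z ∉ insert e E ∧ m₀ ≤ ‖g z‖ ∧ ‖g z‖ ≤ M₀} with hs
      have hs' : s ∈ 𝓝 e := insert_mem_nhds_iff.2 hge
      have hss : ∀ z ∈ s \ {e}, z ∉ insert e E ∧ m₀ ≤ ‖g z‖ ∧ ‖g z‖ ≤ M₀ := fun z hz =>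
        hz.1.resolve_left hz.2
      refine (Complex.differentiableOn_update_limUnder_of_bddAbove hs' (fun z hz =>
        (hgd z (hss z hz).1).1.differentiableWithinAt) ⟨M₀, ?_⟩).differentiableAt hs'
      rintro _ ⟨z, hz, rfl⟩
      exact (hss z hz).2.2
    have hne : ∀ᶠ z in 𝓝[≠] e, g₁ z = g z := by
      filter_upwards [self_mem_nhdsWithin] with z hz using hg₁' z hz
    have h0e : g₁ e ≠ 0 := by
      have h1 : Tendsto (fun z => ‖g₁ z‖) (𝓝[≠] e) (𝓝 ‖g₁ e‖) :=
        (hde.continuousAt.tendsto.mono_left nhdsWithin_le_nhds).norm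
      have h2 : m₀ ≤ ‖g₁ e‖ := ge_of_tendsto h1 (by
        filter_upwards [hge, hne] with z hz hz'
        rw [hz']
        exact hz.2.1)
      exact norm_pos_iff.1 (lt_of_lt_of_le hm₀ h2)
    have key := ih g₁ (d - k) ?_ ?_ ?_
    · rw [Finset.card_insert_of_notMem he]
      push_cast
      linear_combination key
    · intro z hz
      by_cases hze : z = e
      · rw [hze]
        exact ⟨hde, h0e⟩
      have hz' : z ∉ insert e E := by
        rw [Finset.mem_insert, not_or]
        exact ⟨hze, hz⟩
      rw [hg₁' z hze]
      refine ⟨(hgd z hz').1.congr_of_eventuallyEq ?_, (hgd z hz').2⟩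
      filter_upwards [isOpen_ne.mem_nhds hze] with y hy using hg₁' y hy
    · intro x hx
      have hxe : x ≠ e := fun h => he (h ▸ hx)
      obtain ⟨m', M', hm', h'⟩ := hE x (Finset.mem_insert_of_mem hx)
      set a := ‖x - e‖ ^ k with ha
      have ha0 : 0 < a := pow_pos (norm_pos_iff.2 (sub_ne_zero.2 hxe)) k
      have hat : Tendsto (fun z => ‖z - e‖ ^ k) (𝓝 x) (𝓝 a) :=
        Continuous.tendsto (by fun_prop) x
      refine ⟨m' / (2 * a), M' / (a / 2), by positivity, ?_⟩
      filter_upwards [h', nhdsWithin_le_nhds (hat.eventually (lt_mem_nhds (half_lt_self ha0))),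
        nhdsWithin_le_nhds (hat.eventually (gt_mem_nhds (show a < 2 * a by linarith))),
        nhdsWithin_le_nhds (isOpen_ne.mem_nhds hxe)] with z h1 h2 h3 h4
      have h5 := div_bounds (X := ‖z - x‖ ^ k) (Y := 1) (a := a / 2) (b := 2 * a)
        (G := ‖z - e‖ ^ k) hm' (by positivity) (by positivity) one_pos
        h1.1 h1.2 (by linarith) (by linarith)
      rw [hg₁' z h4, hg, norm_div, norm_pow]
      rwa [div_one] at h5
    · refine ⟨m / 2 ^ k, M / (1 / 2) ^ k, by positivity, ?_⟩
      have h1 : ∀ᶠ z : ℂ in cocompact ℂ, 2 * ‖e‖ + 1 < ‖z‖ :=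
        (tendsto_norm_cocompact_atTop (E := ℂ)).eventually (eventually_gt_atTop _)
      filter_upwards [h, h1] with z h2 h3
      have hz0 : 0 < ‖z‖ := by linarith [norm_nonneg e]
      have hz1 : 1 / 2 * ‖z‖ ≤ ‖z - e‖ := by linarith [norm_sub_norm_le z e]
      have hz2 : ‖z - e‖ ≤ 2 * ‖z‖ := by linarith [norm_sub_le z e, norm_nonneg e]
      have hze : z ≠ e := by
        rintro rfl
        linarith [norm_nonneg z]
      have h5 := div_bounds (X := ‖z‖ ^ d) (Y := ‖z‖ ^ k) (a := (1 / 2) ^ k) (b := 2 ^ k)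
        (G := ‖z - e‖ ^ k) hm (by positivity) (by positivity) (by positivity) h2.1 h2.2
        (by rw [← mul_pow]; gcongr) (by rw [← mul_pow]; gcongr)
      rw [hg₁' z hze, hg, norm_div, norm_pow, zpow_sub₀ hz0.ne', zpow_natCast]
      exact h5

end CriticalValues

namespace CriticalValues

open Filter Topology Metric

variable {κ J : Type} [Fintype κ] [Fintype J]

theorem eventually_ncard_eq (hJ : Fintype.card J = 2 * Fintype.card κ) {c₀ : J → ℂ}
    (hc : Function.Injective c₀) : ∀ᶠ c in 𝓝 c₀, (Sol κ c).ncard = (Sol κ c₀).ncard := by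
  obtain ⟨br, -, h⟩ := exists_branches (κ := κ) hJ hc
  exact h.mono fun c hb => (Set.BijOn.ncard_eq hb).symm

theorem differentiableAt_resProd (i : κ) (hJ : Fintype.card J = 2 * Fintype.card κ) {c₀ : J → ℂ}
    (hc : Function.Injective c₀) : DifferentiableAt ℂ (resProd i) c₀ := by
  obtain ⟨br, h1, h2⟩ := exists_branches (κ := κ) hJ hc
  have hfin := finite_sol (κ := κ) hJ hc
  have h3 : resProd i =ᶠ[𝓝 c₀] fun c => ∏ x ∈ hfin.toFinset, (br x c).1 i := by
    filter_upwards [h2] with c hb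
    rw [resProd, ← hb.image_eq, finprod_mem_image hb.injOn,
      finprod_mem_eq_finite_toFinset_prod _ hfin]
  refine DifferentiableAt.congr_of_eventuallyEq ?_ h3
  have h4 : ∀ x ∈ hfin.toFinset, DifferentiableAt ℂ (fun c => (br x c).1 i) c₀ := fun x hx =>
    differentiableAt_pi.1 (h1 x (hfin.mem_toFinset.1 hx)).2.self_of_nhds.fst i
  classical
  have h5 := (HasFDerivAt.finsetProd fun x hx => (h4 x hx).hasFDerivAt).differentiableAt
  simpa only [Finset.prod_fn] using h5

theorem resProd_ne_zero (i : κ) (hJ : Fintype.card J = 2 * Fintype.card κ) {c : J → ℂ}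
    (hc : Function.Injective c) : resProd i c ≠ 0 := by
  have hfin := finite_sol (κ := κ) hJ hc
  rw [resProd, finprod_mem_eq_finite_toFinset_prod _ hfin]
  refine Finset.prod_ne_zero_iff.2 fun x hx => ?_
  have hx' : IsSol c x.1 x.2.1 x.2.2 := hfin.mem_toFinset.1 hx
  exact hx'.res_ne i

/-- Rescaling of a normalised rational function. -/
def rescale (r : ℂ) (x : (κ → ℂ) × (κ → ℂ) × (J → ℂ)) : (κ → ℂ) × (κ → ℂ) × (J → ℂ) :=
  (fun k => r ^ 2 * x.1 k, fun k => r * x.2.1 k, fun j => r * x.2.2 j)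

theorem rescale_mem {c : J → ℂ} {r : ℂ} (hr : r ≠ 0) {x : (κ → ℂ) × (κ → ℂ) × (J → ℂ)}
    (hx : x ∈ Sol κ c) : rescale r x ∈ Sol κ fun j => r * c j := by
  obtain ⟨α, p, z⟩ := x
  have h : IsSol c α p z := hx
  refine ⟨fun k => mul_ne_zero (pow_ne_zero 2 hr) (h.res_ne k),
    fun k l hkl => h.inj (mul_left_cancel₀ hr hkl),
    fun j k hjk => h.ne_pole j k (mul_left_cancel₀ hr hjk), fun j => ?_, fun j => ?_⟩
  · rw [← h.crit j]
    simp only [rescale, rd, ← mul_sub, mul_pow, mul_div_mul_left _ _ (pow_ne_zero 2 hr)]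
  · rw [← h.val j]
    simp only [rescale, rf, ← mul_sub, pow_two, mul_assoc, mul_div_mul_left _ _ hr, mul_add,
      Finset.mul_sum, mul_div_assoc]

theorem bijOn_rescale (c : J → ℂ) {r : ℂ} (hr : r ≠ 0) :
    Set.BijOn (rescale r) (Sol κ c) (Sol κ fun j => r * c j) := by
  have h1 : ∀ {r : ℂ}, r ≠ 0 → ∀ x : (κ → ℂ) × (κ → ℂ) × (J → ℂ),
      rescale r⁻¹ (rescale r x) = x := by
    intro r hr x
    simp only [rescale, ← mul_assoc, ← mul_pow, inv_mul_cancel₀ hr, one_pow, one_mul]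
  refine Set.InvOn.bijOn (f' := rescale r⁻¹) ⟨fun x _ => h1 hr x, fun x _ => ?_⟩
    (fun x hx => rescale_mem hr hx) fun x hx => ?_
  · have := h1 (inv_ne_zero hr) x
    rwa [inv_inv] at this
  · have := rescale_mem (inv_ne_zero hr) hx
    simpa only [← mul_assoc, inv_mul_cancel₀ hr, one_mul] using this

theorem resProd_mul (i : κ) (hJ : Fintype.card J = 2 * Fintype.card κ) {c : J → ℂ}
    (hc : Function.Injective c) {r : ℂ} (hr : r ≠ 0) :
    resProd i (fun j => r * c j) = r ^ (2 * (Sol κ c).ncard) * resProd i c := by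
  have hfin := finite_sol (κ := κ) hJ hc
  have hb := bijOn_rescale (κ := κ) c hr
  rw [resProd, ← hb.image_eq, finprod_mem_image hb.injOn, resProd,
    finprod_mem_eq_finite_toFinset_prod _ hfin, finprod_mem_eq_finite_toFinset_prod _ hfin,
    pow_mul, Set.ncard_eq_toFinset_card _ hfin, ← Finset.prod_const, ← Finset.prod_mul_distrib]
  rfl

/-- A direction in which the points `c j` collide at different times. -/
theorem exists_generic_direction {c : J → ℂ} (hc : Function.Injective c) : ∃ B : J → ℂ,
    Function.Injective B ∧ ∀ j l j' l', j ≠ l → j' ≠ l' →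
      (c j - c l) * (B j' - B l') = (c j' - c l') * (B j - B l) →
        (j' = j ∨ j' = l) ∧ (l' = j ∨ l' = l) := by
  classical
  set φ : J × J → (J → ℂ) →ₗ[ℂ] ℂ := fun t : J × J =>
    LinearMap.proj (R := ℂ) (φ := fun _ : J => ℂ) t.1 - LinearMap.proj t.2 with hφ
  have hφa : ∀ t B, φ t B = B t.1 - B t.2 := fun t B => rfl
  set ψ : (J × J) × (J × J) → (J → ℂ) →ₗ[ℂ] ℂ := fun t =>
    (c t.1.1 - c t.1.2) • φ t.2 - (c t.2.1 - c t.2.2) • φ t.1 with hψ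
  have hψa : ∀ t B, ψ t B = (c t.1.1 - c t.1.2) * (B t.2.1 - B t.2.2) -
    (c t.2.1 - c t.2.2) * (B t.1.1 - B t.1.2) := fun t B => rfl
  set s : Finset (Submodule ℂ (J → ℂ)) :=
    ((Finset.univ.filter fun t => φ t ≠ 0).image fun t => (φ t).ker) ∪
      ((Finset.univ.filter fun t => ψ t ≠ 0).image fun t => (ψ t).ker) with hs
  have htop : ⊤ ∉ s := by
    simp only [hs, Finset.mem_union, Finset.mem_image, Finset.mem_filter, LinearMap.ker_eq_top]
    rintro (⟨t, ⟨-, h1⟩, h2⟩ | ⟨t, ⟨-, h1⟩, h2⟩) <;> exact h1 h2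
  obtain ⟨B, hB⟩ := (Set.ne_univ_iff_exists_notMem _).1
    (Subspace.biUnion_ne_univ_of_top_notMem htop)
  simp only [Set.mem_iUnion, not_exists] at hB
  have hB1 : ∀ t, φ t ≠ 0 → φ t B ≠ 0 := fun t ht h0 => hB (φ t).ker
    (Finset.mem_union_left _ (Finset.mem_image.2 ⟨t, by simpa using ht, rfl⟩)) h0
  have hB2 : ∀ t, ψ t ≠ 0 → ψ t B ≠ 0 := fun t ht h0 => hB (ψ t).ker
    (Finset.mem_union_right _ (Finset.mem_image.2 ⟨t, by simpa using ht, rfl⟩)) h0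
  refine ⟨B, fun j l hjl => ?_, fun j l j' l' hjl hjl' he => ?_⟩
  · by_contra hne
    refine hB1 (j, l) (fun h0 => ?_) (sub_eq_zero.2 hjl)
    have h1 := LinearMap.congr_fun h0 (Pi.single j 1)
    rw [hφa] at h1
    simp [Ne.symm hne] at h1
  · have h0 : ψ ((j, l), (j', l')) = 0 := by
      by_contra h0
      refine hB2 _ h0 ?_
      rw [hψa]
      exact sub_eq_zero.2 he
    constructor
    · by_contra hcon
      rw [not_or] at hcon
      have h1 := LinearMap.congr_fun h0 (Pi.single j' 1)
      rw [hψa] at h1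
      simp [Ne.symm hcon.1, Ne.symm hcon.2, hjl'.symm, sub_eq_zero, hc.eq_iff, hjl] at h1
    · by_contra hcon
      rw [not_or] at hcon
      have h1 := LinearMap.congr_fun h0 (Pi.single l' 1)
      rw [hψa] at h1
      simp [Ne.symm hcon.1, Ne.symm hcon.2, hjl', sub_eq_zero, hc.eq_iff, hjl.symm] at h1

end CriticalValues

namespace CriticalValues

open Filter Topology Metric

variable {κ J : Type} [Fintype κ] [Fintype J]

/-- The time at which the points with indices `q.1` and `q.2` collide on the line `c + σ B`. -/
noncomputable def collisionTime (c B : J → ℂ) (q : J × J) : ℂ :=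
  -(c q.1 - c q.2) / (B q.1 - B q.2)

open Classical in
/-- The finite set of collision times on the line `c + σ B`. -/
noncomputable def collisions (c B : J → ℂ) : Finset ℂ :=
  (Finset.univ : Finset J).offDiag.image (collisionTime c B)

theorem eq_collisionTime_iff {c B : J → ℂ} (hB : Function.Injective B) {j l : J} (h : j ≠ l)
    (σ : ℂ) : c j + σ * B j = c l + σ * B l ↔ σ = collisionTime c B (j, l) := by
  have h1 : B j - B l ≠ 0 := sub_ne_zero.2 fun h' => h (hB h')
  rw [collisionTime, eq_div_iff h1]
  constructor <;> intro h2 <;> linear_combination h2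

theorem mem_collisions {c B : J → ℂ} {σ : ℂ} :
    σ ∈ collisions c B ↔ ∃ j l, j ≠ l ∧ σ = collisionTime c B (j, l) := by
  simp only [collisions, Finset.mem_image, Finset.mem_offDiag, Finset.mem_univ, true_and,
    Prod.exists]
  exact exists_congr fun j => exists_congr fun l => and_congr_right fun _ => eq_comm

theorem injective_of_notMem_collisions {c B : J → ℂ} (hB : Function.Injective B) {σ : ℂ}
    (h : σ ∉ collisions c B) : Function.Injective fun j => c j + σ * B j := by
  intro j l hjl
  by_contra hne
  exact h (mem_collisions.2 ⟨j, l, hne, (eq_collisionTime_iff hB hne σ).1 hjl⟩)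

section generic

variable {c B : J → ℂ}

theorem collisionTime_inj (hB : Function.Injective B)
    (hgen : ∀ j l j' l', j ≠ l → j' ≠ l' →
      (c j - c l) * (B j' - B l') = (c j' - c l') * (B j - B l) →
      (j' = j ∨ j' = l) ∧ (l' = j ∨ l' = l)) {j l j' l' : J} (h : j ≠ l) (h' : j' ≠ l')
    (he : collisionTime c B (j, l) = collisionTime c B (j', l')) :
    (j' = j ∨ j' = l) ∧ (l' = j ∨ l' = l) := by
  have h1 : B j - B l ≠ 0 := sub_ne_zero.2 fun h' => h (hB h')
  have h2 : B j' - B l' ≠ 0 := sub_ne_zero.2 fun h'' => h' (hB h'')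
  refine hgen j l j' l' h h' ?_
  rw [collisionTime, collisionTime, div_eq_div_iff h1 h2] at he
  linear_combination -he

theorem two_mul_card_collisions (hB : Function.Injective B)
    (hgen : ∀ j l j' l', j ≠ l → j' ≠ l' →
      (c j - c l) * (B j' - B l') = (c j' - c l') * (B j - B l) →
      (j' = j ∨ j' = l) ∧ (l' = j ∨ l' = l)) :
    2 * (collisions c B).card = Fintype.card J * (Fintype.card J - 1) := by
  classical
  have h1 := Finset.card_eq_sum_card_image (collisionTime c B) (Finset.univ : Finset J).offDiag
  have h2 : ∀ e ∈ (Finset.univ : Finset J).offDiag.image (collisionTime c B),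
      ((Finset.univ : Finset J).offDiag.filter fun q => collisionTime c B q = e).card = 2 := by
    intro e he
    obtain ⟨⟨j, l⟩, hq, rfl⟩ := Finset.mem_image.1 he
    have hjl : j ≠ l := (Finset.mem_offDiag.1 hq).2.2
    rw [Finset.card_eq_two]
    refine ⟨(j, l), (l, j), fun h => hjl (Prod.ext_iff.1 h).1, ?_⟩
    ext ⟨j', l'⟩
    simp only [Finset.mem_filter, Finset.mem_offDiag, Finset.mem_univ, true_and,
      Finset.mem_insert, Finset.mem_singleton, Prod.mk.injEq]
    constructor
    · rintro ⟨h3, h4⟩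
      obtain ⟨h5 | h5, h6 | h6⟩ := collisionTime_inj hB hgen hjl h3 h4.symm
      · exact absurd (h5.trans h6.symm) h3
      · exact Or.inl ⟨h5, h6⟩
      · exact Or.inr ⟨h5, h6⟩
      · exact absurd (h5.trans h6.symm) h3
    · rintro (⟨rfl, rfl⟩ | ⟨rfl, rfl⟩)
      · exact ⟨hjl, rfl⟩
      · refine ⟨hjl.symm, ?_⟩
        rw [collisionTime, collisionTime, ← neg_div_neg_eq]
        simp only [neg_sub]
  rw [Finset.sum_congr rfl h2, Finset.sum_const, smul_eq_mul, Finset.offDiag_card,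
    Finset.card_univ] at h1
  rw [Nat.mul_sub_one, h1, collisions, mul_comm]

end generic

theorem continuous_line (c B : J → ℂ) : Continuous fun (σ : ℂ) (j : J) => c j + σ * B j := by
  fun_prop

theorem ncard_sol_line (hJ : Fintype.card J = 2 * Fintype.card κ) {c B : J → ℂ}
    (hB : Function.Injective B) {σ τ : ℂ} (hσ : σ ∉ collisions c B) (hτ : τ ∉ collisions c B) :
    (Sol κ fun j => c j + σ * B j).ncard = (Sol κ fun j => c j + τ * B j).ncard := by
  have hconn : IsPreconnected ((collisions c B : Set ℂ)ᶜ) :=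
    ((collisions c B).countable_toSet.isConnected_compl_of_one_lt_rank
      (by rw [Complex.rank_real_complex]; exact Cardinal.one_lt_two)).isPreconnected
  have hcont : ContinuousOn (fun σ : ℂ => (Sol κ fun j => c j + σ * B j).ncard)
      ((collisions c B : Set ℂ)ᶜ) := by
    intro x hx
    have h1 := eventually_ncard_eq (κ := κ) hJ (injective_of_notMem_collisions hB (σ := x) hx)
    have h2 := ((continuous_line c B).tendsto x).eventually h1
    exact (tendsto_const_nhds.congr' (h2.mono fun y hy => hy.symm)).mono_left nhdsWithin_le_nhds
  exact hconn.constant hcont hσ hτ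

theorem resProd_line_bounds_infty (i : κ) (hJ : Fintype.card J = 2 * Fintype.card κ) (c : J → ℂ)
    {B : J → ℂ} (hB : Function.Injective B) : ∃ m M : ℝ, 0 < m ∧ ∀ᶠ σ in cocompact ℂ,
      (Sol κ fun j => c j + σ * B j).ncard = (Sol κ B).ncard ∧
      m * ‖σ‖ ^ (2 * (Sol κ B).ncard) ≤ ‖resProd i fun j => c j + σ * B j‖ ∧
      ‖resProd i fun j => c j + σ * B j‖ ≤ M * ‖σ‖ ^ (2 * (Sol κ B).ncard) := by
  have h0 : Tendsto (fun σ : ℂ => σ⁻¹) (cocompact ℂ) (𝓝 0) := by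
    rw [← Metric.cobounded_eq_cocompact]
    exact tendsto_inv₀_cobounded
  have h1 : Tendsto (fun (σ : ℂ) (j : J) => B j + σ⁻¹ * c j) (cocompact ℂ) (𝓝 B) := by
    have := ((continuous_line B c).tendsto 0).comp h0
    simp only [zero_mul, add_zero] at this
    exact this
  have h2 := eventually_ncard_eq (κ := κ) hJ hB
  have h3 : ∀ᶠ b in 𝓝 B, Function.Injective b := by
    simp only [Function.Injective, Filter.eventually_all]
    intro j l
    by_cases h : j = l
    · exact Eventually.of_forall fun _ _ => h
    · have h4 : Tendsto (fun b : J → ℂ => b j - b l) (𝓝 B) (𝓝 (B j - B l)) :=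
        (by fun_prop : Continuous fun b : J → ℂ => b j - b l).tendsto B
      refine (h4.eventually_ne (sub_ne_zero.2 fun h' => h (hB h'))).mono fun b hb hb' => ?_
      exact absurd (sub_eq_zero.2 hb') hb
  have h4 : Tendsto (fun b => ‖resProd i b‖) (𝓝 B) (𝓝 ‖resProd i B‖) :=
    (differentiableAt_resProd i hJ hB).continuousAt.tendsto.norm
  have hpos : 0 < ‖resProd i B‖ := norm_pos_iff.2 (resProd_ne_zero i hJ hB)
  have h5 := h4.eventually (lt_mem_nhds (half_lt_self hpos))
  have h6 := h4.eventually (gt_mem_nhds (lt_two_mul_self hpos))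
  have hne : ∀ᶠ σ : ℂ in cocompact ℂ, σ ≠ 0 := by
    have := (isCompact_singleton (x := (0 : ℂ))).compl_mem_cocompact
    exact this
  refine ⟨‖resProd i B‖ / 2, 2 * ‖resProd i B‖, half_pos hpos, ?_⟩
  filter_upwards [hne, h1.eventually h2, h1.eventually h3, h1.eventually h5, h1.eventually h6]
    with σ hσ e2 e3 e5 e6
  have hb : (fun j => c j + σ * B j) = fun j => σ * (B j + σ⁻¹ * c j) := by
    funext j
    field_simp
    ring
  rw [hb, ← (bijOn_rescale (κ := κ) (fun j => B j + σ⁻¹ * c j) hσ).ncard_eq, resProd_mul i hJ e3 hσ,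
    e2, norm_mul, norm_pow]
  have hp : 0 ≤ ‖σ‖ ^ (2 * (Sol κ B).ncard) := by positivity
  refine ⟨rfl, ?_, ?_⟩
  · rw [mul_comm]
    exact mul_le_mul_of_nonneg_left e5.le hp
  · rw [mul_comm]
    exact mul_le_mul_of_nonneg_right e6.le hp

theorem countHolds_zero : CountHolds 0 := by
  intro κ J _ _ c hκ hJ hc
  have h1 : IsEmpty κ := Fintype.card_eq_zero_iff.1 hκ
  have h2 : IsEmpty J := Fintype.card_eq_zero_iff.1 (by rw [hJ, hκ])
  have h3 : Sol κ c = {default} := by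
    ext ⟨α, p, z⟩
    simp only [Set.mem_singleton_iff, eq_iff_true_of_subsingleton, iff_true]
    exact ⟨fun k => h1.elim k, fun k => h1.elim k, fun j => h2.elim j, fun j => h2.elim j,
      fun j => h2.elim j⟩
  rw [h3, Set.ncard_singleton]
  rfl

theorem countHolds_step {m : ℕ} (hm : m ≠ 0) (ih : ∀ l < m, CountHolds l) : CountHolds m := by
  intro κ J _ _ c hκ hJ hc
  subst hκ
  obtain ⟨i⟩ : Nonempty κ := Fintype.card_pos_iff.1 (Nat.pos_of_ne_zero hm)
  obtain ⟨B, hB, hgen⟩ := exists_generic_direction hc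
  have hE := two_mul_card_collisions hB hgen
  set E := collisions c B with hEdef
  set b : ℂ → J → ℂ := fun σ j => c j + σ * B j with hb
  set K := (Sol κ B).ncard with hK
  obtain ⟨m₀, M₀, hm₀, hinf⟩ := resProd_line_bounds_infty i hJ c hB
  have hKσ : ∀ σ ∉ E, (Sol κ (b σ)).ncard = K := by
    intro σ hσ
    have h1 : ∀ᶠ τ in cocompact ℂ, τ ∉ E := by
      have := E.finite_toSet.isCompact.compl_mem_cocompact
      exact this
    obtain ⟨τ, h2, h3⟩ := (h1.and hinf).exists
    exact (ncard_sol_line hJ hB hσ h2).trans h3.1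
  set R := (2 * (Fintype.card κ - 1)).factorial *
    (2 * (Fintype.card κ + 1) ^ (Fintype.card κ - 1)) with hR
  have hloc : ∀ e ∈ E, (Fintype.card κ + 1) * (R / (Fintype.card κ + 1)) = R ∧
      ∃ m M : ℝ, 0 < m ∧ ∀ᶠ z in 𝓝[≠] e,
        m * ‖z - e‖ ^ (2 * (R / (Fintype.card κ + 1))) ≤ ‖resProd i (b z)‖ ∧
        ‖resProd i (b z)‖ ≤ M * ‖z - e‖ ^ (2 * (R / (Fintype.card κ + 1))) := by
    intro e he
    obtain ⟨j₁, j₂, hne, het⟩ := mem_collisions.1 he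
    have hcoll : b e j₁ = b e j₂ := (eq_collisionTime_iff hB hne e).2 het
    have hpair : ∀ j l, j ≠ l → b e j = b e l → (j = j₁ ∨ j = j₂) ∧ (l = j₁ ∨ l = j₂) :=
      fun j l hjl h => collisionTime_inj hB hgen hne hjl
        (het.symm.trans ((eq_collisionTime_iff hB hjl e).1 h))
    have hval : ∀ j, b e j = b e j₁ ↔ j = j₁ ∨ j = j₂ := by
      refine fun j => ⟨fun h => ?_, ?_⟩
      · by_cases hj : j = j₁
        · exact Or.inl hj
        · exact (hpair j j₁ hj h).1
      · rintro (rfl | rfl)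
        · rfl
        · exact hcoll.symm
    have hinj : ∀ j l, b e j ≠ b e j₁ → b e j = b e l → j = l := by
      intro j l hj hjl
      by_contra h
      exact hj ((hval j).2 (hpair j l h hjl).1)
    obtain ⟨hfin, hN⟩ := nodes_ncard (i := i) ih hJ hne hval hinj
    have hN' : R / (Fintype.card κ + 1) = (Nodes (b e) (b e j₁) i j₁ j₂).ncard :=
      Nat.div_eq_of_eq_mul_right (Nat.succ_pos _) hN.symm
    rw [hN']
    refine ⟨hN, ?_⟩
    obtain ⟨m, M, hm, hM, hbd⟩ := exists_resProd_bounds i hJ hne hval hinj hfin K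
    have hD : 0 < ‖B j₁ - B j₂‖ := norm_pos_iff.2 (sub_ne_zero.2 fun h => hne (hB h))
    refine ⟨m * ‖B j₁ - B j₂‖ ^ (2 * (Nodes (b e) (b e j₁) i j₁ j₂).ncard),
      M * ‖B j₁ - B j₂‖ ^ (2 * (Nodes (b e) (b e j₁) i j₁ j₂).ncard), by positivity, ?_⟩
    have h1 : ∀ᶠ z in 𝓝[≠] e, z ∉ E := by
      have h2 : ((E.erase e : Finset ℂ) : Set ℂ)ᶜ ∈ 𝓝 e :=
        (E.erase e).finite_toSet.isClosed.isOpen_compl.mem_nhds (by simp)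
      filter_upwards [mem_nhdsWithin_of_mem_nhds h2, self_mem_nhdsWithin] with z hz hze hzE
      exact hz (Finset.mem_coe.2 (Finset.mem_erase.2 ⟨hze, hzE⟩))
    have h2 := ((continuous_line c B).tendsto e).eventually hbd
    filter_upwards [h1, mem_nhdsWithin_of_mem_nhds h2] with z hz hz2
    obtain ⟨h3, h4⟩ := hz2 (injective_of_notMem_collisions hB hz) (hKσ z hz).le
    have h5 : ‖b z j₁ - b z j₂‖ = ‖B j₁ - B j₂‖ * ‖z - e‖ := by
      rw [← norm_mul]
      congr 1
      simp only [hb] at hcoll ⊢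
      linear_combination hcoll
    rw [h5, mul_pow, ← mul_assoc] at h3 h4
    exact ⟨h3, h4⟩
  have key := order_infty_eq E (2 * (R / (Fintype.card κ + 1))) (fun σ => resProd i (b σ))
    ((2 * K : ℕ) : ℤ) (fun z hz => ?_) (fun e he => (hloc e he).2) ?_
  · have hKE : K = R / (Fintype.card κ + 1) * E.card := by
      have : 2 * K = 2 * (R / (Fintype.card κ + 1)) * E.card := by exact_mod_cast key
      linarith
    have h0E : (0 : ℂ) ∉ E := by
      intro h
      obtain ⟨j, l, hjl, h1⟩ := mem_collisions.1 h
      have h2 := (eq_collisionTime_iff hB hjl 0).2 h1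
      simp only [zero_mul, add_zero] at h2
      exact hjl (hc h2)
    have hc0 : (Sol κ c).ncard = K := by
      have := hKσ 0 h0E
      simpa only [hb, zero_mul, add_zero] using this
    obtain ⟨n, hn⟩ := Nat.exists_eq_succ_of_ne_zero hm
    have hcardE : E.card = (n + 1) * (2 * n + 1) := by
      rw [hJ, hn] at hE
      have h1 : 2 * (n.succ) - 1 = 2 * n + 1 := by omega
      rw [h1] at hE
      have : n.succ = n + 1 := rfl
      rw [this] at hE
      linarith
    obtain ⟨e, he⟩ : E.Nonempty := by
      rw [← Finset.card_pos, hcardE]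
      positivity
    have hRdiv := (hloc e he).1
    rw [hc0, hKE, ← mul_assoc, hRdiv, hcardE, hR, hn]
    have h1 : 2 * n.succ = 2 * n + 1 + 1 := by omega
    rw [h1, Nat.factorial_succ, Nat.factorial_succ]
    simp only [Nat.succ_eq_add_one, Nat.add_sub_cancel]
    ring
  · have h1 := injective_of_notMem_collisions hB hz
    refine ⟨?_, resProd_ne_zero i hJ h1⟩
    refine DifferentiableAt.comp (g := resProd i) z (differentiableAt_resProd i hJ h1) ?_
    fun_prop
  · refine ⟨m₀, M₀, hm₀, hinf.mono fun z hz => ?_⟩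
    simp only [zpow_natCast]
    exact hz.2

theorem countHolds (m : ℕ) : CountHolds m := by
  induction m using Nat.strong_induction_on with
  | _ m ih =>
    rcases eq_or_ne m 0 with rfl | hm
    · exact countHolds_zero
    · exact countHolds_step hm ih

/-- The number of normalised rational functions with prescribed labelled critical values. -/
theorem card_mul_ncard_sol (hJ : Fintype.card J = 2 * Fintype.card κ) {c : J → ℂ}
    (hc : Function.Injective c) : (Fintype.card κ + 1) * (Sol κ c).ncard =
      (2 * Fintype.card κ).factorial * (Fintype.card κ + 1) ^ (Fintype.card κ - 1) :=
  countHolds _ κ J c rfl hJ hc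

end CriticalValues

namespace CriticalValues

open Filter Topology

theorem eventually_eval_ne_zero {q : ℂ[X]} (hq : q ≠ 0) : ∀ᶠ z in cofinite, q.eval z ≠ 0 := by
  have := (Polynomial.finite_setOfPred_isRoot hq).compl_mem_cofinite
  exact this

theorem eq_of_eventually_eval_eq {p q : ℂ[X]} (h : ∀ᶠ z in cofinite, p.eval z = q.eval z) :
    p = q :=
  by
  refine Polynomial.eq_of_infinite_eval_eq p q ?_
  have := Filter.frequently_cofinite_iff_infinite.1 h.frequently
  exact this

/-- The value of a rational function at a point, as a quotient of values of polynomials. -/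
noncomputable def ev (f : RatFunc ℂ) (z : ℂ) : ℂ := f.num.eval z / f.denom.eval z

theorem ev_div (p : ℂ[X]) {q : ℂ[X]} (hq : q ≠ 0) :
    ev (algebraMap ℂ[X] (RatFunc ℂ) p / algebraMap ℂ[X] (RatFunc ℂ) q) =ᶠ[cofinite]
      fun z => p.eval z / q.eval z := by
  set f := algebraMap ℂ[X] (RatFunc ℂ) p / algebraMap ℂ[X] (RatFunc ℂ) q with hf
  have h := (RatFunc.num_mul_eq_mul_denom_iff hq).2 hf
  filter_upwards [eventually_eval_ne_zero hq, eventually_eval_ne_zero f.denom_ne_zero] with z h1 h2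
  rw [ev, div_eq_div_iff h2 h1, ← eval_mul, h, eval_mul]

theorem ev_algebraMap (p : ℂ[X]) :
    ev (algebraMap ℂ[X] (RatFunc ℂ) p) = fun z => p.eval z := by
  funext z
  simp [ev]

theorem ev_add (f g : RatFunc ℂ) : ev (f + g) =ᶠ[cofinite] ev f + ev g := by
  have h0 : f + g = algebraMap ℂ[X] (RatFunc ℂ) (f.num * g.denom + f.denom * g.num) /
      algebraMap ℂ[X] (RatFunc ℂ) (f.denom * g.denom) := by
    have h1 := RatFunc.algebraMap_ne_zero f.denom_ne_zero
    have h2 := RatFunc.algebraMap_ne_zero g.denom_ne_zero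
    conv_lhs => rw [← RatFunc.num_div_denom f, ← RatFunc.num_div_denom g]
    rw [div_add_div _ _ h1 h2]
    simp only [map_add, map_mul]
  rw [h0]
  filter_upwards [ev_div (f.num * g.denom + f.denom * g.num)
    (mul_ne_zero f.denom_ne_zero g.denom_ne_zero), eventually_eval_ne_zero f.denom_ne_zero,
    eventually_eval_ne_zero g.denom_ne_zero] with z h1 h2 h3
  rw [h1, Pi.add_apply, ev, ev, div_add_div _ _ h2 h3, eval_add, eval_mul, eval_mul, eval_mul]

theorem ev_mul (f g : RatFunc ℂ) : ev (f * g) =ᶠ[cofinite] ev f * ev g := by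
  have h0 : f * g = algebraMap ℂ[X] (RatFunc ℂ) (f.num * g.num) /
      algebraMap ℂ[X] (RatFunc ℂ) (f.denom * g.denom) := by
    conv_lhs => rw [← RatFunc.num_div_denom f, ← RatFunc.num_div_denom g]
    rw [div_mul_div_comm]
    simp only [map_mul]
  rw [h0]
  filter_upwards [ev_div (f.num * g.num) (mul_ne_zero f.denom_ne_zero g.denom_ne_zero)] with z h1
  rw [h1, Pi.mul_apply, ev, ev, div_mul_div_comm, eval_mul, eval_mul]

theorem ev_inj {f g : RatFunc ℂ} (h : ev f =ᶠ[cofinite] ev g) : f = g := by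
  have h1 : f.num * g.denom = g.num * f.denom := by
    refine eq_of_eventually_eval_eq ?_
    filter_upwards [h, eventually_eval_ne_zero f.denom_ne_zero,
      eventually_eval_ne_zero g.denom_ne_zero] with z h1 h2 h3
    rw [ev, ev, div_eq_div_iff h2 h3] at h1
    rw [eval_mul, eval_mul, h1]
  rw [(RatFunc.num_mul_eq_mul_denom_iff g.denom_ne_zero).1 h1, RatFunc.num_div_denom]

theorem eventually_ev_ne_zero {f : RatFunc ℂ} (hf : f ≠ 0) : ∀ᶠ z in cofinite, ev f z ≠ 0 := by
  filter_upwards [eventually_eval_ne_zero (RatFunc.num_ne_zero hf),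
    eventually_eval_ne_zero f.denom_ne_zero] with z h1 h2
  exact div_ne_zero h1 h2

theorem ev_div' (f : RatFunc ℂ) {g : RatFunc ℂ} (hg : g ≠ 0) :
    ev (f / g) =ᶠ[cofinite] fun z => ev f z / ev g z := by
  have h := ev_mul (f / g) g
  rw [div_mul_cancel₀ f hg] at h
  filter_upwards [h, eventually_ev_ne_zero hg] with z h1 h2
  rw [h1, Pi.mul_apply, mul_div_cancel_right₀ _ h2]

theorem ev_aeval (L : RatFunc ℂ) (p : ℂ[X]) :
    ev (aeval L p) =ᶠ[cofinite] fun z => p.eval (ev L z) := by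
  induction p using Polynomial.induction_on' with
  | add p q hp hq =>
    rw [map_add]
    filter_upwards [ev_add (aeval L p) (aeval L q), hp, hq] with z h1 h2 h3
    rw [h1, Pi.add_apply, h2, h3, eval_add]
  | monomial n a =>
    induction n with
    | zero =>
      rw [monomial_zero_left, aeval_C]
      have : algebraMap ℂ (RatFunc ℂ) a = algebraMap ℂ[X] (RatFunc ℂ) (C a) := rfl
      rw [this, ev_algebraMap]
      simp
    | succ n ih =>
      have h0 : (monomial (n + 1)) a = monomial n a * X := by rw [monomial_mul_X]
      rw [h0, map_mul, aeval_X]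
      filter_upwards [ev_mul (aeval L (monomial n a)) L, ih] with z h1 h2
      rw [h1, Pi.mul_apply, h2, eval_mul, eval_X]

/-- The map `ψ` is the composition of `φ` with a Möbius transformation, up to finitely many
points. -/
def MobRel (φ ψ : ℂ → ℂ) : Prop :=
  ∃ a b c d : ℂ, a * d - b * c ≠ 0 ∧ ∀ᶠ z in cofinite, ψ z = φ ((a * z + b) / (c * z + d))

section mobius

variable {a b c d : ℂ}

theorem linear_ne_zero (h : a * d - b * c ≠ 0) : (C c * X + C d : ℂ[X]) ≠ 0 := by
  intro h0
  have h1 : c = 0 := by simpa using congrArg (fun p => p.coeff 1) h0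
  have h2 : d = 0 := by simpa using congrArg (fun p => p.coeff 0) h0
  exact h (by rw [h1, h2]; ring)

theorem eventually_linear_ne_zero (h : a * d - b * c ≠ 0) :
    ∀ᶠ z in cofinite, c * z + d ≠ 0 := by
  simpa using eventually_eval_ne_zero (linear_ne_zero h)

theorem tendsto_mobius (h : a * d - b * c ≠ 0) :
    Tendsto (fun z => (a * z + b) / (c * z + d)) cofinite cofinite := by
  have h1 : ∀ w, ∀ᶠ z in cofinite, (a * z + b) / (c * z + d) ≠ w := by
    intro w
    have h2 : (C (a - w * c) * X + C (b - w * d) : ℂ[X]) ≠ 0 := by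
      refine linear_ne_zero (a := -c) (b := -d) ?_
      intro h3
      exact h (by linear_combination h3)
    filter_upwards [eventually_linear_ne_zero h, eventually_eval_ne_zero h2] with z h3 h4 h5
    refine h4 ?_
    rw [div_eq_iff h3] at h5
    simp only [eval_add, eval_mul, eval_C, eval_X]
    linear_combination h5
  rw [Tendsto, Filter.le_cofinite_iff_eventually_ne]
  exact h1

theorem MobRel.refl (φ : ℂ → ℂ) : MobRel φ φ :=
  ⟨1, 0, 0, 1, by norm_num, Eventually.of_forall fun z => by simp⟩

theorem MobRel.symm {φ ψ : ℂ → ℂ} (h : MobRel φ ψ) : MobRel ψ φ := by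
  obtain ⟨a, b, c, d, h, hz⟩ := h
  have h' : d * a - -b * -c ≠ 0 := by
    intro h3
    exact h (by linear_combination h3)
  refine ⟨d, -b, -c, a, h', ?_⟩
  filter_upwards [(tendsto_mobius h').eventually hz, eventually_linear_ne_zero h'] with z h1 h2
  rw [h1]
  congr 1
  have h3 : c * ((d * z + -b) / (-c * z + a)) + d = (a * d - b * c) / (-c * z + a) := by
    rw [mul_div_assoc', div_add' _ _ _ h2]
    ring
  have h4 : a * ((d * z + -b) / (-c * z + a)) + b = z * (a * d - b * c) / (-c * z + a) := by
    rw [mul_div_assoc', div_add' _ _ _ h2]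
    ring
  rw [h3, h4, div_div_div_cancel_right₀ h2, mul_div_cancel_right₀ _ h]

theorem MobRel.trans {φ ψ χ : ℂ → ℂ} (h : MobRel φ ψ) (h' : MobRel ψ χ) : MobRel φ χ := by
  obtain ⟨a, b, c, d, h, hz⟩ := h
  obtain ⟨a', b', c', d', h', hz'⟩ := h'
  have h0 : (a * a' + b * c') * (c * b' + d * d') - (a * b' + b * d') * (c * a' + d * c') ≠ 0 := by
    have := mul_ne_zero h h'
    intro h3
    exact this (by linear_combination h3)
  refine ⟨_, _, _, _, h0, ?_⟩
  filter_upwards [hz', (tendsto_mobius h').eventually hz, eventually_linear_ne_zero h']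
    with z h1 h2 h3
  rw [h1, h2]
  congr 1
  have e1 : a * ((a' * z + b') / (c' * z + d')) + b =
      ((a * a' + b * c') * z + (a * b' + b * d')) / (c' * z + d') := by
    rw [mul_div_assoc', div_add' _ _ _ h3]
    ring
  have e2 : c * ((a' * z + b') / (c' * z + d')) + d =
      ((c * a' + d * c') * z + (c * b' + d * d')) / (c' * z + d') := by
    rw [mul_div_assoc', div_add' _ _ _ h3]
    ring
  rw [e1, e2, div_div_div_cancel_right₀ h3]

theorem MobRel.congr {φ ψ φ' ψ' : ℂ → ℂ} (h : MobRel φ ψ) (hφ : φ' =ᶠ[cofinite] φ)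
    (hψ : ψ' =ᶠ[cofinite] ψ) : MobRel φ' ψ' := by
  obtain ⟨a, b, c, d, h, hz⟩ := h
  refine ⟨a, b, c, d, h, ?_⟩
  filter_upwards [hz, (tendsto_mobius h).eventually hφ, hψ] with z h1 h2 h3
  rw [h3, h1, h2]

theorem ev_comp_mobius (h : a * d - b * c ≠ 0) (f : RatFunc ℂ) {L : RatFunc ℂ}
    (hL : L = algebraMap ℂ[X] (RatFunc ℂ) (C a * X + C b) /
      algebraMap ℂ[X] (RatFunc ℂ) (C c * X + C d)) :
    ev (aeval L f.num / aeval L f.denom) =ᶠ[cofinite]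
      fun z => ev f ((a * z + b) / (c * z + d)) := by
  have h1 : ev L =ᶠ[cofinite] fun z => (a * z + b) / (c * z + d) := by
    rw [hL]
    filter_upwards [ev_div (C a * X + C b) (linear_ne_zero h)] with z hz
    rw [hz]
    simp
  have h2 : aeval L f.denom ≠ 0 := by
    intro h0
    have h3 := ev_aeval L f.denom
    rw [h0] at h3
    obtain ⟨z, ⟨h4, h5⟩, h6⟩ := ((h3.and h1).and
      ((tendsto_mobius h).eventually (eventually_eval_ne_zero f.denom_ne_zero))).exists
    refine h6 (Eq.trans (congrArg (fun t => f.denom.eval t) h5.symm) (h4.symm.trans ?_))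
    simp [ev]
  filter_upwards [ev_div' (aeval L f.num) h2, ev_aeval L f.num, ev_aeval L f.denom, h1]
    with z e1 e2 e3 e4
  rw [e1, e2, e3, e4, ev]

end mobius

theorem mobiusEquiv_iff (f g : RatFunc ℂ) : MobiusEquiv f g ↔ MobRel (ev f) (ev g) := by
  constructor
  · rintro ⟨a, b, c, d, h, L, hL, rfl⟩
    exact ⟨a, b, c, d, h, ev_comp_mobius h f hL⟩
  · rintro ⟨a, b, c, d, h, hz⟩
    exact ⟨a, b, c, d, h, _, rfl, ev_inj (EventuallyEq.trans hz (ev_comp_mobius h f rfl).symm)⟩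
end CriticalValues

namespace CriticalValues

open Filter Topology

variable {κ J : Type} [Fintype κ] [Fintype J]

/-- Relabelling of the poles. -/
def permSol (τ : Equiv.Perm κ) (x : (κ → ℂ) × (κ → ℂ) × (J → ℂ)) :
    (κ → ℂ) × (κ → ℂ) × (J → ℂ) :=
  (fun k => x.1 (τ k), fun k => x.2.1 (τ k), x.2.2)

/-- Change of the pole placed at infinity. -/
noncomputable def frameSol (x : (κ → ℂ) × (κ → ℂ) × (J → ℂ)) :
    Option κ → (κ → ℂ) × (κ → ℂ) × (J → ℂ)
  | none => x
  | some i => (frA x.1 x.2.1 i, frP x.1 x.2.1 i, fun j => frX x.1 x.2.1 i (x.2.2 j))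

theorem rf_perm (τ : Equiv.Perm κ) (α p : κ → ℂ) (z : ℂ) :
    rf (fun k => α (τ k)) (fun k => p (τ k)) z = rf α p z := by
  rw [rf, rf, Equiv.sum_comp τ fun k => α k / (z - p k)]

theorem rd_perm (τ : Equiv.Perm κ) (α p : κ → ℂ) (z : ℂ) :
    rd (fun k => α (τ k)) (fun k => p (τ k)) z = rd α p z := by
  rw [rd, rd, Equiv.sum_comp τ fun k => α k / (z - p k) ^ 2]

theorem permSol_mem {c : J → ℂ} (τ : Equiv.Perm κ) {x : (κ → ℂ) × (κ → ℂ) × (J → ℂ)}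
    (hx : x ∈ Sol κ c) : permSol τ x ∈ Sol κ c := by
  have h : IsSol c x.1 x.2.1 x.2.2 := hx
  exact ⟨fun k => h.res_ne _, h.inj.comp τ.injective, fun j k => h.ne_pole j _,
    fun j => (rd_perm τ _ _ _).trans (h.crit j), fun j => (rf_perm τ _ _ _).trans (h.val j)⟩

theorem frameSol_mem {c : J → ℂ} {x : (κ → ℂ) × (κ → ℂ) × (J → ℂ)} (hx : x ∈ Sol κ c)
    (o : Option κ) : frameSol x o ∈ Sol κ c := by
  cases o with
  | none => exact hx
  | some i => exact IsSol.frame hx i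

theorem eventually_cofinite_ne_pole (p : κ → ℂ) : ∀ᶠ z in cofinite, ∀ k, z ≠ p k := by
  rw [eventually_all]
  exact fun k => eventually_cofinite_ne (p k)

theorem mobRel_frameSol {c : J → ℂ} {x : (κ → ℂ) × (κ → ℂ) × (J → ℂ)} (hx : x ∈ Sol κ c)
    (o : Option κ) : MobRel (rf x.1 x.2.1) (rf (frameSol x o).1 (frameSol x o).2.1) := by
  have h : IsSol c x.1 x.2.1 x.2.2 := hx
  cases o with
  | none => exact MobRel.refl _
  | some i =>
    refine MobRel.symm ⟨rf x.1 x.2.1 (x.2.1 i), x.1 i - rf x.1 x.2.1 (x.2.1 i) * x.2.1 i, 1,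
      -x.2.1 i, ?_, ?_⟩
    · have := h.res_ne i
      intro h0
      exact this (by linear_combination -h0)
    · filter_upwards [eventually_cofinite_ne_pole x.2.1] with z hz
      rw [← rf_frX h.inj (h.res_ne i) hz]
      have h1 := sub_ne_zero.2 (hz i)
      congr 1
      rw [frX, one_mul, ← sub_eq_add_neg, add_div' _ _ _ h1]
      congr 1
      ring

/-- The solutions obtained from `x` by changing the pole at infinity and relabelling the poles. -/
noncomputable def orbit (x : (κ → ℂ) × (κ → ℂ) × (J → ℂ)) (t : Option κ × Equiv.Perm κ) :
    (κ → ℂ) × (κ → ℂ) × (J → ℂ) :=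
  permSol t.2 (frameSol x t.1)

theorem orbit_mem {c : J → ℂ} {x : (κ → ℂ) × (κ → ℂ) × (J → ℂ)} (hx : x ∈ Sol κ c)
    (t : Option κ × Equiv.Perm κ) : orbit x t ∈ Sol κ c :=
  permSol_mem _ (frameSol_mem hx _)

theorem mobRel_orbit {c : J → ℂ} {x : (κ → ℂ) × (κ → ℂ) × (J → ℂ)} (hx : x ∈ Sol κ c)
    (t : Option κ × Equiv.Perm κ) : MobRel (rf x.1 x.2.1) (rf (orbit x t).1 (orbit x t).2.1) :=
  (mobRel_frameSol hx t.1).congr EventuallyEq.rfl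
    (Eventually.of_forall fun _ => rf_perm t.2 _ _ _)

section injective

variable {α p : κ → ℂ} {z : J → ℂ}

theorem exists_frX_ne_self (hJ : 2 < Fintype.card J) (hz : Function.Injective z) {i : κ}
    (hα : α i ≠ 0) (hp : ∀ j, z j ≠ p i) : ∃ j, z j ≠ frX α p i (z j) := by
  by_contra! h
  set P : ℂ[X] := (X - C (rf α p (p i))) * (X - C (p i)) - C (α i) with hP
  have hdeg : P.natDegree ≤ 2 := by
    rw [hP]
    compute_degree
  have h0 : P = 0 := by
    refine Polynomial.eq_zero_of_natDegree_lt_card_of_eval_eq_zero P hz (fun j => ?_)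
      (hdeg.trans_lt hJ)
    have h1 := sub_ne_zero.2 (hp j)
    have h2 := h j
    rw [frX, ← sub_eq_iff_eq_add', eq_div_iff h1] at h2
    simp [hP, h2]
  have h1 : P.eval (p i) = -α i := by simp [hP]
  rw [h0, eval_zero] at h1
  exact hα (neg_eq_zero.1 h1.symm)

theorem exists_frX_ne_frX (hJ : 2 < Fintype.card J) (hz : Function.Injective z)
    (hinj : Function.Injective p) {i l : κ} (hil : i ≠ l)
    (hα : α i ≠ 0) (hp : ∀ j k, z j ≠ p k) : ∃ j, frX α p i (z j) ≠ frX α p l (z j) := by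
  by_contra! h
  set P : ℂ[X] := C (rf α p (p i) - rf α p (p l)) * (X - C (p i)) * (X - C (p l)) +
    C (α i) * (X - C (p l)) - C (α l) * (X - C (p i)) with hP
  have hdeg : P.natDegree ≤ 2 := by
    rw [hP]
    compute_degree
  have h0 : P = 0 := by
    refine Polynomial.eq_zero_of_natDegree_lt_card_of_eval_eq_zero P hz (fun j => ?_)
      (hdeg.trans_lt hJ)
    have h1 := sub_ne_zero.2 (hp j i)
    have h3 := sub_ne_zero.2 (hp j l)
    have h2 := h j
    rw [frX, frX] at h2
    field_simp at h2
    simp only [hP, eval_add, eval_sub, eval_mul, eval_C, eval_X]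
    linear_combination h2
  have h1 : P.eval (p i) = α i * (p i - p l) := by simp [hP]
  rw [h0, eval_zero] at h1
  exact mul_ne_zero hα (sub_ne_zero.2 (hinj.ne hil)) h1.symm

theorem orbit_injective {c : J → ℂ} (hJ : 2 < Fintype.card J) (hc : Function.Injective c)
    {x : (κ → ℂ) × (κ → ℂ) × (J → ℂ)} (hx : x ∈ Sol κ c) : Function.Injective (orbit x) := by
  have h : IsSol c x.1 x.2.1 x.2.2 := hx
  have hz := h.z_inj hc
  rintro ⟨o, τ⟩ ⟨o', τ'⟩ heq
  have h2 : (frameSol x o).2.2 = (frameSol x o').2.2 := congrArg (fun y => y.2.2) heq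
  have ho : o = o' := by
    cases o with
    | none =>
      cases o' with
      | none => rfl
      | some i =>
        obtain ⟨j, hj⟩ := exists_frX_ne_self hJ hz (h.res_ne i) fun j => h.ne_pole j i
        exact absurd (congrFun h2 j) hj
    | some i =>
      cases o' with
      | none =>
        obtain ⟨j, hj⟩ := exists_frX_ne_self hJ hz (h.res_ne i) fun j => h.ne_pole j i
        exact absurd (congrFun h2 j).symm hj
      | some l =>
        by_contra hne
        obtain ⟨j, hj⟩ := exists_frX_ne_frX hJ hz h.inj (fun hil => hne (congrArg some hil))
          (h.res_ne i) h.ne_pole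
        exact hj (congrFun h2 j)
  subst ho
  have h3 : ∀ k, (frameSol x o).2.1 (τ k) = (frameSol x o).2.1 (τ' k) :=
    fun k => congrFun (congrArg (fun y => y.2.1) heq) k
  have h4 : IsSol c _ _ _ := frameSol_mem hx o
  have : τ = τ' := Equiv.ext fun k => h4.inj (h3 k)
  rw [this]

end injective

theorem tendsto_const_div_cobounded (a : ℂ) {f : ℂ → ℂ}
    (hf : Tendsto f (Bornology.cobounded ℂ) (Bornology.cobounded ℂ)) :
    Tendsto (fun z => a / f z) (Bornology.cobounded ℂ) (𝓝 0) := by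
  simpa only [div_eq_mul_inv, mul_zero, Function.comp_def] using
    (tendsto_inv₀_cobounded.comp hf).const_mul a

theorem tendsto_rf_sub (α p : κ → ℂ) :
    Tendsto (fun z => rf α p z - z) (Bornology.cobounded ℂ) (𝓝 0) := by
  have h1 : ∀ k, Tendsto (fun z => α k / (z - p k)) (Bornology.cobounded ℂ) (𝓝 0) := fun k =>
    tendsto_const_div_cobounded (α k) (tendsto_sub_const_cobounded (p k))
  have h2 := tendsto_finsetSum Finset.univ fun k _ => h1 k
  simp only [Finset.sum_const_zero] at h2
  simpa only [rf, add_sub_cancel_left] using h2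

theorem cobounded_le_cofinite : Bornology.cobounded ℂ ≤ cofinite := by
  rw [Metric.cobounded_eq_cocompact]
  exact cocompact_le_cofinite

theorem exists_permSol_of_eventuallyEq {c : J → ℂ} (hJ : Fintype.card J = 2 * Fintype.card κ)
    (hc : Function.Injective c) {x y : (κ → ℂ) × (κ → ℂ) × (J → ℂ)} (hx : x ∈ Sol κ c)
    (hy : y ∈ Sol κ c) (h : ∀ᶠ u in cofinite, rf y.1 y.2.1 u = rf x.1 x.2.1 u) :
    ∃ τ, permSol τ x = y := by
  obtain ⟨α, p, z⟩ := x
  obtain ⟨β, q, w⟩ := y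
  have hx : IsSol c α p z := hx
  have hy : IsSol c β q w := hy
  have h : ∀ᶠ u in cofinite, rf β q u = rf α p u := h
  have h1 : num β q * den p = num α p * den q := by
    refine eq_of_eventually_eval_eq ?_
    filter_upwards [h, eventually_cofinite_ne_pole p, eventually_cofinite_ne_pole q] with u h1 h2 h3
    rw [eval_mul, eval_mul, eval_num α h2, eval_num β h3, h1]
    ring
  have h2 : ∀ k, ∃ l, q k = p l := by
    intro k
    rw [← eval_den_eq_zero_iff]
    have h3 := congrArg (eval (q k)) h1
    rw [eval_mul, eval_mul, eval_den_eq_zero_iff.2 ⟨k, rfl⟩, mul_zero, eval_num_pole] at h3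
    exact (mul_eq_zero.1 h3).resolve_left
      (mul_ne_zero (hy.res_ne k) (eval_codn_self hy.inj k))
  choose τ hτ using h2
  have hτi : Function.Injective τ := fun k l hkl => hy.inj (by rw [hτ, hτ, hkl])
  set σ : Equiv.Perm κ := Equiv.ofBijective τ (Finite.injective_iff_bijective.1 hτi) with hσ
  obtain rfl : q = fun k => p (σ k) := funext hτ
  have hden : den (fun k => p (σ k)) = den p := by
    rw [den, den, Equiv.prod_comp σ fun k => X - C (p k)]
  rw [hden] at h1
  have hnum := mul_right_cancel₀ (monic_den p).ne_zero h1
  have hcod : ∀ k, codn (fun k => p (σ k)) k = codn p (σ k) := by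
    intro k
    have h3 := den_eq (fun k => p (σ k)) k
    rw [hden, den_eq p (σ k)] at h3
    exact (mul_left_cancel₀ (X_sub_C_ne_zero _) h3).symm
  have hβ : β = fun k => α (σ k) := by
    funext k
    have h3 := congrArg (eval (p (σ k))) hnum
    have h4 := eval_num_pole β (fun k => p (σ k)) k
    rw [h3, eval_num_pole, hcod] at h4
    exact (mul_right_cancel₀ (eval_codn_self hx.inj (σ k)) h4).symm
  subst hβ
  refine ⟨σ, ?_⟩
  have hw : w = z := by
    funext j
    have h3 : ∀ k, w j ≠ p k := fun k => by
      have := hy.ne_pole j (σ.symm k)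
      rwa [Equiv.apply_symm_apply] at this
    obtain ⟨j', hj'⟩ := hx.exists_eq_of_crit (hx.z_inj hc) hJ h3
      ((rd_perm σ _ _ _).symm.trans (hy.crit j))
    have h4 := (rf_perm σ _ _ _).symm.trans (hy.val j)
    rw [hj', hx.val j'] at h4
    rw [hj', hc h4]
  rw [hw]
  rfl

theorem exists_permSol_of_affine {c : J → ℂ} (hJ : Fintype.card J = 2 * Fintype.card κ)
    (hc : Function.Injective c) {x y : (κ → ℂ) × (κ → ℂ) × (J → ℂ)} (hx : x ∈ Sol κ c)
    (hy : y ∈ Sol κ c) {a b : ℂ} (ha : a ≠ 0)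
    (h : ∀ᶠ u in cofinite, rf y.1 y.2.1 u = rf x.1 x.2.1 (a * u + b)) :
    ∃ τ, permSol τ x = y := by
  have h0 : Tendsto (fun u : ℂ => a * u + b) (Bornology.cobounded ℂ) (Bornology.cobounded ℂ) :=
    (tendsto_add_const_cobounded b).comp (tendsto_mul_left_cobounded ha)
  have h1 := tendsto_rf_sub y.1 y.2.1
  have h2 := (tendsto_rf_sub x.1 x.2.1).comp h0
  have h3 : Tendsto (fun u : ℂ => (a - 1) * u + b) (Bornology.cobounded ℂ) (𝓝 0) := by
    have h4 := h1.sub h2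
    rw [sub_zero] at h4
    refine h4.congr' ?_
    filter_upwards [cobounded_le_cofinite h] with u hu
    have hu : rf y.1 y.2.1 u = rf x.1 x.2.1 (a * u + b) := hu
    rw [Function.comp_apply, hu]
    ring
  have ha1 : a = 1 := by
    have h4 := h3.mul (tendsto_inv₀_cobounded (α := ℂ))
    have h5 : Tendsto (fun u : ℂ => (a - 1) + b * u⁻¹) (Bornology.cobounded ℂ) (𝓝 (a - 1)) := by
      simpa using (tendsto_inv₀_cobounded (α := ℂ)).const_mul b |>.const_add (a - 1)
    have h6 := tendsto_nhds_unique_of_eventuallyEq h4 h5 ?_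
    · rw [zero_mul] at h6
      linear_combination -h6
    · filter_upwards [cobounded_le_cofinite (eventually_cofinite_ne (0 : ℂ))] with u hu
      have hu : u ≠ 0 := hu
      field_simp
  subst ha1
  have hb : b = 0 := by
    simp only [sub_self, zero_mul, zero_add] at h3
    exact tendsto_nhds_unique tendsto_const_nhds h3
  subst hb
  simp only [one_mul, add_zero] at h
  exact exists_permSol_of_eventuallyEq hJ hc hx hy h

theorem exists_orbit_of_mobRel {c : J → ℂ} (hJ : Fintype.card J = 2 * Fintype.card κ)
    (hc : Function.Injective c) {x y : (κ → ℂ) × (κ → ℂ) × (J → ℂ)} (hx : x ∈ Sol κ c)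
    (hy : y ∈ Sol κ c) (h : MobRel (rf x.1 x.2.1) (rf y.1 y.2.1)) : ∃ t, orbit x t = y := by
  obtain ⟨a, b, e, d, hdet, h⟩ := h
  by_cases he : e = 0
  · subst he
    have had : a ≠ 0 ∧ d ≠ 0 := by
      rw [mul_zero, sub_zero] at hdet
      exact ⟨left_ne_zero_of_mul hdet, right_ne_zero_of_mul hdet⟩
    obtain ⟨τ, hτ⟩ := exists_permSol_of_affine hJ hc hx hy (a := a / d) (b := b / d)
      (div_ne_zero had.1 had.2) (h.mono fun u hu => by
        rw [hu, zero_mul, zero_add, add_div, mul_div_right_comm])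
    exact ⟨(none, τ), hτ⟩
  · have hxs : IsSol c x.1 x.2.1 x.2.2 := hx
    have hid : ∀ u, e * u + d ≠ 0 →
        (a * u + b) / (e * u + d) = a / e + (b * e - a * d) / e / (e * u + d) := by
      intro u hu
      rw [div_add_div _ _ he hu, div_eq_div_iff hu (mul_ne_zero he hu)]
      field_simp
      ring
    have hlin : Tendsto (fun u : ℂ => e * u + d) (Bornology.cobounded ℂ) (Bornology.cobounded ℂ) :=
      (tendsto_add_const_cobounded d).comp (tendsto_mul_left_cobounded he)
    have hne := eventually_linear_ne_zero hdet
    have hlim : Tendsto (fun u => (a * u + b) / (e * u + d)) (Bornology.cobounded ℂ)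
        (𝓝 (a / e)) := by
      have h1 : Tendsto (fun u => a / e + (b * e - a * d) / e / (e * u + d))
          (Bornology.cobounded ℂ) (𝓝 (a / e + 0)) :=
        (tendsto_const_div_cobounded _ hlin).const_add _
      rw [add_zero] at h1
      refine h1.congr' ?_
      filter_upwards [cobounded_le_cofinite hne] with u hu
      exact (hid u hu).symm
    obtain ⟨i, hi⟩ : ∃ i, a / e = x.2.1 i := by
      by_contra! hcon
      have h1 : ContinuousAt (rf x.1 x.2.1) (a / e) := by
        have : ∀ k, a / e - x.2.1 k ≠ 0 := fun k => sub_ne_zero.2 (hcon k)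
        unfold rf
        fun_prop (disch := simp [this])
      have h2 := h1.tendsto.comp hlim
      have h3 := (tendsto_rf_sub y.1 y.2.1)
      have h4 : Tendsto (fun u : ℂ => u) (Bornology.cobounded ℂ)
          (𝓝 (rf x.1 x.2.1 (a / e) - 0)) := by
        refine (h2.sub h3).congr' ?_
        filter_upwards [cobounded_le_cofinite h] with u hu
        have hu : rf y.1 y.2.1 u = rf x.1 x.2.1 ((a * u + b) / (e * u + d)) := hu
        rw [Function.comp_apply, ← hu]
        ring
      exact not_tendsto_nhds_of_tendsto_atTop tendsto_norm_cobounded_atTop _ h4.norm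
    have hdet' : b * e - a * d ≠ 0 := fun h0 => hdet (by linear_combination -h0)
    have haff : ∀ᶠ u in cofinite, rf y.1 y.2.1 u =
        rf (frameSol x (some i)).1 (frameSol x (some i)).2.1
          (x.1 i * e ^ 2 / (b * e - a * d) * u +
            (rf x.1 x.2.1 (x.2.1 i) + x.1 i * e * d / (b * e - a * d))) := by
      filter_upwards [h, (tendsto_mobius hdet).eventually (eventually_cofinite_ne_pole x.2.1), hne]
        with u hu hpole hu0
      rw [hu, ← rf_frX hxs.inj (hxs.res_ne i) hpole]
      simp only [frameSol]
      congr 1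
      rw [frX, hid u hu0, hi, add_sub_cancel_left]
      field_simp
      ring
    obtain ⟨τ, hτ⟩ := exists_permSol_of_affine hJ hc (frameSol_mem hx (some i)) hy
      (div_ne_zero (mul_ne_zero (hxs.res_ne i) (pow_ne_zero 2 he)) hdet') haff
    exact ⟨(some i, τ), hτ⟩

end CriticalValues

namespace CriticalValues

open Filter Topology

variable {κ J : Type} [Fintype κ] [Fintype J]

theorem isCoprime_num_den {α p : κ → ℂ} (hα : ∀ k, α k ≠ 0) (hp : Function.Injective p) :
    IsCoprime (num α p) (den p) := by
  refine IsCoprime.prod_right fun k _ => IsCoprime.symm ?_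
  rw [(irreducible_X_sub_C (p k)).coprime_iff_not_dvd, dvd_iff_isRoot, IsRoot.def, eval_num_pole]
  exact mul_ne_zero (hα k) (eval_codn_self hp k)

theorem num_denom_of_isCoprime {P Q : ℂ[X]} (hQ : Q.Monic) (h : IsCoprime P Q) :
    (algebraMap ℂ[X] (RatFunc ℂ) P / algebraMap ℂ[X] (RatFunc ℂ) Q).num = P ∧
    (algebraMap ℂ[X] (RatFunc ℂ) P / algebraMap ℂ[X] (RatFunc ℂ) Q).denom = Q := by
  set f := algebraMap ℂ[X] (RatFunc ℂ) P / algebraMap ℂ[X] (RatFunc ℂ) Q with hf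
  have h1 := (RatFunc.num_mul_eq_mul_denom_iff hQ.ne_zero).2 hf
  have h2 : f.denom ∣ Q := RatFunc.denom_div_dvd P Q
  have h3 : Q ∣ f.denom := h.symm.dvd_of_dvd_mul_left (h1 ▸ Dvd.intro_left _ rfl)
  have h4 : f.denom = Q :=
    eq_of_monic_of_associated f.monic_denom hQ (associated_of_dvd_dvd h2 h3)
  rw [h4] at h1
  exact ⟨mul_right_cancel₀ hQ.ne_zero h1, h4⟩

/-- The rational function with the given residues and poles, as an element of `RatFunc ℂ`. -/
noncomputable def toRat (α p : κ → ℂ) : RatFunc ℂ :=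
  algebraMap ℂ[X] (RatFunc ℂ) (num α p) / algebraMap ℂ[X] (RatFunc ℂ) (den p)

theorem ev_toRat (α p : κ → ℂ) : ev (toRat α p) =ᶠ[cofinite] rf α p := by
  filter_upwards [ev_div (num α p) (monic_den p).ne_zero, eventually_cofinite_ne_pole p]
    with z h1 h2
  rw [toRat, h1, eval_num α h2, mul_div_cancel_right₀ _ (eval_den_ne h2)]

theorem wronskian_num_den (α p : κ → ℂ) :
    derivative (num α p) * den p - num α p * derivative (den p) = wr α p := by
  refine eq_of_eventually_eval_eq ?_
  filter_upwards [eventually_cofinite_ne_pole p] with z hz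
  have h1 := eval_derivative_fiber (α := α) hz
  rw [derivative_sub, derivative_C_mul, eval_sub, eval_mul, eval_C] at h1
  rw [eval_sub, eval_mul, eval_mul, eval_num α hz, eval_wr α hz]
  linear_combination (den p).eval z * h1

theorem genericDegC_toRat (hJ : Fintype.card J = 2 * Fintype.card κ) {c : J → ℂ}
    (hc : Function.Injective c) {α p : κ → ℂ} {z : J → ℂ} (h : IsSol c α p z) :
    GenericDegC (Fintype.card κ + 1) (Set.range c) (toRat α p) := by
  obtain ⟨h1, h2⟩ := num_denom_of_isCoprime (monic_den p) (isCoprime_num_den h.res_ne h.inj)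
  have h1 : (toRat α p).num = num α p := h1
  have h2 : (toRat α p).denom = den p := h2
  have hW : wronskian' (toRat α p) = wr α p := by
    rw [wronskian', h1, h2, wronskian_num_den]
  have hpole : ∀ u, (wr α p).eval u = 0 → ∀ k, u ≠ p k := by
    rintro u hu k rfl
    rw [eval_wr_pole] at hu
    exact mul_ne_zero (neg_ne_zero.2 (h.res_ne k)) (pow_ne_zero 2 (eval_codn_self h.inj k)) hu
  refine ⟨?_, ?_, fun u hu => ?_, ?_⟩
  · rw [h1, h2, natDegree_num, natDegree_den]
    omega
  · rw [hW, natDegree_wr]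
    omega
  · rw [hW] at hu
    rw [h2]
    exact eval_den_ne (hpole u hu)
  · rw [hW, h1, h2]
    ext w
    simp only [Set.mem_ofPred_eq, Set.mem_range]
    constructor
    · rintro ⟨u, hu, rfl⟩
      have hu' := hpole u hu
      rw [h.wr_eq (h.z_inj hc) hJ, eval_prod, Finset.prod_eq_zero_iff] at hu
      obtain ⟨j, -, hj⟩ := hu
      rw [eval_sub, eval_X, eval_C, sub_eq_zero] at hj
      subst hj
      exact ⟨j, by rw [eval_num α hu', mul_div_cancel_right₀ _ (eval_den_ne hu'), h.val]⟩
    · rintro ⟨j, rfl⟩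
      refine ⟨z j, ?_, ?_⟩
      · rw [eval_wr α (h.ne_pole j), h.crit, zero_mul]
      · rw [eval_num α (h.ne_pole j), mul_div_cancel_right₀ _ (eval_den_ne (h.ne_pole j)), h.val]

theorem exists_eq_den {Q : ℂ[X]} (hQ : Q.Monic)
    (hs : ∀ z, Q.eval z = 0 → (derivative Q).eval z ≠ 0) (hκ : Fintype.card κ = Q.natDegree) :
    ∃ p : κ → ℂ, Function.Injective p ∧ Q = den p := by
  classical
  have hnd : Q.roots.Nodup := by
    rw [nodup_roots_iff_of_splits hQ.ne_zero (IsAlgClosed.splits Q),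
      separable_def]
    refine isCoprime_of_dvd _ _ (fun h => hQ.ne_zero h.1) fun r hr hr0 h1 h2 => ?_
    obtain ⟨z, hz⟩ := IsAlgClosed.exists_root r fun h => hr (by
      exact isUnit_iff_degree_eq_zero.2 h)
    exact hs z (eval_eq_zero_of_dvd_of_eval_eq_zero h1 hz)
      (eval_eq_zero_of_dvd_of_eval_eq_zero h2 hz)
  have hcard : Fintype.card κ = Fintype.card {z // z ∈ Q.roots.toFinset} := by
    rw [Fintype.card_coe, Multiset.toFinset_card_of_nodup hnd, hκ]
    exact (IsAlgClosed.splits Q).natDegree_eq_card_roots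
  obtain ⟨e⟩ := Fintype.card_eq.1 hcard
  refine ⟨fun k => e k, Subtype.val_injective.comp e.injective, ?_⟩
  have h1 := (IsAlgClosed.splits Q).eq_prod_roots_of_monic hQ
  rw [den, Equiv.prod_comp e fun z => X - C (z : ℂ),
    Finset.prod_coe_sort Q.roots.toFinset fun z => X - C z, Finset.prod, Multiset.toFinset_val,
    hnd.dedup]
  exact h1

theorem exists_partialFractions {p : κ → ℂ} (hp : Function.Injective p) {P : ℂ[X]}
    (hP : ∀ k, P.eval (p k) ≠ 0) : ∃ γ : κ → ℂ, (∀ k, γ k ≠ 0) ∧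
      ∀ z, (∀ k, z ≠ p k) →
        P.eval z / (den p).eval z = (P /ₘ den p).eval z + ∑ k, γ k / (z - p k) := by
  refine ⟨fun k => P.eval (p k) / (codn p k).eval (p k),
    fun k => div_ne_zero (hP k) (eval_codn_self hp k), ?_⟩
  have h1 : P %ₘ den p = ∑ k, C (P.eval (p k) / (codn p k).eval (p k)) * codn p k := by
    refine Polynomial.eq_of_degrees_lt_of_eval_index_eq Finset.univ (v := p) hp.injOn ?_ ?_ ?_
    · rw [Finset.card_univ, ← degree_den p]
      exact degree_modByMonic_lt _ (monic_den p)
    · rw [Finset.card_univ]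
      exact degree_sum_codn_lt _ p
    · intro k _
      rw [eval_finsetSum, Finset.sum_eq_single k, eval_mul, eval_C,
        div_mul_cancel₀ _ (eval_codn_self hp k)]
      · have h2 := congrArg (eval (p k)) (modByMonic_add_div P (den p))
        rwa [eval_add, eval_mul, eval_den_eq_zero_iff.2 ⟨k, rfl⟩, zero_mul, add_zero] at h2
      · intro l _ hl
        rw [eval_mul, eval_codn_of_ne p hl, mul_zero]
      · exact fun h => absurd (Finset.mem_univ k) h
  intro z hz
  have h0 := eval_den_ne hz
  have h2 := congrArg (eval z) (modByMonic_add_div P (den p))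
  rw [eval_add, eval_mul, h1, eval_finsetSum] at h2
  rw [div_eq_iff h0, ← h2, add_mul, Finset.sum_mul, add_comm, mul_comm (eval z (den p))]
  congr 1
  refine Finset.sum_congr rfl fun k _ => ?_
  rw [eval_mul, eval_C, eval_codn_eq (hz k)]
  ring

theorem exists_isSol_of_pole_infty {c : J → ℂ} {γ p : κ → ℂ} {y : J → ℂ} {A B : ℂ} (hA : A ≠ 0)
    (hγ : ∀ k, γ k ≠ 0) (hp : Function.Injective p) (hy : ∀ j k, y j ≠ p k)
    (hcrit : ∀ j, HasDerivAt (fun u => A * u + B + ∑ k, γ k / (u - p k)) 0 (y j))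
    (hval : ∀ j, A * y j + B + ∑ k, γ k / (y j - p k) = c j) :
    ∃ (α q : κ → ℂ) (w : J → ℂ), IsSol c α q w ∧
      MobRel (fun u => A * u + B + ∑ k, γ k / (u - p k)) (rf α q) := by
  have hrf : ∀ u, rf (fun k => A * γ k) (fun k => A * p k + B) (A * u + B) =
      A * u + B + ∑ k, γ k / (u - p k) := by
    intro u
    simp only [rf, add_sub_add_right_eq_sub, ← mul_sub, mul_div_mul_left _ _ hA]
  refine ⟨fun k => A * γ k, fun k => A * p k + B, fun j => A * y j + B,
    ⟨fun k => mul_ne_zero hA (hγ k), fun k l hkl => hp (mul_left_cancel₀ hA (add_right_cancel hkl)),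
      fun j k hjk => hy j k (mul_left_cancel₀ hA (add_right_cancel hjk)), fun j => ?_,
      fun j => (hrf _).trans (hval j)⟩, ?_⟩
  · have h1 : HasDerivAt (fun u => A * u + B + ∑ k, γ k / (u - p k))
        (A + ∑ k, -(γ k / (y j - p k) ^ 2)) (y j) := by
      refine HasDerivAt.add ?_ (HasDerivAt.fun_sum fun k _ => ?_)
      · simpa using ((hasDerivAt_id (y j)).const_mul A).add_const B
      · have h2 := ((hasDerivAt_id (y j)).sub_const (p k))
        have h3 := (hasDerivAt_const (y j) (γ k)).div h2 (sub_ne_zero.2 (hy j k))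
        refine h3.congr_deriv ?_
        simp [neg_div]
    have h2 := h1.unique (hcrit j)
    have h3 : A * rd (fun k => A * γ k) (fun k => A * p k + B) (A * y j + B) = 0 := by
      rw [← h2, rd, mul_sub, mul_one, sub_eq_add_neg, Finset.mul_sum, ← Finset.sum_neg_distrib]
      congr 1
      refine Finset.sum_congr rfl fun k _ => ?_
      have h4 := sub_ne_zero.2 (hy j k)
      rw [add_sub_add_right_eq_sub, ← mul_sub]
      field_simp
    exact (mul_eq_zero.1 h3).resolve_left hA
  · refine ⟨1, -B, 0, A, by simpa using hA, Eventually.of_forall fun u => ?_⟩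
    have h1 : A * ((1 * u + -B) / (0 * u + A)) + B = u := by
      rw [zero_mul, zero_add, mul_div_cancel₀ _ hA]
      ring
    exact (congrArg _ h1.symm).trans (hrf _)

theorem exists_isSol_of_finite_poles {c : J → ℂ} {γ p : Option κ → ℂ} {y : J → ℂ} {B : ℂ}
    (hγ : ∀ k, γ k ≠ 0) (hp : Function.Injective p) (hy : ∀ j k, y j ≠ p k)
    (hcrit : ∀ j, HasDerivAt (fun u => B + ∑ k, γ k / (u - p k)) 0 (y j))
    (hval : ∀ j, B + ∑ k, γ k / (y j - p k) = c j) :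
    ∃ (α q : κ → ℂ) (w : J → ℂ), IsSol c α q w ∧
      MobRel (fun u => B + ∑ k, γ k / (u - p k)) (rf α q) := by
  set φ : ℂ → ℂ := fun u => B + ∑ k, γ k / (u - p k) with hφ
  set δ : κ → ℂ := fun k => p (some k) - p none with hδ
  have hδ0 : ∀ k, δ k ≠ 0 := fun k => sub_ne_zero.2 (hp.ne (by simp))
  set B' := B - ∑ k, γ (some k) / δ k with hB'
  have hid : ∀ w, w ≠ 0 → (∀ k, w ≠ (δ k)⁻¹) → φ (p none + w⁻¹) =
      γ none * w + B' + ∑ k, -(γ (some k) / δ k ^ 2) / (w - (δ k)⁻¹) := by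
    intro w hw hk
    have h1 : ∀ k, γ (some k) / (p none + w⁻¹ - p (some k)) =
        -(γ (some k) / δ k) + -(γ (some k) / δ k ^ 2) / (w - (δ k)⁻¹) := by
      intro k
      have h2 := hδ0 k
      have h3 : δ k * w - 1 ≠ 0 := by
        intro h0
        exact hk k (eq_inv_of_mul_eq_one_right (sub_eq_zero.1 h0))
      have h4 : 1 - δ k * w ≠ 0 := by
        rw [← neg_sub]
        exact neg_ne_zero.2 h3
      have h5 : p none + w⁻¹ - p (some k) = (1 - δ k * w) / w := by
        rw [eq_div_iff hw, hδ, sub_mul, add_mul, inv_mul_cancel₀ hw]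
        ring
      have h6 : w - (δ k)⁻¹ = -((1 - δ k * w) / δ k) := by
        field_simp
        ring
      rw [h5, h6]
      field_simp
      ring
    rw [hφ]
    simp only [Fintype.sum_option, h1, Finset.sum_add_distrib, Finset.sum_neg_distrib,
      add_sub_cancel_left, div_inv_eq_mul, hB']
    ring
  have hy0 : ∀ j, y j - p none ≠ 0 := fun j => sub_ne_zero.2 (hy j none)
  have hyk : ∀ j k, (y j - p none)⁻¹ ≠ (δ k)⁻¹ := fun j k h =>
    hy j (some k) (sub_left_injective (inv_injective h))
  have hback : ∀ j, p none + (y j - p none)⁻¹⁻¹ = y j := fun j => by rw [inv_inv]; ring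
  have hcrit' : ∀ j, HasDerivAt (fun u => γ none * u + B' +
      ∑ k, -(γ (some k) / δ k ^ 2) / (u - (δ k)⁻¹)) 0 ((y j - p none)⁻¹) := by
    intro j
    have h3 := inv_ne_zero (hy0 j)
    have h4 : HasDerivAt (fun w : ℂ => p none + w⁻¹) (-(((y j - p none)⁻¹) ^ 2)⁻¹)
        ((y j - p none)⁻¹) := (hasDerivAt_inv h3).const_add _
    have h5 : HasDerivAt φ 0 (p none + ((y j - p none)⁻¹)⁻¹) := by
      rw [hback]
      exact hcrit j
    have h6 := HasDerivAt.comp (h₂ := φ) (h := fun w : ℂ => p none + w⁻¹) ((y j - p none)⁻¹) h5 h4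
    rw [zero_mul] at h6
    refine h6.congr_of_eventuallyEq ?_
    have h7 : ∀ᶠ w in 𝓝 ((y j - p none)⁻¹), ∀ k, w ≠ (δ k)⁻¹ := by
      rw [eventually_all]
      exact fun k => isOpen_ne.mem_nhds (hyk j k)
    filter_upwards [isOpen_ne.mem_nhds h3, h7] with w hw hk
    exact (hid w hw hk).symm
  have hval' : ∀ j, γ none * (y j - p none)⁻¹ + B' +
      ∑ k, -(γ (some k) / δ k ^ 2) / ((y j - p none)⁻¹ - (δ k)⁻¹) = c j := by
    intro j
    rw [← hid _ (inv_ne_zero (hy0 j)) (hyk j), hback]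
    exact hval j
  obtain ⟨α, q, w, h1, h2⟩ := exists_isSol_of_pole_infty (hγ none)
    (fun k => neg_ne_zero.2 (div_ne_zero (hγ _) (pow_ne_zero 2 (hδ0 k))))
    (fun k l hkl => Option.some_injective _ (hp (sub_left_injective (inv_injective hkl))))
    hyk hcrit' hval'
  refine ⟨α, q, w, h1, MobRel.trans ⟨p none, 1, 1, 0, by norm_num, ?_⟩ h2⟩
  filter_upwards [eventually_cofinite_ne (0 : ℂ), eventually_cofinite_ne_pole fun k => (δ k)⁻¹]
    with u hu hk
  rw [← hid u hu hk]
  have hu : u ≠ 0 := hu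
  rw [one_mul, add_zero, add_div, mul_div_cancel_right₀ _ hu, one_div]

end CriticalValues

namespace CriticalValues

open Filter Topology

variable {κ J : Type} [Fintype κ] [Fintype J]

section representative

variable {f : RatFunc ℂ}

theorem hasDerivAt_ev {z : ℂ} (hz : f.denom.eval z ≠ 0) :
    HasDerivAt (ev f) ((wronskian' f).eval z / f.denom.eval z ^ 2) z := by
  refine ((f.num.hasDerivAt z).div (f.denom.hasDerivAt z) hz).congr_deriv ?_
  rw [wronskian', eval_sub, eval_mul, eval_mul]

theorem derivative_denom_ne_zero
    (hW : ∀ z, (wronskian' f).eval z = 0 → f.denom.eval z ≠ 0) {z : ℂ}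
    (hz : f.denom.eval z = 0) : (derivative f.denom).eval z ≠ 0 := by
  intro h
  refine hW z ?_ hz
  rw [wronskian', eval_sub, eval_mul, eval_mul, hz, h, mul_zero, mul_zero, sub_zero]

theorem eval_num_ne_zero {z : ℂ} (hz : f.denom.eval z = 0) : f.num.eval z ≠ 0 := by
  intro h
  obtain ⟨a, b, hab⟩ := f.isCoprime_num_denom
  have h1 := congrArg (eval z) hab
  simp [h, hz] at h1

theorem exists_isSol_of_genericDegC {c : J → ℂ} (hκ : 0 < Fintype.card κ)
    (hf : GenericDegC (Fintype.card κ + 1) (Set.range c) f) :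
    ∃ (α q : κ → ℂ) (w : J → ℂ), IsSol c α q w ∧ MobRel (ev f) (rf α q) := by
  obtain ⟨hdeg, hdegW, hW, hrange⟩ := hf
  have hy : ∀ j, ∃ y, (wronskian' f).eval y = 0 ∧ ev f y = c j := fun j =>
    hrange.symm.subset (Set.mem_range_self j)
  choose y hy1 hy2 using hy
  have hcrit : ∀ j, HasDerivAt (ev f) 0 (y j) := fun j =>
    (hasDerivAt_ev (hW _ (hy1 j))).congr_deriv (by rw [hy1, zero_div])
  have hsimple := fun z => derivative_denom_ne_zero hW (z := z)
  have key : ∀ {ι : Type} [Fintype ι], Fintype.card ι = f.denom.natDegree →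
      ∃ γ p : ι → ℂ, (∀ k, γ k ≠ 0) ∧ Function.Injective p ∧ (∀ j k, y j ≠ p k) ∧
        ∀ z, (∀ k, z ≠ p k) → ev f z = (f.num /ₘ f.denom).eval z + ∑ k, γ k / (z - p k) := by
    intro ι _ hι
    obtain ⟨p, hp, hden⟩ := exists_eq_den f.monic_denom hsimple hι
    have hroot : ∀ k, f.denom.eval (p k) = 0 := fun k => by
      rw [hden]
      exact eval_den_eq_zero_iff.2 ⟨k, rfl⟩
    obtain ⟨γ, hγ, h⟩ := exists_partialFractions hp fun k => eval_num_ne_zero (hroot k)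
    rw [← hden] at h
    exact ⟨γ, p, hγ, hp, fun j k hjk => hW _ (hy1 j) (hjk ▸ hroot k), h⟩
  have hnhds : ∀ {ι : Type} [Fintype ι] {p : ι → ℂ} {z : ℂ}, (∀ k, z ≠ p k) →
      ∀ᶠ u in 𝓝 z, ∀ k, u ≠ p k := by
    intro ι _ p z hz
    rw [eventually_all]
    exact fun k => isOpen_ne.mem_nhds (hz k)
  have hdivdeg := natDegree_divByMonic f.num f.monic_denom
  rcases (show f.denom.natDegree ≤ Fintype.card κ + 1 by omega).eq_or_lt with hN | hN
  · obtain ⟨γ, p, hγ, hp, hyp, h⟩ := key (ι := Option κ) (by rw [Fintype.card_option, hN])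
    obtain ⟨B, hB⟩ : ∃ B, f.num /ₘ f.denom = C B :=
      ⟨_, eq_C_of_natDegree_eq_zero (by omega)⟩
    simp only [hB, eval_C] at h
    obtain ⟨α, q, w, h1, h2⟩ := exists_isSol_of_finite_poles hγ hp hyp
      (fun j => (hcrit j).congr_of_eventuallyEq
        ((hnhds (hyp j)).mono fun u hu => (h u hu).symm))
      fun j => (h _ (hyp j)).symm.trans (hy2 j)
    exact ⟨α, q, w, h1, h2.congr ((eventually_cofinite_ne_pole p).mono h) EventuallyEq.rfl⟩
  · have hlt := natDegree_wronskian_lt_add (a := f.denom) (b := f.num) (by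
      intro h0
      have h1 : wronskian' f = 0 := by
        rw [← h0, wronskian', wronskian]
        ring
      rw [h1, natDegree_zero] at hdegW
      omega)
    have h1 : wronskian f.denom f.num = wronskian' f := by
      rw [wronskian', wronskian]
      ring
    rw [h1] at hlt
    obtain ⟨γ, p, hγ, hp, hyp, h⟩ := key (ι := κ) (by omega)
    have hd1 : (f.num /ₘ f.denom).natDegree = 1 := by omega
    obtain ⟨A, hA, B, hB⟩ := natDegree_eq_one.1 hd1
    simp only [← hB, eval_add, eval_mul, eval_C, eval_X] at h
    obtain ⟨α, q, w, h1, h2⟩ := exists_isSol_of_pole_infty hA hγ hp hyp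
      (fun j => (hcrit j).congr_of_eventuallyEq
        ((hnhds (hyp j)).mono fun u hu => (h u hu).symm))
      fun j => (h _ (hyp j)).symm.trans (hy2 j)
    exact ⟨α, q, w, h1, h2.congr ((eventually_cofinite_ne_pole p).mono h) EventuallyEq.rfl⟩

end representative

/-- The set of classes of generic rational functions of degree `n` with critical values `C`. -/
abbrev GenericClasses (n : ℕ) (C : Set ℂ) : Type :=
  Quot fun f g : {f : RatFunc ℂ // GenericDegC n C f} => MobiusEquiv f.1 g.1

theorem mk_eq_mk_iff {n : ℕ} {C : Set ℂ} {f g : {f : RatFunc ℂ // GenericDegC n C f}} :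
    (Quot.mk _ f : GenericClasses n C) = Quot.mk _ g ↔ MobRel (ev f.1) (ev g.1) := by
  have hequiv : Equivalence
      fun f g : {f : RatFunc ℂ // GenericDegC n C f} => MobiusEquiv f.1 g.1 := by
    simp only [mobiusEquiv_iff]
    exact ⟨fun f => MobRel.refl _, fun h => h.symm, fun h h' => h.trans h'⟩
  rw [← mobiusEquiv_iff]
  exact ⟨fun h => hequiv.eqvGen_iff.1 (Quot.eqvGen_exact h), fun h => Quot.sound h⟩

theorem exists_sol_classification {c : J → ℂ} (hJ : Fintype.card J = 2 * Fintype.card κ)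
    (hκ : 0 < Fintype.card κ) (hc : Function.Injective c) :
    ∃ π : Sol κ c → GenericClasses (Fintype.card κ + 1) (Set.range c), Function.Surjective π ∧
      ∀ x y, π x = π y ↔ MobRel (rf x.1.1 x.1.2.1) (rf y.1.1 y.1.2.1) := by
  have hgen : ∀ x : Sol κ c,
      GenericDegC (Fintype.card κ + 1) (Set.range c) (toRat x.1.1 x.1.2.1) := fun x =>
    genericDegC_toRat hJ hc (z := x.1.2.2) x.2
  refine ⟨fun x => Quot.mk _ ⟨toRat x.1.1 x.1.2.1, hgen x⟩, ?_, fun x y => ?_⟩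
  · rintro ⟨f, hf⟩
    obtain ⟨α, p, w, h1, h2⟩ := exists_isSol_of_genericDegC hκ hf
    refine ⟨⟨(α, p, w), h1⟩, mk_eq_mk_iff.2 ?_⟩
    exact h2.symm.congr (ev_toRat _ _) EventuallyEq.rfl
  · rw [mk_eq_mk_iff]
    exact ⟨fun h => h.congr (ev_toRat _ _).symm (ev_toRat _ _).symm,
      fun h => h.congr (ev_toRat _ _) (ev_toRat _ _)⟩

theorem card_genericClasses_mul {c : J → ℂ} (hJ : Fintype.card J = 2 * Fintype.card κ)
    (hJ2 : 2 < Fintype.card J) (hc : Function.Injective c) :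
    Nat.card (GenericClasses (Fintype.card κ + 1) (Set.range c)) *
      (Fintype.card κ + 1).factorial = (Sol κ c).ncard := by
  obtain ⟨π, hsurj, hπ⟩ := exists_sol_classification hJ (by omega) hc
  generalize GenericClasses (Fintype.card κ + 1) (Set.range c) = G at π
  choose s hs using hsurj
  obtain ⟨Φ, hΦ⟩ : ∃ Φ : G × (Option κ × Equiv.Perm κ) → Sol κ c,
      ∀ t, (Φ t).1 = orbit (s t.1).1 t.2 :=
    ⟨fun t => ⟨orbit (s t.1).1 t.2, orbit_mem (s t.1).2 t.2⟩, fun _ => rfl⟩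
  have hπΦ : ∀ t, π (Φ t) = t.1 := by
    intro t
    have h1 := mobRel_orbit (s t.1).2 t.2
    rw [← hΦ] at h1
    rw [← (hπ _ _).2 h1, hs]
  have hbij : Function.Bijective Φ := by
    constructor
    · rintro ⟨q, t⟩ ⟨q', t'⟩ h
      have hq : q = q' := by
        have h1 := congrArg π h
        rwa [hπΦ, hπΦ] at h1
      subst hq
      have h2 := congrArg Subtype.val h
      rw [hΦ, hΦ] at h2
      exact congrArg (Prod.mk q) (orbit_injective hJ2 hc (s q).2 h2)
    · intro y
      obtain ⟨t, ht⟩ := exists_orbit_of_mobRel hJ hc (s (π y)).2 y.2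
        ((hπ _ _).1 (hs (π y)))
      exact ⟨(π y, t), Subtype.ext ((hΦ _).trans ht)⟩
  have h1 : Nat.card (Sol κ c) = Nat.card (G × (Option κ × Equiv.Perm κ)) :=
    (Nat.card_eq_of_bijective Φ hbij).symm
  have h2 : Nat.card κ = Fintype.card κ := Nat.card_eq_fintype_card
  have h3 : (Sol κ c).ncard = Nat.card (Sol κ c) := (Nat.card_coe_set_eq _).symm
  rw [Nat.factorial_succ, h3, h1, Nat.card_prod, Nat.card_prod, Nat.card_perm, Finite.card_option,
    h2]

end CriticalValues

/-- For `n ≥ 3` and a set `C` of `2n − 2` distinct complex numbers, the number of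
Möbius-equivalence classes of generic degree-`n` rational functions over `ℂ` with
critical value set `C` equals `n^(n−3) (2n−2)!/n!`. -/
theorem count_complex_rational_functions_with_given_critical_values
    (n : ℕ) (hn : 3 ≤ n) (C : Set ℂ) (hC : C.ncard = 2 * n - 2) :
    (Nat.card (Quot fun f g : {f : RatFunc ℂ // GenericDegC n C f} =>
        MobiusEquiv f.1 g.1) : ℚ) =
      (n : ℚ) ^ (n - 3) * (2 * n - 2).factorial / n.factorial := by
  obtain ⟨m, rfl⟩ : ∃ m, n = m + 3 := ⟨n - 3, by omega⟩
  have hfin : C.Finite := Set.finite_of_ncard_ne_zero (by omega)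
  have := hfin.fintype
  have hcard : Fintype.card C = 2 * Fintype.card (Fin (m + 2)) := by
    rw [← Nat.card_eq_fintype_card, Nat.card_coe_set_eq, hC, Fintype.card_fin]
    omega
  have h1 := CriticalValues.card_genericClasses_mul (κ := Fin (m + 2)) (c := ((↑) : C → ℂ)) hcard
    (by rw [hcard, Fintype.card_fin]; omega) Subtype.val_injective
  have h2 := CriticalValues.card_mul_ncard_sol (κ := Fin (m + 2)) (c := ((↑) : C → ℂ)) hcard
    Subtype.val_injective
  rw [Subtype.range_coe, Fintype.card_fin] at h1
  rw [Fintype.card_fin, ← h1, show 2 * (m + 2) = 2 * (m + 3) - 2 by omega,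
    show m + 2 - 1 = m + 1 by omega, pow_succ] at h2
  rw [show m + 3 - 3 = m by omega, eq_div_iff (by exact_mod_cast Nat.factorial_ne_zero _)]
  have h3 : Nat.card (CriticalValues.GenericClasses (m + 3) C) * (m + 3).factorial =
      (m + 3) ^ m * (2 * (m + 3) - 2).factorial := by
    refine Nat.eq_of_mul_eq_mul_left (Nat.succ_pos (m + 2)) (h2.trans ?_)
    rw [Nat.succ_eq_add_one]
    ring
  exact_mod_cast h3
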